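/- Let N ≥ 2. There exists a constant c̄ > 0 depending only on the dimension N such that, for every open bounded convex domain Ω in ℝ^N with diameter D and John ellipsoid of semi-axes a₁ ≥ a₂ ≥ … ≥ a_N, the first nontrivial Neumann Laplacian eigenvalue satisfies μ₁(Ω) ≥ π²/D² + c̄ · a₂²/D⁴. -/

import Mathlib

open MeasureTheory Real Set Filter Bornology
open scoped ENNReal RealInnerProductSpace

noncomputable section

/-- Dirichlet Rayleigh quotient of `u` on `Ω ⊆ ℝ^N`. -/
def dRayleigh {N : ℕ} (Ω : Set (EuclideanSpace ℝ (Fin N)))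
    (u : EuclideanSpace ℝ (Fin N) → ℝ) : ℝ≥0∞ :=
  (∫⁻ x in Ω, ENNReal.ofReal (‖fderiv ℝ u x‖ ^ 2)) /
    ∫⁻ x in Ω, ENNReal.ofReal ((u x) ^ 2)

/-- The `k`-th Dirichlet Laplacian eigenvalue of `Ω`, via the Courant–Fischer min-max
over `k`-dimensional subspaces of (a core of) `H¹₀(Ω)`. -/
def dirEV {N : ℕ} (Ω : Set (EuclideanSpace ℝ (Fin N))) (k : ℕ) : ℝ≥0∞ :=
  ⨅ (S : Submodule ℝ (EuclideanSpace ℝ (Fin N) → ℝ))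
    (_ : Module.finrank ℝ S = k ∧ ∀ u ∈ S, ContDiff ℝ 1 u ∧ tsupport u ⊆ Ω),
    ⨆ (u : EuclideanSpace ℝ (Fin N) → ℝ) (_ : u ∈ S ∧ u ≠ 0), dRayleigh Ω u

/-- Weighted Rayleigh quotient of `u` on `Ω` with weight `p`. -/
def wRayleigh {N : ℕ} (Ω : Set (EuclideanSpace ℝ (Fin N)))
    (p u : EuclideanSpace ℝ (Fin N) → ℝ) : ℝ≥0∞ :=
  (∫⁻ x in Ω, ENNReal.ofReal (‖fderiv ℝ u x‖ ^ 2 * p x)) /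
    ∫⁻ x in Ω, ENNReal.ofReal ((u x) ^ 2 * p x)

/-- Admissibility of `u` for the weighted Neumann eigenvalue `μ₁(Ω, p)`:
`u ∈ H¹_loc(Ω) ∩ L²(Ω, p dx)`, `u ≠ 0`, with zero `p`-mean. -/
def wAdm {N : ℕ} (Ω : Set (EuclideanSpace ℝ (Fin N)))
    (p u : EuclideanSpace ℝ (Fin N) → ℝ) : Prop :=
  ContDiffOn ℝ 1 u Ω ∧
    (∫⁻ x in Ω, ENNReal.ofReal ((u x) ^ 2 * p x)) ≠ 0 ∧
    (∫⁻ x in Ω, ENNReal.ofReal ((u x) ^ 2 * p x)) ≠ ∞ ∧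
    (∫ x in Ω, u x * p x) = 0

/-- `μ₁(Ω, p)`, the first nontrivial weighted Neumann eigenvalue of `Ω`.
For `p ≡ 1` this is the first nontrivial Neumann Laplacian eigenvalue. -/
def wEV {N : ℕ} (Ω : Set (EuclideanSpace ℝ (Fin N)))
    (p : EuclideanSpace ℝ (Fin N) → ℝ) : ℝ≥0∞ :=
  ⨅ (u : EuclideanSpace ℝ (Fin N) → ℝ) (_ : wAdm Ω p u), wRayleigh Ω p u

/-- The width of `Ω`: the minimal distance between two parallel supporting hyperplanes,
i.e. the infimum over unit directions of the breadth of `Ω` in that direction. -/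
def width {N : ℕ} (Ω : Set (EuclideanSpace ℝ (Fin N))) : ℝ :=
  ⨅ v : Metric.sphere (0 : EuclideanSpace ℝ (Fin N)) 1,
    (sSup ((fun x => ⟪x, (v : EuclideanSpace ℝ (Fin N))⟫) '' Ω) -
      sInf ((fun x => ⟪x, (v : EuclideanSpace ℝ (Fin N))⟫) '' Ω))

/-- `u` is a first Dirichlet eigenfunction of `Ω` (positive, `L²`-normalized):
it lies in (an avatar of) `H¹₀(Ω)` and achieves `λ₁(Ω)` as a Rayleigh quotient. -/
def IsFirstDirichletEF {N : ℕ} (Ω : Set (EuclideanSpace ℝ (Fin N)))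
    (u : EuclideanSpace ℝ (Fin N) → ℝ) : Prop :=
  Continuous u ∧ (∀ x ∉ Ω, u x = 0) ∧ ContDiffOn ℝ 1 u Ω ∧
    (∫⁻ x in Ω, ENNReal.ofReal (‖fderiv ℝ u x‖ ^ 2)) ≠ ∞ ∧
    (∀ x ∈ Ω, 0 < u x) ∧
    (∫⁻ x in Ω, ENNReal.ofReal ((u x) ^ 2)) = 1 ∧
    dRayleigh Ω u = dirEV Ω 1

/-- `u2` is a second Dirichlet eigenfunction of `Ω` (`L²`-normalized, orthogonal to the
first eigenfunction `u1`), achieving `λ₂(Ω)` as a Rayleigh quotient. -/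
def IsSecondDirichletEF {N : ℕ} (Ω : Set (EuclideanSpace ℝ (Fin N)))
    (u1 u2 : EuclideanSpace ℝ (Fin N) → ℝ) : Prop :=
  Continuous u2 ∧ (∀ x ∉ Ω, u2 x = 0) ∧ ContDiffOn ℝ 1 u2 Ω ∧
    (∫⁻ x in Ω, ENNReal.ofReal (‖fderiv ℝ u2 x‖ ^ 2)) ≠ ∞ ∧
    (∫ x in Ω, u1 x * u2 x) = 0 ∧
    (∫⁻ x in Ω, ENNReal.ofReal ((u2 x) ^ 2)) = 1 ∧
    dRayleigh Ω u2 = dirEV Ω 2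

section HelpersB1
open scoped Pointwise


theorem bm1_compact (A B C : Set ℝ) (hA : IsCompact A) (hB : IsCompact B)
    (hAn : A.Nonempty) (hBn : B.Nonempty) (t : ℝ) (ht0 : 0 < t) (ht1 : t < 1)
    (h : ∀ x ∈ A, ∀ y ∈ B, (1 - t) * x + t * y ∈ C) :
    ENNReal.ofReal (1 - t) * volume A + ENNReal.ofReal t * volume B ≤ volume C := by
  obtain ⟨M, hM⟩ := hA.exists_isGreatest hAn
  obtain ⟨m, hm⟩ := hB.exists_isLeast hBn
  set A' := (fun x => (1 - t) * x + t * m) '' A with hA'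
  set B' := (fun y => (1 - t) * M + t * y) '' B with hB'
  have cA : IsCompact A' := hA.image (by fun_prop)
  have cB : IsCompact B' := hB.image (by fun_prop)
  have vA : volume A' = ENNReal.ofReal (1 - t) * volume A := by
    have : A' = (fun z => z + t * m) '' ((fun x => (1 - t) * x) '' A) := by
      rw [image_image]
    rw [this, image_add_right, measure_preimage_add_right]
    have : (fun x => (1 - t) * x) '' A = (1 - t) • A := rfl
    rw [this, Measure.addHaar_smul]
    simp [abs_of_pos (sub_pos.2 ht1)]
  have vB : volume B' = ENNReal.ofReal t * volume B := by
    have : B' = (fun z => (1 - t) * M + z) '' ((fun x => t * x) '' B) := by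
      rw [image_image]
    rw [this, image_add_left, measure_preimage_add]
    have : (fun x => t * x) '' B = t • B := rfl
    rw [this, Measure.addHaar_smul]
    simp [abs_of_pos ht0]
  rw [← vA, ← vB]
  have hsub : A' ∪ B' ⊆ C := by
    rintro z (⟨x, hx, rfl⟩ | ⟨y, hy, rfl⟩)
    · exact h x hx m hm.1
    · exact h M hM.1 y hy
  have hdis : AEDisjoint volume A' B' := by
    refine measure_mono_null (t := {(1 - t) * M + t * m}) ?_ (by simp)
    rintro z ⟨⟨x, hx, rfl⟩, ⟨y, hy, hxy⟩⟩
    have h1 := hM.2 hx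
    have h2 := hm.2 hy
    simp only at hxy ⊢
    have : (1 - t) * x ≤ (1 - t) * M := by nlinarith
    have : t * m ≤ t * y := by nlinarith
    simp only [mem_singleton_iff]
    linarith
  rw [← measure_union₀ cB.measurableSet.nullMeasurableSet hdis]
  exact measure_mono hsub

theorem vol_iSup_compact (S : Set ℝ) (hS : MeasurableSet S) (hn : S.Nonempty) :
    volume S = ⨆ K : {K : Set ℝ // K ⊆ S ∧ IsCompact K ∧ K.Nonempty}, volume K.1 := by
  obtain ⟨a, ha⟩ := hn
  apply le_antisymm
  · rw [hS.measure_eq_iSup_isCompact]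
    refine iSup_le fun K => iSup_le fun hK => iSup_le fun hc => ?_
    refine le_trans (measure_mono (subset_insert a K)) ?_
    exact le_iSup (fun K : {K : Set ℝ // K ⊆ S ∧ IsCompact K ∧ K.Nonempty} => volume K.1)
      ⟨insert a K, insert_subset ha hK, hc.insert a, insert_nonempty _ _⟩
  · exact iSup_le fun K => measure_mono K.2.1

theorem bm1 (A B C : Set ℝ) (hA : MeasurableSet A) (hB : MeasurableSet B)
    (hAn : A.Nonempty) (hBn : B.Nonempty) (t : ℝ) (ht0 : 0 < t) (ht1 : t < 1)
    (h : ∀ x ∈ A, ∀ y ∈ B, (1 - t) * x + t * y ∈ C) :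
    ENNReal.ofReal (1 - t) * volume A + ENNReal.ofReal t * volume B ≤ volume C := by
  rw [vol_iSup_compact A hA hAn, vol_iSup_compact B hB hBn, ENNReal.mul_iSup, ENNReal.mul_iSup]
  have : Nonempty {K : Set ℝ // K ⊆ A ∧ IsCompact K ∧ K.Nonempty} := by
    obtain ⟨a, ha⟩ := hAn
    exact ⟨{a}, by simpa using ha, isCompact_singleton, by simp⟩
  have : Nonempty {K : Set ℝ // K ⊆ B ∧ IsCompact K ∧ K.Nonempty} := by
    obtain ⟨a, ha⟩ := hBn
    exact ⟨{a}, by simpa using ha, isCompact_singleton, by simp⟩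
  refine ENNReal.iSup_add_iSup_le ?_
  intro K L
  exact bm1_compact K.1 L.1 C K.2.2.1 L.2.2.1 K.2.2.2 L.2.2.2 t ht0 ht1
    (fun x hx y hy => h x (K.2.1 hx) y (L.2.1 hy))

theorem ennreal_amgm (a b : ℝ≥0∞) (t : ℝ) (ht0 : 0 < t) (ht1 : t < 1) :
    a ^ (1 - t) * b ^ t ≤ ENNReal.ofReal (1 - t) * a + ENNReal.ofReal t * b := by
  have h1 : 0 < 1 - t := by linarith
  by_cases ha : a = ∞
  · subst ha
    rw [ENNReal.mul_top (by simp [ht1])]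
    simp
  by_cases hb : b = ∞
  · subst hb
    rw [ENNReal.mul_top (by simp [ht0])]
    simp
  lift a to NNReal using ha
  lift b to NNReal using hb
  have e1 : ((1 - t).toNNReal : ℝ) = 1 - t := Real.coe_toNNReal _ h1.le
  have e2 : (t.toNNReal : ℝ) = t := Real.coe_toNNReal _ ht0.le
  have := NNReal.geom_mean_le_arith_mean2_weighted (1 - t).toNNReal t.toNNReal a b
    (by rw [← NNReal.coe_inj]; push_cast; rw [e1, e2]; ring)
  rw [e1, e2] at this
  rw [← ENNReal.coe_rpow_of_nonneg _ h1.le, ← ENNReal.coe_rpow_of_nonneg _ ht0.le]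
  unfold ENNReal.ofReal
  exact_mod_cast this

theorem pl1 (f g k : ℝ → ℝ) (hf : Measurable f) (hg : Measurable g) (hk : Measurable k)
    (hf0 : ∀ x, 0 ≤ f x) (hg0 : ∀ x, 0 ≤ g x) (hk0 : ∀ x, 0 ≤ k x)
    (hfb : BddAbove (range f)) (hgb : BddAbove (range g))
    (t : ℝ) (ht0 : 0 < t) (ht1 : t < 1)
    (h : ∀ x y, 0 < f x → 0 < g y → f x ^ (1 - t) * g y ^ t ≤ k ((1 - t) * x + t * y)) :
    (∫⁻ x, ENNReal.ofReal (f x)) ^ (1 - t) * (∫⁻ x, ENNReal.ofReal (g x)) ^ t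
      ≤ ∫⁻ x, ENNReal.ofReal (k x) := by
  have h1 : 0 < 1 - t := by linarith
  set F := ⨆ x, f x with hF
  set G := ⨆ x, g x with hG
  have hfF : ∀ x, f x ≤ F := fun x => le_ciSup hfb x
  have hgG : ∀ x, g x ≤ G := fun x => le_ciSup hgb x
  rcases (le_trans (hf0 0) (hfF 0)).eq_or_lt with hF0 | hF0
  · have : ∀ x, f x = 0 := fun x => le_antisymm (by rw [hF0]; exact hfF x) (hf0 x)
    simp [this, ENNReal.zero_rpow_of_pos h1]
  rcases (le_trans (hg0 0) (hgG 0)).eq_or_lt with hG0 | hG0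
  · have : ∀ x, g x = 0 := fun x => le_antisymm (by rw [hG0]; exact hgG x) (hg0 x)
    simp [this, ENNReal.zero_rpow_of_pos ht0]
  set P := F ^ (1 - t) * G ^ t with hP
  have hP0 : 0 < P := by positivity
  have cf : ∫⁻ x, ENNReal.ofReal (f x) = ENNReal.ofReal F * ∫⁻ x, ENNReal.ofReal (f x / F) := by
    rw [← lintegral_const_mul _ (by fun_prop)]
    congr 1; ext x
    rw [← ENNReal.ofReal_mul hF0.le]; congr 1; field_simp
  have cg : ∫⁻ x, ENNReal.ofReal (g x) = ENNReal.ofReal G * ∫⁻ x, ENNReal.ofReal (g x / G) := by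
    rw [← lintegral_const_mul _ (by fun_prop)]
    congr 1; ext x
    rw [← ENNReal.ofReal_mul hG0.le]; congr 1; field_simp
  have ck : ∫⁻ x, ENNReal.ofReal (k x) = ENNReal.ofReal P * ∫⁻ x, ENNReal.ofReal (k x / P) := by
    rw [← lintegral_const_mul _ (by fun_prop)]
    congr 1; ext x
    rw [← ENNReal.ofReal_mul hP0.le]; congr 1; field_simp
  rw [cf, cg, ck, ENNReal.mul_rpow_of_nonneg _ _ h1.le, ENNReal.mul_rpow_of_nonneg _ _ ht0.le,
    ENNReal.ofReal_rpow_of_pos hF0, ENNReal.ofReal_rpow_of_pos hG0, mul_mul_mul_comm,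
    ← ENNReal.ofReal_mul (by positivity), ← hP]
  refine mul_le_mul_right ?_ _
  refine le_trans (ennreal_amgm _ _ t ht0 ht1) ?_
  have lc : ∀ q : ℝ → ℝ, Measurable q → (∀ x, 0 ≤ q x) →
      ∫⁻ x, ENNReal.ofReal (q x) = ∫⁻ s in Ioi (0:ℝ), volume {x | s < q x} := by
    intro q hq hq0
    exact lintegral_eq_lintegral_meas_lt _ (Eventually.of_forall hq0) hq.aemeasurable
  have meas : ∀ q : ℝ → ℝ, Measurable (fun s : ℝ => volume {x | s < q x}) := by
    intro q
    apply Antitone.measurable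
    intro a b hab
    exact measure_mono fun x hx => lt_of_le_of_lt hab hx
  rw [lc _ (by fun_prop) (fun x => div_nonneg (hf0 x) hF0.le),
    lc _ (by fun_prop) (fun x => div_nonneg (hg0 x) hG0.le),
    lc _ (by fun_prop) (fun x => div_nonneg (hk0 x) hP0.le),
    ← lintegral_const_mul _ (meas _), ← lintegral_const_mul _ (meas _),
    ← lintegral_add_left ((meas _).const_mul _)]
  refine setLIntegral_mono (meas _) ?_
  intro s hs
  rw [mem_Ioi] at hs
  by_cases hs1 : s < 1
  · have e1 : {x | s < f x / F}.Nonempty := by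
      obtain ⟨x, hx⟩ := exists_lt_of_lt_ciSup (show s * F < ⨆ x, f x by rw [← hF]; nlinarith)
      exact ⟨x, by simpa [lt_div_iff₀ hF0] using hx⟩
    have e2 : {x | s < g x / G}.Nonempty := by
      obtain ⟨x, hx⟩ := exists_lt_of_lt_ciSup (show s * G < ⨆ x, g x by rw [← hG]; nlinarith)
      exact ⟨x, by simpa [lt_div_iff₀ hG0] using hx⟩
    refine bm1 _ _ _ (measurableSet_lt measurable_const (by fun_prop))
      (measurableSet_lt measurable_const (by fun_prop)) e1 e2 t ht0 ht1 ?_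
    intro x hx y hy
    simp only [mem_ofPred_eq] at hx hy ⊢
    rw [lt_div_iff₀ hF0] at hx
    rw [lt_div_iff₀ hG0] at hy
    rw [lt_div_iff₀ hP0]
    have p1 : 0 < s * F := by positivity
    have p2 : 0 < s * G := by positivity
    refine lt_of_lt_of_le ?_ (h x y (p1.trans hx) (p2.trans hy))
    have q1 : (s * F) ^ (1 - t) < f x ^ (1 - t) := rpow_lt_rpow p1.le hx h1
    have q2 : (s * G) ^ t < g y ^ t := rpow_lt_rpow p2.le hy ht0
    have : s * P = (s * F) ^ (1 - t) * (s * G) ^ t := by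
      rw [mul_rpow hs.le hF0.le, mul_rpow hs.le hG0.le, mul_mul_mul_comm, ← rpow_add hs, hP]
      simp
    rw [this]
    exact mul_lt_mul'' q1 q2 (by positivity) (by positivity)
  · have e1 : {x | s < f x / F} = ∅ := by
      ext x; simp only [mem_ofPred_eq, mem_empty_iff_false, iff_false, not_lt]
      exact le_trans ((div_le_one hF0).2 (hfF x)) (not_lt.1 hs1)
    have e2 : {x | s < g x / G} = ∅ := by
      ext x; simp only [mem_ofPred_eq, mem_empty_iff_false, iff_false, not_lt]
      exact le_trans ((div_le_one hG0).2 (hgG x)) (not_lt.1 hs1)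
    simp [e1, e2]

end HelpersB1

section HelpersB2
open scoped Pointwise

theorem cons_cont (n : ℕ) : Continuous (fun p : ℝ × (Fin n → ℝ) => (Fin.cons p.1 p.2 : Fin (n+1) → ℝ)) := by
  refine continuous_pi fun i => ?_
  refine Fin.cases ?_ (fun j => ?_) i
  · simpa using continuous_fst
  · simp only [Fin.cons_succ]; fun_prop

theorem cons_mp (n : ℕ) : MeasurePreserving
    (fun p : ℝ × (Fin n → ℝ) => (Fin.cons p.1 p.2 : Fin (n+1) → ℝ)) volume volume := by
  have := (volume_preserving_piFinSuccAbove (fun _ : Fin (n+1) => ℝ) 0).symm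
  have e : (fun p : ℝ × (Fin n → ℝ) => (Fin.cons p.1 p.2 : Fin (n+1) → ℝ))
      = (MeasurableEquiv.piFinSuccAbove (fun _ : Fin (n+1) => ℝ) 0).symm := by
    funext p
    exact (Fin.insertNth_zero' p.1 p.2).symm
  rw [e]
  exact this

theorem vol_sec {n : ℕ} (A : Set (Fin (n+1) → ℝ)) (hA : MeasurableSet A) :
    volume A = ∫⁻ s : ℝ, volume {y : Fin n → ℝ | (Fin.cons s y : Fin (n+1) → ℝ) ∈ A} := by
  rw [← (cons_mp n).measure_preimage hA.nullMeasurableSet, Measure.volume_eq_prod,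
    Measure.prod_apply ((cons_mp n).measurable hA)]
  rfl

theorem sec_meas {n : ℕ} (A : Set (Fin (n+1) → ℝ)) (hA : MeasurableSet A) :
    Measurable (fun s : ℝ => volume {y : Fin n → ℝ | (Fin.cons s y : Fin (n+1) → ℝ) ∈ A}) :=
  measurable_measure_prodMk_left ((cons_mp n).measurable hA)

theorem sec_bdd {n : ℕ} (A : Set (Fin (n+1) → ℝ)) (hA : IsBounded A) :
    ∃ R : ℝ, ∀ s : ℝ, {y : Fin n → ℝ | (Fin.cons s y : Fin (n+1) → ℝ) ∈ A} ⊆ Metric.closedBall 0 R := by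
  obtain ⟨R, hR⟩ := hA.subset_closedBall 0
  refine ⟨R, fun s y hy => ?_⟩
  have := hR hy
  simp only [Metric.mem_closedBall, dist_zero_right] at this ⊢
  refine le_trans ?_ this
  refine (pi_norm_le_iff_of_nonneg (norm_nonneg _)).2 fun i => ?_
  have := norm_le_pi_norm (Fin.cons s y : Fin (n+1) → ℝ) i.succ
  simpa using this

theorem bm (n : ℕ) : ∀ (A B C : Set (Fin n → ℝ)), IsOpen A → IsOpen B → MeasurableSet C →
    IsBounded A → IsBounded B → IsBounded C → A.Nonempty → B.Nonempty →
    ∀ t : ℝ, 0 < t → t < 1 → (∀ x ∈ A, ∀ y ∈ B, (1 - t) • x + t • y ∈ C) →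
    volume A ^ (1 - t) * volume B ^ t ≤ volume C := by
  induction n with
  | zero =>
    intro A B C _ _ _ _ _ _ hAn hBn t ht0 ht1 h
    obtain ⟨a, ha⟩ := hAn
    obtain ⟨b, hb⟩ := hBn
    have hC := h a ha b hb
    have e : ∀ (S : Set (Fin 0 → ℝ)) (x), x ∈ S → S = univ := fun S x hx => by
      ext y; simp [Subsingleton.elim y x, hx]
    rw [e A a ha, e B b hb, e C _ hC]
    have v1 : volume (univ : Set (Fin 0 → ℝ)) = 1 := by
      rw [volume_pi, Measure.pi_univ]; simp
    rw [v1]; simp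
  | succ n ih =>
    intro A B C hA hB hC bA bB bC hAn hBn t ht0 ht1 h
    rw [vol_sec A hA.measurableSet, vol_sec B hB.measurableSet, vol_sec C hC]
    have fin : ∀ S : Set (Fin (n+1) → ℝ), IsBounded S → ∃ M : ℝ≥0∞, M ≠ ∞ ∧ ∀ s : ℝ,
        volume {y : Fin n → ℝ | (Fin.cons s y : Fin (n+1) → ℝ) ∈ S} ≤ M := by
      intro S hS
      obtain ⟨R, hR⟩ := sec_bdd S hS
      exact ⟨_, (isCompact_closedBall (0 : Fin n → ℝ) R).measure_lt_top.ne, fun s => measure_mono (hR s)⟩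
    obtain ⟨MA, hMA, hMA'⟩ := fin A bA
    obtain ⟨MB, hMB, hMB'⟩ := fin B bB
    obtain ⟨MC, hMC, hMC'⟩ := fin C bC
    have key := pl1 (fun s => (volume {y : Fin n → ℝ | (Fin.cons s y : Fin (n+1) → ℝ) ∈ A}).toReal)
      (fun s => (volume {y : Fin n → ℝ | (Fin.cons s y : Fin (n+1) → ℝ) ∈ B}).toReal)
      (fun s => (volume {y : Fin n → ℝ | (Fin.cons s y : Fin (n+1) → ℝ) ∈ C}).toReal)
      (sec_meas A hA.measurableSet).ennreal_toReal (sec_meas B hB.measurableSet).ennreal_toReal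
      (sec_meas C hC).ennreal_toReal (fun _ => ENNReal.toReal_nonneg)
      (fun _ => ENNReal.toReal_nonneg) (fun _ => ENNReal.toReal_nonneg)
      ⟨MA.toReal, by rintro _ ⟨s, rfl⟩; exact ENNReal.toReal_mono hMA (hMA' s)⟩
      ⟨MB.toReal, by rintro _ ⟨s, rfl⟩; exact ENNReal.toReal_mono hMB (hMB' s)⟩ t ht0 ht1 ?_
    · have r1 : ∀ s, ENNReal.ofReal (volume {y : Fin n → ℝ | (Fin.cons s y : Fin (n+1) → ℝ) ∈ A}).toReal
         = volume {y : Fin n → ℝ | (Fin.cons s y : Fin (n+1) → ℝ) ∈ A} := fun s =>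
         ENNReal.ofReal_toReal (ne_top_of_le_ne_top hMA (hMA' s))
      have r2 : ∀ s, ENNReal.ofReal (volume {y : Fin n → ℝ | (Fin.cons s y : Fin (n+1) → ℝ) ∈ B}).toReal
         = volume {y : Fin n → ℝ | (Fin.cons s y : Fin (n+1) → ℝ) ∈ B} := fun s =>
         ENNReal.ofReal_toReal (ne_top_of_le_ne_top hMB (hMB' s))
      have r3 : ∀ s, ENNReal.ofReal (volume {y : Fin n → ℝ | (Fin.cons s y : Fin (n+1) → ℝ) ∈ C}).toReal
         = volume {y : Fin n → ℝ | (Fin.cons s y : Fin (n+1) → ℝ) ∈ C} := fun s =>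
         ENNReal.ofReal_toReal (ne_top_of_le_ne_top hMC (hMC' s))
      simp only [r1, r2, r3] at key
      exact key
    · intro x y hx hy
      have nx : {z : Fin n → ℝ | (Fin.cons x z : Fin (n+1) → ℝ) ∈ A}.Nonempty := by
        by_contra hne
        rw [not_nonempty_iff_eq_empty] at hne
        simp [hne] at hx
      have ny : {z : Fin n → ℝ | (Fin.cons y z : Fin (n+1) → ℝ) ∈ B}.Nonempty := by
        by_contra hne
        rw [not_nonempty_iff_eq_empty] at hne
        simp [hne] at hy
      have co : ∀ s : ℝ, Continuous (fun z : Fin n → ℝ => (Fin.cons s z : Fin (n+1) → ℝ)) :=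
        fun s => (cons_cont n).comp (by fun_prop : Continuous fun z : Fin n → ℝ => (s, z))
      have bs : ∀ S : Set (Fin (n+1) → ℝ), IsBounded S → ∀ s : ℝ,
          IsBounded {z : Fin n → ℝ | (Fin.cons s z : Fin (n+1) → ℝ) ∈ S} := by
        intro S hS s
        obtain ⟨R, hR⟩ := sec_bdd S hS
        exact Metric.isBounded_closedBall.subset (hR s)
      have := ih _ _ {z : Fin n → ℝ | (Fin.cons ((1 - t) * x + t * y) z : Fin (n+1) → ℝ) ∈ C}
        (hA.preimage (co x)) (hB.preimage (co y)) ((co _).measurable hC)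
        (bs A bA x) (bs B bB y) (bs C bC _) nx ny t ht0 ht1 ?_
      · have h2 := ENNReal.toReal_mono (ne_top_of_le_ne_top hMC (hMC' _)) this
        rwa [ENNReal.toReal_mul, ← ENNReal.toReal_rpow, ← ENNReal.toReal_rpow] at h2
      · intro p hp q hq
        have := h _ hp _ hq
        have e : (1 - t) • (Fin.cons x p : Fin (n+1) → ℝ) + t • (Fin.cons y q : Fin (n+1) → ℝ)
          = Fin.cons ((1 - t) * x + t * y) ((1 - t) • p + t • q) := by
          ext i
          refine Fin.cases ?_ (fun j => ?_) i <;> simp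
        rw [e] at this
        exact this

end HelpersB2

section HelpersB3
open scoped Pointwise

theorem bm_real {n : ℕ} (A B C : Set (Fin n → ℝ)) (hA : IsOpen A) (hB : IsOpen B)
    (hC : MeasurableSet C) (bA : IsBounded A) (bB : IsBounded B) (bC : IsBounded C)
    (hAn : A.Nonempty) (hBn : B.Nonempty)
    (t : ℝ) (ht0 : 0 < t) (ht1 : t < 1) (h : ∀ x ∈ A, ∀ y ∈ B, (1 - t) • x + t • y ∈ C) :
    volume.real A ^ (1 - t) * volume.real B ^ t ≤ volume.real C := by
  have := bm n A B C hA hB hC bA bB bC hAn hBn t ht0 ht1 h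
  have h2 := ENNReal.toReal_mono bC.measure_lt_top.ne this
  rwa [ENNReal.toReal_mul, ← ENNReal.toReal_rpow, ← ENNReal.toReal_rpow] at h2

theorem bm_half {n : ℕ} (A B C : Set (Fin n → ℝ)) (hA : IsOpen A) (hB : IsOpen B)
    (hC : MeasurableSet C) (bA : IsBounded A) (bB : IsBounded B) (bC : IsBounded C)
    (h : ∀ x ∈ A, ∀ y ∈ B, (1 / 2 : ℝ) • x + (1 / 2 : ℝ) • y ∈ C) :
    volume.real A * volume.real B ≤ volume.real C ^ 2 := by
  rcases A.eq_empty_or_nonempty with rfl | hAn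
  · simp
  rcases B.eq_empty_or_nonempty with rfl | hBn
  · simp
  have := bm_real A B C hA hB hC bA bB bC hAn hBn (1/2) (by norm_num) (by norm_num)
    (by intro x hx y hy; have := h x hx y hy; norm_num at this ⊢; exact this)
  norm_num at this
  rw [← Real.sqrt_eq_rpow, ← Real.sqrt_eq_rpow] at this
  have h3 := pow_le_pow_left₀ (by positivity) this 2
  rwa [mul_pow, Real.sq_sqrt measureReal_nonneg, Real.sq_sqrt measureReal_nonneg] at h3

theorem homothety_vol {n : ℕ} (B S : Set (Fin n → ℝ)) (bS : IsBounded S) (p : Fin n → ℝ)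
    (h : ∀ y ∈ B, p + (1 / 5 : ℝ) • (y - p) ∈ S) :
    (1 / 5 : ℝ) ^ n * volume.real B ≤ volume.real S := by
  have hs : (AffineMap.homothety p (1 / 5 : ℝ)) '' B ⊆ S := by
    rintro _ ⟨y, hy, rfl⟩
    have := h y hy
    simpa [AffineMap.homothety_apply, add_comm] using this
  have := ENNReal.toReal_mono bS.measure_lt_top.ne (measure_mono (μ := volume) hs)
  rw [Measure.addHaar_image_homothety] at this
  rw [ENNReal.toReal_mul, ENNReal.toReal_ofReal (abs_nonneg _)] at this
  simpa [measureReal_def] using this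

theorem width_core {k : ℕ} (A B C : Set (Fin (k+1) → ℝ)) (hA : IsOpen A) (hB : IsOpen B)
    (hC : MeasurableSet C) (bA : IsBounded A) (bB : IsBounded B) (bC : IsBounded C)
    (cB : Convex ℝ B)
    (h : ∀ x ∈ A, ∀ y ∈ B, (1 / 2 : ℝ) • x + (1 / 2 : ℝ) • y ∈ C)
    (a0 α b0 β : ℝ) (hα : 0 < α) (hαβ : 4 * 5 ^ (k+1) * α ≤ β)
    (hAr : ∀ y ∈ A, a0 ≤ y 0 ∧ y 0 ≤ a0 + α)
    (hBr : ∀ y ∈ B, b0 ≤ y 0 ∧ y 0 ≤ b0 + β)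
    (hBl : ∃ p ∈ B, p 0 < b0 + β / 20) (hBu : ∃ p ∈ B, b0 + β - β / 20 < p 0) :
    (1 + (1 / 5 : ℝ) ^ (k+1)) * (volume.real A * volume.real B) ≤ volume.real C ^ 2 := by
  set θ := (1 / 5 : ℝ) ^ (k+1) with hθ
  have hθ0 : 0 < θ := by positivity
  have c0 : Continuous (fun y : Fin (k+1) → ℝ => y 0) := continuous_apply 0
  -- pigeonhole
  set l : ℕ → ℝ := fun i => b0 + β / 4 + 2 * α * i with hl
  set S : ℕ → Set (Fin (k+1) → ℝ) := fun i => {y | l i ≤ y 0 ∧ y 0 ≤ l i + α} with hS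
  have hSm : ∀ i, MeasurableSet (S i) := fun i =>
    ((isClosed_le continuous_const c0).inter (isClosed_le c0 continuous_const)).measurableSet
  have hβ : 0 < β := lt_of_lt_of_le (by positivity) hαβ
  obtain ⟨i, hi, hiB⟩ : ∃ i ∈ Finset.range (5 ^ (k+1)),
      volume.real (B ∩ S i) ≤ θ * volume.real B := by
    by_contra hcon
    push Not at hcon
    have hsum : ∑ i ∈ Finset.range (5 ^ (k+1)), volume.real (B ∩ S i) ≤ volume.real B := by
      rw [← measureReal_biUnion_finset (h := fun i _ => (bB.subset inter_subset_left).measure_lt_top.ne)]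
      · refine measureReal_mono ?_ bB.measure_lt_top.ne
        exact iUnion₂_subset fun i _ => inter_subset_left
      · intro i _ j _ hij
        refine Disjoint.mono inter_subset_right inter_subset_right ?_
        rw [Set.disjoint_left]
        intro y hy1 hy2
        simp only [hS, hl, mem_ofPred_eq] at hy1 hy2
        rcases lt_or_gt_of_ne hij with h1 | h1
        · have : (i:ℝ) + 1 ≤ j := by exact_mod_cast h1
          nlinarith
        · have : (j:ℝ) + 1 ≤ i := by exact_mod_cast h1
          nlinarith
      · intro i _
        exact hB.measurableSet.inter (hSm i)
    have h2 : ∑ i ∈ Finset.range (5 ^ (k+1)), θ * volume.real B <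
        ∑ i ∈ Finset.range (5 ^ (k+1)), volume.real (B ∩ S i) :=
      Finset.sum_lt_sum_of_nonempty (by simp) hcon
    simp only [Finset.sum_const, Finset.card_range, nsmul_eq_mul] at h2
    have h3 : ((5 ^ (k+1) : ℕ) : ℝ) * θ = 1 := by
      rw [hθ]; push_cast; rw [← mul_pow]; norm_num
    rw [← mul_assoc, h3] at h2
    linarith
  have hi' : (i : ℝ) + 1 ≤ 5 ^ (k+1) := by
    have := Finset.mem_range.1 hi
    exact_mod_cast this
  have hil : b0 + β / 4 ≤ l i := by
    simp only [hl]; nlinarith [show (0:ℝ) ≤ i from Nat.cast_nonneg i]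
  have hiu : l i + α ≤ b0 + 3 * β / 4 := by
    simp only [hl]; nlinarith [show (0:ℝ) ≤ i from Nat.cast_nonneg i]
  set B1 := B ∩ {y | y 0 < l i} with hB1
  set B2 := B ∩ {y | l i + α < y 0} with hB2
  have oB1 : IsOpen B1 := hB.inter (isOpen_lt c0 continuous_const)
  have oB2 : IsOpen B2 := hB.inter (isOpen_lt continuous_const c0)
  have b1 : IsBounded B1 := bB.subset inter_subset_left
  have b2 : IsBounded B2 := bB.subset inter_subset_left
  set C1 := C ∩ {y | y 0 < (a0 + α + l i) / 2} with hC1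
  set C2 := C ∩ {y | (a0 + α + l i) / 2 < y 0} with hC2
  have mC1 : MeasurableSet C1 := hC.inter (isOpen_lt c0 continuous_const).measurableSet
  have mC2 : MeasurableSet C2 := hC.inter (isOpen_lt continuous_const c0).measurableSet
  have bC1 : IsBounded C1 := bC.subset inter_subset_left
  have bC2 : IsBounded C2 := bC.subset inter_subset_left
  have hCs : volume.real C1 + volume.real C2 ≤ volume.real C := by
    rw [← measureReal_union _ mC2 bC1.measure_lt_top.ne bC2.measure_lt_top.ne]
    · exact measureReal_mono (union_subset inter_subset_left inter_subset_left) bC.measure_lt_top.ne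
    · rw [Set.disjoint_left]
      rintro y ⟨_, h1⟩ ⟨_, h2⟩
      simp only [mem_ofPred_eq] at h1 h2
      exact lt_asymm h1 h2
  have i1 := bm_half A B1 C1 hA oB1 mC1 bA b1 bC1 (by
    rintro x hx y ⟨hy, hy'⟩
    refine ⟨h x hx y hy, ?_⟩
    have := (hAr x hx).2
    simp only [mem_ofPred_eq, Pi.add_apply, Pi.smul_apply, smul_eq_mul] at hy' ⊢
    linarith)
  have i2 := bm_half A B2 C2 hA oB2 mC2 bA b2 bC2 (by
    rintro x hx y ⟨hy, hy'⟩
    refine ⟨h x hx y hy, ?_⟩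
    have := (hAr x hx).1
    simp only [mem_ofPred_eq, Pi.add_apply, Pi.smul_apply, smul_eq_mul] at hy' ⊢
    linarith)
  have j1 : θ * volume.real B ≤ volume.real B1 := by
    obtain ⟨p, hp, hp'⟩ := hBl
    refine homothety_vol B B1 b1 p fun y hy => ⟨?_, ?_⟩
    · have := cB.add_smul_sub_mem hp hy (t := 1/5) ⟨by norm_num, by norm_num⟩
      exact this
    · have := (hBr y hy).2
      have := (hBr p hp).1
      simp only [mem_ofPred_eq, Pi.add_apply, Pi.smul_apply, smul_eq_mul, Pi.sub_apply]
      linarith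
  have j2 : θ * volume.real B ≤ volume.real B2 := by
    obtain ⟨p, hp, hp'⟩ := hBu
    refine homothety_vol B B2 b2 p fun y hy => ⟨?_, ?_⟩
    · have := cB.add_smul_sub_mem hp hy (t := 1/5) ⟨by norm_num, by norm_num⟩
      exact this
    · have := (hBr y hy).1
      have := (hBr p hp).2
      simp only [mem_ofPred_eq, Pi.add_apply, Pi.smul_apply, smul_eq_mul, Pi.sub_apply]
      linarith
  have j3 : volume.real B ≤ volume.real B1 + volume.real B2 + θ * volume.real B := by
    have hsub : B ⊆ (B1 ∪ B2) ∪ (B ∩ S i) := by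
      intro y hy
      rcases lt_or_ge (y 0) (l i) with h1 | h1
      · exact Or.inl (Or.inl ⟨hy, h1⟩)
      rcases lt_or_ge (l i + α) (y 0) with h2 | h2
      · exact Or.inl (Or.inr ⟨hy, h2⟩)
      · exact Or.inr ⟨hy, h1, h2⟩
    have e1 := measureReal_mono (μ := volume) hsub
      ((b1.union b2).union (bB.subset inter_subset_left)).measure_lt_top.ne
    have e2 := measureReal_union_le (μ := volume) (B1 ∪ B2) (B ∩ S i)
    have e3 := measureReal_union_le (μ := volume) B1 B2
    linarith
  have hA0 : 0 ≤ volume.real A := measureReal_nonneg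
  have hB0 : 0 ≤ volume.real B := measureReal_nonneg
  have hc1 : 0 ≤ volume.real C1 := measureReal_nonneg
  have hc2 : 0 ≤ volume.real C2 := measureReal_nonneg
  have j4 : θ * (volume.real A * volume.real B) ≤ volume.real C1 * volume.real C2 := by
    have k1 : volume.real A * (θ * volume.real B) ≤ volume.real C1 ^ 2 :=
      le_trans (mul_le_mul_of_nonneg_left j1 hA0) i1
    have k2 : volume.real A * (θ * volume.real B) ≤ volume.real C2 ^ 2 :=
      le_trans (mul_le_mul_of_nonneg_left j2 hA0) i2
    have k3 := mul_le_mul k1 k2 (by positivity) (by positivity)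
    rw [← mul_pow, ← pow_two] at k3
    have := (sq_le_sq₀ (by positivity) (by positivity)).1 k3
    linarith
  have j5 : (volume.real C1 + volume.real C2) ^ 2 ≤ volume.real C ^ 2 :=
    pow_le_pow_left₀ (by positivity) hCs 2
  nlinarith [mul_le_mul_of_nonneg_left j3 hA0]

end HelpersB3

section HelpersB4
open scoped Pointwise

theorem open_conv_Ioo (S : Set ℝ) (ho : IsOpen S) (hc : Convex ℝ S) (hb : IsBounded S)
    (hn : S.Nonempty) : ∃ a b : ℝ, a < b ∧ S = Ioo a b := by
  have ba := hb.bddAbove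
  have bb := hb.bddBelow
  have e : S = Ioo (sInf S) (sSup S) := by
    apply Subset.antisymm
    · intro x hx
      obtain ⟨ε, hε, h⟩ := Metric.isOpen_iff.1 ho x hx
      rw [Real.ball_eq_Ioo] at h
      have h1 : x - ε / 2 ∈ S := h ⟨by linarith, by linarith⟩
      have h2 : x + ε / 2 ∈ S := h ⟨by linarith, by linarith⟩
      have := csInf_le bb h1
      have := le_csSup ba h2
      constructor <;> linarith
    · intro x hx
      obtain ⟨y, hy, h1⟩ := exists_lt_of_csInf_lt hn hx.1
      obtain ⟨z, hz, h2⟩ := exists_lt_of_lt_csSup hn hx.2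
      exact hc.ordConnected.out hy hz ⟨h1.le, h2.le⟩
  refine ⟨sInf S, sSup S, ?_, e⟩
  rw [e] at hn
  exact nonempty_Ioo.1 hn

/-- section of a set in a product -/
def secK {n : ℕ} (K : Set (ℝ × (Fin n → ℝ))) (s : ℝ) : Set (Fin n → ℝ) := {y | (s, y) ∈ K}

theorem secK_open {n : ℕ} {K : Set (ℝ × (Fin n → ℝ))} (ho : IsOpen K) (s : ℝ) : IsOpen (secK K s) :=
  ho.preimage (by fun_prop : Continuous fun y : Fin n → ℝ => (s, y))

theorem secK_bdd {n : ℕ} {K : Set (ℝ × (Fin n → ℝ))} (hb : IsBounded K) (s : ℝ) :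
    IsBounded (secK K s) := by
  apply (hb.image_snd).subset
  intro y hy
  exact ⟨(s, y), hy, rfl⟩

theorem secK_conv {n : ℕ} {K : Set (ℝ × (Fin n → ℝ))} (hc : Convex ℝ K) {s t : ℝ} {y z : Fin n → ℝ}
    (hy : y ∈ secK K s) (hz : z ∈ secK K t) {a b : ℝ} (ha : 0 ≤ a) (hb : 0 ≤ b) (hab : a + b = 1) :
    a • y + b • z ∈ secK K (a * s + b * t) := by
  have := hc hy hz ha hb hab
  simpa [secK] using this

theorem secK_convex {n : ℕ} {K : Set (ℝ × (Fin n → ℝ))} (hc : Convex ℝ K) (s : ℝ) :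
    Convex ℝ (secK K s) := by
  intro y hy z hz a b ha hb hab
  have := secK_conv hc hy hz ha hb hab
  rwa [← add_mul, hab, one_mul] at this

theorem sec_pkg {n : ℕ} (K : Set (ℝ × (Fin n → ℝ))) (ho : IsOpen K) (hc : Convex ℝ K)
    (hb : IsBounded K) (hn : K.Nonempty) :
    ∃ s1 s2 : ℝ, s1 < s2 ∧ (∀ s, (secK K s).Nonempty ↔ s ∈ Ioo s1 s2) ∧
      (∀ s ∈ Ioo s1 s2, 0 < volume.real (secK K s)) ∧
      ConvexOn ℝ (Ioo s1 s2) (fun s => -log (volume.real (secK K s))) ∧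
      (∀ g : ℝ → ℝ, Continuous g → Integrable (fun s => g s * volume.real (secK K s)) ∧
        ∀ J : Set ℝ, MeasurableSet J → ∫ p in K ∩ Prod.fst ⁻¹' J, g p.1 =
          ∫ s in J, g s * volume.real (secK K s)) := by
  have e0 : ∀ s, (secK K s).Nonempty ↔ s ∈ Prod.fst '' K := by
    intro s
    constructor
    · rintro ⟨y, hy⟩; exact ⟨(s, y), hy, rfl⟩
    · rintro ⟨⟨s', y⟩, hy, rfl⟩; exact ⟨y, hy⟩
  obtain ⟨s1, s2, h12, e⟩ := open_conv_Ioo (Prod.fst '' K) (isOpenMap_fst _ ho)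
    (hc.is_linear_image ⟨fun _ _ => rfl, fun _ _ => rfl⟩) hb.image_fst (hn.image _)
  have e1 : ∀ s, (secK K s).Nonempty ↔ s ∈ Ioo s1 s2 := by intro s; rw [e0, e]
  have pos : ∀ s ∈ Ioo s1 s2, 0 < volume.real (secK K s) := by
    intro s hs
    rw [measureReal_def]
    exact ENNReal.toReal_pos ((secK_open ho s).measure_pos _ ((e1 s).2 hs)).ne'
      (secK_bdd hb s).measure_lt_top.ne
  refine ⟨s1, s2, h12, e1, pos, ⟨convex_Ioo _ _, ?_⟩, ?_⟩
  · intro s hs t ht a b ha hb' hab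
    rcases ha.eq_or_lt with rfl | ha
    · have : b = 1 := by linarith
      subst this; simp
    rcases hb'.eq_or_lt with rfl | hb'
    · have : a = 1 := by linarith
      subst this; simp
    have q := bm_real (secK K s) (secK K t) (secK K (a * s + b * t)) (secK_open ho _) (secK_open ho _)
      (secK_open ho _).measurableSet (secK_bdd hb _) (secK_bdd hb _) (secK_bdd hb _)
      ((e1 s).2 hs) ((e1 t).2 ht) b hb' (by linarith) (fun x hx y hy => by
        have := secK_conv hc hx hy ha.le hb'.le hab
        rwa [show 1 - b = a by linarith])
    rw [show 1 - b = a by linarith] at q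
    have ps := pos s hs
    have pt := pos t ht
    have := Real.log_le_log (by positivity) q
    rw [Real.log_mul (by positivity) (by positivity), Real.log_rpow ps, Real.log_rpow pt] at this
    simp only [smul_eq_mul]
    linarith
  · intro g cg
    have hi : IntegrableOn (fun p : ℝ × (Fin n → ℝ) => g p.1) K :=
      ((cg.comp continuous_fst).continuousOn.integrableOn_compact hb.isCompact_closure).mono_set
        subset_closure
    have gen : ∀ J : Set ℝ, MeasurableSet J →
        Integrable (fun p : ℝ × (Fin n → ℝ) => (K ∩ Prod.fst ⁻¹' J).indicator (fun p => g p.1) p)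
          (volume.prod volume) ∧
        (fun s => ∫ y : Fin n → ℝ, (K ∩ Prod.fst ⁻¹' J).indicator (fun p => g p.1) (s, y)) =
          J.indicator (fun s => g s * volume.real (secK K s)) := by
      intro J hJ
      constructor
      · rw [← Measure.volume_eq_prod]
        exact (hi.mono_set inter_subset_left).integrable_indicator
          (ho.measurableSet.inter (measurable_fst hJ))
      · funext s
        by_cases hs : s ∈ J
        · have : (fun y : Fin n → ℝ => (K ∩ Prod.fst ⁻¹' J).indicator (fun p => g p.1) (s, y)) =
              (secK K s).indicator (fun _ => g s) := by
            funext y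
            by_cases hy : (s, y) ∈ K
            · simp [indicator, secK, hy, hs]
            · simp [indicator, secK, hy]
          rw [this, integral_indicator (secK_open ho s).measurableSet, setIntegral_const,
            indicator_of_mem hs, smul_eq_mul, mul_comm]
        · simp [indicator, hs]
    constructor
    · have := (gen univ MeasurableSet.univ).1.integral_prod_left
      rw [(gen univ MeasurableSet.univ).2] at this
      simpa using this
    · intro J hJ
      rw [← integral_indicator (ho.measurableSet.inter (measurable_fst hJ)), Measure.volume_eq_prod,
        integral_prod _ (gen J hJ).1, (gen J hJ).2, integral_indicator hJ]

/-- first coordinate projection of the section -/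
def projK {k : ℕ} (K : Set (ℝ × (Fin (k+1) → ℝ))) (s : ℝ) : Set ℝ := (fun y => y 0) '' secK K s

theorem projK_Ioo {k : ℕ} (K : Set (ℝ × (Fin (k+1) → ℝ))) (ho : IsOpen K) (hc : Convex ℝ K)
    (hb : IsBounded K) (s : ℝ) (hn : (secK K s).Nonempty) : ∃ a b : ℝ, a < b ∧ projK K s = Ioo a b := by
  apply open_conv_Ioo
  · exact isOpenMap_eval 0 _ (secK_open ho s)
  · exact (secK_convex hc s).is_linear_image ⟨fun _ _ => rfl, fun _ _ => rfl⟩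
  · have := (LipschitzWith.eval (α := fun _ : Fin (k+1) => ℝ) 0).isBounded_image (secK_bdd hb s)
    exact this
  · exact hn.image _

theorem proj_width {k : ℕ} (K : Set (ℝ × (Fin (k+1) → ℝ))) (ho : IsOpen K) (hc : Convex ℝ K)
    (hb : IsBounded K) (s t : ℝ) (hs : (secK K s).Nonempty) (ht : (secK K t).Nonempty)
    (hr : volume.real (secK K ((s + t) / 2)) ^ 2 <
      (1 + (1 / 5 : ℝ) ^ (k+1)) * (volume.real (secK K s) * volume.real (secK K t))) :
    volume.real (projK K t) ≤ 4 * 5 ^ (k+1) * volume.real (projK K s) := by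
  obtain ⟨a, b, hab, e1⟩ := projK_Ioo K ho hc hb s hs
  obtain ⟨a', b', hab', e2⟩ := projK_Ioo K ho hc hb t ht
  rw [e1, e2, Real.volume_real_Ioo_of_le hab.le, Real.volume_real_Ioo_of_le hab'.le]
  by_contra hcon
  push Not at hcon
  have m1 : ∀ y ∈ secK K s, y 0 ∈ Ioo a b := fun y hy => by rw [← e1]; exact ⟨y, hy, rfl⟩
  have m2 : ∀ y ∈ secK K t, y 0 ∈ Ioo a' b' := fun y hy => by rw [← e2]; exact ⟨y, hy, rfl⟩
  have m3 : ∀ z ∈ Ioo a' b', ∃ p ∈ secK K t, p 0 = z := fun z hz => by rw [← e2] at hz; exact hz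
  have := width_core (secK K s) (secK K t) (secK K ((s + t) / 2)) (secK_open ho _) (secK_open ho _)
      (secK_open ho _).measurableSet (secK_bdd hb _) (secK_bdd hb _) (secK_bdd hb _)
      (secK_convex hc t) (fun x hx y hy => by
        have := secK_conv hc hx hy (a := 1/2) (b := 1/2) (by norm_num) (by norm_num) (by norm_num)
        rwa [show (1 / 2 * s + 1 / 2 * t : ℝ) = (s + t) / 2 by ring] at this)
      a (b - a) a' (b' - a') (by linarith) hcon.le
      (fun y hy => ⟨(m1 y hy).1.le, by linarith [(m1 y hy).2]⟩)
      (fun y hy => ⟨(m2 y hy).1.le, by linarith [(m2 y hy).2]⟩)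
      (by
        obtain ⟨p, hp, e⟩ := m3 (a' + (b' - a') / 30) ⟨by linarith, by linarith⟩
        exact ⟨p, hp, by linarith⟩)
      (by
        obtain ⟨p, hp, e⟩ := m3 (b' - (b' - a') / 30) ⟨by linarith, by linarith⟩
        exact ⟨p, hp, by linarith⟩)
  linarith

end HelpersB4

section HelpersC1
open scoped Pointwise

theorem fub_map {k : ℕ} (m v : EuclideanSpace ℝ (Fin (k+2))) (hm : ‖m‖ = 1) (hv : ‖v‖ = 1)
    (hmv : ⟪m, v⟫ = 0) :
    ∃ Φ : (ℝ × (Fin (k+1) → ℝ)) ≃L[ℝ] EuclideanSpace ℝ (Fin (k+2)),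
      MeasurePreserving Φ volume volume ∧ (∀ p, ⟪Φ p, m⟫ = p.1) ∧ (∀ p, ⟪Φ p, v⟫ = p.2 0) ∧
      (∀ s y, Φ (s, y) = s • m + Φ (0, y)) := by
  have ho : Orthonormal ℝ (({0, 1} : Set (Fin (k+2))).domRestrict
      (Fin.cons m (fun _ => v) : Fin (k+2) → EuclideanSpace ℝ (Fin (k+2)))) := by
    constructor
    · rintro ⟨i, hi⟩
      rcases hi with rfl | rfl
      · simpa using hm
      · simpa using hv
    · rintro ⟨i, hi⟩ ⟨j, hj⟩ hij
      have hne : i ≠ j := fun h => hij (Subtype.ext h)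
      simp only [mem_insert_iff, mem_singleton_iff] at hi hj
      rcases hi with rfl | rfl <;> rcases hj with rfl | rfl
      · exact absurd rfl hne
      · simpa using hmv
      · rw [real_inner_comm]; simpa using hmv
      · exact absurd rfl hne
  obtain ⟨b, hb⟩ := ho.exists_orthonormalBasis_extension_of_card_eq (by simp)
  have hb0 : b 0 = m := by simpa using hb 0 (by simp)
  have hb1 : b 1 = v := by simpa using hb 1 (by simp)
  set Φ : (ℝ × (Fin (k+1) → ℝ)) ≃L[ℝ] EuclideanSpace ℝ (Fin (k+2)) :=
    ((Fin.consEquivL ℝ (fun _ : Fin (k+2) => ℝ)).trans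
      (EuclideanSpace.equiv (Fin (k+2)) ℝ).symm).trans b.repr.symm.toContinuousLinearEquiv with hΦ
  have ap : ∀ p, Φ p = b.repr.symm (WithLp.toLp 2 (Fin.cons p.1 p.2 : Fin (k+2) → ℝ)) := fun p => rfl
  have inn : ∀ p i, ⟪Φ p, b i⟫ = (Fin.cons p.1 p.2 : Fin (k+2) → ℝ) i := by
    intro p i
    rw [real_inner_comm, ← b.repr_apply_apply, ap]
    simp
  refine ⟨Φ, ?_, ?_, ?_, ?_⟩
  · exact (b.measurePreserving_repr_symm.comp (PiLp.volume_preserving_toLp (Fin (k+2)))).comp (cons_mp (k+1))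
  · intro p; rw [← hb0, inn]; simp
  · intro p; rw [← hb1, inn]; exact Fin.cons_succ (α := fun _ : Fin (k+2) => ℝ) p.1 p.2 0
  · intro s y
    have : ((s, y) : ℝ × (Fin (k+1) → ℝ)) = s • (1, 0) + (0, y) := by simp
    rw [this, map_add, map_smul]
    congr 2
    apply b.repr.injective
    rw [ap]
    ext i
    simp only [LinearIsometryEquiv.apply_symm_apply]
    rw [← hb0, b.repr_self]
    refine Fin.cases ?_ (fun j => ?_) i <;> simp

theorem exists_perp {k : ℕ} (m : EuclideanSpace ℝ (Fin (k+2))) : ∃ v : EuclideanSpace ℝ (Fin (k+2)),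
    ‖v‖ = 1 ∧ ⟪m, v⟫ = 0 := by
  have h2 : Module.finrank ℝ (ℝ ∙ m) ≤ 1 := (finrank_span_le_card ({m} : Set (EuclideanSpace ℝ (Fin (k+2))))).trans (by simp)
  have h1 := (ℝ ∙ m).finrank_add_finrank_orthogonal
  rw [finrank_euclideanSpace, Fintype.card_fin] at h1
  have h3 : 0 < Module.finrank ℝ (ℝ ∙ m)ᗮ := by omega
  have := Module.finrank_pos_iff.1 h3
  obtain ⟨x, hx⟩ := exists_ne (0 : (ℝ ∙ m)ᗮ)
  have hx' : (x : EuclideanSpace ℝ (Fin (k+2))) ≠ 0 := fun h => hx (Subtype.ext h)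
  refine ⟨(‖(x : EuclideanSpace ℝ (Fin (k+2)))‖)⁻¹ • x, norm_smul_inv_norm hx', ?_⟩
  rw [inner_smul_right, (Submodule.mem_orthogonal_singleton_iff_inner_right).1 x.2, mul_zero]

end HelpersC1

section HelpersH1
open scoped Pointwise

set_option maxHeartbeats 2000000 in
theorem layer {N : ℕ} (Ω : Set (EuclideanSpace ℝ (Fin N))) (ho : IsOpen Ω) (hc : Convex ℝ Ω)
    (hb : IsBounded Ω) (h0 : (0 : EuclideanSpace ℝ (Fin N)) ∈ Ω) (hd : ∀ x ∈ Ω, ‖x‖ ≤ 1)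
    (u : EuclideanSpace ℝ (Fin N) → ℝ) (hu : ContDiff ℝ 1 u) (hcs : HasCompactSupport u)
    (δ : ℝ) (hδ : 0 < δ) (hδ2 : δ ≤ 1 / 2) :
    (∫ x in Ω, u x ^ 2) - (∫ x in (1 - δ) • Ω, u x ^ 2) ≤
      (2 * N + 1) * δ * ((∫ x in Ω, u x ^ 2) + ∫ x in Ω, ‖fderiv ℝ u x‖ ^ 2) := by
  have cu : Continuous u := hu.continuous
  have cf : Continuous (fderiv ℝ u) := hu.continuous_fderiv one_ne_zero
  have du : Differentiable ℝ u := hu.differentiable one_ne_zero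
  obtain ⟨C1, hC1⟩ := hcs.exists_bound_of_continuous cu
  obtain ⟨C2, hC2⟩ := (hcs.fderiv ℝ).exists_bound_of_continuous cf
  have hC10 : 0 ≤ C1 := (norm_nonneg _).trans (hC1 0)
  have hC20 : 0 ≤ C2 := (norm_nonneg _).trans (hC2 0)
  have hfin : volume Ω ≠ ∞ := hb.measure_lt_top.ne
  have io : ∀ g : EuclideanSpace ℝ (Fin N) → ℝ, Continuous g → ∀ S, IsBounded S → IntegrableOn g S := by
    intro g hg S hS
    exact (hg.continuousOn.integrableOn_compact hS.isCompact_closure).mono_set subset_closure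
  set F : ℝ → EuclideanSpace ℝ (Fin N) → ℝ := fun t x => t ^ N * u (t • x) ^ 2 with hF
  set F' : ℝ → EuclideanSpace ℝ (Fin N) → ℝ := fun t x =>
    N * t ^ (N - 1) * u (t • x) ^ 2 + t ^ N * (2 * u (t • x) * fderiv ℝ u (t • x) x) with hF'
  have hder : ∀ t x, HasDerivAt (fun t => F t x) (F' t x) t := by
    intro t x
    have h1 : HasDerivAt (fun t : ℝ => t • x) x t := by
      simpa using (hasDerivAt_id t).smul_const x
    have h2 : HasDerivAt (fun t : ℝ => u (t • x)) (fderiv ℝ u (t • x) x) t :=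
      (du (t • x)).hasFDerivAt.comp_hasDerivAt t h1
    have h3 := (hasDerivAt_pow N t).mul (h2.pow 2)
    refine h3.congr_deriv ?_
    simp only [hF', Pi.pow_apply]
    push_cast
    ring
  have cF : ∀ t, Continuous (F t) := by intro t; simp only [hF]; fun_prop
  have cF' : ∀ t, Continuous (F' t) := by
    intro t; simp only [hF']
    have : Continuous fun x : EuclideanSpace ℝ (Fin N) => fderiv ℝ u (t • x) x :=
      (cf.comp (continuous_const_smul t)).clm_apply continuous_id
    fun_prop
  have hφ : ∀ t ∈ Ioo (1/4 : ℝ) 2, HasDerivAt (fun t => ∫ x in Ω, F t x) (∫ x in Ω, F' t x) t := by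
    intro t ht
    refine (hasDerivAt_integral_of_dominated_loc_of_deriv_le (s := Ioo (1/4:ℝ) 2)
      (bound := fun _ => N * 2 ^ (N-1) * C1 ^ 2 + 2 ^ N * (2 * C1 * C2)) (Ioo_mem_nhds ht.1 ht.2) ?_ ?_ ?_ ?_ ?_ ?_).2
    · exact Eventually.of_forall fun t => (cF t).aestronglyMeasurable
    · exact io _ (cF t) _ hb
    · exact (cF' t).aestronglyMeasurable
    · filter_upwards [ae_restrict_mem ho.measurableSet] with x hx s hs
      have s0 : 0 ≤ s := by linarith [hs.1]
      have a1 : |u (s • x)| ≤ C1 := hC1 _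
      have a2 : |fderiv ℝ u (s • x) x| ≤ C2 := by
        have := (fderiv ℝ u (s • x)).le_opNorm x
        have h3 := hC2 (s • x)
        have h4 := hd x hx
        rw [Real.norm_eq_abs] at this
        nlinarith only [this, h3, h4, norm_nonneg x, norm_nonneg (fderiv ℝ u (s • x))]
      simp only [hF']
      refine (norm_add_le _ _).trans ?_
      simp only [norm_mul, norm_pow, Real.norm_eq_abs, abs_of_nonneg s0, abs_two, Nat.abs_cast]
      have := hs.2.le
      gcongr
    · exact integrableOn_const hfin
    · exact Eventually.of_forall fun x s _ => hder s x
  have hval : ∀ t : ℝ, 0 < t → ∀ g : EuclideanSpace ℝ (Fin N) → ℝ, ∫ x in Ω, t ^ N * g (t • x) = ∫ x in t • Ω, g x := by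
    intro t ht g
    rw [integral_const_mul, Measure.setIntegral_comp_smul_of_pos _ _ _ ht]
    simp only [finrank_euclideanSpace, Fintype.card_fin, smul_eq_mul]
    field_simp
  have hsub : ∀ t : ℝ, 0 < t → t ≤ 1 → t • Ω ⊆ Ω := by
    rintro t ht0 ht1 _ ⟨x, hx, rfl⟩
    have := hc.starConvex h0
    exact this.smul_mem hx ht0.le ht1
  set A := ∫ x in Ω, u x ^ 2 with hA
  set B := ∫ x in Ω, ‖fderiv ℝ u x‖ ^ 2 with hB
  have A0 : 0 ≤ A := integral_nonneg fun _ => by positivity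
  have B0 : 0 ≤ B := integral_nonneg fun _ => by positivity
  have hbd : ∀ t ∈ Ioo (1/2 : ℝ) 1, ∫ x in Ω, F' t x ≤ (2 * N + 1) * (A + B) := by
    intro t ht
    have t0 : 0 < t := by linarith [ht.1]
    have c1 : Continuous fun x : EuclideanSpace ℝ (Fin N) => (2 * N + 1) * u x ^ 2 + ‖fderiv ℝ u x‖ ^ 2 := by fun_prop
    have s1 : ∫ x in Ω, F' t x ≤ ∫ x in Ω, t ^ N * ((2 * N + 1) * u (t • x) ^ 2 + ‖fderiv ℝ u (t • x)‖ ^ 2) := by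
      refine setIntegral_mono_on (io _ (cF' t) _ hb) (io _ (by fun_prop) _ hb) ho.measurableSet ?_
      intro x hx
      have e1 : (N:ℝ) * t ^ (N-1) ≤ 2 * N * t ^ N := by
        rcases Nat.eq_zero_or_pos N with h | h
        · subst h; simp
        · have : t ^ N = t ^ (N-1) * t := by rw [← pow_succ]; congr 1; omega
          rw [this]
          have p0 : 0 ≤ (N:ℝ) * t ^ (N-1) := by positivity
          nlinarith only [p0, ht.1]
      have e2 : 2 * u (t • x) * fderiv ℝ u (t • x) x ≤ u (t • x) ^ 2 + ‖fderiv ℝ u (t • x)‖ ^ 2 := by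
        have h5 := (fderiv ℝ u (t • x)).le_opNorm x
        have h4 := hd x hx
        rw [Real.norm_eq_abs] at h5
        have h6 : |fderiv ℝ u (t • x) x| ≤ ‖fderiv ℝ u (t • x)‖ :=
          h5.trans (mul_le_of_le_one_right (norm_nonneg _) h4)
        have h7 : (fderiv ℝ u (t • x) x) ^ 2 ≤ ‖fderiv ℝ u (t • x)‖ ^ 2 := by
          rw [← sq_abs]; exact pow_le_pow_left₀ (abs_nonneg _) h6 2
        nlinarith only [h7, sq_nonneg (u (t • x) - fderiv ℝ u (t • x) x)]
      simp only [hF']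
      have e3 := mul_le_mul_of_nonneg_right e1 (sq_nonneg (u (t • x)))
      have e4 := mul_le_mul_of_nonneg_left e2 (pow_nonneg t0.le N)
      nlinarith only [e3, e4]
    refine s1.trans ?_
    rw [hval t t0 (fun x => (2 * N + 1) * u x ^ 2 + ‖fderiv ℝ u x‖ ^ 2)]
    have s2 : ∫ x in t • Ω, ((2 * N + 1) * u x ^ 2 + ‖fderiv ℝ u x‖ ^ 2) ≤
        ∫ x in Ω, ((2 * N + 1) * u x ^ 2 + ‖fderiv ℝ u x‖ ^ 2) :=
      setIntegral_mono_set (io _ c1 _ hb) (Eventually.of_forall fun x => by positivity)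
        (hsub t t0 ht.2.le).eventuallyLE
    refine s2.trans ?_
    rw [integral_add ((io _ (by fun_prop) _ hb)) ((io _ (by fun_prop) _ hb)), integral_const_mul, ← hA, ← hB]
    have : 0 ≤ (N:ℝ) * B := by positivity
    nlinarith only [this]
  have mv := (convex_Icc (1 - δ) 1).image_sub_le_mul_sub_of_deriv_le (f := fun t => ∫ x in Ω, F t x)
    (C := (2 * N + 1) * (A + B)) ?_ ?_ ?_ (1 - δ) (by constructor <;> linarith) 1 (by constructor <;> linarith) (by linarith)
  · simp only [hF] at mv
    rw [hval (1-δ) (by linarith) (fun x => u x ^ 2)] at mv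
    simp only [one_pow, one_mul, one_smul] at mv
    rw [← hA] at mv
    linarith
  · intro t ht
    exact (hφ t ⟨by linarith [ht.1], by linarith [ht.2]⟩).continuousAt.continuousWithinAt
  · intro t ht
    rw [interior_Icc] at ht
    exact (hφ t ⟨by linarith [ht.1], by linarith [ht.2]⟩).differentiableAt.differentiableWithinAt
  · intro t ht
    rw [interior_Icc] at ht
    rw [(hφ t ⟨by linarith [ht.1], by linarith [ht.2]⟩).deriv]
    exact hbd t ⟨by linarith [ht.1], ht.2⟩

end HelpersH1

section HelpersA1
open scoped Pointwise

theorem cs_int (a b : ℝ) (hab : a ≤ b) (f g : ℝ → ℝ) (hf : ContinuousOn f (Icc a b))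
    (hg : ContinuousOn g (Icc a b)) :
    (∫ x in a..b, f x * g x) ^ 2 ≤ (∫ x in a..b, f x ^ 2) * (∫ x in a..b, g x ^ 2) := by
  rw [← uIcc_of_le hab] at hf hg
  have h1 : ∀ t : ℝ, 0 ≤ (∫ x in a..b, g x ^ 2) * (t * t) + (-2 * ∫ x in a..b, f x * g x) * t
      + ∫ x in a..b, f x ^ 2 := by
    intro t
    have : (∫ x in a..b, g x ^ 2) * (t * t) + (-2 * ∫ x in a..b, f x * g x) * t
      + ∫ x in a..b, f x ^ 2 = ∫ x in a..b, (f x - t * g x) ^ 2 := by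
      have e : (fun x => (f x - t * g x) ^ 2) = fun x => g x ^ 2 * (t * t) + f x * g x * (-2 * t) + f x ^ 2 := by
        ext x; ring
      rw [e, intervalIntegral.integral_add, intervalIntegral.integral_add,
        intervalIntegral.integral_mul_const, intervalIntegral.integral_mul_const]
      · ring
      all_goals apply ContinuousOn.intervalIntegrable; fun_prop
    rw [this]
    exact intervalIntegral.integral_nonneg hab fun x _ => sq_nonneg _
  have := discrim_le_zero h1
  unfold discrim at this
  nlinarith

/-- Key identity with an arbitrary comparison function `c`. -/
theorem key_ineq (a b : ℝ) (hab : a ≤ b) (G P φ1 φ2 c c' : ℝ → ℝ)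
    (hG : ∀ x ∈ Icc a b, HasDerivAt G (P x + φ1 x / 2 * G x) x)
    (hφ : ∀ x ∈ Icc a b, HasDerivAt φ1 (φ2 x) x)
    (hc : ∀ x ∈ Icc a b, HasDerivAt c (c' x) x)
    (cP : ContinuousOn P (Icc a b)) (cφ : ContinuousOn φ2 (Icc a b))
    (cc : ContinuousOn c' (Icc a b))
    (h2 : ∀ x ∈ Icc a b, 0 ≤ φ2 x) (Ga : G a = 0) (Gb : G b = 0) :
    (∫ x in a..b, (P x + φ1 x / 2 * G x - c x * G x) ^ 2) + (∫ x in a..b, φ1 x ^ 2 * G x ^ 2) / 4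
      + (∫ x in a..b, - (c x ^ 2 + c' x) * G x ^ 2) ≤ ∫ x in a..b, P x ^ 2 := by
  have cG : ContinuousOn G (Icc a b) := fun x hx => (hG x hx).continuousAt.continuousWithinAt
  have cφ1 : ContinuousOn φ1 (Icc a b) := fun x hx => (hφ x hx).continuousAt.continuousWithinAt
  have ccc : ContinuousOn c (Icc a b) := fun x hx => (hc x hx).continuousAt.continuousWithinAt
  have hu : uIcc a b = Icc a b := uIcc_of_le hab
  set Q : ℝ → ℝ := fun x => (c' x - φ2 x / 2) * G x ^ 2
     + (c x - φ1 x / 2) * (2 * G x * (P x + φ1 x / 2 * G x)) with hQ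
  have cQ : ContinuousOn Q (Icc a b) := by simp only [hQ]; fun_prop
  have I0 : ∫ x in a..b, Q x = 0 := by
    have := intervalIntegral.integral_eq_sub_of_hasDerivAt (f := fun x => (c x - φ1 x / 2) * G x ^ 2)
      (f' := Q) (a := a) (b := b) ?_ ?_
    · rw [this]; simp [Ga, Gb]
    · intro x hx
      rw [hu] at hx
      have := ((hc x hx).sub ((hφ x hx).div_const 2)).mul ((hG x hx).pow 2)
      refine this.congr_deriv ?_
      simp only [Q, Pi.sub_apply, Pi.div_apply]; norm_num
    · apply ContinuousOn.intervalIntegrable; rwa [hu]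
  have I1 : 0 ≤ ∫ x in a..b, φ2 x / 2 * G x ^ 2 :=
    intervalIntegral.integral_nonneg hab fun x hx => mul_nonneg (by linarith [h2 x hx]) (sq_nonneg _)
  have e : ∫ x in a..b, P x ^ 2 = ∫ x in a..b, (P x + φ1 x / 2 * G x - c x * G x) ^ 2
     + φ1 x ^ 2 * G x ^ 2 / 4 + - (c x ^ 2 + c' x) * G x ^ 2 + Q x + φ2 x / 2 * G x ^ 2 := by
    apply intervalIntegral.integral_congr
    intro x _
    simp only [hQ]; ring
  rw [e, intervalIntegral.integral_add, intervalIntegral.integral_add, intervalIntegral.integral_add,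
    intervalIntegral.integral_add, intervalIntegral.integral_div]
  · linarith
  all_goals apply ContinuousOn.intervalIntegrable; rw [hu]; fun_prop

end HelpersA1

section HelpersA2
open scoped Pointwise

theorem setup_G (a b : ℝ) (hab : a ≤ b) (f f' φ φ1 : ℝ → ℝ) (hf : ∀ x, HasDerivAt f (f' x) x)
    (cf' : Continuous f') (hφ : ∀ x, HasDerivAt φ (φ1 x) x)
    (hm : ∫ x in a..b, f x * exp (-φ x) = 0) :
    ∃ G : ℝ → ℝ, G a = 0 ∧ G b = 0 ∧
      (∀ x, HasDerivAt G (f x * exp (-φ x / 2) + φ1 x / 2 * G x) x) ∧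
      (∫ x in a..b, (f x * exp (-φ x / 2)) ^ 2) = ∫ x in a..b, f x ^ 2 * exp (-φ x) ∧
      (∫ x in a..b, f x ^ 2 * exp (-φ x)) ^ 2 ≤
        (∫ x in a..b, G x ^ 2) * ∫ x in a..b, f' x ^ 2 * exp (-φ x) := by
  have cf : Continuous f := continuous_iff_continuousAt.2 fun x => (hf x).continuousAt
  have cφ : Continuous φ := continuous_iff_continuousAt.2 fun x => (hφ x).continuousAt
  have ch : Continuous fun x => f x * exp (-φ x) := by fun_prop
  set F : ℝ → ℝ := fun x => ∫ y in a..x, f y * exp (-φ y) with hF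
  have dF : ∀ x, HasDerivAt F (f x * exp (-φ x)) x := fun x =>
    intervalIntegral.integral_hasDerivAt_right (ch.intervalIntegrable _ _)
      ch.stronglyMeasurable.stronglyMeasurableAtFilter ch.continuousAt
  have cF : Continuous F := continuous_iff_continuousAt.2 fun x => (dF x).continuousAt
  have Fa : F a = 0 := by simp [hF]
  have Fb : F b = 0 := hm
  refine ⟨fun x => F x * exp (φ x / 2), by simp [Fa], by simp [Fb], ?_, ?_, ?_⟩
  · intro x
    have := (dF x).mul (((hφ x).div_const 2).exp)
    refine this.congr_deriv ?_
    have e : exp (-φ x) * exp (φ x / 2) = exp (-φ x / 2) := by rw [← exp_add]; congr 1; ring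
    rw [← e]; ring
  · apply intervalIntegral.integral_congr
    intro x _
    simp only
    rw [mul_pow, ← exp_nat_mul]; congr 2; push_cast; ring
  · have e1 : ∫ x in a..b, f x ^ 2 * exp (-φ x) = - ∫ x in a..b, F x * exp (φ x / 2) * (f' x * exp (-φ x / 2)) := by
      have := intervalIntegral.integral_mul_deriv_eq_deriv_mul (a := a) (b := b) (u := f) (v := F)
        (u' := f') (v' := fun x => f x * exp (-φ x)) (fun x _ => hf x) (fun x _ => dF x)
        (cf'.intervalIntegrable _ _) (ch.intervalIntegrable _ _)
      rw [Fa, Fb] at this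
      simp only [mul_zero, sub_zero, zero_sub] at this
      have e2 : ∫ x in a..b, f x ^ 2 * exp (-φ x) = ∫ x in a..b, f x * (f x * exp (-φ x)) := by
        apply intervalIntegral.integral_congr; intro x _; simp only; ring
      rw [e2, this]
      congr 1
      apply intervalIntegral.integral_congr
      intro x _
      have e : exp (φ x / 2) * exp (-φ x / 2) = 1 := by rw [← exp_add]; simp; ring
      simp only
      linear_combination (-(F x * f' x)) * e
    rw [e1, neg_sq]
    have e3 : ∫ x in a..b, f' x ^ 2 * exp (-φ x) = ∫ x in a..b, (f' x * exp (-φ x / 2)) ^ 2 := by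
      apply intervalIntegral.integral_congr
      intro x _
      simp only
      rw [mul_pow, ← exp_nat_mul]; congr 2; push_cast; ring
    rw [e3]
    exact cs_int a b hab _ _ (by fun_prop) (by fun_prop)

theorem oned_G (a b : ℝ) (hab : a < b) (f f' φ φ1 φ2 : ℝ → ℝ) (hf : ∀ x, HasDerivAt f (f' x) x)
    (cf' : Continuous f') (hφ : ∀ x, HasDerivAt φ (φ1 x) x) (hφ1 : ∀ x, HasDerivAt φ1 (φ2 x) x)
    (cφ2 : Continuous φ2) (h2 : ∀ x ∈ Icc a b, 0 ≤ φ2 x)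
    (hm : ∫ x in a..b, f x * exp (-φ x) = 0) (k θ : ℝ) (hk : 0 < k) (hθ : 0 < θ)
    (hkθ : k * (b - a) + 2 * θ = π) :
    ∃ G G' : ℝ → ℝ, G a = 0 ∧ G b = 0 ∧ (∀ x, HasDerivAt G (G' x) x) ∧ Continuous G' ∧
      (∫ x in a..b, f x ^ 2 * exp (-φ x)) ^ 2 ≤
        (∫ x in a..b, G x ^ 2) * (∫ x in a..b, f' x ^ 2 * exp (-φ x)) ∧
      (∫ x in a..b, G' x ^ 2) ≤ (∫ x in a..b, f x ^ 2 * exp (-φ x)) ∧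
      (∫ x in a..b, (G' x - k * cos (k * (x - a) + θ) / sin (k * (x - a) + θ) * G x) ^ 2)
        + (∫ x in a..b, φ1 x ^ 2 * G x ^ 2) / 4 + k ^ 2 * (∫ x in a..b, G x ^ 2)
        ≤ ∫ x in a..b, f x ^ 2 * exp (-φ x) := by
  obtain ⟨G, Ga, Gb, dG, hP, hcs⟩ := setup_G a b hab.le f f' φ φ1 hf cf' hφ hm
  have cf : Continuous f := continuous_iff_continuousAt.2 fun x => (hf x).continuousAt
  have cφ : Continuous φ := continuous_iff_continuousAt.2 fun x => (hφ x).continuousAt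
  have cφ1 : Continuous φ1 := continuous_iff_continuousAt.2 fun x => (hφ1 x).continuousAt
  have cG : Continuous G := continuous_iff_continuousAt.2 fun x => (dG x).continuousAt
  refine ⟨G, fun x => f x * exp (-φ x / 2) + φ1 x / 2 * G x, Ga, Gb, dG, by fun_prop, hcs, ?_, ?_⟩
  · have := key_ineq a b hab.le G (fun x => f x * exp (-φ x / 2)) φ1 φ2 (fun _ => 0) (fun _ => 0)
      (fun x _ => dG x) (fun x _ => hφ1 x) (fun x _ => hasDerivAt_const x 0) (by fun_prop)
      (by fun_prop) (by fun_prop) h2 Ga Gb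
    rw [hP] at this
    simp only [zero_mul, sub_zero] at this
    have p1 : 0 ≤ ∫ x in a..b, φ1 x ^ 2 * G x ^ 2 :=
      intervalIntegral.integral_nonneg hab.le fun x _ => by positivity
    norm_num at this
    linarith
  · have spos : ∀ x ∈ Icc a b, 0 < sin (k * (x - a) + θ) := by
      intro x hx
      have h0 : 0 ≤ k * (x - a) := mul_nonneg hk.le (by linarith [hx.1])
      have h1 : k * (x - a) ≤ k * (b - a) := mul_le_mul_of_nonneg_left (by linarith [hx.2]) hk.le
      exact sin_pos_of_pos_of_lt_pi (by linarith) (by linarith)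
    have := key_ineq a b hab.le G (fun x => f x * exp (-φ x / 2)) φ1 φ2
      (fun x => k * cos (k * (x - a) + θ) / sin (k * (x - a) + θ))
      (fun x => - k ^ 2 - (k * cos (k * (x - a) + θ) / sin (k * (x - a) + θ)) ^ 2)
      (fun x _ => dG x) (fun x _ => hφ1 x) ?_ (by fun_prop)
      (by fun_prop) ?_ h2 Ga Gb
    · rw [hP] at this
      refine le_trans (le_of_eq ?_) this
      congr 1
      rw [← intervalIntegral.integral_const_mul]
      apply intervalIntegral.integral_congr
      intro x _
      simp only; ring
    · intro x hx
      have s0 := (spos x hx).ne'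
      have d1 : HasDerivAt (fun x => k * (x - a) + θ) k x := by
        simpa using (((hasDerivAt_id x).sub_const a).const_mul k).add_const θ
      have := ((d1.cos).const_mul k).div d1.sin s0
      refine this.congr_deriv ?_
      field_simp
    · have : ∀ x ∈ Icc a b, sin (k * (x - a) + θ) ≠ 0 := fun x hx => (spos x hx).ne'
      fun_prop (disch := assumption)

theorem oned_a (a b : ℝ) (hab : a < b) (f f' φ φ1 φ2 : ℝ → ℝ) (hf : ∀ x, HasDerivAt f (f' x) x)
    (cf' : Continuous f') (hφ : ∀ x, HasDerivAt φ (φ1 x) x) (hφ1 : ∀ x, HasDerivAt φ1 (φ2 x) x)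
    (cφ2 : Continuous φ2) (h2 : ∀ x ∈ Icc a b, 0 ≤ φ2 x)
    (hm : ∫ x in a..b, f x * exp (-φ x) = 0) (k : ℝ) (hk : 0 < k) (hkL : k * (b - a) < π) :
    k ^ 2 * (∫ x in a..b, f x ^ 2 * exp (-φ x)) ≤ ∫ x in a..b, f' x ^ 2 * exp (-φ x) := by
  obtain ⟨G, G', _, _, _, _, h1, _, h3⟩ := oned_G a b hab f f' φ φ1 φ2 hf cf' hφ hφ1 cφ2 h2 hm k
    ((π - k * (b - a)) / 2) hk (by linarith) (by ring)
  set A := ∫ x in a..b, f x ^ 2 * exp (-φ x)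
  set B := ∫ x in a..b, f' x ^ 2 * exp (-φ x)
  have p0 : 0 ≤ B := intervalIntegral.integral_nonneg hab.le fun x _ => by positivity
  have p1 : 0 ≤ ∫ x in a..b, φ1 x ^ 2 * G x ^ 2 :=
      intervalIntegral.integral_nonneg hab.le fun x _ => by positivity
  have p2 : 0 ≤ (∫ x in a..b, (G' x - k * cos (k * (x - a) + (π - k * (b - a)) / 2) / sin (k * (x - a) + (π - k * (b - a)) / 2) * G x) ^ 2) :=
      intervalIntegral.integral_nonneg hab.le fun x _ => by positivity
  set C := ∫ x in a..b, G x ^ 2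
  have p3 : 0 ≤ A := intervalIntegral.integral_nonneg hab.le fun x _ => by positivity
  have p4 : k ^ 2 * C ≤ A := by linarith
  rcases p3.eq_or_lt with h | h
  · rw [← h]; simpa using p0
  have : A * (k ^ 2 * A) ≤ A * B := by
    nlinarith [mul_le_mul_of_nonneg_right p4 p0, mul_le_mul_of_nonneg_left h1 (sq_nonneg k)]
  exact le_of_mul_le_mul_left this h

end HelpersA2

section HelpersA3
open scoped Pointwise

theorem diff_sq_le (x y : ℝ) (hxy : x ≤ y) (g g' : ℝ → ℝ) (hg : ∀ z ∈ Icc x y, HasDerivAt g (g' z) z)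
    (cg : ContinuousOn g' (Icc x y)) : (g y - g x) ^ 2 ≤ (y - x) * ∫ z in x..y, g' z ^ 2 := by
  have hu : uIcc x y = Icc x y := uIcc_of_le hxy
  have := intervalIntegral.integral_eq_sub_of_hasDerivAt (f := g) (f' := g') (a := x) (b := y)
    (by rw [hu]; exact hg) (by apply ContinuousOn.intervalIntegrable; rwa [hu])
  have h2 := cs_int x y hxy (fun _ => 1) g' (by fun_prop) cg
  simp only [one_mul, this] at h2
  simpa using h2

theorem int_mono_sub (a b x y : ℝ) (hax : a ≤ x) (hxy : x ≤ y) (hyb : y ≤ b) (g : ℝ → ℝ)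
    (cg : ContinuousOn g (Icc a b)) (h0 : ∀ z ∈ Icc a b, 0 ≤ g z) :
    ∫ z in x..y, g z ≤ ∫ z in a..b, g z := by
  have hab : a ≤ b := by linarith
  apply intervalIntegral.integral_mono_interval hax hxy hyb
  · filter_upwards [ae_restrict_mem measurableSet_Ioc] with z hz
    exact h0 z (Ioc_subset_Icc_self hz)
  · apply ContinuousOn.intervalIntegrable; rwa [uIcc_of_le hab]

theorem sin_low (τ : ℝ) (hτ : 0 ≤ τ) (z : ℝ) (h1 : τ * π ≤ z) (h2 : z ≤ π - τ * π) :
    2 * τ ≤ sin z := by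
  have hp : 0 ≤ τ * π := mul_nonneg hτ pi_pos.le
  rcases le_total z (π / 2) with h | h
  · have := mul_le_sin (x := z) (by linarith) h
    refine le_trans ?_ this
    rw [div_mul_eq_mul_div, le_div_iff₀ pi_pos]; linarith
  · have := mul_le_sin (x := π - z) (by linarith) (by linarith)
    rw [sin_pi_sub] at this
    refine le_trans ?_ this
    rw [div_mul_eq_mul_div, le_div_iff₀ pi_pos]; linarith

set_option maxHeartbeats 2000000 in
theorem oned_b (a b : ℝ) (hab : a < b) (f f' φ φ1 φ2 : ℝ → ℝ) (hf : ∀ x, HasDerivAt f (f' x) x)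
    (cf' : Continuous f') (hφ : ∀ x, HasDerivAt φ (φ1 x) x) (hφ1 : ∀ x, HasDerivAt φ1 (φ2 x) x)
    (cφ2 : Continuous φ2) (h2 : ∀ x ∈ Icc a b, 0 ≤ φ2 x)
    (hm : ∫ x in a..b, f x * exp (-φ x) = 0) (k e τ : ℝ) (hk : 0 < k) (hkL : k * (b - a) < π)
    (he : 0 ≤ e) (he1 : (b - a) ^ 2 * e ≤ 1) (hA : 0 < ∫ x in a..b, f x ^ 2 * exp (-φ x))
    (hB : ∫ x in a..b, f' x ^ 2 * exp (-φ x) ≤ (k ^ 2 + e) * ∫ x in a..b, f x ^ 2 * exp (-φ x))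
    (hτ : 0 < τ) (hτ1 : τ ≤ 1 / 7) (heτ : (b - a) * √e ≤ 0.4 * τ) (x y : ℝ)
    (hx : a + τ * (b - a) ≤ x) (hxy : x ≤ y) (hy : y ≤ b - τ * (b - a)) :
    |φ y - φ x| ≤ 2 * (b - a) * √e / τ := by
  set θ := (π - k * (b - a)) / 2 with hθ
  have hθ0 : 0 < θ := by rw [hθ]; linarith
  obtain ⟨G, G', Ga, Gb, dG, cG', h1, hGA, h3⟩ := oned_G a b hab f f' φ φ1 φ2 hf cf' hφ hφ1 cφ2 h2 hm k
    θ hk hθ0 (by rw [hθ]; ring)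
  have cG : Continuous G := continuous_iff_continuousAt.2 fun x => (dG x).continuousAt
  have cφ1 : Continuous φ1 := continuous_iff_continuousAt.2 fun x => (hφ1 x).continuousAt
  set A := ∫ x in a..b, f x ^ 2 * exp (-φ x)
  set B := ∫ x in a..b, f' x ^ 2 * exp (-φ x)
  set L := b - a with hL
  have hL0 : 0 < L := by rw [hL]; linarith
  have hτL : 0 < τ * L := by positivity
  have hτL7 : τ * L ≤ L / 7 := by nlinarith only [hτ1, hL0]
  set C := ∫ x in a..b, G x ^ 2 with hC
  have hC0 : 0 ≤ C := intervalIntegral.integral_nonneg hab.le fun x _ => by positivity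
  have hAC : A ≤ (k ^ 2 + e) * C := by
    have : A * A ≤ A * ((k ^ 2 + e) * C) := by nlinarith only [mul_le_mul_of_nonneg_left hB hC0, h1]
    exact le_of_mul_le_mul_left this hA
  have hCpos : 0 < C := by
    rcases hC0.eq_or_lt with h | h
    · rw [← h] at hAC; simp at hAC; linarith
    · exact h
  set R : ℝ → ℝ := fun x => G' x - k * cos (k * (x - a) + θ) / sin (k * (x - a) + θ) * G x with hR
  have p1 : 0 ≤ ∫ x in a..b, φ1 x ^ 2 * G x ^ 2 :=
      intervalIntegral.integral_nonneg hab.le fun x _ => by positivity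
  have p2 : 0 ≤ ∫ x in a..b, R x ^ 2 :=
      intervalIntegral.integral_nonneg hab.le fun x _ => by positivity
  have hR1 : ∫ x in a..b, R x ^ 2 ≤ e * C := by nlinarith only [h3, p1, hAC]
  have hφG : ∫ x in a..b, φ1 x ^ 2 * G x ^ 2 ≤ 4 * e * C := by nlinarith only [h3, p2, hAC]
  set s : ℝ → ℝ := fun x => sin (k * (x - a) + θ) with hs
  have spos : ∀ x ∈ Icc a b, 0 < s x := by
    intro x hx
    have h0 : 0 ≤ k * (x - a) := mul_nonneg hk.le (by linarith [hx.1])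
    have h1 : k * (x - a) ≤ k * (b - a) := mul_le_mul_of_nonneg_left (by linarith [hx.2]) hk.le
    exact sin_pos_of_pos_of_lt_pi (by linarith) (by linarith)
  have hkL2 : k * L + 2 * θ = π := by rw [hθ]; ring
  have sJ : ∀ x ∈ Icc (a + τ * L) (b - τ * L), 2 * τ ≤ s x := by
    intro x hx
    have b0 : τ * (2 * θ) ≤ θ := by nlinarith only [hτ1, hθ0]
    have b0' : τ * π = k * (τ * L) + τ * (2 * θ) := by rw [← hkL2]; ring
    have b1 : τ * π ≤ k * (x - a) + θ := by
      have : k * (τ * L) ≤ k * (x - a) := mul_le_mul_of_nonneg_left (by linarith [hx.1]) hk.le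
      linarith
    have b2 : k * (x - a) + θ ≤ π - τ * π := by
      have : k * (x - a) ≤ k * (L - τ * L) := mul_le_mul_of_nonneg_left (by linarith [hx.2]) hk.le
      have e9 : k * (L - τ * L) = k * L - k * (τ * L) := by ring
      linarith
    exact sin_low τ hτ.le _ b1 b2
  have Jsub : Icc (a + τ * L) (b - τ * L) ⊆ Icc a b := Icc_subset_Icc (by linarith) (by linarith)
  have hpi : π ^ 2 ≤ 10 := by nlinarith only [pi_lt_d2, pi_pos]
  have hkL3 : k ^ 2 * L ^ 2 ≤ 10 := by
    have : (k * L) ^ 2 ≤ π ^ 2 := pow_le_pow_left₀ (by positivity) hkL.le 2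
    rw [mul_pow] at this
    linarith
  have hA11 : L ^ 2 * A ≤ 11 * C := by
    calc L ^ 2 * A ≤ L ^ 2 * ((k ^ 2 + e) * C) := by gcongr
      _ = (k ^ 2 * L ^ 2 + L ^ 2 * e) * C := by ring
      _ ≤ 11 * C := by gcongr; linarith
  have cG2 : ∀ u v : ℝ, IntervalIntegrable (fun x => G x ^ 2) volume u v := fun u v =>
    Continuous.intervalIntegrable (by fun_prop) _ _
  -- ends
  have end1 : ∫ x in a..(a + τ * L), G x ^ 2 ≤ C / 4 := by
    have hle : a ≤ a + τ * L := by linarith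
    have : ∫ x in a..(a + τ * L), G x ^ 2 ≤ ∫ x in a..(a + τ * L), τ * L * A := by
      apply intervalIntegral.integral_mono_on hle (cG2 _ _) (by simp)
      intro z hz
      have hz' : z ≤ b := by linarith [hz.2]
      have d := diff_sq_le a z hz.1 G G' (fun w _ => dG w) cG'.continuousOn
      rw [Ga, sub_zero] at d
      have d2 := int_mono_sub a b a z le_rfl hz.1 hz' (fun z => G' z ^ 2) (by fun_prop)
        (fun z _ => by positivity)
      have : z - a ≤ τ * L := by linarith [hz.2]
      calc G z ^ 2 ≤ _ := d
        _ ≤ (z - a) * A := mul_le_mul_of_nonneg_left (d2.trans hGA) (by linarith [hz.1])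
        _ ≤ τ * L * A := mul_le_mul_of_nonneg_right this hA.le
    rw [intervalIntegral.integral_const, smul_eq_mul] at this
    have t49 : τ ^ 2 ≤ 1/49 := by nlinarith only [hτ, hτ1]
    nlinarith only [this, mul_le_mul_of_nonneg_left hA11 (sq_nonneg τ), hCpos, mul_le_mul_of_nonneg_right t49 hC0]
  have end2 : ∫ x in (b - τ * L)..b, G x ^ 2 ≤ C / 4 := by
    have hle : b - τ * L ≤ b := by linarith
    have : ∫ x in (b - τ * L)..b, G x ^ 2 ≤ ∫ x in (b - τ * L)..b, τ * L * A := by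
      apply intervalIntegral.integral_mono_on hle (cG2 _ _) (by simp)
      intro z hz
      have hz' : a ≤ z := by linarith [hz.1]
      have d := diff_sq_le z b hz.2 G G' (fun w _ => dG w) cG'.continuousOn
      rw [Gb, zero_sub, neg_sq] at d
      have d2 := int_mono_sub a b z b hz' hz.2 le_rfl (fun z => G' z ^ 2) (by fun_prop)
        (fun z _ => by positivity)
      have : b - z ≤ τ * L := by linarith [hz.1]
      calc G z ^ 2 ≤ _ := d
        _ ≤ (b - z) * A := mul_le_mul_of_nonneg_left (d2.trans hGA) (by linarith [hz.2])
        _ ≤ τ * L * A := mul_le_mul_of_nonneg_right this hA.le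
    rw [intervalIntegral.integral_const, smul_eq_mul] at this
    have t49 : τ ^ 2 ≤ 1/49 := by nlinarith only [hτ, hτ1]
    nlinarith only [this, mul_le_mul_of_nonneg_left hA11 (sq_nonneg τ), hCpos, mul_le_mul_of_nonneg_right t49 hC0]
  have hJle : a + τ * L ≤ b - τ * L := by linarith
  have mid : C / 2 ≤ ∫ x in (a + τ * L)..(b - τ * L), G x ^ 2 := by
    have e1 := intervalIntegral.integral_add_adjacent_intervals (cG2 a (a + τ * L)) (cG2 (a + τ * L) (b - τ * L))
    have e2 := intervalIntegral.integral_add_adjacent_intervals (cG2 a (b - τ * L)) (cG2 (b - τ * L) b)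
    rw [← hC] at e2
    linarith
  obtain ⟨x0, hx0, hGx0⟩ : ∃ x0 ∈ Icc (a + τ * L) (b - τ * L), C / (2 * L) ≤ G x0 ^ 2 := by
    by_contra hcon
    push Not at hcon
    have : ∫ x in (a + τ * L)..(b - τ * L), G x ^ 2 ≤ ∫ x in (a + τ * L)..(b - τ * L), C / (2 * L) := by
      apply intervalIntegral.integral_mono_on hJle (cG2 _ _) (by simp)
      intro z hz
      exact (hcon z hz).le
    rw [intervalIntegral.integral_const, smul_eq_mul] at this
    have h5 : (b - τ * L - (a + τ * L)) * (C / (2 * L)) < L * (C / (2 * L)) := by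
      apply mul_lt_mul_of_pos_right _ (by positivity)
      linarith
    have h6 : L * (C / (2 * L)) = C / 2 := by field_simp
    linarith
  -- ρ
  have cR : ContinuousOn R (Icc a b) := by
    have : ∀ x ∈ Icc a b, sin (k * (x - a) + θ) ≠ 0 := fun x hx => (spos x hx).ne'
    simp only [hR]
    fun_prop (disch := assumption)
  have cs : Continuous s := by simp only [hs]; fun_prop
  have dρ : ∀ x ∈ Icc a b, HasDerivAt (fun x => G x / s x) (R x / s x) x := by
    intro x hx
    have d1 : HasDerivAt (fun x => k * (x - a) + θ) k x := by
      simpa using (((hasDerivAt_id x).sub_const a).const_mul k).add_const θ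
    have s0 := (spos x hx).ne'
    have := (dG x).div d1.sin s0
    refine this.congr_deriv ?_
    simp only [hR, hs] at s0 ⊢
    field_simp
  have cρ : ContinuousOn (fun x => R x / s x) (Icc a b) :=
    cR.div cs.continuousOn fun x hx => (spos x hx).ne'
  have osc : ∀ u v : ℝ, a + τ * L ≤ u → u ≤ v → v ≤ b - τ * L →
      (G v / s v - G u / s u) ^ 2 ≤ L * (e * C) / (2 * τ) ^ 2 := by
    intro u v hu huv hv
    have hsub : Icc u v ⊆ Icc (a + τ * L) (b - τ * L) := Icc_subset_Icc hu hv
    have d := diff_sq_le u v huv (fun x => G x / s x) (fun x => R x / s x)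
      (fun z hz => dρ z (Jsub (hsub hz))) (cρ.mono (hsub.trans Jsub))
    have hii : IntervalIntegrable (fun x => R x ^ 2 / (2 * τ) ^ 2) volume u v := by
      apply ContinuousOn.intervalIntegrable
      rw [uIcc_of_le huv]
      exact ((cR.mono (hsub.trans Jsub)).pow 2).div_const _
    have d2 : ∫ z in u..v, (R z / s z) ^ 2 ≤ ∫ z in u..v, R z ^ 2 / (2 * τ) ^ 2 := by
      apply intervalIntegral.integral_mono_on huv _ hii
      · intro z hz
        rw [div_pow]
        have := sJ z (hsub hz)
        gcongr
      · apply ContinuousOn.intervalIntegrable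
        rw [uIcc_of_le huv]
        exact (cρ.mono (hsub.trans Jsub)).pow 2
    rw [intervalIntegral.integral_div] at d2
    have d3 := int_mono_sub a b u v (by linarith) huv (by linarith) (fun z => R z ^ 2) (cR.pow 2)
      (fun z _ => by positivity)
    have hvu : v - u ≤ L := by linarith
    calc _ ≤ _ := d
      _ ≤ (v - u) * ((e * C) / (2 * τ) ^ 2) := by
          apply mul_le_mul_of_nonneg_left _ (by linarith)
          refine d2.trans ?_
          gcongr
          exact d3.trans hR1
      _ ≤ L * ((e * C) / (2 * τ) ^ 2) := by gcongr
      _ = _ := by ring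
  set g0 := √(C / L) with hg0
  have g0sq : g0 ^ 2 = C / L := Real.sq_sqrt (by positivity)
  have g0pos : 0 < g0 := Real.sqrt_pos.2 (by positivity)
  have oscb : ∀ v ∈ Icc (a + τ * L) (b - τ * L), |G v / s v - G x0 / s x0| ≤ 0.2 * g0 := by
    intro v hv
    have : (G v / s v - G x0 / s x0) ^ 2 ≤ L * (e * C) / (2 * τ) ^ 2 := by
      rcases le_total x0 v with h | h
      · exact osc x0 v hx0.1 h hv.2
      · have := osc v x0 hv.1 h hx0.2
        rwa [← neg_sub, neg_sq] at this
    apply abs_le_of_sq_le_sq _ (by positivity)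
    refine this.trans ?_
    rw [mul_pow 0.2 g0, g0sq, div_le_iff₀ (by positivity)]
    have h8 : (L * √e) ^ 2 ≤ (0.4 * τ) ^ 2 := pow_le_pow_left₀ (by positivity) heτ 2
    rw [mul_pow, Real.sq_sqrt he] at h8
    have : L * (e * C) = (L ^ 2 * e) * (C / L) := by field_simp
    rw [this]
    have h9 := mul_le_mul_of_nonneg_right h8 (show 0 ≤ C / L by positivity)
    nlinarith only [h9]
  have ρ0 : 0.7 * g0 ≤ |G x0 / s x0| := by
    have s1 : s x0 ≤ 1 := sin_le_one _
    have sp := spos x0 (Jsub hx0)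
    rw [abs_div, abs_of_pos sp]
    have h10 : |G x0| ≤ |G x0| / s x0 := by
      rw [le_div_iff₀ sp]; nlinarith only [abs_nonneg (G x0), s1]
    refine le_trans ?_ h10
    apply le_abs.2
    by_contra hcon
    push Not at hcon
    have : G x0 ^ 2 < (0.7 * g0) ^ 2 := by
      apply sq_lt_sq'
      · linarith [hcon.2]
      · exact hcon.1
    rw [mul_pow, g0sq] at this
    have h11 : C / (2 * L) = C / L * (1/2) := by field_simp
    rw [h11] at hGx0
    have hCL : 0 < C / L := by positivity
    linarith
  have Glow : ∀ v ∈ Icc (a + τ * L) (b - τ * L), τ ^ 2 * (C / L) ≤ G v ^ 2 := by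
    intro v hv
    have sp := spos v (Jsub hv)
    have h12 : g0 / 2 ≤ |G v / s v| := by
      have := oscb v hv
      have := abs_sub_abs_le_abs_sub (G x0 / s x0) (G v / s v)
      rw [abs_sub_comm] at this
      linarith
    rw [abs_div, abs_of_pos sp, le_div_iff₀ sp] at h12
    have h13 : τ * g0 ≤ |G v| := by
      have := sJ v hv
      nlinarith only [this, h12, g0pos]
    have := pow_le_pow_left₀ (by positivity) h13 2
    rwa [mul_pow, g0sq, sq_abs] at this
  have fin1 : τ ^ 2 * (C / L) * ∫ z in x..y, φ1 z ^ 2 ≤ 4 * e * C := by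
    refine le_trans ?_ hφG
    rw [← intervalIntegral.integral_const_mul]
    refine le_trans ?_ (int_mono_sub a b x y (by linarith) hxy (by linarith) (fun x => φ1 x ^ 2 * G x ^ 2)
      (by fun_prop) (fun z _ => by positivity))
    apply intervalIntegral.integral_mono_on hxy (Continuous.intervalIntegrable (by fun_prop) _ _)
      (Continuous.intervalIntegrable (by fun_prop) _ _)
    intro z hz
    have := Glow z ⟨hx.trans hz.1, hz.2.trans hy⟩
    rw [mul_comm]
    gcongr
  have d := diff_sq_le x y hxy φ φ1 (fun z _ => hφ z) cφ1.continuousOn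
  apply abs_le_of_sq_le_sq _ (by positivity)
  refine d.trans ?_
  have hyx : y - x ≤ L := by linarith
  have i0 : 0 ≤ ∫ z in x..y, φ1 z ^ 2 := intervalIntegral.integral_nonneg hxy fun z _ => by positivity
  have h14 : ∫ z in x..y, φ1 z ^ 2 ≤ 4 * e * L / τ ^ 2 := by
    rw [le_div_iff₀ (by positivity)]
    have : (C / L) * ((∫ z in x..y, φ1 z ^ 2) * τ ^ 2) ≤ (C / L) * (4 * e * L) := by
      have e5 : (C / L) * (4 * e * L) = 4 * e * C := by field_simp
      rw [e5]; linarith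
    exact le_of_mul_le_mul_left this (by positivity)
  calc _ ≤ L * (4 * e * L / τ ^ 2) := by gcongr
    _ = (2 * L * √e / τ) ^ 2 := by
      rw [div_pow, mul_pow, mul_pow, Real.sq_sqrt he]; ring

end HelpersA3

section HelpersA4
open scoped Pointwise

theorem smoothing (φ : ℝ → ℝ) (s1 s2 a b η : ℝ) (hφ : ConvexOn ℝ (Ioo s1 s2) φ) (h1 : s1 < a)
    (hab : a < b) (h2 : b < s2) (hη : 0 < η) :
    ∃ φt φ1 φ2 : ℝ → ℝ, (∀ x, HasDerivAt φt (φ1 x) x) ∧ (∀ x, HasDerivAt φ1 (φ2 x) x) ∧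
      Continuous φ2 ∧ (∀ x ∈ Icc a b, 0 ≤ φ2 x) ∧ ∀ x ∈ Icc a b, |φt x - φ x| ≤ η := by
  set b' := (b + s2) / 2 with hb'
  have hbb' : b < b' := by rw [hb']; linarith
  have hb's : b' < s2 := by rw [hb']; linarith
  have hsub : Icc a b' ⊆ Ioo s1 s2 := Icc_subset_Ioo h1 hb's
  have cφ : ContinuousOn φ (Icc a b') := (hφ.continuousOn isOpen_Ioo).mono hsub
  set φe : ℝ → ℝ := fun x => φ (max a (min b' x)) with hφe
  have ce : Continuous φe := by
    apply cφ.comp_continuous (by fun_prop)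
    intro x
    exact ⟨le_max_left _ _, max_le (by linarith) (min_le_left _ _)⟩
  have ee : ∀ x ∈ Icc a b', φe x = φ x := by
    intro x hx
    simp only [hφe]
    rw [min_eq_right hx.2, max_eq_right hx.1]
  have uc := isCompact_Icc.uniformContinuousOn_of_continuous cφ
  rw [Metric.uniformContinuousOn_iff] at uc
  obtain ⟨δ0, hδ0, huc⟩ := uc η hη
  set δ := min (δ0 / 2) ((b' - b) / 2) with hδ
  have hδpos : 0 < δ := lt_min (by linarith) (by linarith)
  have hδ1 : 2 * δ ≤ δ0 := by have := min_le_left (δ0 / 2) ((b' - b) / 2); linarith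
  have hδ2 : 2 * δ ≤ b' - b := by have := min_le_right (δ0 / 2) ((b' - b) / 2); linarith
  set Φ1 : ℝ → ℝ := fun x => ∫ y in (0:ℝ)..x, φe y with hΦ1
  have d1 : ∀ x, HasDerivAt Φ1 (φe x) x := fun x =>
    intervalIntegral.integral_hasDerivAt_right (ce.intervalIntegrable _ _)
      ce.stronglyMeasurable.stronglyMeasurableAtFilter ce.continuousAt
  have c1 : Continuous Φ1 := continuous_iff_continuousAt.2 fun x => (d1 x).continuousAt
  set Φ2 : ℝ → ℝ := fun x => ∫ y in (0:ℝ)..x, Φ1 y with hΦ2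
  have d2 : ∀ x, HasDerivAt Φ2 (Φ1 x) x := fun x =>
    intervalIntegral.integral_hasDerivAt_right (c1.intervalIntegrable _ _)
      c1.stronglyMeasurable.stronglyMeasurableAtFilter c1.continuousAt
  have c2 : Continuous Φ2 := continuous_iff_continuousAt.2 fun x => (d2 x).continuousAt
  have dd : ∀ (g g' : ℝ → ℝ), (∀ x, HasDerivAt g (g' x) x) → ∀ x,
      HasDerivAt (fun x => (g (x + 2 * δ) - 2 * g (x + δ) + g x) / δ ^ 2)
        ((g' (x + 2 * δ) - 2 * g' (x + δ) + g' x) / δ ^ 2) x := by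
    intro g g' hg x
    exact ((((hg (x + 2 * δ)).comp_add_const x (2 * δ)).sub
      (((hg (x + δ)).comp_add_const x δ).const_mul 2)).add (hg x)).div_const _
  refine ⟨fun x => (Φ2 (x + 2 * δ) - 2 * Φ2 (x + δ) + Φ2 x) / δ ^ 2,
    fun x => (Φ1 (x + 2 * δ) - 2 * Φ1 (x + δ) + Φ1 x) / δ ^ 2,
    fun x => (φe (x + 2 * δ) - 2 * φe (x + δ) + φe x) / δ ^ 2, dd _ _ d2, dd _ _ d1, by fun_prop,
    ?_, ?_⟩
  · intro x hx
    have m0 : x ∈ Icc a b' := ⟨hx.1, by linarith [hx.2]⟩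
    have m1 : x + δ ∈ Icc a b' := ⟨by linarith [hx.1], by linarith [hx.2]⟩
    have m2 : x + 2 * δ ∈ Icc a b' := ⟨by linarith [hx.1], by linarith [hx.2]⟩
    beta_reduce
    rw [ee _ m0, ee _ m1, ee _ m2]
    have hc := hφ.2
    have := hc (hsub m0) (hsub m2) (show (0:ℝ) ≤ 1/2 by norm_num) (show (0:ℝ) ≤ 1/2 by norm_num) (by norm_num)
    simp only [smul_eq_mul] at this
    have e : 1 / 2 * x + 1 / 2 * (x + 2 * δ) = x + δ := by ring
    rw [e] at this
    apply div_nonneg _ (by positivity)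
    linarith
  · intro x hx
    obtain ⟨ξ, hξ, e1⟩ := exists_hasDerivAt_eq_slope (fun t => Φ2 (t + δ) - Φ2 t)
      (fun t => Φ1 (t + δ) - Φ1 t) (show x < x + δ by linarith)
      (by fun_prop) (fun t _ => ((d2 (t + δ)).comp_add_const t δ).sub (d2 t))
    obtain ⟨ζ, hζ, e2⟩ := exists_hasDerivAt_eq_slope Φ1
      φe (show ξ < ξ + δ by linarith) (by fun_prop) (fun t _ => d1 t)
    have e3 : (Φ2 (x + 2 * δ) - 2 * Φ2 (x + δ) + Φ2 x) / δ ^ 2 = φe ζ := by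
      rw [e2]
      have e4 : ξ + δ - ξ = δ := by ring
      have e5 : x + δ - x = δ := by ring
      have e6 : x + δ + δ = x + 2 * δ := by ring
      rw [e4]
      rw [e5, e6] at e1
      rw [e1]
      field_simp
      ring
    simp only
    rw [e3]
    have mζ : ζ ∈ Icc a b' := ⟨by linarith [hx.1, hξ.1, hζ.1], by linarith [hx.2, hξ.2, hζ.2]⟩
    have m0 : x ∈ Icc a b' := ⟨hx.1, by linarith [hx.2]⟩
    rw [ee _ mζ]
    have := huc ζ mζ x m0 (by
      rw [Real.dist_eq, abs_of_pos (by linarith [hξ.1, hζ.1])]; linarith [hξ.2, hζ.2])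
    rw [Real.dist_eq] at this
    exact this.le

end HelpersA4

section HelpersA5
open scoped Pointwise

theorem tail_small (h : ℝ → ℝ) (s1 s2 : ℝ) (hs : s1 < s2) (hi : IntervalIntegrable h volume s1 s2)
    (η : ℝ) (hη : 0 < η) (μ : ℝ) (hμ : 0 < μ) :
    ∃ a b : ℝ, s1 < a ∧ a < b ∧ b < s2 ∧ a - s1 ≤ μ ∧ s2 - b ≤ μ ∧
      ∫ x in s1..a, h x ≤ η ∧ ∫ x in b..s2, h x ≤ η := by
  have c1 : ContinuousOn (fun x => ∫ t in s1..x, h t) (Icc s1 s2) := by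
    have := intervalIntegral.continuousOn_primitive_interval' hi left_mem_uIcc
    rwa [uIcc_of_le hs.le] at this
  have c2 : ContinuousOn (fun x => ∫ t in s2..x, h t) (Icc s1 s2) := by
    have := intervalIntegral.continuousOn_primitive_interval' hi right_mem_uIcc
    rwa [uIcc_of_le hs.le] at this
  have t1 := (c1 s1 (left_mem_Icc.2 hs.le)).mono Ioo_subset_Icc_self
  have t2 := (c2 s2 (right_mem_Icc.2 hs.le)).mono Ioo_subset_Icc_self
  have m1 : Tendsto (fun x => ∫ t in s1..x, h t) (nhdsWithin s1 (Ioo s1 s2)) (nhds 0) := by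
    have := t1.tendsto; simpa using this
  have m2 : Tendsto (fun x => ∫ t in s2..x, h t) (nhdsWithin s2 (Ioo s1 s2)) (nhds 0) := by
    have := t2.tendsto; simpa using this
  rw [nhdsWithin_Ioo_eq_nhdsGT hs] at m1
  rw [nhdsWithin_Ioo_eq_nhdsLT hs] at m2
  have e1 := m1.eventually (gt_mem_nhds hη)
  have e2 := m2.eventually (lt_mem_nhds (show -η < 0 by linarith))
  have e3 : ∀ᶠ x in nhdsWithin s1 (Ioi s1), x ∈ Ioo s1 (min (s1 + μ) ((s1 + s2) / 2)) :=
    Ioo_mem_nhdsGT (lt_min (by linarith) (by linarith))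
  have e4 : ∀ᶠ x in nhdsWithin s2 (Iio s2), x ∈ Ioo (max (s2 - μ) ((s1 + s2) / 2)) s2 :=
    Ioo_mem_nhdsLT (max_lt (by linarith) (by linarith))
  obtain ⟨a, ha1, ha2⟩ := (e1.and e3).exists
  obtain ⟨b, hb1, hb2⟩ := (e2.and e4).exists
  have := lt_min_iff.1 ha2.2
  have := max_lt_iff.1 hb2.1
  refine ⟨a, b, ha2.1, by linarith, hb2.2, by linarith, by linarith, ha1.le, ?_⟩
  rw [intervalIntegral.integral_symm]; linarith

theorem approx (f f' h : ℝ → ℝ) (s1 s2 : ℝ) (hs : s1 < s2) (hf : ∀ x, HasDerivAt f (f' x) x)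
    (cf' : Continuous f') (h0 : ∀ x, 0 ≤ h x) (hpos : ∀ x ∈ Ioo s1 s2, 0 < h x)
    (hconv : ConvexOn ℝ (Ioo s1 s2) (fun x => -log (h x)))
    (hi : IntervalIntegrable h volume s1 s2) (hm : ∫ x in s1..s2, f x * h x = 0)
    (η : ℝ) (hη : 0 < η) (μ : ℝ) (hμ : 0 < μ) :
    ∃ a b c : ℝ, ∃ φt φ1 φ2 : ℝ → ℝ, s1 < a ∧ a < b ∧ b < s2 ∧ a - s1 ≤ μ ∧ s2 - b ≤ μ ∧
      (∀ x, HasDerivAt φt (φ1 x) x) ∧ (∀ x, HasDerivAt φ1 (φ2 x) x) ∧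
      Continuous φ2 ∧ (∀ x ∈ Icc a b, 0 ≤ φ2 x) ∧ (∀ x ∈ Icc a b, |φt x + log (h x)| ≤ η) ∧
      (∫ x in a..b, (f x - c) * exp (-φt x)) = 0 ∧
      (∫ x in a..b, f' x ^ 2 * exp (-φt x)) ≤ exp η * ∫ x in s1..s2, f' x ^ 2 * h x ∧
      exp (-η) * ((∫ x in s1..s2, f x ^ 2 * h x) - η) ≤ ∫ x in a..b, (f x - c) ^ 2 * exp (-φt x) := by
  have cf : Continuous f := continuous_iff_continuousAt.2 fun x => (hf x).continuousAt
  obtain ⟨M, hM⟩ := isCompact_Icc.exists_bound_of_continuousOn (cf.continuousOn (s := Icc s1 s2))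
  have hM0 : 0 ≤ M := (norm_nonneg _).trans (hM s1 (left_mem_Icc.2 hs.le))
  obtain ⟨a, b, h1, hab, h2, h3, h4, h5, h6⟩ := tail_small h s1 s2 hs hi (η / (8 * M ^ 2 + 1))
    (by positivity) μ hμ
  obtain ⟨φt, φ1, φ2, d1, d2, c2, p2, hη'⟩ := smoothing _ s1 s2 a b η hconv h1 hab h2 hη
  have cφ : Continuous φt := continuous_iff_continuousAt.2 fun x => (d1 x).continuousAt
  set W := ∫ x in a..b, exp (-φt x) with hW
  have hW0 : 0 < W := intervalIntegral.intervalIntegral_pos_of_pos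
    (Continuous.intervalIntegrable (by fun_prop) _ _) (fun x => exp_pos _) hab
  set c := (∫ x in a..b, f x * exp (-φt x)) / W with hc
  have ia : ∀ u v, u ∈ Icc s1 s2 → v ∈ Icc s1 s2 → IntervalIntegrable h volume u v := by
    intro u v hu hv
    apply hi.mono_set
    rw [uIcc_of_le hs.le]
    exact uIcc_subset_Icc hu hv
  have ms1 : s1 ∈ Icc s1 s2 := left_mem_Icc.2 hs.le
  have ms2 : s2 ∈ Icc s1 s2 := right_mem_Icc.2 hs.le
  have ma : a ∈ Icc s1 s2 := ⟨h1.le, by linarith⟩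
  have mb : b ∈ Icc s1 s2 := ⟨by linarith, h2.le⟩
  have ig : ∀ u v, u ∈ Icc s1 s2 → v ∈ Icc s1 s2 → ∀ g : ℝ → ℝ, Continuous g →
      IntervalIntegrable (fun x => g x * h x) volume u v := by
    intro u v hu hv g cg
    exact (ia u v hu hv).continuousOn_mul cg.continuousOn
  have hcM : |c| ≤ M := by
    rw [hc, abs_div, abs_of_pos hW0, div_le_iff₀ hW0, hW, ← intervalIntegral.integral_const_mul]
    refine (intervalIntegral.abs_integral_le_integral_abs hab.le).trans ?_
    apply intervalIntegral.integral_mono_on hab.le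
    · exact Continuous.intervalIntegrable (by fun_prop) _ _
    · exact Continuous.intervalIntegrable (by fun_prop) _ _
    · intro x hx
      rw [abs_mul, abs_of_pos (exp_pos _)]
      have := hM x ⟨by linarith [hx.1], by linarith [hx.2]⟩
      rw [Real.norm_eq_abs] at this
      gcongr
  have hh : ∀ x ∈ Icc a b, exp (-φt x) ≤ exp η * h x ∧ exp (-η) * h x ≤ exp (-φt x) := by
    intro x hx
    have hx' : x ∈ Ioo s1 s2 := ⟨by linarith [hx.1], by linarith [hx.2]⟩
    have hp := hpos x hx'
    have := abs_le.1 (hη' x hx)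
    constructor
    · rw [← exp_log hp, ← exp_add]
      apply exp_le_exp.2; linarith
    · rw [← exp_log hp, ← exp_add]
      apply exp_le_exp.2; linarith
  refine ⟨a, b, c, φt, φ1, φ2, h1, hab, h2, h3, h4, d1, d2, c2, p2, ?_, ?_, ?_, ?_⟩
  · intro x hx
    have := hη' x hx
    rwa [sub_neg_eq_add] at this
  · simp only [sub_mul]
    rw [intervalIntegral.integral_sub, intervalIntegral.integral_const_mul, ← hW, hc]
    · field_simp; ring
    all_goals exact Continuous.intervalIntegrable (by fun_prop) _ _
  · calc _ ≤ ∫ x in a..b, exp η * (f' x ^ 2 * h x) := by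
          apply intervalIntegral.integral_mono_on hab.le
          · exact Continuous.intervalIntegrable (by fun_prop) _ _
          · exact (ig a b ma mb _ (by fun_prop)).const_mul _
          · intro x hx
            have := (hh x hx).1
            nlinarith [sq_nonneg (f' x)]
      _ ≤ _ := by
          rw [intervalIntegral.integral_const_mul]
          gcongr
          apply intervalIntegral.integral_mono_interval h1.le hab.le h2.le
          · exact Eventually.of_forall fun x => mul_nonneg (sq_nonneg _) (h0 x)
          · exact ig _ _ ms1 ms2 _ (by fun_prop)
  · have k1 : exp (-η) * ∫ x in a..b, (f x - c) ^ 2 * h x ≤ ∫ x in a..b, (f x - c) ^ 2 * exp (-φt x) := by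
      rw [← intervalIntegral.integral_const_mul]
      apply intervalIntegral.integral_mono_on hab.le
      · exact (ig a b ma mb _ (by fun_prop)).const_mul _
      · exact Continuous.intervalIntegrable (by fun_prop) _ _
      · intro x hx
        have := (hh x hx).2
        nlinarith [sq_nonneg (f x - c)]
    refine le_trans ?_ k1
    gcongr
    have k2 : ∫ x in s1..s2, f x ^ 2 * h x ≤ ∫ x in s1..s2, (f x - c) ^ 2 * h x := by
      have e : ∫ x in s1..s2, (f x - c) ^ 2 * h x = (∫ x in s1..s2, f x ^ 2 * h x)
          - 2 * c * (∫ x in s1..s2, f x * h x) + c ^ 2 * ∫ x in s1..s2, h x := by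
        rw [← intervalIntegral.integral_const_mul, ← intervalIntegral.integral_const_mul,
          ← intervalIntegral.integral_sub, ← intervalIntegral.integral_add]
        · apply intervalIntegral.integral_congr; intro x _; simp only; ring
        · exact (ig _ _ ms1 ms2 _ (by fun_prop)).sub ((ig _ _ ms1 ms2 _ (by fun_prop)).const_mul _)
        · exact hi.const_mul _
        · exact ig _ _ ms1 ms2 _ (by fun_prop)
        · exact (ig _ _ ms1 ms2 _ (by fun_prop)).const_mul _
      rw [e, hm]
      have : 0 ≤ ∫ x in s1..s2, h x := intervalIntegral.integral_nonneg hs.le fun x _ => h0 x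
      nlinarith [sq_nonneg c]
    have tl : ∀ u v, u ∈ Icc s1 s2 → v ∈ Icc s1 s2 → u ≤ v →
        ∫ x in u..v, (f x - c) ^ 2 * h x ≤ 4 * M ^ 2 * ∫ x in u..v, h x := by
      intro u v hu hv huv
      rw [← intervalIntegral.integral_const_mul]
      apply intervalIntegral.integral_mono_on huv (ig _ _ hu hv _ (by fun_prop))
        ((ia _ _ hu hv).const_mul _)
      intro x hx
      apply mul_le_mul_of_nonneg_right _ (h0 x)
      have q1 := hM x ⟨hu.1.trans hx.1, hx.2.trans hv.2⟩
      rw [Real.norm_eq_abs] at q1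
      have q2 : |f x - c| ≤ 2 * M := (abs_sub _ _).trans (by linarith)
      have := pow_le_pow_left₀ (abs_nonneg _) q2 2
      rw [sq_abs] at this
      linarith
    have i1 := ig s1 a ms1 ma (fun x => (f x - c) ^ 2) (by fun_prop)
    have i2 := ig a b ma mb (fun x => (f x - c) ^ 2) (by fun_prop)
    have i3 := ig b s2 mb ms2 (fun x => (f x - c) ^ 2) (by fun_prop)
    have s := intervalIntegral.integral_add_adjacent_intervals (i1.trans i2) i3
    have s' := intervalIntegral.integral_add_adjacent_intervals i1 i2
    have u1 := tl s1 a ms1 ma h1.le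
    have u2 := tl b s2 mb ms2 h2.le
    have u3 : 4 * M ^ 2 * (η / (8 * M ^ 2 + 1)) + 4 * M ^ 2 * (η / (8 * M ^ 2 + 1)) ≤ η := by
      have : 4 * M ^ 2 * (η / (8 * M ^ 2 + 1)) + 4 * M ^ 2 * (η / (8 * M ^ 2 + 1)) =
        (8 * M ^ 2) * η / (8 * M ^ 2 + 1) := by ring
      rw [this, div_le_iff₀ (by positivity)]
      nlinarith
    have u4 : 4 * M ^ 2 * ∫ x in s1..a, h x ≤ 4 * M ^ 2 * (η / (8 * M ^ 2 + 1)) := by gcongr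
    have u5 : 4 * M ^ 2 * ∫ x in b..s2, h x ≤ 4 * M ^ 2 * (η / (8 * M ^ 2 + 1)) := by gcongr
    linarith

end HelpersA5

section HelpersA6
open scoped Pointwise

theorem oned_A (f f' h : ℝ → ℝ) (s1 s2 : ℝ) (hs : s1 < s2) (hf : ∀ x, HasDerivAt f (f' x) x)
    (cf' : Continuous f') (h0 : ∀ x, 0 ≤ h x) (hpos : ∀ x ∈ Ioo s1 s2, 0 < h x)
    (hconv : ConvexOn ℝ (Ioo s1 s2) (fun x => -log (h x)))
    (hi : IntervalIntegrable h volume s1 s2) (hm : ∫ x in s1..s2, f x * h x = 0) :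
    π ^ 2 * (∫ x in s1..s2, f x ^ 2 * h x) ≤ (s2 - s1) ^ 2 * ∫ x in s1..s2, f' x ^ 2 * h x := by
  set A := ∫ x in s1..s2, f x ^ 2 * h x with hA
  set B := ∫ x in s1..s2, f' x ^ 2 * h x with hB
  have key : ∀ η : ℝ, 0 < η → η < π →
      (π - η) ^ 2 * (exp (-η) * (A - η)) ≤ (s2 - s1) ^ 2 * (exp η * B) := by
    intro η hη hη2
    obtain ⟨a, b, c, φt, φ1, φ2, h1, hab, h2, -, -, d1, d2, c2, p2, -, hm', hB', hA'⟩ :=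
      approx f f' h s1 s2 hs hf cf' h0 hpos hconv hi hm η hη 1 one_pos
    have hba : 0 < b - a := by linarith
    have q := oned_a a b hab (fun x => f x - c) f' φt φ1 φ2 (fun x => (hf x).sub_const c) cf' d1 d2 c2 p2
      hm' ((π - η) / (b - a)) (div_pos (by linarith) hba) (by field_simp; linarith)
    rw [div_pow, div_mul_eq_mul_div, div_le_iff₀ (by positivity)] at q
    have hp : 0 ≤ (π - η) ^ 2 := sq_nonneg _
    have e1 : (b - a) ^ 2 ≤ (s2 - s1) ^ 2 := by
      apply pow_le_pow_left₀ hba.le; linarith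
    have e2 : 0 ≤ exp η * B := by
      refine le_trans ?_ hB'
      exact intervalIntegral.integral_nonneg hab.le fun x _ => by positivity
    calc _ ≤ _ := mul_le_mul_of_nonneg_left hA' hp
      _ ≤ _ := q
      _ ≤ (exp η * B) * (b - a) ^ 2 := by gcongr
      _ ≤ (exp η * B) * (s2 - s1) ^ 2 := by gcongr
      _ = _ := by ring
  have t1 : Tendsto (fun η : ℝ => (π - η) ^ 2 * (exp (-η) * (A - η))) (nhdsWithin 0 (Ioi 0))
      (nhds ((π - 0) ^ 2 * (exp (-0) * (A - 0)))) :=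
    (Continuous.tendsto (by fun_prop) 0).mono_left nhdsWithin_le_nhds
  have t2 : Tendsto (fun η : ℝ => (s2 - s1) ^ 2 * (exp η * B)) (nhdsWithin 0 (Ioi 0))
      (nhds ((s2 - s1) ^ 2 * (exp 0 * B))) :=
    (Continuous.tendsto (by fun_prop) 0).mono_left nhdsWithin_le_nhds
  have := le_of_tendsto_of_tendsto t1 t2 (by
    filter_upwards [Ioo_mem_nhdsGT pi_pos] with η hη
    exact key η hη.1 hη.2)
  simpa using this

set_option maxHeartbeats 1000000 in
theorem oned_B (f f' h : ℝ → ℝ) (s1 s2 : ℝ) (hs : s1 < s2) (hf : ∀ x, HasDerivAt f (f' x) x)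
    (cf' : Continuous f') (h0 : ∀ x, 0 ≤ h x) (hpos : ∀ x ∈ Ioo s1 s2, 0 < h x)
    (hconv : ConvexOn ℝ (Ioo s1 s2) (fun x => -log (h x)))
    (hi : IntervalIntegrable h volume s1 s2) (hm : ∫ x in s1..s2, f x * h x = 0)
    (ε τ : ℝ) (hε : 0 < ε) (hε1 : ε ≤ 1 / 2) (hτ : 0 < τ) (hτ1 : τ ≤ 1 / 7)
    (hετ : √(2 * ε) ≤ 0.4 * τ)
    (hA : 0 < ∫ x in s1..s2, f x ^ 2 * h x)
    (hB : (s2 - s1) ^ 2 * (∫ x in s1..s2, f' x ^ 2 * h x) ≤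
      (π ^ 2 + ε) * ∫ x in s1..s2, f x ^ 2 * h x)
    (x y : ℝ) (hx : s1 + 2 * τ * (s2 - s1) ≤ x) (hxy : x ≤ y) (hy : y ≤ s2 - 2 * τ * (s2 - s1)) :
    |log (h y) - log (h x)| ≤ 4 * √(2 * ε) / τ := by
  set A := ∫ x in s1..s2, f x ^ 2 * h x with hA'
  set B := ∫ x in s1..s2, f' x ^ 2 * h x with hB'
  set L := s2 - s1 with hL
  have hL0 : 0 < L := by linarith
  have hse : 0 < √(2 * ε) := Real.sqrt_pos.2 (by linarith)
  have t1 : Tendsto (fun η : ℝ => (π ^ 2 + 1.5 * ε) * (exp (-η) * (A - η)) - exp η * ((π ^ 2 + ε) * A))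
      (nhdsWithin 0 (Ioi 0)) (nhds ((π ^ 2 + 1.5 * ε) * (exp (-0) * (A - 0)) - exp 0 * ((π ^ 2 + ε) * A))) :=
    (Continuous.tendsto (by fun_prop) 0).mono_left nhdsWithin_le_nhds
  have ev := t1.eventually (lt_mem_nhds (show 0 < (π ^ 2 + 1.5 * ε) * (exp (-0) * (A - 0)) - exp 0 * ((π ^ 2 + ε) * A) by
    simp only [neg_zero, exp_zero, sub_zero, one_mul]
    nlinarith))
  obtain ⟨η, he1, hη⟩ := (ev.and (Ioo_mem_nhdsGT (lt_min (div_pos hse hτ) hA))).exists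
  have hη2 := lt_min_iff.1 hη.2
  obtain ⟨a, b, c, φt, φ1, φ2, h1, hab, h2, h3, h4, d1, d2, c2, p2, hl, hm', hB', hA'⟩ :=
      approx f f' h s1 s2 hs hf cf' h0 hpos hconv hi hm η hη.1 (τ * L) (by positivity)
  have hba : 0 < b - a := by linarith
  have hbaL : b - a ≤ L := by linarith
  set ζ := ε / (4 * π) with hζ
  have hpi := pi_gt_three
  have hpiz : 4 * π * ζ = ε := by rw [hζ]; field_simp
  have hζ0 : 0 < ζ := by positivity
  have hζ1 : ζ < π := by rw [hζ, div_lt_iff₀ (by positivity)]; nlinarith only [hpi, hε1]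
  set A' := ∫ x in a..b, (f x - c) ^ 2 * exp (-φt x) with hA''
  have hA'0 : 0 < A' := lt_of_lt_of_le (mul_pos (exp_pos _) (by linarith)) hA'
  have hsq : (b - a) * √(2 * ε / L ^ 2) ≤ √(2 * ε) := by
    rw [Real.sqrt_div (by linarith), Real.sqrt_sq hL0.le, mul_div_assoc', div_le_iff₀ hL0, mul_comm]
    gcongr
  have hτL : τ * (b - a) ≤ τ * L := by gcongr
  have hτL0 : 0 ≤ τ * (b - a) := by positivity
  have hx1 : a + τ * (b - a) ≤ x := by linarith
  have hy1 : y ≤ b - τ * (b - a) := by linarith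
  have q := oned_b a b hab (fun x => f x - c) f' φt φ1 φ2 (fun x => (hf x).sub_const c) cf' d1 d2 c2 p2
      hm' ((π - ζ) / (b - a)) (2 * ε / L ^ 2) τ (div_pos (by linarith) hba) (by field_simp; linarith)
      (by positivity) (by
        rw [mul_div_assoc', div_le_one (by positivity)]
        have : (b - a) ^ 2 ≤ L ^ 2 := by gcongr
        nlinarith only [sq_nonneg (b - a), hε1, hε, this]) hA'0 (by
        have e3 : (π ^ 2 + 1.5 * ε) / L ^ 2 ≤ ((π - ζ) / (b - a)) ^ 2 + 2 * ε / L ^ 2 := by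
          have : (π - ζ) ^ 2 / L ^ 2 ≤ ((π - ζ) / (b - a)) ^ 2 := by
            rw [div_pow]
            gcongr
          have e4 : (π ^ 2 + 1.5 * ε) / L ^ 2 ≤ (π - ζ) ^ 2 / L ^ 2 + 2 * ε / L ^ 2 := by
            rw [← add_div]
            apply div_le_div_of_nonneg_right _ (by positivity)
            nlinarith only [sq_nonneg ζ, hpiz]
          linarith
        calc _ ≤ exp η * B := hB'
          _ ≤ exp η * ((π ^ 2 + ε) * A / L ^ 2) := by
            gcongr
            rw [le_div_iff₀ (by positivity)]; linarith
          _ = exp η * ((π ^ 2 + ε) * A) / L ^ 2 := by ring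
          _ ≤ (π ^ 2 + 1.5 * ε) * (exp (-η) * (A - η)) / L ^ 2 := by
            apply div_le_div_of_nonneg_right _ (by positivity)
            linarith
          _ ≤ (π ^ 2 + 1.5 * ε) * A' / L ^ 2 := by gcongr
          _ = (π ^ 2 + 1.5 * ε) / L ^ 2 * A' := by ring
          _ ≤ _ := by gcongr) hτ hτ1 (hsq.trans hετ) x y hx1 hxy hy1
  have mx : x ∈ Icc a b := ⟨by linarith, by linarith⟩
  have my : y ∈ Icc a b := ⟨by linarith, by linarith⟩
  have lx := abs_le.1 (hl x mx)
  have ly := abs_le.1 (hl y my)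
  have q2 : 2 * (b - a) * √(2 * ε / L ^ 2) / τ ≤ 2 * √(2 * ε) / τ := by
    rw [mul_assoc]; gcongr
  have q3 := abs_le.1 (q.trans q2)
  have e5 : 4 * √(2 * ε) / τ = 2 * √(2 * ε) / τ + √(2 * ε) / τ + √(2 * ε) / τ := by ring
  rw [e5, abs_le]
  constructor <;> linarith [hη2.1]

theorem end_left (f f' h : ℝ → ℝ) (s1 s2 : ℝ) (hs : s1 < s2) (hf : ∀ x, HasDerivAt f (f' x) x)
    (cf' : Continuous f') (h0 : ∀ x, 0 ≤ h x) (hpos : ∀ x ∈ Ioo s1 s2, 0 < h x)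
    (hconv : ConvexOn ℝ (Ioo s1 s2) (fun x => -log (h x)))
    (hi : IntervalIntegrable h volume s1 s2)
    (σ : ℝ) (hσ : 0 < σ) (hσ1 : 6 * σ ≤ s2 - s1)
    (hr : ∀ x y, s1 + σ ≤ x → y ≤ s2 - σ → x ≤ y → h x ≤ 2 * h y) :
    ∫ x in s1..(s1 + σ), f x ^ 2 * h x ≤ 4 * (∫ x in (s1 + σ)..(s1 + 2 * σ), f x ^ 2 * h x) +
      4 * σ ^ 2 * ∫ x in s1..s2, f' x ^ 2 * h x := by
  have cf : Continuous f := continuous_iff_continuousAt.2 fun x => (hf x).continuousAt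
  have claim : ∀ x y, s1 < x → x ≤ s1 + σ → x ≤ y → y ≤ x + σ → h x ≤ 2 * h y := by
    intro x y hx1 hx2 hxy hyx
    rcases hxy.eq_or_lt with e | hlt
    · rw [← e]; linarith [h0 x]
    by_contra hcon
    push Not at hcon
    have mem : ∀ z, x ≤ z → z ≤ s1 + 5 * σ → z ∈ Ioo s1 s2 := fun z hz1 hz2 => ⟨by linarith, by linarith⟩
    have mx := mem x le_rfl (by linarith)
    have my := mem y hxy (by linarith)
    have m1 := mem (y + σ) (by linarith) (by linarith)
    have m2 := mem (y + 2 * σ) (by linarith) (by linarith)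
    have k1 := hconv.slope_mono_adjacent mx m1 hlt (by linarith)
    have k2 := hconv.slope_mono_adjacent my m2 (show y < y + σ by linarith) (by linarith)
    have hy2 := hr (y + σ) (y + 2 * σ) (by linarith) (by linarith) (by linarith)
    have l1 : log 2 < log (h x) - log (h y) := by
      have := Real.log_lt_log (by linarith [hpos y my]) hcon
      rw [Real.log_mul (by norm_num) (hpos y my).ne'] at this
      linarith
    have l2 : log (h (y + σ)) - log (h (y + 2 * σ)) ≤ log 2 := by
      have := Real.log_le_log (hpos _ m1) hy2
      rw [Real.log_mul (by norm_num) (hpos _ m2).ne'] at this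
      linarith
    have l3 : log 2 / σ < (-log (h y) - -log (h x)) / (y - x) := by
      rw [div_lt_div_iff₀ hσ (by linarith)]
      have : 0 < log 2 := Real.log_pos (by norm_num)
      nlinarith
    have e1 : y + σ - y = σ := by ring
    have e2 : y + 2 * σ - (y + σ) = σ := by ring
    rw [e1] at k1
    rw [e1, e2] at k2
    have l4 : (-log (h (y + 2 * σ)) - -log (h (y + σ))) / σ ≤ log 2 / σ := by
      gcongr; linarith
    linarith
  have ig : ∀ u v, u ∈ Icc s1 s2 → v ∈ Icc s1 s2 → ∀ g : ℝ → ℝ, Continuous g →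
      IntervalIntegrable (fun x => g x * h x) volume u v := by
    intro u v hu hv g cg
    have : IntervalIntegrable h volume u v := by
      apply hi.mono_set
      rw [uIcc_of_le hs.le]
      exact uIcc_subset_Icc hu hv
    exact this.continuousOn_mul cg.continuousOn
  have ms1 : s1 ∈ Icc s1 s2 := left_mem_Icc.2 hs.le
  have ms2 : s2 ∈ Icc s1 s2 := right_mem_Icc.2 hs.le
  have mc : s1 + σ ∈ Icc s1 s2 := ⟨by linarith, by linarith⟩
  have md : s1 + 2 * σ ∈ Icc s1 s2 := ⟨by linarith, by linarith⟩
  set B := ∫ x in s1..s2, f' x ^ 2 * h x with hB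
  have pt : ∀ x, s1 < x → x ≤ s1 + σ → f x ^ 2 * h x ≤ 4 * (f (x + σ) ^ 2 * h (x + σ)) + 4 * σ * B := by
    intro x hx1 hx2
    have d := diff_sq_le x (x + σ) (by linarith) f f' (fun z _ => hf z) cf'.continuousOn
    have e : x + σ - x = σ := by ring
    rw [e] at d
    have d2 : (∫ z in x..(x + σ), f' z ^ 2) * h x ≤ 2 * B := by
      rw [hB, ← intervalIntegral.integral_mul_const, ← intervalIntegral.integral_const_mul]
      have i2 := (ig s1 s2 ms1 ms2 (fun x => f' x ^ 2) (by fun_prop)).const_mul 2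
      refine le_trans ?_ (intervalIntegral.integral_mono_interval (c := s1) (d := s2) (a := x) (b := x + σ)
        hx1.le (by linarith) (by linarith)
        (Eventually.of_forall fun z => ?_) i2)
      · apply intervalIntegral.integral_mono_on (by linarith)
        · exact Continuous.intervalIntegrable (by fun_prop) _ _
        · exact (ig x (x+σ) ⟨hx1.le, by linarith⟩ ⟨by linarith, by linarith⟩ (fun x => f' x ^ 2) (by fun_prop)).const_mul 2
        · intro z hz
          have := claim x z hx1 hx2 hz.1 hz.2
          nlinarith [sq_nonneg (f' z)]
      · simp only [Pi.zero_apply]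
        have := h0 z
        positivity
    have c1 := claim x (x + σ) hx1 hx2 (by linarith) le_rfl
    have hx0 := h0 x
    have a1 : f x ^ 2 ≤ 2 * f (x + σ) ^ 2 + 2 * (f (x + σ) - f x) ^ 2 := by
      nlinarith [sq_nonneg (2 * f (x + σ) - f x)]
    calc f x ^ 2 * h x ≤ (2 * f (x + σ) ^ 2 + 2 * (σ * ∫ z in x..(x + σ), f' z ^ 2)) * h x := by
          gcongr; linarith
      _ = 2 * f (x + σ) ^ 2 * h x + 2 * σ * ((∫ z in x..(x + σ), f' z ^ 2) * h x) := by ring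
      _ ≤ 2 * f (x + σ) ^ 2 * (2 * h (x + σ)) + 2 * σ * (2 * B) := by gcongr
      _ = _ := by ring
  have sh : ∫ x in s1..(s1 + σ), f (x + σ) ^ 2 * h (x + σ) = ∫ x in (s1 + σ)..(s1 + 2 * σ), f x ^ 2 * h x := by
    rw [intervalIntegral.integral_comp_add_right (fun x => f x ^ 2 * h x)]
    congr 1; ring
  have i3 : IntervalIntegrable (fun x => f (x + σ) ^ 2 * h (x + σ)) volume s1 (s1 + σ) := by
    have := (ig (s1 + σ) (s1 + 2 * σ) mc md (fun x => f x ^ 2) (by fun_prop)).comp_add_right σ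
    have e : s1 + 2 * σ - σ = s1 + σ := by ring
    simpa [e] using this
  rw [← sh]
  have e : 4 * σ ^ 2 * B = ∫ x in s1..(s1 + σ), 4 * σ * B := by
    rw [intervalIntegral.integral_const]; simp only [smul_eq_mul]; ring
  rw [e, ← intervalIntegral.integral_const_mul, ← intervalIntegral.integral_add (i3.const_mul _) (by simp)]
  apply intervalIntegral.integral_mono_on_of_le_Ioo (by linarith)
  · exact ig s1 (s1 + σ) ms1 mc (fun x => f x ^ 2) (by fun_prop)
  · exact (i3.const_mul _).add (by simp)
  · intro x hx
    exact pt x hx.1 hx.2.le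

theorem oned_mid (f f' h : ℝ → ℝ) (s1 s2 : ℝ) (hs : s1 < s2) (hf : ∀ x, HasDerivAt f (f' x) x)
    (cf' : Continuous f') (h0 : ∀ x, 0 ≤ h x) (hpos : ∀ x ∈ Ioo s1 s2, 0 < h x)
    (hconv : ConvexOn ℝ (Ioo s1 s2) (fun x => -log (h x)))
    (hi : IntervalIntegrable h volume s1 s2)
    (σ : ℝ) (hσ1 : σ = (s2 - s1) / 20)
    (hr : ∀ x y, s1 + σ ≤ x → x ≤ s2 - σ → s1 + σ ≤ y → y ≤ s2 - σ → h x ≤ 2 * h y)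
    (hB : (s2 - s1) ^ 2 * (∫ x in s1..s2, f' x ^ 2 * h x) ≤ 11 * ∫ x in s1..s2, f x ^ 2 * h x) :
    (∫ x in s1..s2, f x ^ 2 * h x) ≤ 12 * ∫ x in (s1 + σ)..(s2 - σ), f x ^ 2 * h x := by
  have hσ : 0 < σ := by rw [hσ1]; linarith
  have cf : Continuous f := continuous_iff_continuousAt.2 fun x => (hf x).continuousAt
  have l := end_left f f' h s1 s2 hs hf cf' h0 hpos hconv hi σ hσ (by linarith)
    (fun x y a b c => hr x y a (by linarith) (by linarith) b)
  have r := end_left (fun x => f (-x)) (fun x => - f' (-x)) (fun x => h (-x)) (-s2) (-s1) (by linarith)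
    (fun x => by
      have := HasDerivAt.comp (h₂ := f) x (hf (-x)) (hasDerivAt_neg x)
      simpa [Function.comp_def] using this) (by fun_prop) (fun x => h0 _)
    (fun x hx => hpos _ ⟨by linarith [hx.2], by linarith [hx.1]⟩)
    (by
      have := hconv.comp_linearMap (-LinearMap.id)
      have e : (-LinearMap.id : ℝ →ₗ[ℝ] ℝ) ⁻¹' Ioo s1 s2 = Ioo (-s2) (-s1) := by
        ext x; simp only [mem_preimage, LinearMap.neg_apply, LinearMap.id_apply, mem_Ioo]
        constructor <;> rintro ⟨a, b⟩ <;> constructor <;> linarith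
      rw [e] at this
      exact this)
    (by
      have := (IntervalIntegrable.iff_comp_neg (by finiteness)).1 hi.symm
      exact this) σ hσ (by linarith)
    (fun x y a b c => hr (-x) (-y) (by linarith) (by linarith) (by linarith) (by linarith))
  have ig : ∀ u v, u ∈ Icc s1 s2 → v ∈ Icc s1 s2 → ∀ g : ℝ → ℝ, Continuous g →
      IntervalIntegrable (fun x => g x * h x) volume u v := by
    intro u v hu hv g cg
    have : IntervalIntegrable h volume u v := by
      apply hi.mono_set
      rw [uIcc_of_le hs.le]
      exact uIcc_subset_Icc hu hv
    exact this.continuousOn_mul cg.continuousOn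
  rw [intervalIntegral.integral_comp_neg (fun x => f x ^ 2 * h x),
    intervalIntegral.integral_comp_neg (fun x => f x ^ 2 * h x)] at r
  simp only [neg_sq] at r
  rw [intervalIntegral.integral_comp_neg (fun x => f' x ^ 2 * h x)] at r
  have e1 : -(-s2 + σ) = s2 - σ := by ring
  have e2 : -(-s2 + 2 * σ) = s2 - 2 * σ := by ring
  rw [e1, e2, neg_neg, neg_neg] at r
  have ms1 : s1 ∈ Icc s1 s2 := left_mem_Icc.2 hs.le
  have ms2 : s2 ∈ Icc s1 s2 := right_mem_Icc.2 hs.le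
  have mc : s1 + σ ∈ Icc s1 s2 := ⟨by linarith, by linarith⟩
  have md : s2 - σ ∈ Icc s1 s2 := ⟨by linarith, by linarith⟩
  have cf2 : Continuous fun x => f x ^ 2 := by fun_prop
  have i1 := ig s1 (s1 + σ) ms1 mc _ cf2
  have i2 := ig (s1 + σ) (s2 - σ) mc md _ cf2
  have i3 := ig (s2 - σ) s2 md ms2 _ cf2
  have s := intervalIntegral.integral_add_adjacent_intervals (i1.trans i2) i3
  have s' := intervalIntegral.integral_add_adjacent_intervals i1 i2
  have nn : 0 ≤ᵐ[volume.restrict (Ioc (s1 + σ) (s2 - σ))] fun x => f x ^ 2 * h x :=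
    Eventually.of_forall fun x => mul_nonneg (sq_nonneg _) (h0 x)
  have b1 : ∫ x in (s1 + σ)..(s1 + 2 * σ), f x ^ 2 * h x ≤ ∫ x in (s1 + σ)..(s2 - σ), f x ^ 2 * h x :=
    intervalIntegral.integral_mono_interval le_rfl (by linarith) (by linarith) nn i2
  have b2 : ∫ x in (s2 - 2 * σ)..(s2 - σ), f x ^ 2 * h x ≤ ∫ x in (s1 + σ)..(s2 - σ), f x ^ 2 * h x :=
    intervalIntegral.integral_mono_interval (by linarith) (by linarith) le_rfl nn i2
  have e3 : σ ^ 2 = (s2 - s1) ^ 2 / 400 := by rw [hσ1]; ring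
  rw [e3] at l r
  have g : ∀ X Y Z P Q R T U V W : ℝ, X ≤ 4 * Y + 4 * (U / 400) * W → Z ≤ 4 * P + 4 * (U / 400) * W →
      U * W ≤ 11 * T → Q + Z = T → X + V = Q → Y ≤ V → P ≤ V → 0 ≤ V → T ≤ 12 * V := by
    intro X Y Z P Q R T U V W h1 h2 h3 h4 h5 h6 h7 h8
    have : 4 * (U / 400) * W = U * W / 100 := by ring
    have hT : T ≤ V + 8 * V + 22 / 100 * T := by linarith
    linarith
  exact g _ _ _ _ _ 0 _ _ _ _ l r hB s s' b1 b2
    (intervalIntegral.integral_nonneg (by linarith) fun x _ => mul_nonneg (sq_nonneg _) (h0 x))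

end HelpersA6

section HelpersI1
open scoped Pointwise

theorem point_bound (f f' : ℝ → ℝ) (hf : ∀ x, HasDerivAt f (f' x) x) (cf' : Continuous f') (s l : ℝ)
    (hl : 0 < l) (hl1 : l ≤ 1) : f s ^ 2 ≤ 2 / l * ∫ x in s..(s + l), (f x ^ 2 + f' x ^ 2) := by
  have cf : Continuous f := continuous_iff_continuousAt.2 fun x => (hf x).continuousAt
  have c2 : Continuous fun x => f x ^ 2 := by fun_prop
  have c3 : Continuous fun x => f' x ^ 2 := by fun_prop
  set B := ∫ x in s..(s + l), f' x ^ 2 with hB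
  have B0 : 0 ≤ B := intervalIntegral.integral_nonneg (by linarith) fun _ _ => by positivity
  have pt : ∀ x ∈ Icc s (s + l), f s ^ 2 ≤ 2 * f x ^ 2 + 2 * l * B := by
    intro x hx
    have h1 := diff_sq_le s x hx.1 f f' (fun z _ => hf z) cf'.continuousOn
    have h2 : ∫ z in s..x, f' z ^ 2 ≤ B :=
      intervalIntegral.integral_mono_interval le_rfl hx.1 hx.2 (Eventually.of_forall fun _ => by positivity)
        (c3.intervalIntegrable _ _)
    have h4 : 0 ≤ ∫ z in s..x, f' z ^ 2 := intervalIntegral.integral_nonneg hx.1 fun _ _ => by positivity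
    have h3 : (x - s) * ∫ z in s..x, f' z ^ 2 ≤ l * B := by
      apply mul_le_mul (by linarith [hx.2]) h2 h4 hl.le
    nlinarith only [h1, h3, sq_nonneg (f s - 2 * f x), sq_nonneg (f s - f x - f x)]
  have int := intervalIntegral.integral_mono_on (by linarith : s ≤ s + l) (by simp : IntervalIntegrable (fun _ => f s ^ 2) volume s (s+l))
    ((by fun_prop : Continuous fun x => 2 * f x ^ 2 + 2 * l * B).intervalIntegrable _ _) pt
  rw [intervalIntegral.integral_add ((by fun_prop : Continuous fun x => 2 * f x ^ 2).intervalIntegrable _ _) (by simp),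
    intervalIntegral.integral_const_mul, intervalIntegral.integral_const, intervalIntegral.integral_const] at int
  rw [intervalIntegral.integral_add (c2.intervalIntegrable _ _) (c3.intervalIntegrable _ _), ← hB]
  simp only [add_sub_cancel_left, smul_eq_mul] at int
  rw [div_mul_eq_mul_div, le_div_iff₀ hl]
  have : l * l * B ≤ 1 * B := by apply mul_le_mul_of_nonneg_right _ B0; nlinarith only [hl, hl1]
  linarith

set_option maxHeartbeats 1000000 in
theorem lines_bound {k : ℕ} (Ω S : Set (EuclideanSpace ℝ (Fin (k + 2)))) (ho : IsOpen Ω) (hb : IsBounded Ω)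
    (hSm : MeasurableSet S) (hSΩ : S ⊆ Ω) (v : EuclideanSpace ℝ (Fin (k + 2))) (hv : ‖v‖ = 1)
    (l m : ℝ) (hl : 0 < l) (hl1 : l ≤ 1) (hm : 0 ≤ m)
    (hS : ∀ z ∈ S, ∀ s, 0 ≤ s → s ≤ l → z + s • v ∈ Ω)
    (hk : ∀ z, volume {s : ℝ | z + s • v ∈ S} ≤ ENNReal.ofReal m)
    (u : EuclideanSpace ℝ (Fin (k + 2)) → ℝ) (hu : ContDiff ℝ 1 u) :
    ∫ x in S, u x ^ 2 ≤ 2 * m / l * ((∫ x in Ω, u x ^ 2) + ∫ x in Ω, (fderiv ℝ u x v) ^ 2) := by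
  have cu : Continuous u := hu.continuous
  have cf : Continuous (fderiv ℝ u) := hu.continuous_fderiv one_ne_zero
  have du : Differentiable ℝ u := hu.differentiable one_ne_zero
  have cfv : Continuous fun x => fderiv ℝ u x v := cf.clm_apply continuous_const
  have io : ∀ g : EuclideanSpace ℝ (Fin (k+2)) → ℝ, Continuous g → ∀ S, IsBounded S → IntegrableOn g S := by
    intro g hg S hS
    exact (hg.continuousOn.integrableOn_compact hS.isCompact_closure).mono_set subset_closure
  obtain ⟨v', hv', hvv⟩ := exists_perp v
  obtain ⟨Φ, hΦ, -, -, hΦs⟩ := fub_map v v' hv hv' hvv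
  set G : EuclideanSpace ℝ (Fin (k+2)) → ℝ := fun x => u x ^ 2 + (fderiv ℝ u x v) ^ 2 with hG
  have cG : Continuous G := by simp only [hG]; fun_prop
  have tr : ∀ (A : Set (EuclideanSpace ℝ (Fin (k+2)))) (g : EuclideanSpace ℝ (Fin (k+2)) → ℝ), MeasurableSet A → Continuous g →
      ∫⁻ x in A, ENNReal.ofReal (g x) =
        ∫⁻ y, ∫⁻ s, A.indicator (fun x => ENNReal.ofReal (g x)) (Φ (s, y)) := by
    intro A g hA hg
    have mg : Measurable (A.indicator fun x => ENNReal.ofReal (g x)) :=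
      (ENNReal.measurable_ofReal.comp hg.measurable).indicator hA
    rw [← lintegral_indicator hA, ← hΦ.lintegral_comp mg, Measure.volume_eq_prod, lintegral_prod_symm']
    exact mg.comp Φ.continuous.measurable
  have per : ∀ y, ∫⁻ s, S.indicator (fun x => ENNReal.ofReal (u x ^ 2)) (Φ (s, y)) ≤
      ENNReal.ofReal (2 * m / l) * ∫⁻ s, Ω.indicator (fun x => ENNReal.ofReal (G x)) (Φ (s, y)) := by
    intro y
    set W := ∫⁻ s, Ω.indicator (fun x => ENNReal.ofReal (G x)) (Φ (s, y)) with hW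
    have hline : ∀ s, Φ (s, y) = Φ (0, y) + s • v := by intro s; rw [hΦs s y]; exact add_comm _ _
    have hder : ∀ s, HasDerivAt (fun s => u (Φ (s, y))) (fderiv ℝ u (Φ (s, y)) v) s := by
      intro s
      have h1 : HasDerivAt (fun s : ℝ => Φ (s, y)) v s := by
        have : (fun s : ℝ => Φ (s, y)) = fun s => Φ (0, y) + s • v := funext hline
        rw [this]
        simpa using ((hasDerivAt_id s).smul_const v).const_add (Φ (0, y))
      exact (du _).hasFDerivAt.comp_hasDerivAt s h1
    have cder : Continuous fun s : ℝ => fderiv ℝ u (Φ (s, y)) v :=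
      cfv.comp (Φ.continuous.comp (by fun_prop))
    have cGs : Continuous fun s : ℝ => G (Φ (s, y)) := cG.comp (Φ.continuous.comp (by fun_prop))
    have pb : ∀ s, S.indicator (fun x => ENNReal.ofReal (u x ^ 2)) (Φ (s, y)) ≤
        {s : ℝ | Φ (0, y) + s • v ∈ S}.indicator (fun _ => ENNReal.ofReal (2 / l) * W) s := by
      intro s
      by_cases h : Φ (s, y) ∈ S
      · have h' : s ∈ {s : ℝ | Φ (0, y) + s • v ∈ S} := by
          show _ ∈ S
          rw [← hline]; exact h
        rw [indicator_of_mem h, indicator_of_mem h']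
        have h1 := point_bound _ _ hder cder s l hl hl1
        refine (ENNReal.ofReal_le_ofReal h1).trans ?_
        rw [ENNReal.ofReal_mul (by positivity)]
        gcongr
        rw [intervalIntegral.integral_of_le (by linarith),
          ofReal_integral_eq_lintegral_ofReal
            ((cGs.continuousOn.integrableOn_Icc (a := s) (b := s + l)).mono_set Ioc_subset_Icc_self)
            (Eventually.of_forall fun x => by positivity), ← lintegral_indicator measurableSet_Ioc]
        apply lintegral_mono
        intro x
        by_cases hx : x ∈ Ioc s (s + l)
        · have : Φ (x, y) ∈ Ω := by
            have := hS _ h (x - s) (by linarith [hx.1]) (by linarith [hx.2])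
            rw [hline, add_assoc, ← add_smul] at this
            rw [hline]
            convert this using 3
            ring
          simp only [indicator_of_mem hx, indicator_of_mem this]
          exact le_rfl
        · simp only [indicator_of_notMem hx]
          exact zero_le
      · rw [indicator_of_notMem h]; exact zero_le
    have mS : MeasurableSet {s : ℝ | Φ (0, y) + s • v ∈ S} :=
      hSm.preimage (by fun_prop : Continuous fun s : ℝ => Φ (0, y) + s • v).measurable
    refine (lintegral_mono pb).trans ?_
    rw [lintegral_indicator mS, setLIntegral_const]
    calc ENNReal.ofReal (2 / l) * W * volume {s : ℝ | Φ (0, y) + s • v ∈ S}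
        ≤ ENNReal.ofReal (2 / l) * W * ENNReal.ofReal m := by gcongr; exact hk _
      _ = ENNReal.ofReal (2 / l) * ENNReal.ofReal m * W := by ring
      _ = _ := by rw [← ENNReal.ofReal_mul (by positivity)]; congr 2; ring
  have fin : ∫⁻ x in S, ENNReal.ofReal (u x ^ 2) ≤ ENNReal.ofReal (2 * m / l) * ∫⁻ x in Ω, ENNReal.ofReal (G x) := by
    rw [tr S _ hSm (by fun_prop), tr Ω G ho.measurableSet cG, ← lintegral_const_mul']
    · exact lintegral_mono per
    · exact ENNReal.ofReal_ne_top
  have iS := io (fun x => u x ^ 2) (by fun_prop) S (hb.subset hSΩ)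
  have iG := io G cG Ω hb
  rw [← ofReal_integral_eq_lintegral_ofReal iS (Eventually.of_forall fun x => by positivity),
    ← ofReal_integral_eq_lintegral_ofReal iG (Eventually.of_forall fun x => by positivity),
    ← ENNReal.ofReal_mul (by positivity), ENNReal.ofReal_le_ofReal_iff] at fin
  · refine fin.trans (le_of_eq ?_)
    rw [← integral_add (io _ (by fun_prop) Ω hb) (io _ (by fun_prop) Ω hb)]
  · have : 0 ≤ ∫ x in Ω, G x := integral_nonneg fun x => by positivity
    positivity

end HelpersI1

section HelpersD1
open scoped Pointwise

theorem hyper_null {N : ℕ} (n : EuclideanSpace ℝ (Fin N)) (hn : n ≠ 0) (c : ℝ) :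
    volume {y : EuclideanSpace ℝ (Fin N) | ⟪y, n⟫ = c} = 0 := by
  rcases Set.eq_empty_or_nonempty {y : EuclideanSpace ℝ (Fin N) | ⟪y, n⟫ = c} with h | ⟨y0, hy0⟩
  · rw [h]; simp
  have h1 : volume ((ℝ ∙ n)ᗮ : Set (EuclideanSpace ℝ (Fin N))) = 0 := by
    apply Measure.addHaar_submodule
    intro h
    have : n ∈ (ℝ ∙ n)ᗮ := by rw [h]; trivial
    rw [Submodule.mem_orthogonal_singleton_iff_inner_right] at this
    exact hn (inner_self_eq_zero.1 this)
  have h2 : {y : EuclideanSpace ℝ (Fin N) | ⟪y, n⟫ = c} = (fun y => -y0 + y) ⁻¹' ((ℝ ∙ n)ᗮ : Set (EuclideanSpace ℝ (Fin N))) := by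
    ext y
    have hy0' : ⟪y0, n⟫ = c := hy0
    simp only [mem_preimage, SetLike.mem_coe, Submodule.mem_orthogonal_singleton_iff_inner_left, inner_add_left,
      inner_neg_left, hy0']
    show ⟪y, n⟫ = c ↔ _
    constructor <;> intro h <;> linarith
  rw [h2, measure_preimage_add, h1]

theorem cut_lemma {N : ℕ} (K : Set (EuclideanSpace ℝ (Fin N))) (ho : IsOpen K)
    (u : EuclideanSpace ℝ (Fin N) → ℝ) (hu : IntegrableOn u K) (h0 : ∫ x in K, u x = 0)
    (e1 e2 z : EuclideanSpace ℝ (Fin N)) (h1 : ‖e1‖ = 1) (h2 : ‖e2‖ = 1) (h12 : ⟪e1, e2⟫ = 0) :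
    ∃ a b : ℝ, a ^ 2 + b ^ 2 = 1 ∧ ∫ x in K ∩ {y | 0 < ⟪y - z, a • e1 + b • e2⟫}, u x = 0 := by
  set n : ℝ → EuclideanSpace ℝ (Fin N) := fun t => cos t • e1 + sin t • e2 with hn
  have nn : ∀ t, n t ≠ 0 := by
    intro t h
    have : ⟪n t, n t⟫ = 1 := by
      simp only [hn, inner_add_left, inner_add_right, inner_smul_left, inner_smul_right, conj_trivial,
        real_inner_self_eq_norm_sq, h1, h2, h12, real_inner_comm e1 e2]
      nlinarith [sin_sq_add_cos_sq t]
    rw [h] at this; simp at this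
  have cn : Continuous n := by simp only [hn]; fun_prop
  set S : ℝ → Set (EuclideanSpace ℝ (Fin N)) := fun t => {y | 0 < ⟪y - z, n t⟫} with hS
  have oS : ∀ t, IsOpen (S t) := by
    intro t
    exact isOpen_lt continuous_const (by fun_prop)
  set Ψ : ℝ → ℝ := fun t => ∫ x in K, (S t).indicator u x with hΨ
  have null : ∀ t, ∀ᵐ x ∂(volume.restrict K), ⟪x - z, n t⟫ ≠ 0 := by
    intro t
    apply ae_restrict_of_ae
    rw [ae_iff]
    refine measure_mono_null ?_ (hyper_null (n t) (nn t) ⟪z, n t⟫)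
    intro x hx
    have : ⟪x - z, n t⟫ = 0 := by
      by_contra h
      exact hx h
    show ⟪x, n t⟫ = ⟪z, n t⟫
    rw [inner_sub_left] at this; linarith
  have cΨ : Continuous Ψ := by
    rw [continuous_iff_continuousAt]
    intro t
    refine continuousAt_of_dominated (bound := fun x => ‖u x‖) ?_ ?_ hu.norm ?_
    · exact Eventually.of_forall fun s => hu.aestronglyMeasurable.indicator (oS s).measurableSet
    · exact Eventually.of_forall fun s => Eventually.of_forall fun x => norm_indicator_le_norm_self _ _
    · filter_upwards [null t] with x hx
      have cin : Continuous fun s => ⟪x - z, n s⟫ := by fun_prop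
      rcases lt_or_gt_of_ne hx with h | h
      · have : (fun s => (S s).indicator u x) =ᶠ[nhds t] fun _ => 0 := by
          filter_upwards [(isOpen_lt cin continuous_const).mem_nhds h] with s hs
          apply indicator_of_notMem
          intro h'
          exact lt_asymm hs h'
        exact (continuousAt_const).congr this.symm
      · have : (fun s => (S s).indicator u x) =ᶠ[nhds t] fun _ => u x := by
          filter_upwards [(isOpen_lt continuous_const cin).mem_nhds h] with s hs
          exact indicator_of_mem (s := S s) hs _
        exact (continuousAt_const).congr this.symm
  have hneg : Ψ π = - Ψ 0 := by
    have : Ψ π + Ψ 0 = ∫ x in K, u x := by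
      rw [hΨ]
      dsimp only
      rw [← integral_add (hu.indicator (oS _).measurableSet) (hu.indicator (oS _).measurableSet)]
      apply integral_congr_ae
      filter_upwards [null 0] with x hx
      have e : ⟪x - z, n π⟫ = - ⟪x - z, n 0⟫ := by simp [hn]
      rcases lt_or_gt_of_ne hx with h | h
      · have m1 : x ∈ S π := by show 0 < ⟪x - z, n π⟫; rw [e]; linarith
        have m2 : x ∉ S 0 := fun h' => lt_asymm h h'
        rw [indicator_of_mem m1, indicator_of_notMem m2, add_zero]
      · have m1 : x ∉ S π := by
          intro h'
          have : 0 < ⟪x - z, n π⟫ := h'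
          rw [e] at this; linarith
        have m2 : x ∈ S 0 := h
        rw [indicator_of_mem m2, indicator_of_notMem m1, zero_add]
    linarith
  have hz : ∃ t, Ψ t = 0 := by
    rcases le_total (Ψ 0) 0 with h | h
    · obtain ⟨t, -, ht⟩ := intermediate_value_Icc pi_pos.le cΨ.continuousOn (by constructor <;> linarith : (0:ℝ) ∈ Icc (Ψ 0) (Ψ π))
      exact ⟨t, ht⟩
    · obtain ⟨t, -, ht⟩ := intermediate_value_Icc' pi_pos.le cΨ.continuousOn (by constructor <;> linarith : (0:ℝ) ∈ Icc (Ψ π) (Ψ 0))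
      exact ⟨t, ht⟩
  obtain ⟨t, ht⟩ := hz
  refine ⟨cos t, sin t, by nlinarith [sin_sq_add_cos_sq t], ?_⟩
  simp only [hΨ] at ht
  rw [setIntegral_indicator (oS t).measurableSet] at ht
  exact ht

/-- finite partition (up to null sets) into open convex cells with zero mean of `u` -/
def IsPart {N : ℕ} (u : EuclideanSpace ℝ (Fin N) → ℝ) (K0 : Set (EuclideanSpace ℝ (Fin N)))
    (P : Finset (Set (EuclideanSpace ℝ (Fin N)))) : Prop :=
  (∀ K ∈ P, IsOpen K ∧ Convex ℝ K ∧ K.Nonempty ∧ K ⊆ K0 ∧ ∫ x in K, u x = 0) ∧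
  (∀ K ∈ P, ∀ K' ∈ P, K ≠ K' → Disjoint K K') ∧ volume (K0 \ ⋃ K ∈ P, K) = 0

open Classical in
theorem IsPart.refine {N : ℕ} {u : EuclideanSpace ℝ (Fin N) → ℝ} {K0 : Set (EuclideanSpace ℝ (Fin N))}
    {P : Finset (Set (EuclideanSpace ℝ (Fin N)))} (hP : IsPart u K0 P)
    (Q : Set (EuclideanSpace ℝ (Fin N)) → Finset (Set (EuclideanSpace ℝ (Fin N))))
    (hQ : ∀ K ∈ P, IsPart u K (Q K)) : IsPart u K0 (P.biUnion Q) := by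
  obtain ⟨p1, p2, p3⟩ := hP
  refine ⟨?_, ?_, ?_⟩
  · intro K hK
    obtain ⟨L, hL, hKL⟩ := Finset.mem_biUnion.1 hK
    obtain ⟨a1, a2, a3, a4, a5⟩ := (hQ L hL).1 K hKL
    exact ⟨a1, a2, a3, a4.trans (p1 L hL).2.2.2.1, a5⟩
  · intro K hK K' hK' hne
    obtain ⟨L, hL, hKL⟩ := Finset.mem_biUnion.1 hK
    obtain ⟨L', hL', hKL'⟩ := Finset.mem_biUnion.1 hK'
    by_cases h : L = L'
    · subst h
      exact (hQ L hL).2.1 K hKL K' hKL' hne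
    · exact (p2 L hL L' hL' h).mono ((hQ L hL).1 K hKL).2.2.2.1 ((hQ L' hL').1 K' hKL').2.2.2.1
  · have : K0 \ ⋃ K ∈ P.biUnion Q, K ⊆ (K0 \ ⋃ K ∈ P, K) ∪ ⋃ K ∈ P, (K \ ⋃ K' ∈ Q K, K') := by
      intro x hx
      by_cases h : x ∈ ⋃ K ∈ P, K
      · right
        obtain ⟨K, hK, hxK⟩ := mem_iUnion₂.1 h
        refine mem_iUnion₂.2 ⟨K, hK, hxK, ?_⟩
        intro h'
        obtain ⟨K', hK', hxK'⟩ := mem_iUnion₂.1 h'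
        exact hx.2 (mem_iUnion₂.2 ⟨K', Finset.mem_biUnion.2 ⟨K, hK, hK'⟩, hxK'⟩)
      · left; exact ⟨hx.1, h⟩
    refine measure_mono_null this (measure_union_null p3 ?_)
    refine (measure_biUnion_null_iff P.countable_toSet).2 ?_
    intro K hK
    exact (hQ K hK).2.2

theorem IsPart.self {N : ℕ} {u : EuclideanSpace ℝ (Fin N) → ℝ} {K0 : Set (EuclideanSpace ℝ (Fin N))}
    (ho : IsOpen K0) (hc : Convex ℝ K0) (hne : K0.Nonempty) (h0 : ∫ x in K0, u x = 0) : IsPart u K0 {K0} := by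
  refine ⟨?_, ?_, ?_⟩
  · intro K hK
    rw [Finset.mem_singleton] at hK
    subst hK
    exact ⟨ho, hc, hne, subset_rfl, h0⟩
  · intro K hK K' hK' hne
    rw [Finset.mem_singleton] at hK hK'
    exact absurd (hK.trans hK'.symm) hne
  · simp

/-- separation of a point from a cell by a planar direction -/
def PSep {N : ℕ} (e1 e2 z : EuclideanSpace ℝ (Fin N)) (K : Set (EuclideanSpace ℝ (Fin N))) : Prop :=
  ∃ a b : ℝ, a ^ 2 + b ^ 2 = 1 ∧ ∀ x ∈ K, 0 < ⟪x - z, a • e1 + b • e2⟫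

/-- saturation -/
def PSat {N : ℕ} (e1 e2 : EuclideanSpace ℝ (Fin N)) (K0 K : Set (EuclideanSpace ℝ (Fin N))) : Prop :=
  ∀ x ∈ K, ∀ y ∈ K0, ⟪x - y, e1⟫ = 0 → ⟪x - y, e2⟫ = 0 → y ∈ K

open Classical in
theorem cut_once {N : ℕ} (K : Set (EuclideanSpace ℝ (Fin N))) (ho : IsOpen K) (hc : Convex ℝ K)
    (u : EuclideanSpace ℝ (Fin N) → ℝ) (hu : IntegrableOn u K) (h0 : ∫ x in K, u x = 0)
    (e1 e2 z : EuclideanSpace ℝ (Fin N)) (h1 : ‖e1‖ = 1) (h2 : ‖e2‖ = 1) (h12 : ⟪e1, e2⟫ = 0) :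
    ∃ P, IsPart u K P ∧ ∀ K' ∈ P, PSep e1 e2 z K' ∧ PSat e1 e2 K K' := by
  obtain ⟨a, b, hab, hIntg⟩ := cut_lemma K ho u hu h0 e1 e2 z h1 h2 h12
  set n := a • e1 + b • e2 with hn
  have nn : n ≠ 0 := by
    intro h
    have : ⟪n, n⟫ = 1 := by
      simp only [hn, inner_add_left, inner_add_right, inner_smul_left, inner_smul_right, conj_trivial,
        real_inner_self_eq_norm_sq, h1, h2, h12, real_inner_comm e1 e2]
      nlinarith only [hab]
    rw [h] at this; simp at this
  set A := K ∩ {y | 0 < ⟪y - z, n⟫} with hA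
  set B := K ∩ {y | ⟪y - z, n⟫ < 0} with hB
  have oA : IsOpen A := ho.inter (isOpen_lt continuous_const (by fun_prop))
  have oB : IsOpen B := ho.inter (isOpen_lt (by fun_prop) continuous_const)
  have cA : Convex ℝ A := by
    refine hc.inter ?_
    intro x hx y hy s t hs ht hst
    have hx' : 0 < ⟪x - z, n⟫ := hx
    have hy' : 0 < ⟪y - z, n⟫ := hy
    show 0 < ⟪s • x + t • y - z, n⟫
    have e : s • x + t • y - z = s • (x - z) + t • (y - z) := by
      have : s = 1 - t := by linarith
      rw [this]; module
    rw [e, inner_add_left, inner_smul_left, inner_smul_left, conj_trivial, conj_trivial]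
    rcases eq_or_lt_of_le hs with h | h
    · have : t = 1 := by linarith
      rw [← h, this]; linarith
    · positivity
  have cB : Convex ℝ B := by
    refine hc.inter ?_
    intro x hx y hy s t hs ht hst
    have hx' : ⟪x - z, n⟫ < 0 := hx
    have hy' : ⟪y - z, n⟫ < 0 := hy
    show ⟪s • x + t • y - z, n⟫ < 0
    have e : s • x + t • y - z = s • (x - z) + t • (y - z) := by
      have : s = 1 - t := by linarith
      rw [this]; module
    rw [e, inner_add_left, inner_smul_left, inner_smul_left, conj_trivial, conj_trivial]
    rcases eq_or_lt_of_le hs with h | h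
    · have : t = 1 := by linarith
      rw [← h, this]; linarith
    · nlinarith only [mul_pos h (neg_pos.2 hx'), mul_nonneg ht (neg_pos.2 hy').le]
  have dAB : Disjoint A B := by
    rw [Set.disjoint_left]
    intro x hx hx'
    have g1 : 0 < ⟪x - z, n⟫ := hx.2
    have g2 : ⟪x - z, n⟫ < 0 := hx'.2
    exact lt_asymm g1 g2
  have nul : volume (K \ (A ∪ B)) = 0 := by
    refine measure_mono_null ?_ (hyper_null n nn ⟪z, n⟫)
    intro x hx
    have h3 : ⟪x - z, n⟫ = 0 := by
      by_contra h
      rcases lt_or_gt_of_ne h with h | h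
      · exact hx.2 (Or.inr ⟨hx.1, h⟩)
      · exact hx.2 (Or.inl ⟨hx.1, h⟩)
    show ⟪x, n⟫ = ⟪z, n⟫
    rw [inner_sub_left] at h3; linarith
  have intB : ∫ x in B, u x = 0 := by
    have sAB : A ∪ B ⊆ K := union_subset inter_subset_left inter_subset_left
    have e : ∫ x in K, u x = ∫ x in A ∪ B, u x := by
      apply setIntegral_congr_set
      exact (ae_eq_set.2 ⟨nul, by rw [sdiff_eq_empty.2 sAB]; simp⟩)
    rw [setIntegral_union dAB oB.measurableSet (hu.mono_set inter_subset_left) (hu.mono_set inter_subset_left), h0, hIntg] at e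
    linarith
  refine ⟨({A, B} : Finset _).filter fun S => S.Nonempty, ⟨?_, ?_, ?_⟩, ?_⟩
  · intro K' hK'
    rw [Finset.mem_filter, Finset.mem_insert, Finset.mem_singleton] at hK'
    obtain ⟨rfl | rfl, hne⟩ := hK'
    · exact ⟨oA, cA, hne, inter_subset_left, hIntg⟩
    · exact ⟨oB, cB, hne, inter_subset_left, intB⟩
  · intro K' hK' K'' hK'' hne
    rw [Finset.mem_filter, Finset.mem_insert, Finset.mem_singleton] at hK' hK''
    obtain ⟨rfl | rfl, -⟩ := hK' <;> obtain ⟨rfl | rfl, -⟩ := hK''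
    · exact absurd rfl hne
    · exact dAB
    · exact dAB.symm
    · exact absurd rfl hne
  · refine measure_mono_null ?_ nul
    rintro x ⟨hx, hx'⟩
    refine ⟨hx, ?_⟩
    intro h
    apply hx'
    rcases h with h | h
    · exact mem_iUnion₂.2 ⟨A, by simp [show A.Nonempty from ⟨x, h⟩], h⟩
    · exact mem_iUnion₂.2 ⟨B, by simp [show B.Nonempty from ⟨x, h⟩], h⟩
  · have sat : ∀ x y : EuclideanSpace ℝ (Fin N), ⟪x - y, e1⟫ = 0 → ⟪x - y, e2⟫ = 0 → ⟪y - z, n⟫ = ⟪x - z, n⟫ := by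
      intro x y g1 g2
      have : ⟪x - y, n⟫ = 0 := by
        rw [hn, inner_add_right, inner_smul_right, inner_smul_right, g1, g2]; simp
      have e : x - z = (x - y) + (y - z) := by abel
      rw [e, inner_add_left, this, zero_add]
    intro K' hK'
    rw [Finset.mem_filter, Finset.mem_insert, Finset.mem_singleton] at hK'
    obtain ⟨rfl | rfl, hne⟩ := hK'
    · refine ⟨⟨a, b, hab, fun x hx => hx.2⟩, ?_⟩
      intro x hx y hy g1 g2
      refine ⟨hy, ?_⟩
      show 0 < ⟪y - z, n⟫
      rw [sat x y g1 g2]; exact hx.2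
    · refine ⟨⟨-a, -b, by nlinarith only [hab], fun x hx => ?_⟩, ?_⟩
      · have : (-a) • e1 + (-b) • e2 = -n := by rw [hn]; module
        rw [this, inner_neg_right]
        have h5 : ⟪x - z, n⟫ < 0 := hx.2
        linarith
      · intro x hx y hy g1 g2
        refine ⟨hy, ?_⟩
        show ⟪y - z, n⟫ < 0
        rw [sat x y g1 g2]; exact hx.2

end HelpersD1

section HelpersD2
open scoped Pointwise

theorem cut_many {N : ℕ} (K0 : Set (EuclideanSpace ℝ (Fin N))) (ho : IsOpen K0) (hc : Convex ℝ K0) (hne : K0.Nonempty)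
    (u : EuclideanSpace ℝ (Fin N) → ℝ) (hu : IntegrableOn u K0) (h0 : ∫ x in K0, u x = 0)
    (e1 e2 : EuclideanSpace ℝ (Fin N)) (h1 : ‖e1‖ = 1) (h2 : ‖e2‖ = 1) (h12 : ⟪e1, e2⟫ = 0)
    (Z : List (EuclideanSpace ℝ (Fin N))) :
    ∃ P, IsPart u K0 P ∧ ∀ K ∈ P, (∀ z ∈ Z, PSep e1 e2 z K) ∧ PSat e1 e2 K0 K := by
  classical
  induction Z with
  | nil =>
    refine ⟨{K0}, IsPart.self ho hc hne h0, ?_⟩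
    intro K hK
    rw [Finset.mem_singleton] at hK
    subst hK
    exact ⟨by simp, fun x _ y hy _ _ => hy⟩
  | cons z Z ih =>
    obtain ⟨P, hP, hP2⟩ := ih
    have hex : ∀ K, ∃ Q, K ∈ P → IsPart u K Q ∧ ∀ K' ∈ Q, PSep e1 e2 z K' ∧ PSat e1 e2 K K' := by
      intro K
      by_cases hK : K ∈ P
      · obtain ⟨a1, a2, a3, a4, a5⟩ := hP.1 K hK
        obtain ⟨Q, hQ⟩ := cut_once K a1 a2 u (hu.mono_set a4) a5 e1 e2 z h1 h2 h12
        exact ⟨Q, fun _ => hQ⟩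
      · exact ⟨∅, fun h => absurd h hK⟩
    choose Q hQ using hex
    refine ⟨P.biUnion Q, hP.refine Q fun K hK => (hQ K hK).1, ?_⟩
    intro K' hK'
    obtain ⟨K, hK, hKK⟩ := Finset.mem_biUnion.1 hK'
    obtain ⟨q1, q2⟩ := hQ K hK
    have sub := (q1.1 K' hKK).2.2.2.1
    obtain ⟨s1, s2⟩ := q2 K' hKK
    obtain ⟨t1, t2⟩ := hP2 K hK
    refine ⟨?_, ?_⟩
    · intro z' hz'
      rcases List.mem_cons.1 hz' with rfl | h
      · exact s1
      · obtain ⟨a, b, hab, h⟩ := t1 z' h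
        exact ⟨a, b, hab, fun x hx => h x (sub hx)⟩
    · intro x hx y hy g1 g2
      exact s2 x hx y (t2 x (sub hx) y hy g1 g2) g1 g2

/-- coordinates version of the strip estimate -/
theorem strip_coord (b r X1 X2 Y1 Y2 a c d H : ℝ) (hr : 0 ≤ r) (hac : a ^ 2 + c ^ 2 = 1) (hb : 9 * r ≤ b) (hb0 : 0 < b)
    (hY : Y1 ^ 2 + Y2 ^ 2 = b ^ 2) (hX : X1 ^ 2 + X2 ^ 2 ≤ d ^ 2) (hd0 : 0 ≤ d) (hd : 9 * d ≤ 10 * b)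
    (h1 : |a * Y1 + c * Y2| ≤ 3 * r) (h2 : |a * X1 + c * X2| ≤ 3 * r)
    (hH : H = (-Y2) / b * X1 + Y1 / b * X2) : |H| ≤ 10 * r := by
  set p := (a * Y1 + c * Y2) / b with hp
  set q := (c * Y1 - a * Y2) / b with hq
  set T := (Y1 * X1 + Y2 * X2) / b with hT
  have pq : p ^ 2 + q ^ 2 = 1 := by
    have : p ^ 2 + q ^ 2 = (a ^ 2 + c ^ 2) * (Y1 ^ 2 + Y2 ^ 2) / b ^ 2 := by
      rw [hp, hq]; field_simp; ring
    rw [this, hac, hY]; field_simp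
  have TH : T ^ 2 + H ^ 2 = X1 ^ 2 + X2 ^ 2 := by
    have : T ^ 2 + H ^ 2 = (X1 ^ 2 + X2 ^ 2) * (Y1 ^ 2 + Y2 ^ 2) / b ^ 2 := by
      rw [hT, hH]; field_simp; ring
    rw [this, hY]; field_simp
  have key : a * X1 + c * X2 = p * T + q * H := by
    have : p * T + q * H = (a * X1 + c * X2) * (Y1 ^ 2 + Y2 ^ 2) / b ^ 2 := by
      rw [hp, hT, hq, hH]; field_simp; ring
    rw [this, hY]; field_simp
  have hpb : |p| * b ≤ 3 * r := by
    rw [hp, abs_div, abs_of_pos hb0, div_mul_cancel₀ _ hb0.ne']; exact h1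
  have hp3 : |p| ≤ 1 / 3 := by
    by_contra hcon
    push Not at hcon
    nlinarith only [hcon, hpb, hb, hb0]
  have hTd : |T| ≤ d := by
    apply abs_le_of_sq_le_sq _ hd0
    nlinarith only [TH, hX, sq_nonneg H]
  have hq3 : 9 / 10 ≤ |q| := by
    have e1 : |p| ^ 2 ≤ (1 / 3) ^ 2 := pow_le_pow_left₀ (abs_nonneg _) hp3 2
    rw [sq_abs] at e1
    have e2 : |q| ^ 2 = q ^ 2 := sq_abs q
    by_contra hcon
    push Not at hcon
    nlinarith only [e1, e2, pq, hcon, abs_nonneg q]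
  have h3 : |p * T| ≤ 4 * r := by
    rw [abs_mul]
    have : |p| * |T| ≤ |p| * (10 / 9 * b) := by
      apply mul_le_mul_of_nonneg_left _ (abs_nonneg _); linarith
    linarith
  have h4 : |q * H| ≤ 7 * r := by
    have : q * H = (a * X1 + c * X2) - p * T := by linarith
    rw [this]
    refine (abs_sub _ _).trans ?_
    linarith
  rw [abs_mul] at h4
  nlinarith only [h4, hq3, abs_nonneg H, hr]

theorem strip_lemma {N : ℕ} (K : Set (EuclideanSpace ℝ (Fin N))) (hc : Convex ℝ K) (hb : IsBounded K)
    (e1 e2 : EuclideanSpace ℝ (Fin N)) (h1 : ‖e1‖ = 1) (h2 : ‖e2‖ = 1)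
    (Z : Set (EuclideanSpace ℝ (Fin N))) (r : ℝ) (hr : 0 < r) (hZ : ∀ x ∈ K, ∃ z ∈ Z, ‖x - z‖ ≤ r / 2)
    (hsep : ∀ z ∈ Z, PSep e1 e2 z K) :
    ∃ a b : ℝ, a ^ 2 + b ^ 2 = 1 ∧ ∀ x ∈ K, ∀ y ∈ K, |⟪x - y, a • e1 + b • e2⟫| ≤ 20 * r := by
  set D : Set ℝ := {t | ∃ x ∈ K, ∃ y ∈ K, t = √(⟪x - y, e1⟫ ^ 2 + ⟪x - y, e2⟫ ^ 2)} with hD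
  have abs_le : ∀ x : EuclideanSpace ℝ (Fin N), ∀ e, ‖e‖ = 1 → |⟪x, e⟫| ≤ ‖x‖ := by
    intro x e he
    have := abs_real_inner_le_norm x e
    rwa [he, mul_one] at this
  rcases K.eq_empty_or_nonempty with hem | ⟨x0, hx0⟩
  · subst hem; exact ⟨1, 0, by norm_num, by simp⟩
  have bD : BddAbove D := by
    obtain ⟨C, hC⟩ := hb.exists_norm_le
    refine ⟨√((2 * C) ^ 2 + (2 * C) ^ 2), ?_⟩
    rintro t ⟨x, hx, y, hy, rfl⟩
    apply Real.sqrt_le_sqrt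
    have : ‖x - y‖ ≤ 2 * C := (norm_sub_le _ _).trans (by linarith [hC x hx, hC y hy])
    have g1 := (abs_le (x - y) e1 h1).trans this
    have g2 := (abs_le (x - y) e2 h2).trans this
    have k1 : |⟪x - y, e1⟫| ^ 2 ≤ (2 * C) ^ 2 := pow_le_pow_left₀ (abs_nonneg _) g1 2
    have k2 : |⟪x - y, e2⟫| ^ 2 ≤ (2 * C) ^ 2 := pow_le_pow_left₀ (abs_nonneg _) g2 2
    rw [sq_abs] at k1 k2
    linarith
  have neD : D.Nonempty := ⟨_, x0, hx0, x0, hx0, rfl⟩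
  set d := sSup D with hd
  have dub : ∀ x ∈ K, ∀ y ∈ K, ⟪x - y, e1⟫ ^ 2 + ⟪x - y, e2⟫ ^ 2 ≤ d ^ 2 := by
    intro x hx y hy
    have := le_csSup bD ⟨x, hx, y, hy, rfl⟩
    have h3 := pow_le_pow_left₀ (Real.sqrt_nonneg _) this 2
    rwa [Real.sq_sqrt (by positivity)] at h3
  have d0 : 0 ≤ d := by
    have := le_csSup bD ⟨x0, hx0, x0, hx0, rfl⟩
    exact (Real.sqrt_nonneg _).trans this
  by_cases hsmall : d ≤ 20 * r
  · refine ⟨1, 0, by norm_num, ?_⟩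
    intro x hx y hy
    rw [one_smul, zero_smul, add_zero]
    refine le_trans ?_ hsmall
    apply abs_le_of_sq_le_sq _ d0
    nlinarith only [dub x hx y hy, sq_nonneg ⟪x - y, e2⟫]
  push Not at hsmall
  obtain ⟨t, ⟨q, hq, p, hp, rfl⟩, ht⟩ := exists_lt_of_lt_csSup neD (by linarith : 9 / 10 * d < sSup D)
  set Y1 := ⟪q - p, e1⟫ with hY1
  set Y2 := ⟪q - p, e2⟫ with hY2
  set b := √(Y1 ^ 2 + Y2 ^ 2) with hbdef
  have b0 : 0 < b := by linarith
  have hY : Y1 ^ 2 + Y2 ^ 2 = b ^ 2 := (Real.sq_sqrt (by positivity)).symm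
  have one : ∀ x ∈ K, |⟪x - p, (-Y2 / b) • e1 + (Y1 / b) • e2⟫| ≤ 10 * r := by
    intro x hx
    have hg : (1/3 : ℝ) • p + (1/3 : ℝ) • q + (1/3 : ℝ) • x ∈ K := by
      have h3 := hc hp hq (by norm_num : (0:ℝ) ≤ 1/2) (by norm_num : (0:ℝ) ≤ 1/2) (by norm_num)
      have := hc h3 hx (by norm_num : (0:ℝ) ≤ 2/3) (by norm_num : (0:ℝ) ≤ 1/3) (by norm_num)
      convert this using 1
      module
    set g := (1/3 : ℝ) • p + (1/3 : ℝ) • q + (1/3 : ℝ) • x with hgdef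
    obtain ⟨z, hz, hzr⟩ := hZ g hg
    obtain ⟨a, c, hac, hs⟩ := hsep z hz
    have gz : |⟪g - z, a • e1 + c • e2⟫| ≤ r := by
      rw [inner_add_right, inner_smul_right, inner_smul_right]
      have g1 := (abs_le (g - z) e1 h1).trans hzr
      have g2 := (abs_le (g - z) e2 h2).trans hzr
      have a1 : |a| ≤ 1 := abs_le_of_sq_le_sq (by nlinarith only [hac, sq_nonneg c]) zero_le_one
      have c1 : |c| ≤ 1 := abs_le_of_sq_le_sq (by nlinarith only [hac, sq_nonneg a]) zero_le_one
      refine (abs_add_le _ _).trans ?_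
      rw [abs_mul, abs_mul]
      nlinarith only [g1, g2, a1, c1, abs_nonneg a, abs_nonneg c, abs_nonneg ⟪g - z, e1⟫, abs_nonneg ⟪g - z, e2⟫]
    set n := a • e1 + c • e2 with hn
    have i1 := hs p hp
    have i2 := hs q hq
    have i3 := hs x hx
    have eg : ⟪g - z, n⟫ = (⟪p - z, n⟫ + ⟪q - z, n⟫ + ⟪x - z, n⟫) / 3 := by
      rw [hgdef]
      simp only [inner_sub_left, inner_add_left, inner_smul_left, conj_trivial]
      ring
    have gz' := (_root_.abs_le.1 gz).2
    have j1 : |⟪q - p, n⟫| ≤ 3 * r := by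
      have : ⟪q - p, n⟫ = ⟪q - z, n⟫ - ⟪p - z, n⟫ := by rw [← inner_sub_left]; congr 1; abel
      rw [this, _root_.abs_le]; constructor <;> linarith
    have j2 : |⟪x - p, n⟫| ≤ 3 * r := by
      have : ⟪x - p, n⟫ = ⟪x - z, n⟫ - ⟪p - z, n⟫ := by rw [← inner_sub_left]; congr 1; abel
      rw [this, _root_.abs_le]; constructor <;> linarith
    rw [hn, inner_add_right, inner_smul_right, inner_smul_right] at j1 j2
    refine strip_coord b r ⟪x - p, e1⟫ ⟪x - p, e2⟫ Y1 Y2 a c d _ hr.le hac (by linarith) b0 hY (dub x hx p hp) d0 (by linarith)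
      j1 j2 ?_
    rw [inner_add_right, inner_smul_right, inner_smul_right]
  refine ⟨-Y2 / b, Y1 / b, ?_, ?_⟩
  · rw [div_pow, div_pow, ← add_div, div_eq_one_iff_eq (by positivity)]; linarith
  · intro x hx y hy
    have e : x - y = (x - p) - (y - p) := by abel
    rw [e, inner_sub_left]
    refine (abs_sub _ _).trans ?_
    linarith [one x hx, one y hy]

theorem grid_lemma {N : ℕ} (K0 : Set (EuclideanSpace ℝ (Fin N))) (ho : IsOpen K0) (hc : Convex ℝ K0) (hne : K0.Nonempty)
    (hb : IsBounded K0) (u : EuclideanSpace ℝ (Fin N) → ℝ) (hu : IntegrableOn u K0) (h0 : ∫ x in K0, u x = 0)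
    (e1 e2 : EuclideanSpace ℝ (Fin N)) (h1 : ‖e1‖ = 1) (h2 : ‖e2‖ = 1) (h12 : ⟪e1, e2⟫ = 0) (ρ : ℝ) (hρ : 0 < ρ) :
    ∃ P, IsPart u K0 P ∧ ∀ K ∈ P, PSat e1 e2 K0 K ∧
      ∃ a b : ℝ, a ^ 2 + b ^ 2 = 1 ∧ ∀ x ∈ K, ∀ y ∈ K, |⟪x - y, a • e1 + b • e2⟫| ≤ ρ := by
  have tb : TotallyBounded K0 := hb.isCompact_closure.totallyBounded.subset subset_closure
  obtain ⟨t, tfin, ht⟩ := Metric.totallyBounded_iff.1 tb (ρ / 40) (by positivity)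
  obtain ⟨P, hP, hP2⟩ := cut_many K0 ho hc hne u hu h0 e1 e2 h1 h2 h12 tfin.toFinset.toList
  refine ⟨P, hP, fun K hK => ⟨(hP2 K hK).2, ?_⟩⟩
  obtain ⟨a1, a2, a3, a4, a5⟩ := hP.1 K hK
  obtain ⟨a, b, hab, h⟩ := strip_lemma K a2 (hb.subset a4) e1 e2 h1 h2 t (ρ / 20) (by positivity)
    (by
      intro x hx
      obtain ⟨z, hz, hxz⟩ := mem_iUnion₂.1 (ht (a4 hx))
      refine ⟨z, hz, ?_⟩
      rw [Metric.mem_ball, dist_eq_norm] at hxz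
      linarith)
    (fun z hz => (hP2 K hK).1 z (by simpa using hz))
  refine ⟨a, b, hab, fun x hx y hy => (h x hx y hy).trans (by linarith)⟩

end HelpersD2

section HelpersD3
open scoped Pointwise

/-- saturation along lines in direction `v` -/
def VSat {N : ℕ} (v : EuclideanSpace ℝ (Fin N)) (Ω K : Set (EuclideanSpace ℝ (Fin N))) : Prop :=
  ∀ x ∈ K, ∀ s : ℝ, x + s • v ∈ Ω → x + s • v ∈ K

theorem exists_unit_of_finrank_pos {N : ℕ} (W : Submodule ℝ (EuclideanSpace ℝ (Fin N))) (h : 0 < Module.finrank ℝ W) :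
    ∃ e ∈ W, ‖e‖ = 1 := by
  have : Nontrivial W := Module.finrank_pos_iff.1 h
  obtain ⟨⟨x, hx⟩, hne⟩ := exists_ne (0 : W)
  have hx0 : x ≠ 0 := fun h => hne (Subtype.ext h)
  refine ⟨‖x‖⁻¹ • x, W.smul_mem _ hx, ?_⟩
  rw [norm_smul, norm_inv, norm_norm, inv_mul_cancel₀ (norm_ne_zero_iff.2 hx0)]

theorem finrank_inf_orth {N : ℕ} (U : Submodule ℝ (EuclideanSpace ℝ (Fin N))) (n : EuclideanSpace ℝ (Fin N))
    (hn : n ∈ U) (h1 : n ≠ 0) : Module.finrank ℝ ((ℝ ∙ n)ᗮ ⊓ U : Submodule ℝ (EuclideanSpace ℝ (Fin N))) + 1 = Module.finrank ℝ U := by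
  have hle : (ℝ ∙ n) ≤ U := by rw [Submodule.span_singleton_le_iff_mem]; exact hn
  have := Submodule.finrank_add_inf_finrank_orthogonal hle
  rw [finrank_span_singleton h1] at this
  omega

theorem stage_one {N : ℕ} (Ω : Set (EuclideanSpace ℝ (Fin N))) (ho : IsOpen Ω) (hc : Convex ℝ Ω) (hne : Ω.Nonempty)
    (hb : IsBounded Ω) (u : EuclideanSpace ℝ (Fin N) → ℝ) (hu : IntegrableOn u Ω) (h0 : ∫ x in Ω, u x = 0)
    (v : EuclideanSpace ℝ (Fin N)) (hv : ‖v‖ = 1) (j : ℕ) (hj : j + 2 ≤ N) :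
    ∀ ε > 0, ∃ P, IsPart u Ω P ∧ ∀ K ∈ P, VSat v Ω K ∧ ∃ U : Submodule ℝ (EuclideanSpace ℝ (Fin N)),
      v ∈ U ∧ Module.finrank ℝ U = N - j ∧ ∀ x ∈ K, ∀ y ∈ K, ∃ d ∈ U, ‖x - y - d‖ ≤ ε := by
  classical
  induction j with
  | zero =>
    intro ε hε
    refine ⟨{Ω}, IsPart.self ho hc hne h0, ?_⟩
    intro K hK
    rw [Finset.mem_singleton] at hK
    subst hK
    refine ⟨fun x _ s h => h, ⊤, trivial, by simp, fun x _ y _ => ⟨x - y, trivial, by simpa using hε.le⟩⟩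
  | succ j ih =>
    intro ε hε
    obtain ⟨P, hP, hP2⟩ := ih (by omega) (ε / 3) (by positivity)
    have hex : ∀ K, ∃ Q, K ∈ P → IsPart u K Q ∧ ∀ K' ∈ Q, VSat v Ω K' ∧ ∃ U : Submodule ℝ (EuclideanSpace ℝ (Fin N)),
      v ∈ U ∧ Module.finrank ℝ U = N - (j + 1) ∧ ∀ x ∈ K', ∀ y ∈ K', ∃ d ∈ U, ‖x - y - d‖ ≤ ε := by
      intro K
      by_cases hK : K ∈ P
      · obtain ⟨a1, a2, a3, a4, a5⟩ := hP.1 K hK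
        obtain ⟨vs, U, hvU, hUr, hUt⟩ := hP2 K hK
        have v0 : v ≠ 0 := by intro h; rw [h] at hv; simp at hv
        have r1 := finrank_inf_orth U v hvU v0
        obtain ⟨e1, ⟨he1v, he1U⟩, he1⟩ := exists_unit_of_finrank_pos ((ℝ ∙ v)ᗮ ⊓ U) (by omega)
        have e10 : e1 ≠ 0 := by intro h; rw [h] at he1; simp at he1
        have r2 := finrank_inf_orth ((ℝ ∙ v)ᗮ ⊓ U) e1 ⟨he1v, he1U⟩ e10
        obtain ⟨e2, ⟨he12, he2v, he2U⟩, he2⟩ := exists_unit_of_finrank_pos ((ℝ ∙ e1)ᗮ ⊓ ((ℝ ∙ v)ᗮ ⊓ U)) (by omega)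
        have o12 : ⟪e1, e2⟫ = 0 := Submodule.mem_orthogonal_singleton_iff_inner_right.1 he12
        have ov1 : ⟪v, e1⟫ = 0 := Submodule.mem_orthogonal_singleton_iff_inner_right.1 he1v
        have ov2 : ⟪v, e2⟫ = 0 := Submodule.mem_orthogonal_singleton_iff_inner_right.1 he2v
        obtain ⟨Q, hQ, hQ2⟩ := grid_lemma K a1 a2 a3 (hb.subset a4) u (hu.mono_set a4) a5 e1 e2 he1 he2 o12 (ε / 3) (by positivity)
        refine ⟨Q, fun _ => ⟨hQ, ?_⟩⟩
        intro K' hK'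
        have sub := (hQ.1 K' hK').2.2.2.1
        obtain ⟨ps, a, b, hab, hthin⟩ := hQ2 K' hK'
        refine ⟨?_, ?_⟩
        · intro x hx s hs
          apply ps x hx _ (vs x (sub hx) s hs)
          · simp [inner_neg_left, inner_smul_left, ov1]
          · simp [inner_neg_left, inner_smul_left, ov2]
        · set n := a • e1 + b • e2 with hn
          have nn : ⟪n, n⟫ = 1 := by
            simp only [hn, inner_add_left, inner_add_right, inner_smul_left, inner_smul_right, conj_trivial,
              real_inner_self_eq_norm_sq, he1, he2, o12, real_inner_comm e1 e2]
            nlinarith only [hab]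
          have nnorm : ‖n‖ = 1 := by
            rw [real_inner_self_eq_norm_sq] at nn
            exact (pow_eq_one_iff_of_nonneg (norm_nonneg n) two_ne_zero).1 nn
          have n0 : n ≠ 0 := by intro h; rw [h] at nn; simp at nn
          have nU : n ∈ U := U.add_mem (U.smul_mem _ he1U) (U.smul_mem _ he2U)
          have r3 := finrank_inf_orth U n nU n0
          refine ⟨(ℝ ∙ n)ᗮ ⊓ U, ⟨?_, hvU⟩, by omega, ?_⟩
          · apply Submodule.mem_orthogonal_singleton_iff_inner_left.2
            rw [hn, inner_add_right, inner_smul_right, inner_smul_right, ov1, ov2]; simp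
          · intro x hx y hy
            obtain ⟨d, hdU, hd⟩ := hUt x (sub hx) y (sub hy)
            refine ⟨d - ⟪d, n⟫ • n, ⟨?_, U.sub_mem hdU (U.smul_mem _ nU)⟩, ?_⟩
            · apply Submodule.mem_orthogonal_singleton_iff_inner_left.2
              rw [inner_sub_left, inner_smul_left, nn]; simp
            · have h3 : |⟪d, n⟫| ≤ ε / 3 + ε / 3 := by
                have e : ⟪d, n⟫ = ⟪x - y, n⟫ - ⟪x - y - d, n⟫ := by rw [← inner_sub_left]; congr 1; abel
                rw [e]
                refine (abs_sub _ _).trans ?_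
                have h4 := abs_real_inner_le_norm (x - y - d) n
                rw [nnorm, mul_one] at h4
                linarith [hthin x hx y hy]
              have e : x - y - (d - ⟪d, n⟫ • n) = (x - y - d) + ⟪d, n⟫ • n := by abel
              rw [e]
              refine (norm_add_le _ _).trans ?_
              rw [norm_smul, nnorm, mul_one, Real.norm_eq_abs]
              linarith
      · exact ⟨∅, fun h => absurd h hK⟩
    choose Q hQ using hex
    refine ⟨P.biUnion Q, hP.refine Q fun K hK => (hQ K hK).1, ?_⟩
    intro K' hK'
    obtain ⟨K, hK, hKK⟩ := Finset.mem_biUnion.1 hK'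
    exact (hQ K hK).2 K' hKK

theorem partition_final {N : ℕ} (hN : 2 ≤ N) (Ω : Set (EuclideanSpace ℝ (Fin N))) (ho : IsOpen Ω) (hc : Convex ℝ Ω) (hne : Ω.Nonempty)
    (hb : IsBounded Ω) (u : EuclideanSpace ℝ (Fin N) → ℝ) (hu : IntegrableOn u Ω) (h0 : ∫ x in Ω, u x = 0)
    (v : EuclideanSpace ℝ (Fin N)) (hv : ‖v‖ = 1) (ρ : ℝ) (hρ : 0 < ρ) :
    ∃ (P : Finset (Set (EuclideanSpace ℝ (Fin N)))) (grp : Set (EuclideanSpace ℝ (Fin N)) → Set (EuclideanSpace ℝ (Fin N)))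
      (e' dir : Set (EuclideanSpace ℝ (Fin N)) → EuclideanSpace ℝ (Fin N)),
      IsPart u Ω P ∧
      (∀ K ∈ P, ∀ K' ∈ P, grp K ≠ grp K' → Disjoint (grp K) (grp K')) ∧
      ∀ K ∈ P, K ⊆ grp K ∧ grp K ⊆ Ω ∧ VSat v Ω (grp K) ∧ ‖e' (grp K)‖ = 1 ∧ ⟪e' (grp K), v⟫ = 0 ∧
        PSat (e' (grp K)) v (grp K) K ∧
        (∃ a b : ℝ, 0 ≤ a ∧ a ^ 2 + b ^ 2 = 1 ∧ dir K = a • e' (grp K) + b • v) ∧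
        ∀ x ∈ K, ∀ y ∈ K, ∃ t : ℝ, ‖x - y - t • dir K‖ ≤ ρ := by
  classical
  obtain ⟨G, hG, hG2⟩ := stage_one Ω ho hc hne hb u hu h0 v hv (N - 2) (by omega) (ρ / 3) (by positivity)
  have v0 : v ≠ 0 := by intro h; rw [h] at hv; simp at hv
  have hex : ∀ g, ∃ e' : EuclideanSpace ℝ (Fin N), g ∈ G → ‖e'‖ = 1 ∧ ⟪e', v⟫ = 0 ∧ ∀ x ∈ g, ∀ y ∈ g, ∃ s t : ℝ, ‖x - y - (s • e' + t • v)‖ ≤ ρ / 3 := by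
    intro g
    by_cases hg : g ∈ G
    · obtain ⟨-, U, hvU, hUr, hUt⟩ := hG2 g hg
      have r1 := finrank_inf_orth U v hvU v0
      obtain ⟨e, ⟨hev, heU⟩, he⟩ := exists_unit_of_finrank_pos ((ℝ ∙ v)ᗮ ⊓ U) (by omega)
      have e0 : e ≠ 0 := by intro h; rw [h] at he; simp at he
      have oev : ⟪e, v⟫ = 0 := Submodule.mem_orthogonal_singleton_iff_inner_left.1 hev
      have r2 := finrank_inf_orth ((ℝ ∙ v)ᗮ ⊓ U) e ⟨hev, heU⟩ e0
      have hbot : (ℝ ∙ e)ᗮ ⊓ ((ℝ ∙ v)ᗮ ⊓ U) = ⊥ := by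
        rw [← Submodule.finrank_eq_zero (R := ℝ)]; omega
      refine ⟨e, fun _ => ⟨he, oev, ?_⟩⟩
      intro x hx y hy
      obtain ⟨d, hdU, hd⟩ := hUt x hx y hy
      refine ⟨⟪d, e⟫, ⟪d, v⟫, ?_⟩
      have hz : d - (⟪d, e⟫ • e + ⟪d, v⟫ • v) ∈ (ℝ ∙ e)ᗮ ⊓ ((ℝ ∙ v)ᗮ ⊓ U) := by
        refine ⟨?_, ?_, U.sub_mem hdU (U.add_mem (U.smul_mem _ heU) (U.smul_mem _ hvU))⟩
        · apply Submodule.mem_orthogonal_singleton_iff_inner_left.2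
          rw [inner_sub_left, inner_add_left, inner_smul_left, inner_smul_left, real_inner_self_eq_norm_sq, he,
            real_inner_comm e v, oev]; simp
        · apply Submodule.mem_orthogonal_singleton_iff_inner_left.2
          rw [inner_sub_left, inner_add_left, inner_smul_left, inner_smul_left, real_inner_self_eq_norm_sq, hv,
            oev]; simp
      rw [hbot, Submodule.mem_bot, sub_eq_zero] at hz
      rw [← hz]; exact hd
    · exact ⟨0, fun h => absurd h hg⟩
  choose e' he' using hex
  have hex2 : ∀ g, ∃ Q, g ∈ G → IsPart u g Q ∧ ∀ K ∈ Q, PSat (e' g) v g K ∧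
      ∃ a b : ℝ, a ^ 2 + b ^ 2 = 1 ∧ ∀ x ∈ K, ∀ y ∈ K, |⟪x - y, a • e' g + b • v⟫| ≤ ρ / 3 := by
    intro g
    by_cases hg : g ∈ G
    · obtain ⟨a1, a2, a3, a4, a5⟩ := hG.1 g hg
      obtain ⟨n1, n2, -⟩ := he' g hg
      obtain ⟨Q, hQ⟩ := grid_lemma g a1 a2 a3 (hb.subset a4) u (hu.mono_set a4) a5 (e' g) v n1 hv n2 (ρ / 3) (by positivity)
      exact ⟨Q, fun _ => hQ⟩
    · exact ⟨∅, fun h => absurd h hg⟩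
  choose Q hQ using hex2
  have hex3 : ∀ K, ∃ g, K ∈ G.biUnion Q → g ∈ G ∧ K ∈ Q g := by
    intro K
    by_cases h : K ∈ G.biUnion Q
    · obtain ⟨g, hg, hK⟩ := Finset.mem_biUnion.1 h
      exact ⟨g, fun _ => ⟨hg, hK⟩⟩
    · exact ⟨∅, fun h' => absurd h' h⟩
  choose grp hgrp using hex3
  have hex4 : ∀ K, ∃ d, K ∈ G.biUnion Q → (∃ a b : ℝ, 0 ≤ a ∧ a ^ 2 + b ^ 2 = 1 ∧ d = a • e' (grp K) + b • v) ∧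
        ∀ x ∈ K, ∀ y ∈ K, ∃ t : ℝ, ‖x - y - t • d‖ ≤ ρ := by
    intro K
    by_cases h : K ∈ G.biUnion Q
    · obtain ⟨hg, hK⟩ := hgrp K h
      obtain ⟨n1, n2, n3⟩ := he' _ hg
      obtain ⟨-, a, b, hab, hthin⟩ := (hQ _ hg).2 K hK
      have sub := ((hQ _ hg).1.1 K hK).2.2.2.1
      set g := grp K
      set n := a • e' g + b • v with hn
      have nn : ⟪n, n⟫ = 1 := by
        simp only [hn, inner_add_left, inner_add_right, inner_smul_left, inner_smul_right, conj_trivial,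
          real_inner_self_eq_norm_sq, n1, hv, n2, real_inner_comm (e' g) v]
        nlinarith only [hab]
      have nnorm : ‖n‖ = 1 := by
        rw [real_inner_self_eq_norm_sq] at nn
        exact (pow_eq_one_iff_of_nonneg (norm_nonneg n) two_ne_zero).1 nn
      have main : ∀ x ∈ K, ∀ y ∈ K, ∃ t : ℝ, ‖x - y - t • ((-b) • e' g + a • v)‖ ≤ ρ := by
        intro x hx y hy
        obtain ⟨s, t, hst⟩ := n3 x (sub hx) y (sub hy)
        refine ⟨-b * s + a * t, ?_⟩
        have e1 : x - y - (-b * s + a * t) • ((-b) • e' g + a • v) =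
            (x - y - (s • e' g + t • v)) + (a * s + b * t) • n := by
          have h5 : b ^ 2 = 1 - a ^ 2 := by linarith
          have h6 : s • e' g + t • v = (-b * s + a * t) • ((-b) • e' g + a • v) + (a * s + b * t) • n := by
            have k1 : s = (-b * s + a * t) * (-b) + (a * s + b * t) * a := by linear_combination (-s) * hab
            have k2 : t = (-b * s + a * t) * a + (a * s + b * t) * b := by linear_combination (-t) * hab
            calc s • e' g + t • v = ((-b * s + a * t) * (-b) + (a * s + b * t) * a) • e' g +
                  ((-b * s + a * t) * a + (a * s + b * t) * b) • v := by rw [← k1, ← k2]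
              _ = _ := by rw [hn]; module
          rw [h6]; abel
        have e2 : a * s + b * t = ⟪x - y, n⟫ - ⟪x - y - (s • e' g + t • v), n⟫ := by
          rw [← inner_sub_left]
          have : x - y - (x - y - (s • e' g + t • v)) = s • e' g + t • v := by abel
          rw [this]
          simp only [hn, inner_add_left, inner_add_right, inner_smul_left, inner_smul_right, conj_trivial,
            real_inner_self_eq_norm_sq, n1, hv, n2, real_inner_comm (e' g) v]
          ring
        have h4 := abs_real_inner_le_norm (x - y - (s • e' g + t • v)) n
        rw [nnorm, mul_one] at h4
        have e3 : |a * s + b * t| ≤ ρ / 3 + ρ / 3 := by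
          rw [e2]
          refine (abs_sub _ _).trans ?_
          linarith [hthin x hx y hy]
        rw [e1]
        refine (norm_add_le _ _).trans ?_
        rw [norm_smul, nnorm, mul_one, Real.norm_eq_abs]
        linarith
      rcases le_total 0 b with hb0 | hb0
      · refine ⟨b • e' g + (-a) • v, fun _ => ⟨⟨b, -a, hb0, by nlinarith only [hab], rfl⟩, ?_⟩⟩
        intro x hx y hy
        obtain ⟨t, ht⟩ := main x hx y hy
        refine ⟨-t, ?_⟩
        convert ht using 2
        module
      · exact ⟨(-b) • e' g + a • v, fun _ => ⟨⟨-b, a, by linarith, by nlinarith only [hab], rfl⟩, main⟩⟩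
    · exact ⟨0, fun h' => absurd h' h⟩
  choose dir hdir using hex4
  refine ⟨G.biUnion Q, grp, e', dir, hG.refine Q fun g hg => (hQ g hg).1, ?_, ?_⟩
  · intro K hK K' hK' hne
    exact hG.2.1 _ (hgrp K hK).1 _ (hgrp K' hK').1 hne
  · intro K hK
    obtain ⟨hg, hKQ⟩ := hgrp K hK
    obtain ⟨n1, n2, -⟩ := he' _ hg
    exact ⟨((hQ _ hg).1.1 K hKQ).2.2.2.1, (hG.1 _ hg).2.2.2.1, (hG2 _ hg).1, n1, n2, ((hQ _ hg).2 K hKQ).1, (hdir K hK).1, (hdir K hK).2⟩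

end HelpersD3

section HelpersG1
open scoped Pointwise

variable {V : Type*} [NormedAddCommGroup V] [InnerProductSpace ℝ V]

/-- algebraic core of the crossing case -/
theorem cross_aux (P Q P' : V) (l γ : ℝ) (hl0 : 0 ≤ l) (hl1 : l ≤ 1) (hγ : 0 ≤ γ) (hγ1 : γ ≤ 1 / 4)
    (h1 : (1 + l) * ‖P‖ ≤ 1) (h2 : ‖P'‖ + ‖Q‖ ≤ 1) (h3 : 1 - γ ≤ ‖P - Q‖)
    (h4 : 1 - γ ≤ ‖P' + l • P‖) : ‖Q + l • P‖ ^ 2 ≤ 5 * γ := by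
  have t1 : ‖P - Q‖ ≤ ‖P‖ + ‖Q‖ := norm_sub_le _ _
  have t2 : ‖P' + l • P‖ ≤ ‖P'‖ + l * ‖P‖ := by
    refine (norm_add_le _ _).trans ?_
    rw [norm_smul, Real.norm_of_nonneg hl0]
  set a := ‖P‖ with ha
  set d := ‖Q‖ with hd
  have e1 : ‖P - Q‖ ^ 2 = a ^ 2 - 2 * ⟪P, Q⟫ + d ^ 2 := norm_sub_sq_real P Q
  have e2 : ‖Q + l • P‖ ^ 2 = d ^ 2 + 2 * (l * ⟪P, Q⟫) + l ^ 2 * a ^ 2 := by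
    rw [norm_add_sq_real, inner_smul_right, norm_smul, Real.norm_of_nonneg hl0, real_inner_comm]
    ring
  have a0 : 0 ≤ a := norm_nonneg _
  have d0 : 0 ≤ d := norm_nonneg _
  have p0 : 0 ≤ ‖P'‖ := norm_nonneg _
  have b1 : |d - l * a| ≤ γ := by rw [abs_le]; constructor <;> linarith
  have b2 : a + d ≤ 1 + γ := by linarith
  have b3 : (1 - γ) ^ 2 ≤ ‖P - Q‖ ^ 2 := pow_le_pow_left₀ (by linarith) h3 2
  have b4 : (a + d) ^ 2 ≤ (1 + γ) ^ 2 := pow_le_pow_left₀ (by linarith) b2 2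
  have b5 : a * d + ⟪P, Q⟫ ≤ 2 * γ := by nlinarith only [b3, b4, e1]
  have b6 : (d - l * a) ^ 2 ≤ γ ^ 2 := by rw [← sq_abs]; exact pow_le_pow_left₀ (abs_nonneg _) b1 2
  have b7 : 0 ≤ a * d + ⟪P, Q⟫ := by
    have := abs_le.1 (abs_real_inner_le_norm P Q)
    linarith [this.1]
  have b8 : l * (a * d + ⟪P, Q⟫) ≤ 2 * γ := by nlinarith only [b5, b7, hl1, hl0]
  rw [e2]
  nlinarith only [b8, b6, hγ, hγ1]

set_option maxHeartbeats 1000000 in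
theorem inner_hull {p q q' p' : V} {a b c γ : ℝ} (ha : 0 ≤ a) (hb : 0 ≤ b) (hc : 0 ≤ c)
    (habc : a + b + c = 1) (e : p' = a • p + b • q + c • q') (hγ : 0 ≤ γ) (hγ1 : γ ≤ 1 / 500)
    (h1 : ‖p - q'‖ ≤ 1) (h2 : ‖q - q'‖ ≤ 1) (h5 : ‖p - q‖ ≤ 1) (h3 : 1 - γ ≤ ‖p - q‖) (h4 : 1 - γ ≤ ‖p' - q'‖) :
    ‖p - p'‖ ^ 2 ≤ 9 * γ ∨ ‖q - p'‖ ^ 2 ≤ 9 * γ := by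
  have e1 : p' - q' = a • (p - q') + b • (q - q') := by
    have : c = 1 - a - b := by linarith
    subst this
    rw [e]; module
  have e2 : ‖p' - q'‖ ^ 2 = (a + b) * (a * ‖p - q'‖ ^ 2 + b * ‖q - q'‖ ^ 2) - a * b * ‖p - q‖ ^ 2 := by
    have e3 : p - q = (p - q') - (q - q') := by abel
    rw [e1, e3, norm_add_sq_real, norm_sub_sq_real (p - q'), norm_smul, norm_smul, inner_smul_left, inner_smul_right,
      Real.norm_of_nonneg ha, Real.norm_of_nonneg hb]
    simp only [conj_trivial]
    ring
  have n1 : ‖p - q'‖ ^ 2 ≤ 1 := by nlinarith [norm_nonneg (p - q')]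
  have n2 : ‖q - q'‖ ^ 2 ≤ 1 := by nlinarith [norm_nonneg (q - q')]
  have n3 : (1 - γ) ^ 2 ≤ ‖p - q‖ ^ 2 := pow_le_pow_left₀ (by linarith) h3 2
  have n4 : (1 - γ) ^ 2 ≤ ‖p' - q'‖ ^ 2 := pow_le_pow_left₀ (by linarith) h4 2
  have hab : 0 ≤ a * b := by positivity
  have k1 : (1 - γ) ^ 2 + a * b * (1 - γ) ^ 2 ≤ (a + b) ^ 2 := by
    have : a * ‖p - q'‖ ^ 2 + b * ‖q - q'‖ ^ 2 ≤ a + b := by nlinarith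
    have : (a + b) * (a * ‖p - q'‖ ^ 2 + b * ‖q - q'‖ ^ 2) ≤ (a + b) * (a + b) := by gcongr
    have : a * b * (1 - γ) ^ 2 ≤ a * b * ‖p - q‖ ^ 2 := by gcongr
    nlinarith
  have k2 : 1 - γ ≤ a + b := by
    by_contra hcon
    push Not at hcon
    have : (a + b) ^ 2 < (1 - γ) ^ 2 := by gcongr
    nlinarith [mul_nonneg hab (sq_nonneg (1 - γ))]
  have k3 : a * b ≤ 4 * γ := by
    have : (a + b) ^ 2 ≤ 1 := by nlinarith
    have g1 : (1:ℝ) / 2 ≤ (1 - γ) ^ 2 := by nlinarith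
    nlinarith [mul_le_mul_of_nonneg_left g1 hab]
  have key : ∀ (x y : V) (s t : ℝ), 0 ≤ s → 0 ≤ t → s + t + c = 1 → s * t ≤ 4 * γ → 1 / 4 ≤ s →
      p' = s • x + t • y + c • q' → ‖x - y‖ ≤ 1 → ‖x - q'‖ ≤ 1 → ‖x - p'‖ ^ 2 ≤ 9 * γ := by
    intro x y s t hs ht hst hst2 hs4 ep hxy hxq
    have e4 : x - p' = t • (x - y) + c • (x - q') := by
      have : s = 1 - t - c := by linarith
      rw [ep, this]; module
    have t16 : t ≤ 16 * γ := by nlinarith only [hst2, hs4, ht]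
    have cg : c ≤ γ := by linarith
    have : ‖x - p'‖ ≤ t + c := by
      rw [e4]
      refine (norm_add_le _ _).trans ?_
      rw [norm_smul, norm_smul, Real.norm_of_nonneg hc, Real.norm_of_nonneg ht]
      nlinarith only [mul_le_mul_of_nonneg_left hxy ht, mul_le_mul_of_nonneg_left hxq hc]
    have h17 : ‖x - p'‖ ≤ 17 * γ := by linarith
    have h18 : ‖x - p'‖ ^ 2 ≤ (17 * γ) ^ 2 := pow_le_pow_left₀ (norm_nonneg _) h17 2
    nlinarith only [h18, hγ, hγ1]
  rcases le_total a b with h | h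
  · right
    refine key q p b a hb ha (by linarith) (by linarith) (by linarith) (by rw [e]; abel) ?_ h2
    rw [norm_sub_rev]; exact h5
  · left
    exact key p q a b ha hb habc k3 (by linarith) e h5 h1

/-- crossing of segments `p q'` and `q p'`, given by an affine relation -/
theorem cross_rel {p q p' q' : V} {a b c d γ : ℝ} (ha : 0 ≤ a) (hd : 0 ≤ d) (hb : 0 ≤ b) (hc : 0 ≤ c)
    (h1 : a + d = 1) (h2 : b + c = 1) (e : a • p + d • q' = b • q + c • p')
    (hγ : 0 ≤ γ) (hγ1 : γ ≤ 1 / 4) (g1 : ‖p - q'‖ ≤ 1) (g2 : ‖q - p'‖ ≤ 1)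
    (g3 : 1 - γ ≤ ‖p - q‖) (g4 : 1 - γ ≤ ‖p' - q'‖) :
    ‖q - q'‖ ^ 2 ≤ 5 * γ ∨ ‖p - p'‖ ^ 2 ≤ 5 * γ := by
  set o := a • p + d • q' with ho
  have eP : p - o = d • (p - q') := by
    have : a = 1 - d := by linarith
    rw [ho, this]; module
  have eQ' : q' - o = (-a) • (p - q') := by
    have : d = 1 - a := by linarith
    rw [ho, this]; module
  have eQ : q - o = c • (q - p') := by
    have : b = 1 - c := by linarith
    rw [e, this]; module
  have eP' : p' - o = (-b) • (q - p') := by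
    have : c = 1 - b := by linarith
    rw [e, this]; module
  have s1 : ‖p' - o‖ + ‖q - o‖ ≤ 1 := by
    rw [eP', eQ, norm_smul, norm_smul, norm_neg, Real.norm_of_nonneg hb, Real.norm_of_nonneg hc]
    nlinarith
  have s2 : ‖p - o‖ + ‖q' - o‖ ≤ 1 := by
    rw [eP, eQ', norm_smul, norm_smul, norm_neg, Real.norm_of_nonneg ha, Real.norm_of_nonneg hd]
    nlinarith
  have d1 : p - q = (p - o) - (q - o) := by abel
  have d2 : p' - q' = (p' - o) - (q' - o) := by abel
  rcases le_total a d with h | h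
  · left
    have hd0 : 0 < d := by linarith
    have el : q' - o = -((a / d) • (p - o)) := by
      rw [eQ', eP, smul_smul, div_mul_cancel₀ _ hd0.ne', neg_smul]
    have n1 : ‖q' - o‖ = a / d * ‖p - o‖ := by
      rw [el, norm_neg, norm_smul, Real.norm_of_nonneg (by positivity)]
    have := cross_aux (p - o) (q - o) (p' - o) (a / d) γ (by positivity) ((div_le_one hd0).2 h) hγ hγ1
      (by rw [n1] at s2; linarith) s1 (by rw [← d1]; exact g3)
      (by rw [d2, el, sub_neg_eq_add] at g4; exact g4)
    have e5 : q - q' = (q - o) + (a / d) • (p - o) := by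
      have : q - q' = (q - o) - (q' - o) := by abel
      rw [this, el, sub_neg_eq_add]
    rwa [e5]
  · right
    have ha0 : 0 < a := by linarith
    have el : p - o = -((d / a) • (q' - o)) := by
      rw [eQ', eP, smul_smul, ← neg_smul]
      congr 1
      field_simp
      try ring
    have n1 : ‖p - o‖ = d / a * ‖q' - o‖ := by
      rw [el, norm_neg, norm_smul, Real.norm_of_nonneg (by positivity)]
    have e6 : ‖p - q‖ = ‖(q - o) + (d / a) • (q' - o)‖ := by
      rw [← norm_neg (p - q), d1, el]; congr 1; abel
    have := cross_aux (q' - o) (p' - o) (q - o) (d / a) γ (by positivity) ((div_le_one ha0).2 h) hγ hγ1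
      (by rw [n1] at s2; linarith) (by linarith) (by rw [← norm_neg, neg_sub, ← d2]; exact g4)
      (by rw [← e6]; exact g3)
    have e5 : p - p' = -((p' - o) + (d / a) • (q' - o)) := by
      have : p - p' = (p - o) - (p' - o) := by abel
      rw [this, el]; abel
    rw [e5, norm_neg]; exact this

theorem seg_mem {p q : V} {a b : ℝ} (ha : 0 ≤ a) (hb : 0 ≤ b) (h : a + b = 1) :
    a • p + b • q ∈ segment ℝ p q := ⟨a, b, ha, hb, h, rfl⟩

set_option maxHeartbeats 4000000 in
theorem pair_lemma [FiniteDimensional ℝ V] (hdim : Module.finrank ℝ V = 2) (p q p' q' : V) (γ : ℝ) (hγ : 0 ≤ γ)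
    (hγ1 : γ ≤ 1 / 500) (hd : ∀ x ∈ ({p, q, p', q'} : Set V), ∀ y ∈ ({p, q, p', q'} : Set V), ‖x - y‖ ≤ 1)
    (h1 : 1 - γ ≤ ‖p - q‖) (h2 : 1 - γ ≤ ‖p' - q'‖)
    (hdis : Disjoint (segment ℝ p q) (segment ℝ p' q')) :
    ‖p - p'‖ ^ 2 ≤ 9 * γ ∨ ‖q - q'‖ ^ 2 ≤ 9 * γ ∨ ‖p - q'‖ ^ 2 ≤ 9 * γ ∨ ‖q - p'‖ ^ 2 ≤ 9 * γ := by
  have hg4 : γ ≤ 1 / 4 := by linarith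
  have hpq := hd p (by simp) q (by simp)
  have hpp' := hd p (by simp) p' (by simp)
  have hpq' := hd p (by simp) q' (by simp)
  have hqp' := hd q (by simp) p' (by simp)
  have hqq' := hd q (by simp) q' (by simp)
  have hp'q' := hd p' (by simp) q' (by simp)
  have rel : ∃ a b c d : ℝ, a + b + c + d = 0 ∧ a • p + b • q + c • p' + d • q' = 0 ∧
      ¬ (a = 0 ∧ b = 0 ∧ c = 0 ∧ d = 0) := by
    have hld : ¬ LinearIndependent ℝ ![q - p, p' - p, q' - p] := by
      intro h
      have := h.fintype_card_le_finrank
      rw [hdim] at this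
      simp at this
    rw [Fintype.not_linearIndependent_iff] at hld
    obtain ⟨g, hg, i, hi⟩ := hld
    refine ⟨-(g 0 + g 1 + g 2), g 0, g 1, g 2, by ring, ?_, ?_⟩
    · simp only [Fin.sum_univ_three, Matrix.cons_val_zero, Matrix.cons_val_one, Matrix.cons_val_two,
        Matrix.head_cons, Matrix.tail_cons] at hg
      rw [← hg]
      simp
      module
    · rintro ⟨-, h0, h1, h2⟩
      fin_cases i
      · exact hi h0
      · exact hi h1
      · exact hi h2
  obtain ⟨a, b, c, d, hs, he, hne⟩ := rel
  -- one point in the hull of the three others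
  have one : ∀ (x y z t : V) (X Y Z T : ℝ), X + Y + Z + T = 0 → X • x + Y • y + Z • z + T • t = 0 →
      0 < -X → 0 ≤ Y → 0 ≤ Z → 0 ≤ T →
      ∃ r s w : ℝ, 0 ≤ r ∧ 0 ≤ s ∧ 0 ≤ w ∧ r + s + w = 1 ∧ x = r • y + s • z + w • t := by
    intro x y z t X Y Z T hS hE hX hY hZ hT
    refine ⟨Y / (-X), Z / (-X), T / (-X), by positivity, by positivity, by positivity, ?_, ?_⟩
    · rw [← add_div, ← add_div, div_eq_one_iff_eq hX.ne']; linarith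
    · have : x = (-X)⁻¹ • ((-X) • x) := by rw [smul_smul, inv_mul_cancel₀ hX.ne', one_smul]
      have h3 : (-X) • x = Y • y + Z • z + T • t := by
        rw [neg_smul, neg_eq_iff_add_eq_zero, ← hE]; abel
      rw [this, h3, smul_add, smul_add, smul_smul, smul_smul, smul_smul]
      simp only [div_eq_inv_mul]
  have two : ∀ (x y z t : V) (X Y Z T : ℝ), X + Y + Z + T = 0 → X • x + Y • y + Z • z + T • t = 0 →
      0 < X + Y → 0 ≤ X → 0 ≤ Y → Z ≤ 0 → T ≤ 0 →
      ∃ r s r' s' : ℝ, 0 ≤ r ∧ 0 ≤ s ∧ 0 ≤ r' ∧ 0 ≤ s' ∧ r + s = 1 ∧ r' + s' = 1 ∧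
        r • x + s • y = r' • z + s' • t := by
    intro x y z t X Y Z T hS hE hp hX hY hZ hT
    refine ⟨X / (X + Y), Y / (X + Y), -Z / (X + Y), -T / (X + Y), by positivity, by positivity,
      div_nonneg (by linarith) hp.le, div_nonneg (by linarith) hp.le, ?_, ?_, ?_⟩
    · rw [← add_div, div_self hp.ne']
    · rw [← add_div, div_eq_one_iff_eq hp.ne']; linarith
    · have h3 : X • x + Y • y = (-Z) • z + (-T) • t := by
        rw [← sub_eq_zero, ← hE]; module
      simp only [div_eq_inv_mul, mul_smul, ← smul_add]
      rw [h3]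
  have O1 : (∃ r s w : ℝ, 0 ≤ r ∧ 0 ≤ s ∧ 0 ≤ w ∧ r + s + w = 1 ∧ p = r • p' + s • q' + w • q) →
      ‖p - p'‖ ^ 2 ≤ 9 * γ ∨ ‖q - q'‖ ^ 2 ≤ 9 * γ ∨ ‖p - q'‖ ^ 2 ≤ 9 * γ ∨ ‖q - p'‖ ^ 2 ≤ 9 * γ := by
    rintro ⟨r, s, w, hr, hs, hw, hh, e⟩
    rcases inner_hull hr hs hw hh e hγ hγ1 (by rwa [norm_sub_rev]) (by rwa [norm_sub_rev]) hp'q' h2 h1 with k | k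
    · rw [norm_sub_rev] at k; exact Or.inl k
    · rw [norm_sub_rev] at k; exact Or.inr (Or.inr (Or.inl k))
  have O2 : (∃ r s w : ℝ, 0 ≤ r ∧ 0 ≤ s ∧ 0 ≤ w ∧ r + s + w = 1 ∧ q = r • p' + s • q' + w • p) →
      ‖p - p'‖ ^ 2 ≤ 9 * γ ∨ ‖q - q'‖ ^ 2 ≤ 9 * γ ∨ ‖p - q'‖ ^ 2 ≤ 9 * γ ∨ ‖q - p'‖ ^ 2 ≤ 9 * γ := by
    rintro ⟨r, s, w, hr, hs, hw, hh, e⟩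
    rcases inner_hull hr hs hw hh e hγ hγ1 (by rwa [norm_sub_rev]) (by rwa [norm_sub_rev]) hp'q' h2 (by rwa [norm_sub_rev]) with k | k
    · rw [norm_sub_rev] at k; exact Or.inr (Or.inr (Or.inr k))
    · rw [norm_sub_rev] at k; exact Or.inr (Or.inl k)
  have O3 : (∃ r s w : ℝ, 0 ≤ r ∧ 0 ≤ s ∧ 0 ≤ w ∧ r + s + w = 1 ∧ p' = r • p + s • q + w • q') →
      ‖p - p'‖ ^ 2 ≤ 9 * γ ∨ ‖q - q'‖ ^ 2 ≤ 9 * γ ∨ ‖p - q'‖ ^ 2 ≤ 9 * γ ∨ ‖q - p'‖ ^ 2 ≤ 9 * γ := by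
    rintro ⟨r, s, w, hr, hs, hw, hh, e⟩
    rcases inner_hull hr hs hw hh e hγ hγ1 hpq' hqq' hpq h1 h2 with k | k
    · exact Or.inl k
    · exact Or.inr (Or.inr (Or.inr k))
  have O4 : (∃ r s w : ℝ, 0 ≤ r ∧ 0 ≤ s ∧ 0 ≤ w ∧ r + s + w = 1 ∧ q' = r • p + s • q + w • p') →
      ‖p - p'‖ ^ 2 ≤ 9 * γ ∨ ‖q - q'‖ ^ 2 ≤ 9 * γ ∨ ‖p - q'‖ ^ 2 ≤ 9 * γ ∨ ‖q - p'‖ ^ 2 ≤ 9 * γ := by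
    rintro ⟨r, s, w, hr, hs, hw, hh, e⟩
    rcases inner_hull hr hs hw hh e hγ hγ1 hpp' hqp' hpq h1 (by rwa [norm_sub_rev]) with k | k
    · exact Or.inr (Or.inr (Or.inl k))
    · exact Or.inr (Or.inl k)
  have T1 : ¬ (∃ r s r' s' : ℝ, 0 ≤ r ∧ 0 ≤ s ∧ 0 ≤ r' ∧ 0 ≤ s' ∧ r + s = 1 ∧ r' + s' = 1 ∧
        r • p + s • q = r' • p' + s' • q') := by
    rintro ⟨r, s, r', s', hr, hs, hr', hs', e1, e2, e3⟩
    exact Set.disjoint_left.1 hdis (seg_mem hr hs e1) (by rw [e3]; exact seg_mem hr' hs' e2)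
  have T2 : (∃ r s r' s' : ℝ, 0 ≤ r ∧ 0 ≤ s ∧ 0 ≤ r' ∧ 0 ≤ s' ∧ r + s = 1 ∧ r' + s' = 1 ∧
        r • p + s • q' = r' • q + s' • p') →
      ‖p - p'‖ ^ 2 ≤ 9 * γ ∨ ‖q - q'‖ ^ 2 ≤ 9 * γ ∨ ‖p - q'‖ ^ 2 ≤ 9 * γ ∨ ‖q - p'‖ ^ 2 ≤ 9 * γ := by
    rintro ⟨r, s, r', s', hr, hs, hr', hs', e1, e2, e3⟩
    rcases cross_rel hr hs hr' hs' e1 e2 e3 hγ hg4 hpq' hqp' h1 h2 with k | k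
    · right; left; linarith
    · left; linarith
  have T3 : (∃ r s r' s' : ℝ, 0 ≤ r ∧ 0 ≤ s ∧ 0 ≤ r' ∧ 0 ≤ s' ∧ r + s = 1 ∧ r' + s' = 1 ∧
        r • p + s • p' = r' • q + s' • q') →
      ‖p - p'‖ ^ 2 ≤ 9 * γ ∨ ‖q - q'‖ ^ 2 ≤ 9 * γ ∨ ‖p - q'‖ ^ 2 ≤ 9 * γ ∨ ‖q - p'‖ ^ 2 ≤ 9 * γ := by
    rintro ⟨r, s, r', s', hr, hs, hr', hs', e1, e2, e3⟩
    rcases cross_rel hr hs hr' hs' e1 e2 e3 hγ hg4 hpp' hqq' h1 (by rwa [norm_sub_rev]) with k | k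
    · right; right; right; linarith
    · right; right; left; linarith
  -- it suffices to treat b given sign of a nonneg
  have main : ∀ a b c d : ℝ, a + b + c + d = 0 → a • p + b • q + c • p' + d • q' = 0 →
      ¬ (a = 0 ∧ b = 0 ∧ c = 0 ∧ d = 0) → 0 ≤ a →
      ‖p - p'‖ ^ 2 ≤ 9 * γ ∨ ‖q - q'‖ ^ 2 ≤ 9 * γ ∨ ‖p - q'‖ ^ 2 ≤ 9 * γ ∨ ‖q - p'‖ ^ 2 ≤ 9 * γ := by
    intro a b c d hs he hne ha
    have hne' : 0 < |a| + |b| + |c| + |d| := by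
      by_contra hcon
      push Not at hcon
      have := abs_nonneg a; have := abs_nonneg b; have := abs_nonneg c; have := abs_nonneg d
      exact hne ⟨abs_eq_zero.1 (by linarith), abs_eq_zero.1 (by linarith), abs_eq_zero.1 (by linarith),
        abs_eq_zero.1 (by linarith)⟩
    have en : (-a) + (-b) + (-c) + (-d) = 0 := by linarith
    have hen : (-a) • p + (-b) • q + (-c) • p' + (-d) • q' = 0 := by
      rw [← neg_eq_zero, ← he]; module
    rw [abs_of_nonneg ha] at hne'
    rcases le_total 0 b with hb | hb <;> rcases le_total 0 c with hc | hc <;> rcases le_total 0 d with hd | hd <;>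
      simp only [abs_of_nonneg, abs_of_nonpos, hb, hc, hd] at hne'
    · linarith
    · exact O4 (one q' p q p' d a b c (by linarith) (by rw [← he]; abel) (by linarith) ha hb hc)
    · exact O3 (one p' p q q' c a b d (by linarith) (by rw [← he]; abel) (by linarith) ha hb hd)
    · exact absurd (two p q p' q' a b c d hs he (by linarith) ha hb hc hd) T1
    · exact O2 (one q p' q' p b c d a (by linarith) (by rw [← he]; abel) (by linarith) hc hd ha)
    · exact T3 (two p p' q q' a c b d (by linarith) (by rw [← he]; abel) (by linarith) ha hc hb hd)
    · exact T2 (two p q' q p' a d b c (by linarith) (by rw [← he]; abel) (by linarith) ha hd hb hc)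
    · exact O1 (one p p' q' q (-a) (-c) (-d) (-b) (by linarith) (by rw [← hen]; abel) (by linarith)
        (by linarith) (by linarith) (by linarith))
  rcases le_total 0 a with h | h
  · exact main a b c d hs he hne h
  · refine main (-a) (-b) (-c) (-d) (by linarith) ?_ ?_ (by linarith)
    · rw [← neg_eq_zero, ← he]; module
    · simpa using hne

theorem star_lemma {ι : Type*} (J : Finset ι) (hJ : J.Nonempty) (p q : ι → V) (r : ℝ)
    (h : ∀ i ∈ J, ∀ j ∈ J, ‖p i - p j‖ ≤ r ∨ ‖q i - q j‖ ≤ r) :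
    ∃ i ∈ J, (∀ j ∈ J, ‖p i - p j‖ ≤ 2 * r) ∨ (∀ j ∈ J, ‖q i - q j‖ ≤ 2 * r) := by
  obtain ⟨i, hi⟩ := hJ
  refine ⟨i, hi, ?_⟩
  have r0 : 0 ≤ r := by rcases h i hi i hi with h | h <;> simpa using h
  by_contra hcon
  push Not at hcon
  obtain ⟨⟨j, hj, h1⟩, ⟨l, hl, h2⟩⟩ := hcon
  have a1 := (h i hi j hj).resolve_left (by linarith)
  have a2 := (h i hi l hl).resolve_right (by linarith)
  rcases h l hl j hj with k | k
  · have := norm_sub_le_norm_sub_add_norm_sub (p i) (p l) (p j)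
    linarith
  · have := norm_sub_le_norm_sub_add_norm_sub (q i) (q j) (q l)
    rw [norm_sub_rev (q j)] at this
    linarith

end HelpersG1

section HelpersE1
open scoped Pointwise

/-- Section data of `K` along the first coordinate of the linear chart `Φ`. -/
def SecD {k : ℕ} (Φ : (ℝ × (Fin (k+1) → ℝ)) ≃L[ℝ] EuclideanSpace ℝ (Fin (k+2))) (m : EuclideanSpace ℝ (Fin (k+2)))
    (K : Set (EuclideanSpace ℝ (Fin (k+2)))) (s1 s2 : ℝ) : Prop :=
  s1 < s2 ∧ (∀ s, (secK (Φ ⁻¹' K) s).Nonempty ↔ s ∈ Ioo s1 s2) ∧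
  (∀ x ∈ K, ⟪x, m⟫ ∈ Ioo s1 s2) ∧
  (∀ s ∈ Ioo s1 s2, 0 < volume.real (secK (Φ ⁻¹' K) s)) ∧
  ConvexOn ℝ (Ioo s1 s2) (fun s => -log (volume.real (secK (Φ ⁻¹' K) s))) ∧
  (∀ g : ℝ → ℝ, Continuous g → Integrable (fun s => g s * volume.real (secK (Φ ⁻¹' K) s))) ∧
  (∀ g : ℝ → ℝ, Continuous g → ∀ a b : ℝ, a ≤ b → ∫ s in a..b, g s * volume.real (secK (Φ ⁻¹' K) s) =
    ∫ x in K ∩ {x | ⟪x, m⟫ ∈ Ioc a b}, g ⟪x, m⟫) ∧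
  (∀ g : ℝ → ℝ, Continuous g → ∫ s in s1..s2, g s * volume.real (secK (Φ ⁻¹' K) s) = ∫ x in K, g ⟪x, m⟫)

theorem secD_exists {k : ℕ} (Φ : (ℝ × (Fin (k+1) → ℝ)) ≃L[ℝ] EuclideanSpace ℝ (Fin (k+2)))
    (m : EuclideanSpace ℝ (Fin (k+2))) (mp : MeasurePreserving Φ volume volume) (hm : ∀ p, ⟪Φ p, m⟫ = p.1)
    (K : Set (EuclideanSpace ℝ (Fin (k+2)))) (ho : IsOpen K) (hc : Convex ℝ K) (hb : IsBounded K) (hn : K.Nonempty) :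
    ∃ s1 s2, SecD Φ m K s1 s2 := by
  have hb' : IsBounded (Φ ⁻¹' K) := by
    have := (Φ.symm : EuclideanSpace ℝ (Fin (k+2)) →L[ℝ] (ℝ × (Fin (k+1) → ℝ))).lipschitz.isBounded_image hb
    apply this.subset
    intro p hp
    exact ⟨Φ p, hp, by simp⟩
  have hn' : (Φ ⁻¹' K).Nonempty := by
    obtain ⟨x, hx⟩ := hn
    exact ⟨Φ.symm x, by simpa using hx⟩
  have hc' : Convex ℝ (Φ ⁻¹' K) := hc.linear_preimage (Φ : (ℝ × (Fin (k+1) → ℝ)) →L[ℝ] _).toLinearMap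
  obtain ⟨s1, s2, h12, hne, hpos, hcv, hg⟩ := sec_pkg (Φ ⁻¹' K) (ho.preimage Φ.continuous) hc' hb' hn'
  have hin : ∀ x ∈ K, ⟪x, m⟫ ∈ Ioo s1 s2 := by
    intro x hx
    rw [← hne]
    refine ⟨(Φ.symm x).2, ?_⟩
    have : ⟪x, m⟫ = (Φ.symm x).1 := by rw [← hm]; simp
    show Φ (⟪x, m⟫, (Φ.symm x).2) ∈ K
    rw [this]; simpa using hx
  have me : MeasurableEmbedding Φ := Φ.toHomeomorph.measurableEmbedding
  have h7 : (∀ g : ℝ → ℝ, Continuous g → ∀ a b : ℝ, a ≤ b → ∫ s in a..b, g s * volume.real (secK (Φ ⁻¹' K) s) =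
    ∫ x in K ∩ {x | ⟪x, m⟫ ∈ Ioc a b}, g ⟪x, m⟫) := by
    intro g cg a b hab
    rw [intervalIntegral.integral_of_le hab, ← (hg g cg).2 _ measurableSet_Ioc,
      ← mp.setIntegral_preimage_emb me]
    have : (Φ ⁻¹' K ∩ Prod.fst ⁻¹' Ioc a b) = Φ ⁻¹' (K ∩ {x | ⟪x, m⟫ ∈ Ioc a b}) := by
      ext p
      simp only [mem_inter_iff, mem_preimage, mem_ofPred_eq, hm]
    rw [this]
    congr 1
    ext p
    rw [hm]
  refine ⟨s1, s2, h12, hne, hin, hpos, hcv, fun g cg => (hg g cg).1, h7, ?_⟩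
  intro g cg
  rw [h7 g cg s1 s2 h12.le]
  congr 2
  ext x
  simp only [mem_inter_iff, mem_ofPred_eq, and_iff_left_iff_imp]
  intro hx
  exact ⟨(hin x hx).1, (hin x hx).2.le⟩

theorem sq_compare {α : Type*} [MeasurableSpace α] (μ : Measure α) (S : Set α) (hS : MeasurableSet S) (fS : μ S ≠ ∞)
    (p q : α → ℝ) (hp : IntegrableOn (fun x => p x ^ 2) S μ) (hq : IntegrableOn (fun x => q x ^ 2) S μ)
    (ω δ : ℝ) (hδ : 0 < δ) (hω : ∀ x ∈ S, |p x - q x| ≤ ω) :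
    ∫ x in S, p x ^ 2 ∂μ ≤ (1 + δ) * (∫ x in S, q x ^ 2 ∂μ) + (1 + 1 / δ) * ω ^ 2 * μ.real S := by
  have : ∫ x in S, p x ^ 2 ∂μ ≤ ∫ x in S, ((1 + δ) * q x ^ 2 + (1 + 1 / δ) * ω ^ 2) ∂μ := by
    apply setIntegral_mono_on hp _ hS
    · intro x hx
      have h1 := sq_le_sq' (abs_le.1 (hω x hx)).1 (abs_le.1 (hω x hx)).2
      have h2 : p x ^ 2 ≤ (1 + δ) * q x ^ 2 + (1 + 1 / δ) * (p x - q x) ^ 2 := by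
        have : 0 ≤ (δ * q x - (p x - q x)) ^ 2 / δ := by positivity
        have e : (δ * q x - (p x - q x)) ^ 2 / δ = δ * q x ^ 2 - 2 * q x * (p x - q x) + (1 / δ) * (p x - q x) ^ 2 := by
          field_simp
          ring
        rw [e] at this
        nlinarith only [this]
      have h3 : (1 + 1 / δ) * (p x - q x) ^ 2 ≤ (1 + 1 / δ) * ω ^ 2 :=
        mul_le_mul_of_nonneg_left h1 (by positivity)
      linarith
    · exact (hq.const_mul _).add (integrableOn_const fS)
  refine this.trans (le_of_eq ?_)
  rw [integral_add (hq.const_mul _) (integrableOn_const fS), integral_const_mul, setIntegral_const, smul_eq_mul]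
  ring

theorem unif_osc {N : ℕ} (u : EuclideanSpace ℝ (Fin N) → ℝ) (hu : ContDiff ℝ 1 u) (hcs : HasCompactSupport u)
    (ω : ℝ) (hω : 0 < ω) : ∃ r > 0, ∀ x y, ‖x - y‖ ≤ r → |u x - u y| ≤ ω ∧ ‖fderiv ℝ u x - fderiv ℝ u y‖ ≤ ω := by
  have h1 := hcs.uniformContinuous_of_continuous hu.continuous
  have h2 := (hcs.fderiv ℝ).uniformContinuous_of_continuous (hu.continuous_fderiv one_ne_zero)
  rw [Metric.uniformContinuous_iff] at h1 h2
  obtain ⟨r1, p1, q1⟩ := h1 ω hω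
  obtain ⟨r2, p2, q2⟩ := h2 ω hω
  refine ⟨min r1 r2 / 2, by positivity, fun x y hxy => ?_⟩
  have hm : dist x y < min r1 r2 := by
    rw [dist_eq_norm]
    have : 0 < min r1 r2 := by positivity
    linarith
  constructor
  · have := q1 (lt_of_lt_of_le hm (min_le_left _ _))
    rw [Real.dist_eq] at this
    exact this.le
  · have := q2 (lt_of_lt_of_le hm (min_le_right _ _))
    rw [dist_eq_norm] at this
    exact this.le

theorem cell_reduce {k : ℕ} {Φ : (ℝ × (Fin (k+1) → ℝ)) ≃L[ℝ] EuclideanSpace ℝ (Fin (k+2))}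
    {m : EuclideanSpace ℝ (Fin (k+2))} {K : Set (EuclideanSpace ℝ (Fin (k+2)))} {s1 s2 : ℝ} (hS : SecD Φ m K s1 s2)
    (ho : IsOpen K) (hb : IsBounded K) (u : EuclideanSpace ℝ (Fin (k+2)) → ℝ) (hu : ContDiff ℝ 1 u)
    (hcs : HasCompactSupport u) (e : EuclideanSpace ℝ (Fin (k+2))) (β : ℝ) (hβ : 0 < β) (x0 : EuclideanSpace ℝ (Fin (k+2)))
    (hx0 : x0 ∈ K) (ω : ℝ)
    (hω : ∀ x ∈ K, |u x - u (x0 + ((⟪x, m⟫ - ⟪x0, m⟫) / β) • e)| ≤ ω ∧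
      |fderiv ℝ u x e - fderiv ℝ u (x0 + ((⟪x, m⟫ - ⟪x0, m⟫) / β) • e) e| ≤ ω)
    (hu0 : ∫ x in K, u x = 0) :
    ∃ f f' : ℝ → ℝ, (∀ s, HasDerivAt f (f' s) s) ∧ Continuous f' ∧
      (∫ s in s1..s2, f s * volume.real (secK (Φ ⁻¹' K) s) = 0) ∧
      (∀ x ∈ K, |u x - f ⟪x, m⟫| ≤ 2 * ω) ∧ (∀ x ∈ K, |fderiv ℝ u x e - β * f' ⟪x, m⟫| ≤ ω) := by
  obtain ⟨h12, hne, hin, hpos, hcv, hIntg, hab, hall⟩ := hS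
  have cfd := hu.continuous_fderiv one_ne_zero
  have fK : volume K ≠ ∞ := hb.measure_lt_top.ne
  have pK : 0 < volume.real K := by
    rw [Measure.real, ENNReal.toReal_pos_iff]
    exact ⟨ho.measure_pos _ ⟨x0, hx0⟩, hb.measure_lt_top⟩
  set f0 : ℝ → ℝ := fun s => u (x0 + ((s - ⟪x0, m⟫) / β) • e) with hf0
  set f' : ℝ → ℝ := fun s => β⁻¹ * fderiv ℝ u (x0 + ((s - ⟪x0, m⟫) / β) • e) e with hf'
  have d0 : ∀ s, HasDerivAt f0 (f' s) s := by
    intro s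
    have l : HasDerivAt (fun s : ℝ => x0 + ((s - ⟪x0, m⟫) / β) • e) (β⁻¹ • e) s := by
      have := ((((hasDerivAt_id s).sub_const ⟪x0, m⟫).div_const β).smul_const e).const_add x0
      refine this.congr_deriv ?_
      simp
    have := ((hu.differentiable one_ne_zero) (x0 + ((s - ⟪x0, m⟫) / β) • e)).hasFDerivAt.comp_hasDerivAt s l
    refine this.congr_deriv ?_
    simp [f']
  have c0 : Continuous f0 := continuous_iff_continuousAt.2 fun x => (d0 x).continuousAt
  have c' : Continuous f' := by
    have : Continuous fun s : ℝ => x0 + ((s - ⟪x0, m⟫) / β) • e := by fun_prop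
    exact continuous_const.mul ((cfd.comp this).clm_apply continuous_const)
  have vol : ∫ s in s1..s2, (1:ℝ) * volume.real (secK (Φ ⁻¹' K) s) = volume.real K := by
    rw [hall (fun _ => 1) continuous_const]; simp
  have uI : IntegrableOn u K := (hu.continuous.integrable_of_hasCompactSupport hcs).integrableOn
  have fI : IntegrableOn (fun x => f0 ⟪x, m⟫) K := by
    have : Continuous fun x : EuclideanSpace ℝ (Fin (k+2)) => f0 ⟪x, m⟫ := by fun_prop
    exact (this.continuousOn.integrableOn_compact hb.isCompact_closure).mono_set subset_closure
  set I := ∫ x in K, f0 ⟪x, m⟫ with hI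
  have hIb : |I| ≤ ω * volume.real K := by
    have : I = ∫ x in K, (f0 ⟪x, m⟫ - u x) := by
      rw [integral_sub fI uI, hu0, sub_zero]
    rw [this, ← Real.norm_eq_abs]
    apply norm_setIntegral_le_of_norm_le_const hb.measure_lt_top
    intro x hx
    rw [Real.norm_eq_abs, abs_sub_comm]
    exact (hω x hx).1
  set c := I / volume.real K with hc
  have hcb : |c| ≤ ω := by
    rw [hc, abs_div, abs_of_pos pK, div_le_iff₀ pK]; exact hIb
  refine ⟨fun s => f0 s - c, f', fun s => (d0 s).sub_const c, c', ?_, ?_, ?_⟩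
  · rw [hall (fun s => f0 s - c) (c0.sub continuous_const)]
    rw [integral_sub fI (integrableOn_const fK), setIntegral_const, smul_eq_mul, hc]
    field_simp
    simp [hI]
  · intro x hx
    have := (hω x hx).1
    have e : u x - (f0 ⟪x, m⟫ - c) = (u x - f0 ⟪x, m⟫) + c := by ring
    rw [e]
    calc _ ≤ |u x - f0 ⟪x, m⟫| + |c| := abs_add_le _ _
      _ ≤ 2 * ω := by linarith
  · intro x hx
    have := (hω x hx).2
    have e : β * f' ⟪x, m⟫ = fderiv ℝ u (x0 + ((⟪x, m⟫ - ⟪x0, m⟫) / β) • e) e := by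
      simp only [f']; field_simp
    rw [e]; exact this

end HelpersE1

section HelpersE2
open scoped Pointwise

theorem bdd_of_dist {N : ℕ} {K : Set (EuclideanSpace ℝ (Fin N))} (hd : ∀ x ∈ K, ∀ y ∈ K, ‖x - y‖ ≤ 1) : IsBounded K := by
  rw [Metric.isBounded_iff]
  exact ⟨1, fun x hx y hy => by rw [dist_eq_norm]; exact hd x hx y hy⟩

theorem thin_geom {N : ℕ} (x y e m : EuclideanSpace ℝ (Fin N)) (he : ‖e‖ = 1) (hm : ‖m‖ = 1) (β β₀ ρ t : ℝ)
    (hβ : β = ⟪e, m⟫) (hβ₀ : 0 < β₀) (hββ : β₀ ≤ β) (hxy : ‖x - y‖ ≤ 1) (ht : ‖x - y - t • e‖ ≤ ρ) :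
    ‖x - (y + ((⟪x, m⟫ - ⟪y, m⟫) / β) • e)‖ ≤ 2 * ρ / β₀ ∧ ⟪x, m⟫ - ⟪y, m⟫ ≤ β * (1 + 2 * ρ / β₀) := by
  have hρ : 0 ≤ ρ := (norm_nonneg _).trans ht
  have hβ1 : β ≤ 1 := by
    rw [hβ]; refine (real_inner_le_norm _ _).trans ?_; rw [he, hm]; norm_num
  have bp : 0 < β := hβ₀.trans_le hββ
  set r := x - y - t • e with hr
  have hrm : |⟪r, m⟫| ≤ ρ := by
    refine (abs_real_inner_le_norm _ _).trans ?_; rw [hm, mul_one]; exact ht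
  have e1 : ⟪x, m⟫ - ⟪y, m⟫ = t * β + ⟪r, m⟫ := by
    rw [hr, inner_sub_left, inner_sub_left, real_inner_smul_left, hβ]; ring
  have htb : |t| ≤ 1 + ρ := by
    have : ‖t • e‖ ≤ 1 + ρ := by
      have : t • e = (x - y) - r := by rw [hr]; abel
      rw [this]
      exact (norm_sub_le _ _).trans (add_le_add hxy ht)
    rwa [norm_smul, he, mul_one, Real.norm_eq_abs] at this
  have q : ρ ≤ ρ / β₀ * β := by
    rw [div_mul_eq_mul_div, le_div_iff₀ hβ₀]; exact mul_le_mul_of_nonneg_left hββ hρ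
  have b01 : β₀ ≤ 1 := hββ.trans hβ1
  have q2 : ρ ≤ ρ / β₀ := by rw [le_div_iff₀ hβ₀]; nlinarith
  constructor
  · have e2 : x - (y + ((⟪x, m⟫ - ⟪y, m⟫) / β) • e) = r - (⟪r, m⟫ / β) • e := by
      rw [e1, add_div, mul_div_assoc, div_self bp.ne', mul_one, add_smul, hr]
      abel
    rw [e2]
    refine (norm_sub_le _ _).trans ?_
    rw [norm_smul, he, mul_one, Real.norm_eq_abs, abs_div, abs_of_pos bp]
    have : |⟪r, m⟫| / β ≤ ρ / β₀ := div_le_div₀ hρ hrm hβ₀ hββ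
    have e3 : 2 * ρ / β₀ = ρ / β₀ + ρ / β₀ := by ring
    rw [e3]
    linarith
  · rw [e1]
    have a1 : t * β ≤ (1 + ρ) * β := mul_le_mul_of_nonneg_right ((le_abs_self _).trans htb) bp.le
    have a2 := (le_abs_self _).trans hrm
    have e3 : β * (1 + 2 * ρ / β₀) = β + ρ / β₀ * β + ρ / β₀ * β := by ring
    rw [e3]
    nlinarith only [a1, a2, q, q2, bp, hρ, mul_le_mul_of_nonneg_right q2 bp.le]

theorem SecD.len_le {k : ℕ} {Φ : (ℝ × (Fin (k+1) → ℝ)) ≃L[ℝ] EuclideanSpace ℝ (Fin (k+2))}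
    {m : EuclideanSpace ℝ (Fin (k+2))} {K : Set (EuclideanSpace ℝ (Fin (k+2)))} {s1 s2 : ℝ} (hS : SecD Φ m K s1 s2)
    (hm : ∀ p, ⟪Φ p, m⟫ = p.1) :
    ∀ s ∈ Ioo s1 s2, ∃ x ∈ K, ⟪x, m⟫ = s := by
  intro s hs
  obtain ⟨y, hy⟩ := (hS.2.1 s).2 hs
  exact ⟨Φ (s, y), hy, by rw [hm]⟩

/-- The analytic data of a thin cell. -/
def CellD {k : ℕ} (u : EuclideanSpace ℝ (Fin (k+2)) → ℝ) (K : Set (EuclideanSpace ℝ (Fin (k+2))))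
    (e m : EuclideanSpace ℝ (Fin (k+2))) (Φ : (ℝ × (Fin (k+1) → ℝ)) ≃L[ℝ] EuclideanSpace ℝ (Fin (k+2)))
    (β δ s1 s2 : ℝ) : Prop :=
  SecD Φ m K s1 s2 ∧ s2 - s1 ≤ β * (1 + δ / 3) ∧ ∃ f f' : ℝ → ℝ, (∀ s, HasDerivAt f (f' s) s) ∧ Continuous f' ∧
    (∫ s in s1..s2, f s * volume.real (secK (Φ ⁻¹' K) s) = 0) ∧
    (∫ x in K, u x ^ 2) ≤ (1 + δ) * (∫ s in s1..s2, f s ^ 2 * volume.real (secK (Φ ⁻¹' K) s)) + δ * (∫ x in K, u x ^ 2) ∧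
    (∀ a b : ℝ, a ≤ b → (∫ s in a..b, f s ^ 2 * volume.real (secK (Φ ⁻¹' K) s)) ≤
      (1 + δ) * (∫ x in K ∩ {x | ⟪x, m⟫ ∈ Ioc a b}, u x ^ 2) + δ * (∫ x in K, u x ^ 2)) ∧
    β ^ 2 * (∫ s in s1..s2, f' s ^ 2 * volume.real (secK (Φ ⁻¹' K) s)) ≤
      (1 + δ) * (∫ x in K, (fderiv ℝ u x e) ^ 2) + δ * (∫ x in K, u x ^ 2)

theorem cell {k : ℕ} (u : EuclideanSpace ℝ (Fin (k+2)) → ℝ) (hu : ContDiff ℝ 1 u) (hcs : HasCompactSupport u)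
    (η δ β₀ : ℝ) (hη : 0 < η) (hδ : 0 < δ) (hδ1 : δ ≤ 1) (hβ₀ : 0 < β₀) :
    ∃ ρ0 > 0, ∀ K : Set (EuclideanSpace ℝ (Fin (k+2))), IsOpen K → Convex ℝ K → K.Nonempty →
      (∀ x ∈ K, ∀ y ∈ K, ‖x - y‖ ≤ 1) → ∀ e m : EuclideanSpace ℝ (Fin (k+2)), ‖e‖ = 1 → ‖m‖ = 1 →
      (∀ x ∈ K, ∀ y ∈ K, ∃ t : ℝ, ‖x - y - t • e‖ ≤ ρ0) → ∫ x in K, u x = 0 →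
      η * volume.real K ≤ ∫ x in K, u x ^ 2 →
      ∀ Φ : (ℝ × (Fin (k+1) → ℝ)) ≃L[ℝ] EuclideanSpace ℝ (Fin (k+2)), MeasurePreserving Φ volume volume →
      (∀ p, ⟪Φ p, m⟫ = p.1) → ∀ β : ℝ, β = ⟪e, m⟫ → β₀ ≤ β →
      ∃ s1 s2, CellD u K e m Φ β δ s1 s2 := by
  set ω := δ * √η / 4 with hωd
  have hω : 0 < ω := by positivity
  have hωs : (1 + 1 / δ) * (2 * ω) ^ 2 ≤ δ * η := by
    rw [hωd]
    have : (1 + 1 / δ) * (2 * (δ * √η / 4)) ^ 2 = (δ ^ 2 + δ) * (√η) ^ 2 / 4 := by field_simp; ring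
    rw [this, Real.sq_sqrt hη.le]
    nlinarith [mul_pos hδ hη, mul_le_mul_of_nonneg_right hδ1 (mul_pos hδ hη).le]
  obtain ⟨r, hr, hosc⟩ := unif_osc u hu hcs ω hω
  have hr3 : 0 < min r (δ / 3) := by positivity
  refine ⟨β₀ * min r (δ / 3) / 2, by positivity, ?_⟩
  intro K ho hc hn hd e m he hm hthin hu0 hηM Φ mp hΦ β hβ hββ
  have hb := bdd_of_dist hd
  obtain ⟨x0, hx0⟩ := hn
  have bp : 0 < β := hβ₀.trans_le hββ
  have eρ : 2 * (β₀ * min r (δ / 3) / 2) / β₀ = min r (δ / 3) := by field_simp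
  have geo : ∀ x ∈ K, ∀ y ∈ K, ‖x - (y + ((⟪x, m⟫ - ⟪y, m⟫) / β) • e)‖ ≤ min r (δ / 3) ∧
      ⟪x, m⟫ - ⟪y, m⟫ ≤ β * (1 + min r (δ / 3)) := by
    intro x hx y hy
    obtain ⟨t, ht⟩ := hthin x hx y hy
    have := thin_geom x y e m he hm β β₀ _ t hβ hβ₀ hββ (hd x hx y hy) ht
    rw [eρ] at this
    exact this
  obtain ⟨s1, s2, hS⟩ := secD_exists Φ m mp hΦ K ho hc hb ⟨x0, hx0⟩
  have hS' := hS
  obtain ⟨h12, hne, hin, hpos, hcv, hIntg, hab, hall⟩ := hS'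
  obtain ⟨f, f', hf, cf', hmean, o1, o2⟩ := cell_reduce hS ho hb u hu hcs e β bp x0 hx0 ω (by
    intro x hx
    have := hosc x _ ((geo x hx x0 hx0).1.trans (min_le_left _ _))
    refine ⟨this.1, ?_⟩
    rw [← ContinuousLinearMap.sub_apply, ← Real.norm_eq_abs]
    refine (ContinuousLinearMap.le_opNorm _ _).trans ?_
    rw [he, mul_one]
    exact this.2) hu0
  refine ⟨s1, s2, hS, ?_, f, f', hf, cf', hmean, ?_, ?_, ?_⟩
  · by_contra hcon
    push Not at hcon
    set ξ := ((s2 - s1) - β * (1 + δ / 3)) / 3 with hξ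
    have hξp : 0 < ξ := by rw [hξ]; linarith
    have h00 : 0 < β * (1 + δ / 3) := by positivity
    obtain ⟨x, hx, ex⟩ := hS.len_le hΦ (s2 - ξ) ⟨by linarith, by linarith⟩
    obtain ⟨y, hy, ey⟩ := hS.len_le hΦ (s1 + ξ) ⟨by linarith, by linarith⟩
    have g := (geo x hx y hy).2
    rw [ex, ey] at g
    have : β * (1 + min r (δ / 3)) ≤ β * (1 + δ / 3) :=
      mul_le_mul_of_nonneg_left (by linarith [min_le_right r (δ/3)]) bp.le
    linarith
  all_goals
    have cf : Continuous f := continuous_iff_continuousAt.2 fun x => (hf x).continuousAt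
    have fK : ∀ S ⊆ K, volume S ≠ ∞ := fun S hS => ((measure_mono hS).trans_lt hb.measure_lt_top).ne
    have int : ∀ (g : EuclideanSpace ℝ (Fin (k+2)) → ℝ), Continuous g → ∀ S ⊆ K, IntegrableOn g S := fun g cg S hS =>
      (cg.continuousOn.integrableOn_compact hb.isCompact_closure).mono_set (hS.trans subset_closure)
    have cu := hu.continuous
    have cdu : Continuous fun x => fderiv ℝ u x e := (hu.continuous_fderiv one_ne_zero).clm_apply continuous_const
    have cm : Continuous fun x : EuclideanSpace ℝ (Fin (k+2)) => ⟪x, m⟫ := by fun_prop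
    have ve : ∀ S ⊆ K, (1 + 1 / δ) * (2 * ω) ^ 2 * volume.real S ≤ δ * ∫ x in K, u x ^ 2 := by
      intro S hS
      have v1 : volume.real S ≤ volume.real K := measureReal_mono hS (fK K subset_rfl)
      calc _ ≤ δ * η * volume.real K := mul_le_mul hωs v1 measureReal_nonneg (by positivity)
        _ = δ * (η * volume.real K) := by ring
        _ ≤ _ := mul_le_mul_of_nonneg_left hηM hδ.le
  · have := sq_compare volume K ho.measurableSet (fK K subset_rfl) u (fun x => f ⟪x, m⟫) (int _ (cu.pow 2) K subset_rfl)
      (int _ ((cf.comp cm).pow 2) K subset_rfl) (2 * ω) δ hδ o1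
    rw [hall (fun s => f s ^ 2) (cf.pow 2)]
    linarith [ve K subset_rfl]
  · intro a b hab'
    have ms : MeasurableSet (K ∩ {x | ⟪x, m⟫ ∈ Ioc a b}) := ho.measurableSet.inter (cm.measurable measurableSet_Ioc)
    have := sq_compare volume (K ∩ {x | ⟪x, m⟫ ∈ Ioc a b}) ms (fK _ inter_subset_left)
      (fun x => f ⟪x, m⟫) u (int _ ((cf.comp cm).pow 2) _ inter_subset_left) (int _ (cu.pow 2) _ inter_subset_left)
       (2 * ω) δ hδ (fun x hx => by rw [abs_sub_comm]; exact o1 x hx.1)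
    rw [hab (fun s => f s ^ 2) (cf.pow 2) a b hab']
    linarith [ve _ (inter_subset_left : K ∩ {x | ⟪x, m⟫ ∈ Ioc a b} ⊆ K)]
  · have := sq_compare volume K ho.measurableSet (fK K subset_rfl) (fun x => β * f' ⟪x, m⟫) (fun x => fderiv ℝ u x e)
      (int _ ((continuous_const.mul (cf'.comp cm)).pow 2) K subset_rfl) (int _ (cdu.pow 2) K subset_rfl)
      (2 * ω) δ hδ (fun x hx => by rw [abs_sub_comm]; linarith [o2 x hx])
    rw [hall (fun s => f' s ^ 2) (cf'.pow 2), ← integral_const_mul]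
    simp only [mul_pow] at this
    linarith [ve K subset_rfl]

end HelpersE2

section HelpersE3
open scoped Pointwise

theorem pi_sq_bounds : 9.8 < π ^ 2 ∧ π ^ 2 < 9.87 := by
  have h1 := Real.pi_gt_d4
  have h2 := Real.pi_lt_d4
  constructor <;> nlinarith

theorem SecD.ii {k : ℕ} {Φ : (ℝ × (Fin (k+1) → ℝ)) ≃L[ℝ] EuclideanSpace ℝ (Fin (k+2))}
    {m : EuclideanSpace ℝ (Fin (k+2))} {K : Set (EuclideanSpace ℝ (Fin (k+2)))} {s1 s2 : ℝ} (hS : SecD Φ m K s1 s2) :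
    IntervalIntegrable (fun s => volume.real (secK (Φ ⁻¹' K) s)) volume s1 s2 := by
  have := hS.2.2.2.2.2.1 (fun _ => 1) continuous_const
  simp only [one_mul] at this
  exact this.intervalIntegrable

theorem cell_A {k : ℕ} {u : EuclideanSpace ℝ (Fin (k+2)) → ℝ} {K : Set (EuclideanSpace ℝ (Fin (k+2)))}
    {e m : EuclideanSpace ℝ (Fin (k+2))} {Φ : (ℝ × (Fin (k+1) → ℝ)) ≃L[ℝ] EuclideanSpace ℝ (Fin (k+2))}
    {β δ s1 s2 : ℝ} (hC : CellD u K e m Φ β δ s1 s2) (hβ : 0 < β) (hδ : 0 < δ) (hδ1 : δ ≤ 1 / 1000) :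
    (π ^ 2 - 41 * δ) * (∫ x in K, u x ^ 2) ≤ ∫ x in K, (fderiv ℝ u x e) ^ 2 := by
  obtain ⟨hS, hL, f, f', hf, cf', hmean, hM, -, hB⟩ := hC
  have hA := oned_A f f' (fun s => volume.real (secK (Φ ⁻¹' K) s)) s1 s2 hS.1 hf cf' (fun _ => measureReal_nonneg) hS.2.2.2.1
    hS.2.2.2.2.1 hS.ii hmean
  have hB0 : 0 ≤ ∫ s in s1..s2, f' s ^ 2 * volume.real (secK (Φ ⁻¹' K) s) :=
    intervalIntegral.integral_nonneg hS.1.le fun s _ => mul_nonneg (sq_nonneg _) measureReal_nonneg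
  have hM0 : 0 ≤ ∫ x in K, u x ^ 2 := integral_nonneg fun _ => sq_nonneg _
  set M := ∫ x in K, u x ^ 2
  set R := ∫ x in K, (fderiv ℝ u x e) ^ 2
  set A := ∫ s in s1..s2, f s ^ 2 * volume.real (secK (Φ ⁻¹' K) s)
  set B := ∫ s in s1..s2, f' s ^ 2 * volume.real (secK (Φ ⁻¹' K) s)
  have p := pi_sq_bounds
  have hL2 : (s2 - s1) ^ 2 ≤ β ^ 2 * (1 + δ) := by
    have : (s2 - s1) ^ 2 ≤ (β * (1 + δ / 3)) ^ 2 := pow_le_pow_left₀ (by linarith [hS.1]) hL 2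
    refine this.trans ?_
    rw [mul_pow]
    apply mul_le_mul_of_nonneg_left _ (sq_nonneg _)
    nlinarith
  have h1 : π ^ 2 * A ≤ (1 + δ) * ((1 + δ) * R + δ * M) := by
    have a1 := mul_le_mul_of_nonneg_right hL2 hB0
    have a2 := mul_le_mul_of_nonneg_left hB (by linarith : 0 ≤ 1 + δ)
    nlinarith only [a1, a2, hA]
  have h2 : π ^ 2 * (M * (1 - δ)) ≤ (1 + δ) ^ 2 * ((1 + δ) * R + δ * M) := by
    have a1 : M * (1 - δ) ≤ (1 + δ) * A := by linarith
    have a2 := mul_le_mul_of_nonneg_left a1 (sq_nonneg π)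
    have a3 := mul_le_mul_of_nonneg_left h1 (by linarith : 0 ≤ 1 + δ)
    nlinarith only [a2, a3]
  by_contra hcon
  push Not at hcon
  have h3 : (1 + δ) ^ 3 * R ≤ (1 + 3.01 * δ) * ((π ^ 2 - 41 * δ) * M) := by
    have b1 : (1 + δ) ^ 3 ≤ 1 + 3.01 * δ := by nlinarith [mul_pos hδ hδ]
    have b2 : 0 ≤ (π ^ 2 - 41 * δ) * M := mul_nonneg (by linarith) hM0
    calc _ ≤ (1 + δ) ^ 3 * ((π ^ 2 - 41 * δ) * M) := mul_le_mul_of_nonneg_left hcon.le (by positivity)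
      _ ≤ _ := mul_le_mul_of_nonneg_right b1 b2
  have hMp : 0 < M := by
    rcases hM0.eq_or_lt with h | h
    · exfalso
      rw [← h] at hcon
      have : 0 ≤ R := integral_nonneg fun _ => sq_nonneg _
      linarith
    · exact h
  have h4 : π ^ 2 * (1 - δ) * M ≤ ((1 + 3.01 * δ) * (π ^ 2 - 41 * δ) + (1 + δ) ^ 2 * δ) * M := by
    nlinarith only [h2, h3]
  have h5 := le_of_mul_le_mul_right h4 hMp
  nlinarith only [h5, hδ, hδ1, p.1, p.2, mul_pos hδ hδ, mul_pos hδ (mul_pos hδ hδ), mul_le_mul_of_nonneg_left hδ1 (mul_pos hδ hδ).le,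
    mul_le_mul_of_nonneg_left p.2.le hδ.le, mul_le_mul_of_nonneg_left hδ1 hδ.le]

theorem cell_B {k : ℕ} {u : EuclideanSpace ℝ (Fin (k+2)) → ℝ} {K : Set (EuclideanSpace ℝ (Fin (k+2)))}
    {e m : EuclideanSpace ℝ (Fin (k+2))} {Φ : (ℝ × (Fin (k+1) → ℝ)) ≃L[ℝ] EuclideanSpace ℝ (Fin (k+2))}
    {β δ s1 s2 : ℝ} (hC : CellD u K e m Φ β δ s1 s2) (hβ : 0 < β) (hδ : 0 < δ) (g : ℝ) (hδ1 : δ ≤ g / 100)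
    (hg1 : g ≤ 1 / 1000) (hMp : 0 < ∫ x in K, u x ^ 2)
    (hR : ∫ x in K, (fderiv ℝ u x e) ^ 2 ≤ (π ^ 2 + g) * ∫ x in K, u x ^ 2) :
    β * (1 - g / 4) ≤ s2 - s1 ∧ ∀ τ : ℝ, 0 < τ → τ ≤ 1 / 40 → 2 * √g ≤ 0.4 * τ →
      (∀ x y, s1 + 2 * τ * (s2 - s1) ≤ x → x ≤ s2 - 2 * τ * (s2 - s1) → s1 + 2 * τ * (s2 - s1) ≤ y →
        y ≤ s2 - 2 * τ * (s2 - s1) →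
        |log (volume.real (secK (Φ ⁻¹' K) y)) - log (volume.real (secK (Φ ⁻¹' K) x))| ≤ 8 * √g / τ) ∧
      (8 * √g / τ ≤ log 2 → (∫ x in K, u x ^ 2) ≤
        13 * ∫ x in K ∩ {x | ⟪x, m⟫ ∈ Ioc (s1 + (s2 - s1) / 20) (s2 - (s2 - s1) / 20)}, u x ^ 2) := by
  have hg : 0 < g := by linarith
  obtain ⟨hS, hL, f, f', hf, cf', hmean, hM, hMab, hB⟩ := hC
  have hA := oned_A f f' (fun s => volume.real (secK (Φ ⁻¹' K) s)) s1 s2 hS.1 hf cf' (fun _ => measureReal_nonneg) hS.2.2.2.1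
    hS.2.2.2.2.1 hS.ii hmean
  have oB := oned_B f f' (fun s => volume.real (secK (Φ ⁻¹' K) s)) s1 s2 hS.1 hf cf' (fun _ => measureReal_nonneg) hS.2.2.2.1
    hS.2.2.2.2.1 hS.ii hmean
  have oM := oned_mid f f' (fun s => volume.real (secK (Φ ⁻¹' K) s)) s1 s2 hS.1 hf cf' (fun _ => measureReal_nonneg) hS.2.2.2.1
    hS.2.2.2.2.1 hS.ii ((s2 - s1) / 20) rfl
  have hMm := hMab (s1 + (s2 - s1) / 20) (s2 - (s2 - s1) / 20) (by linarith [hS.1])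
  have hB0 : 0 ≤ ∫ s in s1..s2, f' s ^ 2 * volume.real (secK (Φ ⁻¹' K) s) :=
    intervalIntegral.integral_nonneg hS.1.le fun s _ => mul_nonneg (sq_nonneg _) measureReal_nonneg
  set M := ∫ x in K, u x ^ 2
  set R := ∫ x in K, (fderiv ℝ u x e) ^ 2
  set A := ∫ s in s1..s2, f s ^ 2 * volume.real (secK (Φ ⁻¹' K) s)
  set B := ∫ s in s1..s2, f' s ^ 2 * volume.real (secK (Φ ⁻¹' K) s)
  have p := pi_sq_bounds
  have hAM : M * (1 - δ) ≤ (1 + δ) * A := by linarith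
  have hMA : M ≤ (1 + 2.1 * δ) * A := by
    have : 0 < A := by
      have : 0 < (1 + δ) * A := lt_of_lt_of_le (mul_pos hMp (by linarith)) hAM
      exact pos_of_mul_pos_right this (by linarith)
    have h2 : (1 + δ) * A ≤ ((1 + 2.1 * δ) * A) * (1 - δ) := by
      have : (1 + δ) ≤ (1 + 2.1 * δ) * (1 - δ) := by nlinarith
      nlinarith
    exact le_of_mul_le_mul_right (hAM.trans h2) (by linarith)
  have hAp : 0 < A := by
    have : 0 < (1 + 2.1 * δ) * A := hMp.trans_le hMA
    exact pos_of_mul_pos_right this (by linarith)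
  have hBM : β ^ 2 * B ≤ (π ^ 2 + 1.4 * g) * A := by
    have a1 : β ^ 2 * B ≤ ((1 + δ) * (π ^ 2 + g) + δ) * M := by nlinarith only [hB, hR, hδ]
    have a2 : (1 + δ) * (π ^ 2 + g) + δ ≤ π ^ 2 + g + 11 * δ := by nlinarith only [hδ, p.2, hg1, hg]
    have a3 : ((1 + δ) * (π ^ 2 + g) + δ) * M ≤ (π ^ 2 + g + 11 * δ) * ((1 + 2.1 * δ) * A) :=
      mul_le_mul a2 hMA hMp.le (by positivity)
    have a4 : (π ^ 2 + g + 11 * δ) * (1 + 2.1 * δ) ≤ π ^ 2 + 1.4 * g := by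
      nlinarith only [hδ, p.2, hg1, hg, hδ1, mul_le_mul_of_nonneg_left p.2.le hδ.le, mul_le_mul_of_nonneg_left hg1 hδ.le,
        mul_le_mul_of_nonneg_left (hδ1.trans (by linarith : g / 100 ≤ 1/1000)) hδ.le]
    nlinarith only [a1, a3, a4, hAp]
  have hL2 : (s2 - s1) ^ 2 ≤ β ^ 2 * (1 + δ) := by
    have : (s2 - s1) ^ 2 ≤ (β * (1 + δ / 3)) ^ 2 := pow_le_pow_left₀ (by linarith [hS.1]) hL 2
    refine this.trans ?_
    rw [mul_pow]
    apply mul_le_mul_of_nonneg_left _ (sq_nonneg _)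
    nlinarith
  have hLB : (s2 - s1) ^ 2 * B ≤ (π ^ 2 + 2 * g) * A := by
    have a1 := mul_le_mul_of_nonneg_right hL2 hB0
    have a2 := mul_le_mul_of_nonneg_left hBM (by linarith : 0 ≤ 1 + δ)
    have a3 : (1 + δ) * (π ^ 2 + 1.4 * g) ≤ π ^ 2 + 2 * g := by nlinarith only [hδ, p.2, hg1, hg, hδ1]
    have a4 := mul_le_mul_of_nonneg_right a3 hAp.le
    nlinarith only [a1, a2, a4]
  constructor
  · by_contra hcon
    push Not at hcon
    have b1 : (s2 - s1) ^ 2 ≤ (β * (1 - g / 4)) ^ 2 := pow_le_pow_left₀ (by linarith [hS.1]) hcon.le 2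
    have b2 := mul_le_mul_of_nonneg_right b1 hB0
    have b3 := mul_le_mul_of_nonneg_left hBM (sq_nonneg (1 - g / 4))
    have b4 : π ^ 2 * A ≤ ((1 - g / 4) ^ 2 * (π ^ 2 + 1.4 * g)) * A := by nlinarith only [hA, b2, b3]
    have b5 := le_of_mul_le_mul_right b4 hAp
    nlinarith only [b5, p.1, p.2, hg, hg1, mul_pos hg hg, mul_le_mul_of_nonneg_left hg1 hg.le, mul_le_mul_of_nonneg_left p.1.le hg.le,
      mul_le_mul_of_nonneg_left hg1 (mul_pos hg hg).le, mul_le_mul_of_nonneg_left p.2.le (mul_pos hg hg).le]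
  · intro τ hτ hτ1 hτg
    have sq4 : √(2 * (2 * g)) = 2 * √g := by
      rw [show 2 * (2 * g) = 2 ^ 2 * g by ring, Real.sqrt_mul (by norm_num), Real.sqrt_sq (by norm_num)]
    have log_b : (∀ x y, s1 + 2 * τ * (s2 - s1) ≤ x → x ≤ s2 - 2 * τ * (s2 - s1) → s1 + 2 * τ * (s2 - s1) ≤ y →
        y ≤ s2 - 2 * τ * (s2 - s1) →
        |log (volume.real (secK (Φ ⁻¹' K) y)) - log (volume.real (secK (Φ ⁻¹' K) x))| ≤ 8 * √g / τ) := by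
      intro x y hx1 hx2 hy1 hy2
      have o := oB (2 * g) τ (by linarith) (by linarith) hτ (by linarith) (by rw [sq4]; exact hτg) hAp hLB
      rw [sq4, show 4 * (2 * √g) = 8 * √g by ring] at o
      rcases le_total x y with h | h
      · exact o x y hx1 h hy2
      · rw [abs_sub_comm]; exact o y x hy1 h hx2
    refine ⟨log_b, fun hl2 => ?_⟩
    have hLp : 0 < s2 - s1 := by linarith [hS.1]
    have hh : ∀ x y, s1 + (s2 - s1) / 20 ≤ x → x ≤ s2 - (s2 - s1) / 20 → s1 + (s2 - s1) / 20 ≤ y → y ≤ s2 - (s2 - s1) / 20 →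
        volume.real (secK (Φ ⁻¹' K) x) ≤ 2 * volume.real (secK (Φ ⁻¹' K) y) := by
      intro x y hx1 hx2 hy1 hy2
      have ht : 2 * τ * (s2 - s1) ≤ (s2 - s1) / 20 := by nlinarith
      have l := log_b y x (by linarith) (by linarith) (by linarith) (by linarith)
      have px := hS.2.2.2.1 x ⟨by linarith, by linarith⟩
      have py := hS.2.2.2.1 y ⟨by linarith, by linarith⟩
      have := (le_abs_self _).trans (l.trans hl2)
      have h2 : log (volume.real (secK (Φ ⁻¹' K) x)) ≤ log (2 * volume.real (secK (Φ ⁻¹' K) y)) := by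
        rw [Real.log_mul (by norm_num) py.ne']; linarith
      exact (Real.log_le_log_iff px (by positivity)).1 h2
    have := oM hh (hLB.trans (mul_le_mul_of_nonneg_right (by linarith [p.2]) hAp.le))
    nlinarith only [this, hMm, hMA, hδ, hδ1, hg1, hMp, hAp, mul_le_mul_of_nonneg_right (hδ1.trans (by linarith : g / 100 ≤ 1/100000)) hMp.le, mul_le_mul_of_nonneg_right (hδ1.trans (by linarith : g / 100 ≤ 1/100000)) hAp.le, show (0:ℝ) ≤ ∫ x in K ∩ {x | ⟪x, m⟫ ∈ Ioc (s1 + (s2 - s1) / 20) (s2 - (s2 - s1) / 20)}, u x ^ 2 from integral_nonneg fun _ => sq_nonneg _, mul_le_mul_of_nonneg_right (hδ1.trans (by linarith : g / 100 ≤ 1/100000)) (show (0:ℝ) ≤ ∫ x in K ∩ {x | ⟪x, m⟫ ∈ Ioc (s1 + (s2 - s1) / 20) (s2 - (s2 - s1) / 20)}, u x ^ 2 from integral_nonneg fun _ => sq_nonneg _)]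

end HelpersE3

section HelpersG2
open scoped Pointwise

theorem mem_projK {k : ℕ} {Φ : (ℝ × (Fin (k+1) → ℝ)) ≃L[ℝ] EuclideanSpace ℝ (Fin (k+2))}
    {m v : EuclideanSpace ℝ (Fin (k+2))} (hm : ∀ p, ⟪Φ p, m⟫ = p.1) (hv : ∀ p, ⟪Φ p, v⟫ = p.2 0)
    (K : Set (EuclideanSpace ℝ (Fin (k+2)))) (s z : ℝ) :
    z ∈ projK (Φ ⁻¹' K) s ↔ ∃ x ∈ K, ⟪x, m⟫ = s ∧ ⟪x, v⟫ = z := by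
  constructor
  · rintro ⟨y, hy, rfl⟩
    exact ⟨Φ (s, y), hy, by rw [hm], by rw [hv]⟩
  · rintro ⟨x, hx, h1, h2⟩
    have e : x = Φ (Φ.symm x) := by simp
    rw [e, hm] at h1
    rw [e, hv] at h2
    refine ⟨(Φ.symm x).2, ?_, h2⟩
    show Φ (s, (Φ.symm x).2) ∈ K
    rw [← h1]
    simpa using hx

theorem station {k : ℕ} {Φ : (ℝ × (Fin (k+1) → ℝ)) ≃L[ℝ] EuclideanSpace ℝ (Fin (k+2))}
    {m v : EuclideanSpace ℝ (Fin (k+2))} (hm : ∀ p, ⟪Φ p, m⟫ = p.1) (hv : ∀ p, ⟪Φ p, v⟫ = p.2 0)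
    (J : Finset (Set (EuclideanSpace ℝ (Fin (k+2))))) (s1 s2 : Set (EuclideanSpace ℝ (Fin (k+2))) → ℝ)
    (hS : ∀ K ∈ J, SecD Φ m K (s1 K) (s2 K)) (ho : ∀ K ∈ J, IsOpen K) (hc : ∀ K ∈ J, Convex ℝ K)
    (hb : ∀ K ∈ J, IsBounded K)
    (G : Set (EuclideanSpace ℝ (Fin (k+2)))) (hG : ∀ K ∈ J, K ⊆ G) (hP : ∀ K ∈ J, PSat m v G K)
    (hdis : ∀ K ∈ J, ∀ K' ∈ J, K ≠ K' → Disjoint K K')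
    (τ θ : ℝ) (hτ : 0 < τ) (hθ : 2 * θ < log (1 + (1 / 5 : ℝ) ^ (k+1)))
    (hlog : ∀ K ∈ J, ∀ x y, s1 K + 2 * τ * (s2 K - s1 K) ≤ x → x ≤ s2 K - 2 * τ * (s2 K - s1 K) →
       s1 K + 2 * τ * (s2 K - s1 K) ≤ y → y ≤ s2 K - 2 * τ * (s2 K - s1 K) →
        |log (volume.real (secK (Φ ⁻¹' K) y)) - log (volume.real (secK (Φ ⁻¹' K) x))| ≤ θ)
    (x₀ s c H : ℝ) (hH : 0 ≤ H)
    (hx₀ : ∀ K ∈ J, s1 K + 2 * τ * (s2 K - s1 K) ≤ x₀ ∧ x₀ ≤ s2 K - 2 * τ * (s2 K - s1 K))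
    (hs : ∀ K ∈ J, s1 K + 2 * τ * (s2 K - s1 K) ≤ s ∧ s ≤ s2 K - 2 * τ * (s2 K - s1 K))
    (hwin : ∀ K ∈ J, ∀ x ∈ K, ⟪x, m⟫ = s → |⟪x, v⟫ - c| ≤ H) :
    ∑ K ∈ J, volume.real (projK (Φ ⁻¹' K) x₀) ≤ 4 * 5 ^ (k+1) * (2 * H) := by
  have hb' : ∀ K ∈ J, IsBounded (Φ ⁻¹' K) := by
    intro K hK
    have := (Φ.symm : EuclideanSpace ℝ (Fin (k+2)) →L[ℝ] (ℝ × (Fin (k+1) → ℝ))).lipschitz.isBounded_image (hb K hK)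
    apply this.subset
    intro p hp
    exact ⟨Φ p, hp, by simp⟩
  have hc' : ∀ K ∈ J, Convex ℝ (Φ ⁻¹' K) := fun K hK =>
    (hc K hK).linear_preimage (Φ : (ℝ × (Fin (k+1) → ℝ)) →L[ℝ] _).toLinearMap
  have ho' : ∀ K ∈ J, IsOpen (Φ ⁻¹' K) := fun K hK => (ho K hK).preimage Φ.continuous
  have inI : ∀ K ∈ J, ∀ x, s1 K + 2 * τ * (s2 K - s1 K) ≤ x → x ≤ s2 K - 2 * τ * (s2 K - s1 K) → x ∈ Ioo (s1 K) (s2 K) := by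
    intro K hK x h1 h2
    have : 0 < s2 K - s1 K := by linarith [(hS K hK).1]
    have : 0 < 2 * τ * (s2 K - s1 K) := by positivity
    exact ⟨by linarith, by linarith⟩
  have step : ∀ K ∈ J, volume.real (projK (Φ ⁻¹' K) x₀) ≤ 4 * 5 ^ (k+1) * volume.real (projK (Φ ⁻¹' K) s) := by
    intro K hK
    obtain ⟨a1, a2⟩ := hx₀ K hK
    obtain ⟨b1, b2⟩ := hs K hK
    have m1 : s1 K + 2 * τ * (s2 K - s1 K) ≤ (s + x₀) / 2 := by linarith
    have m2 : (s + x₀) / 2 ≤ s2 K - 2 * τ * (s2 K - s1 K) := by linarith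
    have S := hS K hK
    apply proj_width (Φ ⁻¹' K) (ho' K hK) (hc' K hK) (hb' K hK) s x₀ ((S.2.1 s).2 (inI K hK s b1 b2))
      ((S.2.1 x₀).2 (inI K hK x₀ a1 a2))
    have ps := S.2.2.2.1 s (inI K hK s b1 b2)
    have px := S.2.2.2.1 x₀ (inI K hK x₀ a1 a2)
    have pm := S.2.2.2.1 ((s + x₀) / 2) (inI K hK _ m1 m2)
    rw [← Real.log_lt_log_iff (by positivity) (by positivity), Real.log_pow,
      Real.log_mul (by positivity) (by positivity), Real.log_mul ps.ne' px.ne']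
    have l1 := (le_abs_self _).trans (hlog K hK s ((s + x₀) / 2) b1 b2 m1 m2)
    have l2 := (le_abs_self _).trans (hlog K hK x₀ ((s + x₀) / 2) a1 a2 m1 m2)
    push_cast
    linarith
  have dis : Set.PairwiseDisjoint (↑J : Set (Set (EuclideanSpace ℝ (Fin (k+2))))) (fun K => projK (Φ ⁻¹' K) s) := by
    intro K hK K' hK' hne
    rw [Function.onFun, Set.disjoint_left]
    intro z hz hz'
    rw [mem_projK hm hv] at hz hz'
    obtain ⟨x, hx, h1, h2⟩ := hz
    obtain ⟨y, hy, h3, h4⟩ := hz'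
    have : y ∈ K := hP K hK x hx y (hG K' hK' hy) (by rw [inner_sub_left]; linarith) (by rw [inner_sub_left]; linarith)
    exact Set.disjoint_left.1 (hdis K hK K' hK' hne) this hy
  have sub : ∀ K ∈ J, projK (Φ ⁻¹' K) s ⊆ Icc (c - H) (c + H) := by
    intro K hK z hz
    rw [mem_projK hm hv] at hz
    obtain ⟨x, hx, h1, h2⟩ := hz
    have := abs_le.1 (hwin K hK x hx h1)
    rw [h2] at this
    exact ⟨by linarith, by linarith⟩
  have meas : ∀ K ∈ J, MeasurableSet (projK (Φ ⁻¹' K) s) := by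
    intro K hK
    obtain ⟨b1, b2⟩ := hs K hK
    obtain ⟨a, b, -, e⟩ := projK_Ioo _ (ho' K hK) (hc' K hK) (hb' K hK) s (((hS K hK).2.1 s).2 (inI K hK s b1 b2))
    rw [e]; exact measurableSet_Ioo
  calc _ ≤ ∑ K ∈ J, 4 * 5 ^ (k+1) * volume.real (projK (Φ ⁻¹' K) s) := Finset.sum_le_sum step
    _ = 4 * 5 ^ (k+1) * ∑ K ∈ J, volume.real (projK (Φ ⁻¹' K) s) := by rw [Finset.mul_sum]
    _ = 4 * 5 ^ (k+1) * volume.real (⋃ K ∈ J, projK (Φ ⁻¹' K) s) := by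
      rw [measureReal_biUnion_finset dis meas
        (fun K hK => ((measure_mono (sub K hK)).trans_lt (by simp)).ne)]
    _ ≤ 4 * 5 ^ (k+1) * volume.real (Icc (c - H) (c + H)) := by
      apply mul_le_mul_of_nonneg_left _ (by positivity)
      exact measureReal_mono (iUnion₂_subset sub) (by simp)
    _ = _ := by rw [Real.volume_real_Icc_of_le (by linarith)]; ring

end HelpersG2

section HelpersG3
open scoped Pointwise

/-- Planar projection onto the plane spanned by `m` and `v`. -/
def pl {N : ℕ} (m v x : EuclideanSpace ℝ (Fin N)) : ℂ := ⟨⟪x, m⟫, ⟪x, v⟫⟩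

theorem pl_sub {N : ℕ} (m v x y : EuclideanSpace ℝ (Fin N)) : pl m v (x - y) = pl m v x - pl m v y := by
  apply Complex.ext <;> simp [pl, inner_sub_left]

theorem pl_comb {N : ℕ} (m v x y : EuclideanSpace ℝ (Fin N)) (a b : ℝ) :
    pl m v (a • x + b • y) = a • pl m v x + b • pl m v y := by
  apply Complex.ext <;> simp [pl, inner_add_left, real_inner_smul_left]

theorem pl_norm_le {N : ℕ} {m v : EuclideanSpace ℝ (Fin N)} (hm : ‖m‖ = 1) (hv : ‖v‖ = 1) (hmv : ⟪m, v⟫ = 0)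
    (x : EuclideanSpace ℝ (Fin N)) : ‖pl m v x‖ ≤ ‖x‖ := by
  have h : 0 ≤ ‖x - (⟪x, m⟫ • m + ⟪x, v⟫ • v)‖ ^ 2 := sq_nonneg _
  have e : ‖x - (⟪x, m⟫ • m + ⟪x, v⟫ • v)‖ ^ 2 = ‖x‖ ^ 2 - (⟪x, m⟫ ^ 2 + ⟪x, v⟫ ^ 2) := by
    rw [norm_sub_sq_real, norm_add_sq_real, inner_add_right, real_inner_smul_right, real_inner_smul_right,
      real_inner_smul_right, real_inner_smul_left, hmv, norm_smul, norm_smul, hm, hv, Real.norm_eq_abs, Real.norm_eq_abs,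
      mul_one, mul_one, sq_abs, sq_abs]
    ring
  have e2 : ‖pl m v x‖ ^ 2 = ⟪x, m⟫ ^ 2 + ⟪x, v⟫ ^ 2 := by
    rw [Complex.sq_norm, Complex.normSq_apply]; simp [pl]; ring
  rw [e] at h
  exact le_of_sq_le_sq (by rw [e2]; linarith) (norm_nonneg _)
where le_of_sq_le_sq {a b : ℝ} (h : a ^ 2 ≤ b ^ 2) (hb : 0 ≤ b) : a ≤ b := abs_le_of_sq_le_sq' h hb |>.2

theorem pl_dir {N : ℕ} {m v : EuclideanSpace ℝ (Fin N)} (hm : ‖m‖ = 1) (hv : ‖v‖ = 1) (hmv : ⟪m, v⟫ = 0)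
    (t a b : ℝ) (hab : a ^ 2 + b ^ 2 = 1) : ‖pl m v (t • (a • m + b • v))‖ = |t| := by
  have hvm : ⟪v, m⟫ = 0 := by rw [real_inner_comm]; exact hmv
  have e2 : ‖pl m v (t • (a • m + b • v))‖ ^ 2 = |t| ^ 2 := by
    rw [Complex.sq_norm, Complex.normSq_apply]
    simp only [pl, real_inner_smul_left, inner_add_left, real_inner_self_eq_norm_sq, hm, hv, hmv, hvm, sq_abs]
    linear_combination t ^ 2 * hab
  exact (sq_eq_sq₀ (norm_nonneg _) (abs_nonneg _)).1 e2

/-- Nonsteep bad cell data. -/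
def NCell {k : ℕ} (m v : EuclideanSpace ℝ (Fin (k+2))) (Φ : (ℝ × (Fin (k+1) → ℝ)) ≃L[ℝ] EuclideanSpace ℝ (Fin (k+2)))
    (G : Set (EuclideanSpace ℝ (Fin (k+2)))) (g ρ τ θ B0 : ℝ) (K : Set (EuclideanSpace ℝ (Fin (k+2)))) (s1 s2 : ℝ) : Prop :=
  SecD Φ m K s1 s2 ∧ IsOpen K ∧ Convex ℝ K ∧ K ⊆ G ∧ PSat m v G K ∧
  (∀ x y, s1 + 2 * τ * (s2 - s1) ≤ x → x ≤ s2 - 2 * τ * (s2 - s1) →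
       s1 + 2 * τ * (s2 - s1) ≤ y → y ≤ s2 - 2 * τ * (s2 - s1) →
        |log (volume.real (secK (Φ ⁻¹' K) y)) - log (volume.real (secK (Φ ⁻¹' K) x))| ≤ θ) ∧
  s2 - s1 ≤ 2 ∧ ∃ a b : ℝ, 0.01 ≤ a ∧ a ^ 2 + b ^ 2 = 1 ∧ |b| ≤ B0 ∧ a * (1 - g / 4) ≤ s2 - s1 ∧
    ∀ x ∈ K, ∀ y ∈ K, ∃ t : ℝ, ‖x - y - t • (a • m + b • v)‖ ≤ ρ

theorem NCell.window {k : ℕ} {m v : EuclideanSpace ℝ (Fin (k+2))} {Φ : (ℝ × (Fin (k+1) → ℝ)) ≃L[ℝ] EuclideanSpace ℝ (Fin (k+2))}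
    {G : Set (EuclideanSpace ℝ (Fin (k+2)))} {g ρ τ θ B0 : ℝ} {K : Set (EuclideanSpace ℝ (Fin (k+2)))} {s1 s2 : ℝ}
    (hC : NCell m v Φ G g ρ τ θ B0 K s1 s2) (hm : ‖m‖ = 1) (hv : ‖v‖ = 1) (hmv : ⟪m, v⟫ = 0)
    (x y : EuclideanSpace ℝ (Fin (k+2))) (hx : x ∈ K) (hy : y ∈ K) (d : ℝ) (hd : |⟪x, m⟫ - ⟪y, m⟫| ≤ d) :
    |⟪x, v⟫ - ⟪y, v⟫| ≤ 100 * (d + ρ) * B0 + ρ := by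
  obtain ⟨-, -, -, -, -, -, -, a, b, ha, hab, hb, -, hth⟩ := hC
  obtain ⟨t, ht⟩ := hth x hx y hy
  have hvm : ⟪v, m⟫ = 0 := by rw [real_inner_comm]; exact hmv
  set r := x - y - t • (a • m + b • v) with hr
  have rm : |⟪r, m⟫| ≤ ρ := by
    refine (abs_real_inner_le_norm _ _).trans ?_; rw [hm, mul_one]; exact ht
  have rv : |⟪r, v⟫| ≤ ρ := by
    refine (abs_real_inner_le_norm _ _).trans ?_; rw [hv, mul_one]; exact ht
  have e1 : ⟪r, m⟫ = ⟪x, m⟫ - ⟪y, m⟫ - t * a := by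
    simp only [hr, inner_sub_left, real_inner_smul_left, inner_add_left, real_inner_self_eq_norm_sq, hm, hvm]; ring
  have e2 : ⟪r, v⟫ = ⟪x, v⟫ - ⟪y, v⟫ - t * b := by
    simp only [hr, inner_sub_left, real_inner_smul_left, inner_add_left, real_inner_self_eq_norm_sq, hv, hmv]; ring
  have ta : |t| * 0.01 ≤ d + ρ := by
    have : |t * a| ≤ d + ρ := by
      have : t * a = (⟪x, m⟫ - ⟪y, m⟫) - ⟪r, m⟫ := by rw [e1]; ring
      rw [this]
      exact (abs_sub _ _).trans (add_le_add hd rm)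
    rw [abs_mul, abs_of_nonneg (by linarith : 0 ≤ a)] at this
    exact (mul_le_mul_of_nonneg_left ha (abs_nonneg t)).trans this
  have : ⟪x, v⟫ - ⟪y, v⟫ = t * b + ⟪r, v⟫ := by rw [e2]; ring
  rw [this]
  refine (abs_add_le _ _).trans (add_le_add ?_ rv)
  rw [abs_mul]
  exact mul_le_mul (by linarith) hb (abs_nonneg _) (by linarith [abs_nonneg t])

theorem NCell.plen {k : ℕ} {m v : EuclideanSpace ℝ (Fin (k+2))} {Φ : (ℝ × (Fin (k+1) → ℝ)) ≃L[ℝ] EuclideanSpace ℝ (Fin (k+2))}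
    {G : Set (EuclideanSpace ℝ (Fin (k+2)))} {g ρ τ θ B0 : ℝ} {K : Set (EuclideanSpace ℝ (Fin (k+2)))} {s1 s2 : ℝ}
    (hC : NCell m v Φ G g ρ τ θ B0 K s1 s2) (hm : ‖m‖ = 1) (hv : ‖v‖ = 1) (hmv : ⟪m, v⟫ = 0) (hρ : 0 < ρ) (hρg : ρ ≤ g / 500)
    (x y : EuclideanSpace ℝ (Fin (k+2))) (hx : x ∈ K) (hy : y ∈ K) (ex : ⟪x, m⟫ = s1 + ρ) (ey : ⟪y, m⟫ = s2 - ρ) :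
    1 - g ≤ ‖pl m v x - pl m v y‖ := by
  obtain ⟨-, -, -, -, -, -, -, a, b, ha, hab, hb, hL, hth⟩ := hC
  obtain ⟨t, ht⟩ := hth y hy x hx
  have hvm : ⟪v, m⟫ = 0 := by rw [real_inner_comm]; exact hmv
  set r := y - x - t • (a • m + b • v) with hr
  have rm : |⟪r, m⟫| ≤ ρ := by
    refine (abs_real_inner_le_norm _ _).trans ?_; rw [hm, mul_one]; exact ht
  have e1 : ⟪r, m⟫ = ⟪y, m⟫ - ⟪x, m⟫ - t * a := by
    simp only [hr, inner_sub_left, real_inner_smul_left, inner_add_left, real_inner_self_eq_norm_sq, hm, hvm]; ring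
  have ta : 1 - g / 4 - 300 * ρ ≤ t := by
    have h1 : t * a ≥ (s2 - s1) - 3 * ρ := by
      rw [ex, ey] at e1
      linarith [(abs_le.1 rm).2]
    have h2 : (1 - g / 4 - 300 * ρ) * a ≤ t * a := by nlinarith
    exact le_of_mul_le_mul_right h2 (by linarith)
  have n1 := pl_dir hm hv hmv t a b hab
  have n2 := (pl_norm_le hm hv hmv r).trans ht
  have e3 : pl m v (t • (a • m + b • v)) = (pl m v y - pl m v x) - pl m v r := by
    rw [← pl_sub, ← pl_sub]; congr 1; rw [hr]; abel
  have : |t| ≤ ‖pl m v y - pl m v x‖ + ρ := by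
    rw [← n1, e3]
    exact (norm_sub_le _ _).trans (add_le_add le_rfl n2)
  rw [norm_sub_rev]
  linarith [le_abs_self t]

theorem group_lemma {k : ℕ} {Φ : (ℝ × (Fin (k+1) → ℝ)) ≃L[ℝ] EuclideanSpace ℝ (Fin (k+2))}
    {m v : EuclideanSpace ℝ (Fin (k+2))} (hm : ‖m‖ = 1) (hv : ‖v‖ = 1) (hmv : ⟪m, v⟫ = 0)
    (hΦm : ∀ p, ⟪Φ p, m⟫ = p.1) (hΦv : ∀ p, ⟪Φ p, v⟫ = p.2 0)
    (G : Set (EuclideanSpace ℝ (Fin (k+2)))) (hG : ∀ x ∈ G, ∀ y ∈ G, ‖x - y‖ ≤ 1)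
    (g ρ τ θ B0 τ₁ : ℝ) (hg : 0 < g) (hg1 : g ≤ 1 / 10 ^ 8) (hρ : 0 < ρ) (hρg : ρ ≤ g / 500) (hτ : 0 < τ) (hτ1 : τ ≤ 1 / 40)
    (hB0 : 0 ≤ B0) (h1 : 4 * τ + 6 * √g ≤ τ₁) (h2 : τ₁ + 6 * √g + ρ + 4 * τ ≤ 0.009)
    (hθ : 2 * θ < log (1 + (1 / 5 : ℝ) ^ (k+1)))
    (J : Finset (Set (EuclideanSpace ℝ (Fin (k+2))))) (s1 s2 : Set (EuclideanSpace ℝ (Fin (k+2))) → ℝ)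
    (hJ : ∀ K ∈ J, NCell m v Φ G g ρ τ θ B0 K (s1 K) (s2 K))
    (hdis : ∀ K ∈ J, ∀ K' ∈ J, K ≠ K' → Disjoint K K')
    (x₀ : ℝ) (hx₀ : ∀ K ∈ J, s1 K + (s2 K - s1 K) / 20 ≤ x₀ ∧ x₀ ≤ s2 K - (s2 K - s1 K) / 20) :
    ∑ K ∈ J, volume.real (projK (Φ ⁻¹' K) x₀) ≤
      4 * 5 ^ (k+1) * (2 * (100 * (τ₁ + 6 * √g + ρ) * B0 + ρ + 6 * √g)) := by
  have sg : 0 < √g := Real.sqrt_pos.2 hg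
  have sg1 : √g ≤ 1 / 10 ^ 4 := by
    rw [Real.sqrt_le_left (by norm_num)]; refine hg1.trans (by norm_num)
  have τ1p : 0 < τ₁ := by linarith
  rcases J.eq_empty_or_nonempty with rfl | hne
  · simp; positivity
  have hL : ∀ K ∈ J, 0.0099 ≤ s2 K - s1 K := by
    intro K hK
    obtain ⟨-, -, -, -, -, -, -, a, b, ha, hab, hb, hL, hth⟩ := hJ K hK
    nlinarith
  have hL2 : ∀ K ∈ J, s2 K - s1 K ≤ 2 := fun K hK => (hJ K hK).2.2.2.2.2.2.1
  have hp : ∀ K, ∃ x, K ∈ J → x ∈ K ∧ ⟪x, m⟫ = s1 K + ρ := by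
    intro K
    by_cases hK : K ∈ J
    · obtain ⟨x, hx, ex⟩ := (hJ K hK).1.len_le hΦm (s1 K + ρ) ⟨by linarith, by linarith [hL K hK]⟩
      exact ⟨x, fun _ => ⟨hx, ex⟩⟩
    · exact ⟨0, fun h => absurd h hK⟩
  have hq : ∀ K, ∃ x, K ∈ J → x ∈ K ∧ ⟪x, m⟫ = s2 K - ρ := by
    intro K
    by_cases hK : K ∈ J
    · obtain ⟨x, hx, ex⟩ := (hJ K hK).1.len_le hΦm (s2 K - ρ) ⟨by linarith [hL K hK], by linarith⟩
      exact ⟨x, fun _ => ⟨hx, ex⟩⟩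
    · exact ⟨0, fun h => absurd h hK⟩
  choose p hp using hp
  choose q hq using hq
  have inG : ∀ K ∈ J, K ⊆ G := fun K hK => (hJ K hK).2.2.2.1
  have sat : ∀ K ∈ J, PSat m v G K := fun K hK => (hJ K hK).2.2.2.2.1
  have dpl : ∀ x ∈ G, ∀ y ∈ G, ‖pl m v x - pl m v y‖ ≤ 1 := by
    intro x hx y hy
    rw [← pl_sub]
    exact (pl_norm_le hm hv hmv _).trans (hG x hx y hy)
  have segm : ∀ K ∈ J, ∀ z ∈ segment ℝ (pl m v (p K)) (pl m v (q K)), ∃ x ∈ K, pl m v x = z := by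
    rintro K hK z ⟨a, b, ha, hb, hab, rfl⟩
    exact ⟨a • p K + b • q K, (hJ K hK).2.2.1 (hp K hK).1 (hq K hK).1 ha hb hab, pl_comb _ _ _ _ _ _⟩
  have sq9 : ∀ z : ℂ, ‖z‖ ^ 2 ≤ 9 * g → ‖z‖ ≤ 3 * √g := by
    intro z hz
    have : ‖z‖ ^ 2 ≤ (3 * √g) ^ 2 := by rw [mul_pow, Real.sq_sqrt hg.le]; linarith
    exact (abs_le_of_sq_le_sq' this (by positivity)).2
  have far : ∀ K ∈ J, ∀ K' ∈ J, ¬ ‖pl m v (p K) - pl m v (q K')‖ ≤ 3 * √g := by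
    intro K hK K' hK' h
    have a1 := (Complex.abs_re_le_norm _).trans h
    have a2 : (pl m v (p K) - pl m v (q K')).re = (s1 K + ρ) - (s2 K' - ρ) := by
      rw [← (hp K hK).2, ← (hq K' hK').2]; simp [pl]
    rw [a2] at a1
    have a3 := (abs_le.1 a1).1
    have := (hx₀ K hK).1
    have := (hx₀ K' hK').2
    have := hL K hK
    have := hL K' hK'
    linarith
  obtain ⟨K1, hK1, hstar⟩ := star_lemma J hne (fun K => pl m v (p K)) (fun K => pl m v (q K)) (3 * √g) (by
    intro K hK K' hK'
    by_cases he : K = K'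
    · left; rw [he]; simp
    have := pair_lemma Complex.finrank_real_complex (pl m v (p K)) (pl m v (q K)) (pl m v (p K')) (pl m v (q K')) g hg.le
      (by linarith) (by
        intro x hx y hy
        have : ∀ z ∈ ({pl m v (p K), pl m v (q K), pl m v (p K'), pl m v (q K')} : Set ℂ), ∃ w ∈ G, pl m v w = z := by
          intro z hz
          simp only [mem_insert_iff, mem_singleton_iff] at hz
          rcases hz with rfl | rfl | rfl | rfl
          · exact ⟨_, inG K hK (hp K hK).1, rfl⟩
          · exact ⟨_, inG K hK (hq K hK).1, rfl⟩
          · exact ⟨_, inG K' hK' (hp K' hK').1, rfl⟩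
          · exact ⟨_, inG K' hK' (hq K' hK').1, rfl⟩
        obtain ⟨w, hw, rfl⟩ := this x hx
        obtain ⟨w', hw', rfl⟩ := this y hy
        exact dpl w hw w' hw')
      ((hJ K hK).plen hm hv hmv hρ hρg _ _ (hp K hK).1 (hq K hK).1 (hp K hK).2 (hq K hK).2)
      ((hJ K' hK').plen hm hv hmv hρ hρg _ _ (hp K' hK').1 (hq K' hK').1 (hp K' hK').2 (hq K' hK').2)
      (by
        rw [Set.disjoint_left]
        intro z hz hz'
        obtain ⟨x, hx, ex⟩ := segm K hK z hz
        obtain ⟨y, hy, ey⟩ := segm K' hK' z hz'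
        have exy : pl m v x = pl m v y := by rw [ex, ey]
        have r1 : ⟪x, m⟫ = ⟪y, m⟫ := congrArg Complex.re exy
        have r2 : ⟪x, v⟫ = ⟪y, v⟫ := congrArg Complex.im exy
        have : y ∈ K := sat K hK x hx y (inG K' hK' hy) (by rw [inner_sub_left, r1, sub_self]) (by rw [inner_sub_left, r2, sub_self])
        exact Set.disjoint_left.1 (hdis K hK K' hK' he) this hy)
    rcases this with h | h | h | h
    · exact Or.inl (sq9 _ h)
    · exact Or.inr (sq9 _ h)
    · exact absurd (sq9 _ h) (far K hK K' hK')
    · rw [norm_sub_rev] at h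
      exact absurd (sq9 _ h) (far K' hK' K hK))
  have tauL : ∀ K ∈ J, 2 * τ * (s2 K - s1 K) ≤ 4 * τ ∧ 2 * τ * (s2 K - s1 K) ≤ (s2 K - s1 K) / 20 := by
    intro K hK
    have a := hL K hK
    have b := hL2 K hK
    constructor <;> nlinarith
  have hx₀' : ∀ K ∈ J, s1 K + 2 * τ * (s2 K - s1 K) ≤ x₀ ∧ x₀ ≤ s2 K - 2 * τ * (s2 K - s1 K) := by
    intro K hK
    have a := tauL K hK
    have b := hx₀ K hK
    exact ⟨by linarith, by linarith⟩
  have mainS := station hΦm hΦv J s1 s2 (fun K hK => (hJ K hK).1) (fun K hK => (hJ K hK).2.1) (fun K hK => (hJ K hK).2.2.1)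
    (fun K hK => (bdd_of_dist hG).subset (inG K hK)) G inG sat hdis τ θ hτ hθ (fun K hK => (hJ K hK).2.2.2.2.2.1) x₀
  rcases hstar with hst | hst
  · have cl : ∀ K ∈ J, |(s1 K1 + ρ) - (s1 K + ρ)| ≤ 6 * √g ∧ |⟪p K1, v⟫ - ⟪p K, v⟫| ≤ 6 * √g := by
      intro K hK
      have a := hst K hK
      have a1 := (Complex.abs_re_le_norm _).trans a
      have a2 := (Complex.abs_im_le_norm _).trans a
      have e1 : (pl m v (p K1) - pl m v (p K)).re = (s1 K1 + ρ) - (s1 K + ρ) := by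
        rw [← (hp K1 hK1).2, ← (hp K hK).2]; simp [pl]
      have e2 : (pl m v (p K1) - pl m v (p K)).im = ⟪p K1, v⟫ - ⟪p K, v⟫ := by simp [pl]
      rw [e1] at a1
      rw [e2] at a2
      exact ⟨by linarith, by linarith⟩
    apply mainS (s1 K1 + ρ + τ₁) ⟪p K1, v⟫ _ (by positivity) hx₀'
    · intro K hK
      have a := abs_le.1 (cl K hK).1
      have b := tauL K hK
      have c := hL K hK
      exact ⟨by linarith, by linarith⟩
    · intro K hK x hx ex
      have a := abs_le.1 (cl K hK).1
      have w := (hJ K hK).window hm hv hmv x (p K) hx (hp K hK).1 (τ₁ + 6 * √g) (by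
        rw [ex, (hp K hK).2, abs_le]; exact ⟨by linarith, by linarith⟩)
      have e : ⟪x, v⟫ - ⟪p K1, v⟫ = (⟪x, v⟫ - ⟪p K, v⟫) - (⟪p K1, v⟫ - ⟪p K, v⟫) := by ring
      rw [e]
      exact (abs_sub _ _).trans (add_le_add w (cl K hK).2)
  · have cl : ∀ K ∈ J, |(s2 K1 - ρ) - (s2 K - ρ)| ≤ 6 * √g ∧ |⟪q K1, v⟫ - ⟪q K, v⟫| ≤ 6 * √g := by
      intro K hK
      have a := hst K hK
      have a1 := (Complex.abs_re_le_norm _).trans a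
      have a2 := (Complex.abs_im_le_norm _).trans a
      have e1 : (pl m v (q K1) - pl m v (q K)).re = (s2 K1 - ρ) - (s2 K - ρ) := by
        rw [← (hq K1 hK1).2, ← (hq K hK).2]; simp [pl]
      have e2 : (pl m v (q K1) - pl m v (q K)).im = ⟪q K1, v⟫ - ⟪q K, v⟫ := by simp [pl]
      rw [e1] at a1
      rw [e2] at a2
      exact ⟨by linarith, by linarith⟩
    apply mainS (s2 K1 - ρ - τ₁) ⟪q K1, v⟫ _ (by positivity) hx₀'
    · intro K hK
      have a := abs_le.1 (cl K hK).1
      have b := tauL K hK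
      have c := hL K hK
      exact ⟨by linarith, by linarith⟩
    · intro K hK x hx ex
      have a := abs_le.1 (cl K hK).1
      have w := (hJ K hK).window hm hv hmv x (q K) hx (hq K hK).1 (τ₁ + 6 * √g) (by
        rw [ex, (hq K hK).2, abs_le]; exact ⟨by linarith, by linarith⟩)
      have e : ⟪x, v⟫ - ⟪q K1, v⟫ = (⟪x, v⟫ - ⟪q K, v⟫) - (⟪q K1, v⟫ - ⟪q K, v⟫) := by ring
      rw [e]
      exact (abs_sub _ _).trans (add_le_add w (cl K hK).2)

end HelpersG3

section HelpersJ1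
open scoped Pointwise

/-- Middle part of a cell. -/
def midK {N : ℕ} (m : EuclideanSpace ℝ (Fin N)) (K : Set (EuclideanSpace ℝ (Fin N))) (s1 s2 : ℝ) : Set (EuclideanSpace ℝ (Fin N)) :=
  K ∩ {x | ⟪x, m⟫ ∈ Ioc (s1 + (s2 - s1) / 20) (s2 - (s2 - s1) / 20)}

theorem line_measure {k : ℕ} (v : EuclideanSpace ℝ (Fin (k+2))) (hv : ‖v‖ = 1)
    (Ω : Set (EuclideanSpace ℝ (Fin (k+2)))) (hΩ : ∀ x ∈ Ω, ∀ y ∈ Ω, ‖x - y‖ ≤ 1)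
    (B : Finset (Set (EuclideanSpace ℝ (Fin (k+2)))))
    (grp : Set (EuclideanSpace ℝ (Fin (k+2))) → Set (EuclideanSpace ℝ (Fin (k+2))))
    (e' : Set (EuclideanSpace ℝ (Fin (k+2))) → EuclideanSpace ℝ (Fin (k+2)))
    (Φ : Set (EuclideanSpace ℝ (Fin (k+2))) → ((ℝ × (Fin (k+1) → ℝ)) ≃L[ℝ] EuclideanSpace ℝ (Fin (k+2))))
    (s1 s2 : Set (EuclideanSpace ℝ (Fin (k+2))) → ℝ)
    (hgrp : ∀ K ∈ B, ∀ K' ∈ B, grp K ≠ grp K' → Disjoint (grp K) (grp K'))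
    (hdis : ∀ K ∈ B, ∀ K' ∈ B, K ≠ K' → Disjoint K K')
    (hsub : ∀ K ∈ B, grp K ⊆ Ω) (hsat : ∀ K ∈ B, VSat v Ω (grp K))
    (he : ∀ K ∈ B, ‖e' (grp K)‖ = 1 ∧ ⟪e' (grp K), v⟫ = 0)
    (hΦ : ∀ K ∈ B, (∀ p, ⟪Φ (grp K) p, e' (grp K)⟫ = p.1) ∧ (∀ p, ⟪Φ (grp K) p, v⟫ = p.2 0))
    (g ρ τ θ B0 τ₁ : ℝ) (hg : 0 < g) (hg1 : g ≤ 1 / 10 ^ 8) (hρ : 0 < ρ) (hρg : ρ ≤ g / 500) (hτ : 0 < τ) (hτ1 : τ ≤ 1 / 40)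
    (hB0 : 0 ≤ B0) (h1 : 4 * τ + 6 * √g ≤ τ₁) (h2 : τ₁ + 6 * √g + ρ + 4 * τ ≤ 0.009)
    (hθ : 2 * θ < log (1 + (1 / 5 : ℝ) ^ (k+1)))
    (hB : ∀ K ∈ B, NCell (e' (grp K)) v (Φ (grp K)) (grp K) g ρ τ θ B0 K (s1 K) (s2 K)) (z : EuclideanSpace ℝ (Fin (k+2))) :
    volume {s : ℝ | z + s • v ∈ ⋃ K ∈ B, midK (e' (grp K)) K (s1 K) (s2 K)} ≤
      ENNReal.ofReal (4 * 5 ^ (k+1) * (2 * (100 * (τ₁ + 6 * √g + ρ) * B0 + ρ + 6 * √g))) := by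
  classical
  rcases (Set.eq_empty_or_nonempty {s : ℝ | z + s • v ∈ ⋃ K ∈ B, midK (e' (grp K)) K (s1 K) (s2 K)}) with h | ⟨s0, hs0⟩
  · rw [h]; simp
  simp only [mem_ofPred_eq, mem_iUnion] at hs0
  obtain ⟨K0, hK0, hz0⟩ := hs0
  have inG0 : z + s0 • v ∈ grp K0 := (hB K0 hK0).2.2.2.1 hz0.1
  set G := grp K0 with hG
  set m := e' G with hm
  have hmv := (he K0 hK0).2
  have hvm : ⟪v, m⟫ = 0 := by rw [real_inner_comm]; exact hmv
  set J := B.filter fun K => grp K = G ∧ (s1 K + (s2 K - s1 K) / 20 ≤ ⟪z, m⟫ ∧ ⟪z, m⟫ ≤ s2 K - (s2 K - s1 K) / 20) with hJ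
  have memJ : ∀ K ∈ J, K ∈ B ∧ grp K = G ∧ (s1 K + (s2 K - s1 K) / 20 ≤ ⟪z, m⟫ ∧ ⟪z, m⟫ ≤ s2 K - (s2 K - s1 K) / 20) := by
    intro K hK; exact Finset.mem_filter.1 hK
  have hN : ∀ K ∈ J, NCell m v (Φ G) G g ρ τ θ B0 K (s1 K) (s2 K) := by
    intro K hK
    obtain ⟨a, b, -⟩ := memJ K hK
    have := hB K a
    rw [b] at this
    exact this
  have cover : {s : ℝ | z + s • v ∈ ⋃ K ∈ B, midK (e' (grp K)) K (s1 K) (s2 K)} ⊆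
      ⋃ K ∈ J, (fun s => ⟪z, v⟫ + s) ⁻¹' (projK ((Φ G) ⁻¹' K) ⟪z, m⟫) := by
    intro s hs
    simp only [mem_ofPred_eq, mem_iUnion] at hs
    obtain ⟨K, hK, hz⟩ := hs
    have inGK : z + s • v ∈ grp K := (hB K hK).2.2.2.1 hz.1
    have inG : z + s • v ∈ G := by
      have := hsat K0 hK0 _ inG0 (s - s0)
      have e : z + s0 • v + (s - s0) • v = z + s • v := by rw [add_assoc, ← add_smul]; congr 2; ring
      rw [e] at this
      exact this (hsub K hK inGK)
    have hgK : grp K = G := by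
      by_contra hne
      exact Set.disjoint_left.1 (hgrp K hK K0 hK0 hne) inGK inG
    have hmem := hz.2
    rw [mem_ofPred_eq, hgK, ← hm, inner_add_left, real_inner_smul_left, hvm, mul_zero, add_zero] at hmem
    simp only [mem_iUnion]
    refine ⟨K, Finset.mem_filter.2 ⟨hK, hgK, hmem.1.le, hmem.2⟩, ?_⟩
    rw [mem_preimage, mem_projK (hΦ K0 hK0).1 (hΦ K0 hK0).2]
    refine ⟨z + s • v, hz.1, ?_, ?_⟩
    · rw [inner_add_left, real_inner_smul_left]
      show ⟪z, m⟫ + s * ⟪v, m⟫ = _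
      rw [hvm, mul_zero, add_zero]
    · rw [inner_add_left, real_inner_smul_left, real_inner_self_eq_norm_sq, hv]; ring
  have gl := group_lemma (he K0 hK0).1 hv hmv (hΦ K0 hK0).1 (hΦ K0 hK0).2 G (fun x hx y hy => hΩ x (hsub K0 hK0 hx) y (hsub K0 hK0 hy))
    g ρ τ θ B0 τ₁ hg hg1 hρ hρg hτ hτ1 hB0 h1 h2 hθ J s1 s2 hN (fun K hK K' hK' => hdis K (memJ K hK).1 K' (memJ K' hK').1)
    ⟪z, m⟫ (fun K hK => (memJ K hK).2.2)
  refine (measure_mono cover).trans ((measure_biUnion_finset_le _ _).trans ?_)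
  refine le_trans ?_ (ENNReal.ofReal_le_ofReal gl)
  rw [ENNReal.ofReal_sum_of_nonneg (fun _ _ => measureReal_nonneg)]
  apply Finset.sum_le_sum
  intro K hK
  have bd : IsBounded (projK ((Φ G) ⁻¹' K) ⟪z, m⟫) := by
    rw [Metric.isBounded_iff]
    refine ⟨1, ?_⟩
    intro a ha b hb
    rw [mem_projK (hΦ K0 hK0).1 (hΦ K0 hK0).2] at ha hb
    obtain ⟨x, hx, -, rfl⟩ := ha
    obtain ⟨y, hy, -, rfl⟩ := hb
    rw [Real.dist_eq, ← inner_sub_left]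
    refine (abs_real_inner_le_norm _ _).trans ?_
    rw [hv, mul_one]
    have := (hN K hK).2.2.2.1
    exact hΩ x (hsub K0 hK0 (this hx)) y (hsub K0 hK0 (this hy))
  rw [measure_preimage_add, ofReal_measureReal bd.measure_lt_top.ne]

theorem sum_part {N : ℕ} {u : EuclideanSpace ℝ (Fin N) → ℝ} {Ω : Set (EuclideanSpace ℝ (Fin N))}
    {P : Finset (Set (EuclideanSpace ℝ (Fin N)))} (hP : IsPart u Ω P) (f : EuclideanSpace ℝ (Fin N) → ℝ)
    (hf : IntegrableOn f Ω) : ∫ x in Ω, f x = ∑ K ∈ P, ∫ x in K, f x := by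
  have sub : (⋃ K ∈ P, K) ⊆ Ω := iUnion₂_subset fun K hK => (hP.1 K hK).2.2.2.1
  rw [← integral_biUnion_finset P (fun K hK => (hP.1 K hK).1.measurableSet)
    (fun K hK K' hK' hne => hP.2.1 K hK K' hK' hne) (fun K hK => hf.mono_set (hP.1 K hK).2.2.2.1)]
  symm
  apply setIntegral_congr_set
  apply Filter.EventuallyLE.antisymm
  · exact sub.eventuallyLE
  · rw [ae_le_set]; exact hP.2.2

end HelpersJ1

section HelpersJ2
open scoped Pointwise

theorem io_bdd {N : ℕ} (f : EuclideanSpace ℝ (Fin N) → ℝ) (hf : Continuous f) (S : Set (EuclideanSpace ℝ (Fin N)))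
    (hS : IsBounded S) : IntegrableOn f S :=
  (hf.continuousOn.integrableOn_compact hS.isCompact_closure).mono_set subset_closure

theorem mid_mass {k : ℕ} (Ω T : Set (EuclideanSpace ℝ (Fin (k+2)))) (ho : IsOpen Ω) (hc : Convex ℝ Ω)
    (hd : ∀ x ∈ Ω, ∀ y ∈ Ω, ‖x - y‖ ≤ 1) (v : EuclideanSpace ℝ (Fin (k+2))) (hv : ‖v‖ = 1)
    (w : ℝ) (hw : 0 < w) (hw2 : w ≤ 1 / 2) (hwv : ∀ s : ℝ, |s| < w → s • v ∈ Ω)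
    (hTm : MeasurableSet T) (hT : T ⊆ Ω) (δ κ : ℝ) (hδ : δ = 1 / (2000 * (2 * ((k : ℝ) + 2) + 1))) (hκ : κ = δ / 8000)
    (hk : ∀ z, volume {s : ℝ | z + s • v ∈ T} ≤ ENNReal.ofReal (κ * w))
    (u : EuclideanSpace ℝ (Fin (k+2)) → ℝ) (hu : ContDiff ℝ 1 u) (hcs : HasCompactSupport u)
    (hD : ∫ x in Ω, ‖fderiv ℝ u x‖ ^ 2 ≤ 10 * ∫ x in Ω, u x ^ 2) :
    ∫ x in T, u x ^ 2 ≤ 0.011 * ∫ x in Ω, u x ^ 2 := by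
  have cu : Continuous u := hu.continuous
  have cf : Continuous (fderiv ℝ u) := hu.continuous_fderiv one_ne_zero
  have cfv : Continuous fun x => fderiv ℝ u x v := cf.clm_apply continuous_const
  have hb : IsBounded Ω := bdd_of_dist hd
  have h0 : (0 : EuclideanSpace ℝ (Fin (k+2))) ∈ Ω := by
    have := hwv 0 (by simpa using hw)
    simpa using this
  have k0 : (0 : ℝ) ≤ k := Nat.cast_nonneg k
  have hδp : 0 < δ := by rw [hδ]; positivity
  have hδ1 : (2 * ((k : ℝ) + 2) + 1) * δ = 1 / 2000 := by rw [hδ]; field_simp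
  have hδ2 : δ ≤ 1 / 2 := by nlinarith only [hδ1, hδp, k0]
  have hκp : 0 < κ := by rw [hκ]; positivity
  have lay := layer Ω ho hc hb h0 (fun x hx => by simpa using hd x hx 0 h0) u hu hcs δ hδp hδ2
  push_cast at lay
  rw [hδ1] at lay
  have subΩ : (1 - δ) • Ω ⊆ Ω := by
    rintro _ ⟨y, hy, rfl⟩
    have := hc h0 hy hδp.le (by linarith : (0:ℝ) ≤ 1 - δ) (by ring)
    simpa using this
  have mΩ : MeasurableSet ((1 - δ) • Ω) := (ho.smul₀ (by linarith : (1 - δ) ≠ 0)).measurableSet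
  have lb := lines_bound Ω (T ∩ (1 - δ) • Ω) ho hb (hTm.inter mΩ) (inter_subset_left.trans hT) v hv (δ * w / 2) (κ * w)
    (by positivity) (by nlinarith only [hδ2, hw2, hδp, hw]) (by positivity) (by
      rintro z ⟨-, y, hy, rfl⟩ s hs hs2
      have h1 : (s / δ) • v ∈ Ω := by
        apply hwv
        rw [abs_of_nonneg (by positivity), div_lt_iff₀ hδp]
        nlinarith only [hs2, hδp, hw]
      have := hc hy h1 (by linarith : (0:ℝ) ≤ 1 - δ) hδp.le (by ring)
      convert this using 2
      rw [smul_smul]; congr 1; field_simp)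
    (fun z => (measure_mono (fun s hs => hs.1)).trans (hk z)) u hu
  have e1 : 2 * (κ * w) / (δ * w / 2) = 1 / 2000 := by rw [hκ]; field_simp; norm_num
  rw [e1] at lb
  have i2 : IntegrableOn (fun x => u x ^ 2) Ω := io_bdd _ (cu.pow 2) _ hb
  have VD : ∫ x in Ω, (fderiv ℝ u x v) ^ 2 ≤ ∫ x in Ω, ‖fderiv ℝ u x‖ ^ 2 := by
    apply integral_mono (io_bdd _ (cfv.pow 2) _ hb) (io_bdd _ (cf.norm.pow 2) _ hb)
    intro x
    have := (fderiv ℝ u x).le_opNorm v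
    rw [hv, mul_one] at this
    show (fderiv ℝ u x v) ^ 2 ≤ ‖fderiv ℝ u x‖ ^ 2
    rw [← sq_abs, ← Real.norm_eq_abs]
    gcongr
  have sp : ∫ x in T, u x ^ 2 ≤ (∫ x in T ∩ (1 - δ) • Ω, u x ^ 2) + ((∫ x in Ω, u x ^ 2) - (∫ x in (1-δ) • Ω, u x ^ 2)) := by
    have a1 := integral_inter_add_sdiff (μ := volume) (f := fun x => u x ^ 2) mΩ (i2.mono_set hT)
    have a2 := integral_inter_add_sdiff (μ := volume) (f := fun x => u x ^ 2) mΩ i2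
    rw [inter_eq_self_of_subset_right subΩ] at a2
    have a3 : ∫ x in T \ ((1 - δ) • Ω), u x ^ 2 ≤ ∫ x in Ω \ ((1 - δ) • Ω), u x ^ 2 := by
      apply setIntegral_mono_set (i2.mono_set sdiff_subset)
      · exact Eventually.of_forall fun x => sq_nonneg _
      · exact (sdiff_subset_sdiff_left hT).eventuallyLE
    linarith
  linarith

/-- Counting. -/
theorem count_bad {ι : Type*} (P P1 G Bd : Finset ι) (M R Dd : ι → ℝ) (m D c g : ℝ)
    (h1 : P1 ⊆ P) (hGB : Disjoint G Bd) (hP1 : ∀ K ∈ P1, K ∈ G ∨ K ∈ Bd) (hG : G ⊆ P1) (hBd : Bd ⊆ P1)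
    (hc : 0 < c) (hc1 : c ≤ 1 / 1000) (hg : g = 100 * c) (hM0 : ∀ K ∈ P, 0 ≤ M K) (hD0 : ∀ K ∈ P, 0 ≤ Dd K)
    (hM : m = ∑ K ∈ P, M K) (hD : D = ∑ K ∈ P, Dd K) (hP0 : m - ∑ K ∈ P1, M K ≤ c / 1000 * m)
    (hR : ∀ K ∈ P1, (π ^ 2 - c / 100) * M K ≤ R K) (hRD : ∀ K ∈ P1, R K ≤ Dd K)
    (hGg : ∀ K ∈ G, (π ^ 2 + g) * M K ≤ R K) (hm : 0 ≤ m) (hlt : D ≤ (π ^ 2 + c) * m) :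
    0.98 * m ≤ ∑ K ∈ Bd, M K := by
  classical
  have hP1' : P1 = G ∪ Bd := by
    ext K; constructor
    · intro h; exact Finset.mem_union.2 (hP1 K h)
    · intro h; rcases Finset.mem_union.1 h with h | h
      · exact hG h
      · exact hBd h
  have s1 : ∑ K ∈ P1, M K = ∑ K ∈ G, M K + ∑ K ∈ Bd, M K := by rw [hP1', Finset.sum_union hGB]
  have s2 : ∑ K ∈ P1, Dd K = ∑ K ∈ G, Dd K + ∑ K ∈ Bd, Dd K := by rw [hP1', Finset.sum_union hGB]
  have s3 : ∑ K ∈ P1, Dd K ≤ D := by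
    rw [hD]; exact Finset.sum_le_sum_of_subset_of_nonneg h1 fun K hK _ => hD0 K hK
  have s4 : (π ^ 2 + g) * ∑ K ∈ G, M K ≤ ∑ K ∈ G, Dd K := by
    rw [Finset.mul_sum]; exact Finset.sum_le_sum fun K hK => (hGg K hK).trans (hRD K (hG hK))
  have s5 : (π ^ 2 - c / 100) * ∑ K ∈ Bd, M K ≤ ∑ K ∈ Bd, Dd K := by
    rw [Finset.mul_sum]; exact Finset.sum_le_sum fun K hK => (hR K (hBd hK)).trans (hRD K (hBd hK))
  obtain ⟨p1, p2⟩ := pi_sq_bounds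
  set X := ∑ K ∈ G, M K
  set Y := ∑ K ∈ Bd, M K
  have X0 : 0 ≤ X := Finset.sum_nonneg fun K hK => hM0 K (h1 (hG hK))
  subst hg
  have k1 : (π ^ 2 - c / 100) * (X + Y) + 100 * c * X ≤ (π ^ 2 + c) * m := by nlinarith only [s1, s2, s3, s4, s5, hlt, X0, hc]
  have k2 : (1 - c / 1000) * m ≤ X + Y := by linarith
  have k3 : (π ^ 2 - c / 100) * ((1 - c / 1000) * m) ≤ (π ^ 2 - c / 100) * (X + Y) :=
    mul_le_mul_of_nonneg_left k2 (by linarith)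
  have k5 : π ^ 2 * (c * m) ≤ 9.87 * (c * m) := mul_le_mul_of_nonneg_right p2.le (by positivity)
  have k4 : 100 * c * X ≤ c * (1.02 * m) := by
    have : 0 ≤ c * (c * m) := by positivity
    have e : (π ^ 2 - c / 100) * ((1 - c / 1000) * m) = π ^ 2 * m - π ^ 2 * (c * m) / 1000 - c * m / 100 + c * (c * m) / 100000 := by ring
    rw [e] at k3
    have cm : 0 ≤ c * m := by positivity
    nlinarith only [k1, k3, k5, this, cm]
  have k6 : 100 * X ≤ 1.02 * m := le_of_mul_le_mul_left (by linarith) hc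
  nlinarith only [k2, k6, hc1, hm]

end HelpersJ2

section HelpersJ3
open scoped Pointwise

theorem slope_small {k : ℕ} {Φ : (ℝ × (Fin (k+1) → ℝ)) ≃L[ℝ] EuclideanSpace ℝ (Fin (k+2))}
    {e v : EuclideanSpace ℝ (Fin (k+2))} {K : Set (EuclideanSpace ℝ (Fin (k+2)))} {s1 s2 : ℝ}
    (hS : SecD Φ e K s1 s2) (hm : ∀ p, ⟪Φ p, e⟫ = p.1) (hlen : 0.9 ≤ s2 - s1) (he : ‖e‖ = 1) (hv : ‖v‖ = 1)
    (ρ W : ℝ) (hρ : ρ ≤ 0.1) (hρW : ρ ≤ W / 2) (hth : ∀ x ∈ K, ∀ y ∈ K, ∃ t : ℝ, ‖x - y - t • e‖ ≤ ρ)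
    (hW : ∀ x ∈ K, |⟪x, v⟫| ≤ W) : |⟪e, v⟫| ≤ 5 * W := by
  obtain ⟨x, hx, ex⟩ := SecD.len_le hS hm (s2 - (s2 - s1) / 10) ⟨by linarith, by linarith⟩
  obtain ⟨y, hy, ey⟩ := SecD.len_le hS hm (s1 + (s2 - s1) / 10) ⟨by linarith, by linarith⟩
  obtain ⟨t, ht⟩ := hth x hx y hy
  have h1 : |⟪x - y - t • e, e⟫| ≤ ρ := (abs_real_inner_le_norm (x - y - t • e) e).trans (by rw [he, mul_one]; exact ht)
  have h2 : |⟪x - y - t • e, v⟫| ≤ ρ := (abs_real_inner_le_norm (x - y - t • e) v).trans (by rw [hv, mul_one]; exact ht)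
  rw [inner_sub_left, inner_sub_left, real_inner_smul_left, real_inner_self_eq_norm_sq, he, ex, ey] at h1
  rw [inner_sub_left, inner_sub_left, real_inner_smul_left] at h2
  have t1 : 1 / 2 ≤ t := by
    have := (abs_le.1 h1).2
    linarith
  have h3 : t * |⟪e, v⟫| ≤ 2 * W + ρ := by
    rw [← abs_of_nonneg (by linarith : 0 ≤ t), ← abs_mul]
    have a1 := abs_le.1 h2
    have a2 := abs_le.1 (hW x hx)
    have a3 := abs_le.1 (hW y hy)
    rw [abs_le]; constructor <;> linarith [a1.1, a1.2, a2.1, a2.2, a3.1, a3.2]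
  nlinarith only [h3, t1, hρW, abs_nonneg ⟪e, v⟫]

theorem dir_bound (A B a b : ℝ) (hab : a ^ 2 + b ^ 2 = 1) (ha : a ^ 2 ≤ 1 / 10000) :
    (a * A + b * B) ^ 2 ≤ 1.01 * B ^ 2 + 0.0101 * A ^ 2 := by
  have hb : b ^ 2 ≤ 1 := by nlinarith only [hab, sq_nonneg a]
  have h1 : (a * A + b * B) ^ 2 ≤ 1.01 * (b ^ 2 * B ^ 2) + 101 * (a ^ 2 * A ^ 2) := by
    nlinarith only [sq_nonneg (10 * a * A - 0.1 * (b * B))]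
  have h2 : b ^ 2 * B ^ 2 ≤ 1 * B ^ 2 := by gcongr
  have h3 : a ^ 2 * A ^ 2 ≤ 1 / 10000 * A ^ 2 := by gcongr
  linarith

/-- steep cells have small mass -/
theorem steep_mass {N : ℕ} (u : EuclideanSpace ℝ (Fin N) → ℝ) (hu : ContDiff ℝ 1 u) (K : Set (EuclideanSpace ℝ (Fin N)))
    (hK : IsBounded K) (e v : EuclideanSpace ℝ (Fin N)) (he : ‖e‖ = 1) (a b : ℝ) (hab : a ^ 2 + b ^ 2 = 1)
    (ha : a ^ 2 ≤ 1 / 10000) :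
    ∫ x in K, (fderiv ℝ u x (a • e + b • v)) ^ 2 ≤
      1.01 * (∫ x in K, (fderiv ℝ u x v) ^ 2) + 0.0101 * ∫ x in K, ‖fderiv ℝ u x‖ ^ 2 := by
  have cf : Continuous (fderiv ℝ u) := hu.continuous_fderiv one_ne_zero
  have cfv : ∀ z, Continuous fun x => fderiv ℝ u x z := fun z => cf.clm_apply continuous_const
  rw [← integral_const_mul, ← integral_const_mul, ← integral_add]
  · apply integral_mono (io_bdd _ ((cfv _).pow 2) _ hK)
    · exact (io_bdd _ (((cfv v).pow 2).const_mul 1.01 |>.add ((cf.norm.pow 2).const_mul 0.0101)) _ hK)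
    intro x
    have h1 := (fderiv ℝ u x).le_opNorm e
    rw [he, mul_one, Real.norm_eq_abs] at h1
    have h2 : (fderiv ℝ u x e) ^ 2 ≤ ‖fderiv ℝ u x‖ ^ 2 := by
      rw [← sq_abs]; gcongr
    have := dir_bound (fderiv ℝ u x e) (fderiv ℝ u x v) a b hab ha
    simp only [map_add, map_smul, smul_eq_mul, Pi.pow_apply]
    linarith
  · exact io_bdd _ (((cfv v).pow 2).const_mul 1.01) _ hK
  · exact io_bdd _ ((cf.norm.pow 2).const_mul 0.0101) _ hK

end HelpersJ3

section HelpersJ4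
open scoped Pointwise

theorem sqrt_g (sc w : ℝ) (h1 : 0 ≤ sc) (h2 : 0 ≤ w) : √(100 * (sc ^ 2 * w ^ 2)) = 10 * sc * w := by
  rw [show 100 * (sc ^ 2 * w ^ 2) = (10 * sc * w) ^ 2 by ring]
  exact Real.sqrt_sq (by positivity)

set_option maxHeartbeats 4000000 in
theorem core1 {k : ℕ} (τ₁ τ sc δ κ : ℝ) (hτ₁ : 0 < τ₁) (hτ₁s : τ₁ ≤ 1 / 1000) (hτ : τ = τ₁ / 10) (hsc : 0 < sc)
    (hsc1 : sc ≤ τ₁ / 1000) (hsc2 : 800 * sc < log (1 + (1 / 5 : ℝ) ^ (k+1)) * τ₁)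
    (hδ : δ = 1 / (2000 * (2 * ((k : ℝ) + 2) + 1))) (hκ : κ = δ / 8000)
    (hκ1 : 9600 * ((k : ℝ) + 2) * τ₁ * 5 ^ (k+1) ≤ κ)
    (Ω : Set (EuclideanSpace ℝ (Fin (k+2)))) (ho : IsOpen Ω) (hc : Convex ℝ Ω)
    (hd : ∀ x ∈ Ω, ∀ y ∈ Ω, ‖x - y‖ ≤ 1) (v : EuclideanSpace ℝ (Fin (k+2))) (hv : ‖v‖ = 1)
    (w : ℝ) (hw : 0 < w) (hw2 : w ≤ 1 / 2) (hwv : ∀ s : ℝ, |s| < w → s • v ∈ Ω)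
    (u : EuclideanSpace ℝ (Fin (k+2)) → ℝ) (hu : ContDiff ℝ 1 u) (hcs : HasCompactSupport u) (hu0 : ∫ x in Ω, u x = 0)
    (hAB : (1 ≤ 10 * ((k : ℝ) + 2) * w ∧ ∫ x in Ω, (fderiv ℝ u x v) ^ 2 ≤ 1 / 2 * ∫ x in Ω, ‖fderiv ℝ u x‖ ^ 2) ∨
      (10 * ((k : ℝ) + 2) * w < 1 ∧ ∀ x ∈ Ω, |⟪x, v⟫| ≤ ((k : ℝ) + 2) * w)) :
    (π ^ 2 + sc ^ 2 * w ^ 2) * (∫ x in Ω, u x ^ 2) ≤ ∫ x in Ω, ‖fderiv ℝ u x‖ ^ 2 := by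
  classical
  by_contra hcon
  push Not at hcon
  obtain ⟨p1, p2⟩ := pi_sq_bounds
  have cu : Continuous u := hu.continuous
  have cf : Continuous (fderiv ℝ u) := hu.continuous_fderiv one_ne_zero
  have cfv : ∀ z, Continuous fun x => fderiv ℝ u x z := fun z => cf.clm_apply continuous_const
  have hb : IsBounded Ω := bdd_of_dist hd
  have k0 : (0 : ℝ) ≤ k := Nat.cast_nonneg k
  set c := sc ^ 2 * w ^ 2 with hcdef
  have hcp : 0 < c := by positivity
  have hscs : sc ≤ 1 / 1000000 := by linarith
  have hswb : sc * w ≤ sc / 2 := by nlinarith only [hsc, hw2]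
  have hsw : sc * w ≤ 1 / 2000000 := by linarith
  have hswp : 0 < sc * w := by positivity
  have hcsm : c ≤ 1 / 10 ^ 10 := by
    have : c = (sc * w) * (sc * w) := by rw [hcdef]; ring
    rw [this]
    nlinarith only [hsw, hswp]
  set g := 100 * c with hgdef
  have hsg : √g = 10 * sc * w := sqrt_g sc w hsc.le hw.le
  have hgp : 0 < g := by positivity
  have hg8 : g ≤ 1 / 10 ^ 8 := by rw [hgdef]; linarith
  set m := ∫ x in Ω, u x ^ 2 with hm
  set D := ∫ x in Ω, ‖fderiv ℝ u x‖ ^ 2 with hD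
  have D0 : 0 ≤ D := integral_nonneg fun x => by positivity
  have mp : 0 < m := by
    by_contra h
    push Not at h
    nlinarith only [h, D0, hcon, p1, hcp]
  have hDm : D ≤ 10 * m := by nlinarith only [hcon, p2, hcsm, mp]
  set VΩ := volume.real Ω with hVΩ
  have VΩ0 : 0 ≤ VΩ := measureReal_nonneg
  set η := c * m / (1000 * (VΩ + 1)) with hη
  have hηp : 0 < η := by positivity
  set dl := c / 4100 with hdl
  have hdlp : 0 < dl := by positivity
  have hdl1 : dl ≤ 1 / 1000 := by rw [hdl]; linarith
  obtain ⟨ρ0, hρ0, hcell⟩ := cell u hu hcs η dl 0.01 hηp hdlp (by linarith) (by norm_num)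
  set ρ := min ρ0 (min (g / 500) (τ₁ * w / 100)) with hρdef
  have hρp : 0 < ρ := by rw [hρdef]; positivity
  have hρ0' : ρ ≤ ρ0 := min_le_left _ _
  have hρg : ρ ≤ g / 500 := (min_le_right _ _).trans (min_le_left _ _)
  have hρw : ρ ≤ τ₁ * w / 100 := (min_le_right _ _).trans (min_le_right _ _)
  have hne : Ω.Nonempty := ⟨_, hwv 0 (by simpa using hw)⟩
  obtain ⟨P, grp, e', dir, hP, hgrp, hcl⟩ := partition_final (by omega) Ω ho hc hne hb u (io_bdd u cu Ω hb) hu0 v hv ρ hρp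
  have hab : ∀ K, ∃ ab : ℝ × ℝ, K ∈ P → 0 ≤ ab.1 ∧ ab.1 ^ 2 + ab.2 ^ 2 = 1 ∧ dir K = ab.1 • e' (grp K) + ab.2 • v := by
    intro K
    by_cases hK : K ∈ P
    · obtain ⟨-, -, -, -, -, -, ⟨a, b, h⟩, -⟩ := hcl K hK
      exact ⟨(a, b), fun _ => h⟩
    · exact ⟨0, fun h => absurd h hK⟩
  choose ab hab using hab
  set M := fun K : Set (EuclideanSpace ℝ (Fin (k+2))) => ∫ x in K, u x ^ 2 with hM
  set Dd := fun K : Set (EuclideanSpace ℝ (Fin (k+2))) => ∫ x in K, ‖fderiv ℝ u x‖ ^ 2 with hDd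
  set R := fun K : Set (EuclideanSpace ℝ (Fin (k+2))) => ∫ x in K, (fderiv ℝ u x (dir K)) ^ 2 with hR
  have bK : ∀ K ∈ P, IsBounded K := fun K hK => hb.subset (hP.1 K hK).2.2.2.1
  have dK : ∀ K ∈ P, ∀ x ∈ K, ∀ y ∈ K, ‖x - y‖ ≤ 1 := fun K hK x hx y hy =>
    hd x ((hP.1 K hK).2.2.2.1 hx) y ((hP.1 K hK).2.2.2.1 hy)
  have ine : ∀ K ∈ P, ⟪dir K, e' (grp K)⟫ = (ab K).1 ∧ ⟪dir K, v⟫ = (ab K).2 ∧ ‖dir K‖ = 1 := by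
    intro K hK
    obtain ⟨-, h2, h3⟩ := hab K hK
    obtain ⟨-, -, -, n1, n2, -⟩ := hcl K hK
    have n3 : ⟪v, e' (grp K)⟫ = 0 := by rw [real_inner_comm]; exact n2
    have i1 : ⟪dir K, e' (grp K)⟫ = (ab K).1 := by
      rw [h3, inner_add_left, real_inner_smul_left, real_inner_smul_left, real_inner_self_eq_norm_sq, n1, n3]; ring
    have i2 : ⟪dir K, v⟫ = (ab K).2 := by
      rw [h3, inner_add_left, real_inner_smul_left, real_inner_smul_left, real_inner_self_eq_norm_sq, hv, n2]; ring
    refine ⟨i1, i2, ?_⟩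
    have : ⟪dir K, dir K⟫ = 1 := by
      nth_rewrite 2 [h3]
      rw [inner_add_right, real_inner_smul_right, real_inner_smul_right, i1, i2]
      nlinarith only [h2]
    rw [real_inner_self_eq_norm_sq] at this
    exact (pow_eq_one_iff_of_nonneg (norm_nonneg _) two_ne_zero).1 this
  have thin : ∀ K ∈ P, ∀ x ∈ K, ∀ y ∈ K, ∃ t : ℝ, ‖x - y - t • dir K‖ ≤ ρ := fun K hK => (hcl K hK).2.2.2.2.2.2.2
  set P1 := P.filter fun K => η * volume.real K ≤ M K with hP1
  have P1P : ∀ K ∈ P1, K ∈ P := fun K hK => (Finset.mem_filter.1 hK).1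
  have cell1 : ∀ K ∈ P1, ∀ n : EuclideanSpace ℝ (Fin (k+2)), ‖n‖ = 1 →
      ∀ Φ : (ℝ × (Fin (k+1) → ℝ)) ≃L[ℝ] EuclideanSpace ℝ (Fin (k+2)), MeasurePreserving Φ volume volume →
      (∀ p, ⟪Φ p, n⟫ = p.1) → 0.01 ≤ ⟪dir K, n⟫ → ∃ s1 s2, CellD u K (dir K) n Φ ⟪dir K, n⟫ dl s1 s2 := by
    intro K hK1 n hn Φ mpΦ hΦ hβ
    have hK := P1P K hK1
    obtain ⟨q1, q2, q3, q4, q5⟩ := hP.1 K hK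
    refine hcell K q1 q2 q3 (dK K hK) (dir K) n (ine K hK).2.2 hn (fun x hx y hy => ?_) q5 (Finset.mem_filter.1 hK1).2
      Φ mpΦ hΦ _ rfl hβ
    obtain ⟨t, ht⟩ := thin K hK x hx y hy
    exact ⟨t, ht.trans hρ0'⟩
  have cell2 : ∀ K ∈ P1, ∃ Φ : (ℝ × (Fin (k+1) → ℝ)) ≃L[ℝ] EuclideanSpace ℝ (Fin (k+2)),
      (∀ p, ⟪Φ p, dir K⟫ = p.1) ∧ ∃ s1 s2, CellD u K (dir K) (dir K) Φ 1 dl s1 s2 := by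
    intro K hK
    have hn := (ine K (P1P K hK)).2.2
    obtain ⟨v', hv', hp⟩ := exists_perp (dir K)
    obtain ⟨Φ, mpΦ, hΦ, -⟩ := fub_map (dir K) v' hn hv' hp
    have e1 : ⟪dir K, dir K⟫ = 1 := by rw [real_inner_self_eq_norm_sq, hn]; norm_num
    have := cell1 K hK (dir K) hn Φ mpΦ hΦ (by rw [e1]; norm_num)
    rw [e1] at this
    exact ⟨Φ, hΦ, this⟩
  have hRlow : ∀ K ∈ P1, (π ^ 2 - c / 100) * M K ≤ R K := by
    intro K hK
    obtain ⟨Φ, -, s1, s2, hC⟩ := cell2 K hK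
    have := cell_A hC one_pos hdlp hdl1
    have e : 41 * dl = c / 100 := by rw [hdl]; ring
    rwa [e] at this
  have hRD : ∀ K ∈ P1, R K ≤ Dd K := by
    intro K hK
    apply integral_mono (io_bdd _ ((cfv _).pow 2) _ (bK K (P1P K hK))) (io_bdd _ (cf.norm.pow 2) _ (bK K (P1P K hK)))
    intro x
    have := (fderiv ℝ u x).le_opNorm (dir K)
    rw [(ine K (P1P K hK)).2.2, mul_one] at this
    show (fderiv ℝ u x (dir K)) ^ 2 ≤ ‖fderiv ℝ u x‖ ^ 2
    rw [← sq_abs, ← Real.norm_eq_abs]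
    gcongr
  have M0 : ∀ K, 0 ≤ M K := fun K => integral_nonneg fun x => by positivity
  have Dd0 : ∀ K, 0 ≤ Dd K := fun K => integral_nonneg fun x => by positivity
  have sM : m = ∑ K ∈ P, M K := sum_part hP _ (io_bdd _ (cu.pow 2) _ hb)
  have sD : D = ∑ K ∈ P, Dd K := sum_part hP _ (io_bdd _ (cf.norm.pow 2) _ hb)
  have sV : VΩ = ∑ K ∈ P, volume.real K := by
    have := sum_part hP (fun _ => (1 : ℝ)) (io_bdd _ continuous_const _ hb)
    simpa using this
  have hP0 : m - ∑ K ∈ P1, M K ≤ c / 1000 * m := by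
    have h1 := Finset.sum_filter_add_sum_filter_not P (fun K => η * volume.real K ≤ M K) M
    have h2 : ∑ K ∈ P with ¬ (η * volume.real K ≤ M K), M K ≤ ∑ K ∈ P, η * volume.real K := by
      refine (Finset.sum_le_sum fun K hK => ?_).trans (Finset.sum_le_sum_of_subset_of_nonneg (Finset.filter_subset _ _)
        fun K _ _ => by positivity)
      exact (not_le.1 (Finset.mem_filter.1 hK).2).le
    rw [← Finset.mul_sum, ← sV] at h2
    have h3 : η * VΩ ≤ c / 1000 * m := by
      have : η * (VΩ + 1) = c / 1000 * m := by rw [hη]; field_simp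
      linarith
    rw [← sM, ← hP1] at h1
    linarith
  set G := P1.filter fun K => (π ^ 2 + g) * M K < R K with hG
  set Bd := P1.filter fun K => ¬ ((π ^ 2 + g) * M K < R K) with hBd
  have BdP1 : ∀ K ∈ Bd, K ∈ P1 := fun K hK => (Finset.mem_filter.1 hK).1
  have badR : ∀ K ∈ Bd, R K ≤ (π ^ 2 + g) * M K := fun K hK => not_lt.1 (Finset.mem_filter.1 hK).2
  have massBd := count_bad P P1 G Bd M R Dd m D c g (Finset.filter_subset _ _) (Finset.disjoint_filter_filter_not _ _ _)
    (fun K hK => by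
      by_cases h : (π ^ 2 + g) * M K < R K
      · exact Or.inl (Finset.mem_filter.2 ⟨hK, h⟩)
      · exact Or.inr (Finset.mem_filter.2 ⟨hK, h⟩))
    (Finset.filter_subset _ _) (Finset.filter_subset _ _) hcp (hcsm.trans (by norm_num)) rfl (fun K _ => M0 K) (fun K _ => Dd0 K) sM sD hP0
    hRlow hRD (fun K hK => (Finset.mem_filter.1 hK).2.le) mp.le hcon.le
  have Mp : ∀ K ∈ P1, 0 < M K := by
    intro K hK
    refine lt_of_lt_of_le ?_ (Finset.mem_filter.1 hK).2
    have hKP := P1P K hK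
    have : 0 < volume.real K := ENNReal.toReal_pos ((hP.1 K hKP).1.measure_pos volume (hP.1 K hKP).2.2.1).ne' (bK K hKP).measure_lt_top.ne
    positivity
  set B0 := 10 * ((k : ℝ) + 2) * w with hB0
  have B0p : 0 ≤ B0 := by positivity
  set NB := Bd.filter fun K => 0.01 ≤ (ab K).1 with hNB
  have NBBd : ∀ K ∈ NB, K ∈ Bd := fun K hK => (Finset.mem_filter.1 hK).1
  have key : 0.3 * m ≤ ∑ K ∈ NB, M K ∧ ∀ K ∈ NB, |(ab K).2| ≤ B0 := by
    rcases hAB with ⟨hA, hAV⟩ | ⟨hB, hBw⟩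
    · constructor
      · have h1 := Finset.sum_filter_add_sum_filter_not Bd (fun K => 0.01 ≤ (ab K).1) M
        rw [← hNB] at h1
        set St := Bd.filter fun K => ¬ (0.01 ≤ (ab K).1) with hSt
        set V := fun K : Set (EuclideanSpace ℝ (Fin (k+2))) => ∫ x in K, (fderiv ℝ u x v) ^ 2 with hV
        have V0 : ∀ K, 0 ≤ V K := fun K => integral_nonneg fun x => by positivity
        have sVV : (∫ x in Ω, (fderiv ℝ u x v) ^ 2) = ∑ K ∈ P, V K := sum_part hP _ (io_bdd _ ((cfv v).pow 2) _ hb)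
        have StP : St ⊆ P := fun K hK => P1P K (BdP1 K (Finset.mem_filter.1 hK).1)
        have h2 : ∀ K ∈ St, (π ^ 2 - c / 100) * M K ≤ 1.01 * V K + 0.0101 * Dd K := by
          intro K hK
          have hKP := StP hK
          obtain ⟨a0, a1, a2⟩ := hab K hKP
          have h3 := hRlow K (BdP1 K (Finset.mem_filter.1 hK).1)
          have ha := not_le.1 (Finset.mem_filter.1 hK).2
          have h4 := steep_mass u hu K (bK K hKP) (e' (grp K)) v (hcl K hKP).2.2.2.1 (ab K).1 (ab K).2 a1
            (by nlinarith only [a0, ha])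
          rw [← a2] at h4
          exact h3.trans h4
        have h5 : (π ^ 2 - c / 100) * ∑ K ∈ St, M K ≤ 1.01 * (∫ x in Ω, (fderiv ℝ u x v) ^ 2) + 0.0101 * D := by
          rw [sVV, sD, Finset.mul_sum, Finset.mul_sum, Finset.mul_sum, ← Finset.sum_add_distrib]
          refine (Finset.sum_le_sum h2).trans (Finset.sum_le_sum_of_subset_of_nonneg StP fun K _ _ => ?_)
          have := V0 K
          have := Dd0 K
          positivity
        have h6 : (π ^ 2 - c / 100) * ∑ K ∈ St, M K ≤ 0.5151 * D := by linarith
        have S0 : 0 ≤ ∑ K ∈ St, M K := Finset.sum_nonneg fun K _ => M0 K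
        have h7 : 9.79 * ∑ K ∈ St, M K ≤ 0.5151 * (9.88 * m) := by
          have a1 : 9.79 * ∑ K ∈ St, M K ≤ (π ^ 2 - c / 100) * ∑ K ∈ St, M K := mul_le_mul_of_nonneg_right (by linarith) S0
          have a2 : D ≤ 9.88 * m := hcon.le.trans (mul_le_mul_of_nonneg_right (by linarith) mp.le)
          linarith
        linarith
      · intro K hK
        have := (hab K (P1P K (BdP1 K (NBBd K hK)))).2.1
        refine le_trans ?_ hA
        exact (sq_le_one_iff_abs_le_one _).1 (by nlinarith only [this, sq_nonneg (ab K).1])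
    · have small : ∀ K ∈ Bd, |(ab K).2| ≤ 5 * (((k : ℝ) + 2) * w) := by
        intro K hK
        have hK1 := BdP1 K hK
        have hKP := P1P K hK1
        obtain ⟨Φ, hΦ, s1, s2, hC⟩ := cell2 K hK1
        have hBB := (cell_B hC one_pos hdlp g (by rw [hdl, hgdef]; linarith) (hg8.trans (by norm_num)) (Mp K hK1) (badR K hK)).1
        rw [← (ine K hKP).2.1]
        have hτw : τ₁ * w ≤ 1 / 1000 * w := mul_le_mul_of_nonneg_right hτ₁s hw.le
        exact slope_small hC.1 hΦ (by linarith) (ine K hKP).2.2 hv ρ _ (by linarith) (by nlinarith only [hρw, hτw, hw, k0])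
          (thin K hKP) (fun x hx => hBw x ((hP.1 K hKP).2.2.2.1 hx))
      have all : NB = Bd := by
        rw [hNB]
        apply Finset.filter_true_of_mem
        intro K hK
        have h1 := small K hK
        obtain ⟨a0, a1, -⟩ := hab K (P1P K (BdP1 K hK))
        have h2 : |(ab K).2| ≤ 1 / 2 := by linarith
        have h3 : (ab K).2 ^ 2 ≤ 1 / 4 := by rw [← sq_abs]; nlinarith only [h2, abs_nonneg (ab K).2]
        nlinarith only [a0, a1, h3]
      rw [all]
      refine ⟨by linarith, fun K hK => (small K hK).trans ?_⟩
      rw [hB0]; nlinarith only [hw, k0]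
  obtain ⟨massNB, bNB⟩ := key
  have exΦ : ∀ H : Set (EuclideanSpace ℝ (Fin (k+2))), ∃ Φ : (ℝ × (Fin (k+1) → ℝ)) ≃L[ℝ] EuclideanSpace ℝ (Fin (k+2)),
      ‖e' H‖ = 1 → ⟪e' H, v⟫ = 0 → MeasurePreserving Φ volume volume ∧ (∀ p, ⟪Φ p, e' H⟫ = p.1) ∧ (∀ p, ⟪Φ p, v⟫ = p.2 0) := by
    intro H
    by_cases h : ‖e' H‖ = 1 ∧ ⟪e' H, v⟫ = 0
    · obtain ⟨Φ, h1, h2, h3, -⟩ := fub_map (e' H) v h.1 hv h.2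
      exact ⟨Φ, fun _ _ => ⟨h1, h2, h3⟩⟩
    · obtain ⟨v', hv', hp⟩ := exists_perp v
      obtain ⟨Φ, -⟩ := fub_map v v' hv hv' hp
      exact ⟨Φ, fun a b => absurd ⟨a, b⟩ h⟩
  choose Φ hΦ using exΦ
  set θ := 8 * √g / τ with hθ
  have hτp : 0 < τ := by rw [hτ]; positivity
  have hlog2 : log (1 + (1 / 5 : ℝ) ^ (k+1)) ≤ log 2 := by
    apply Real.log_le_log (by positivity)
    have : (1 / 5 : ℝ) ^ (k+1) ≤ 1 := pow_le_one₀ (by norm_num) (by norm_num)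
    linarith
  have hθ2 : 2 * θ < log (1 + (1 / 5 : ℝ) ^ (k+1)) := by
    have : 2 * θ = 1600 * (sc * w) / τ₁ := by rw [hθ, hsg, hτ]; field_simp; ring
    rw [this, div_lt_iff₀ hτ₁]
    linarith
  have θ0 : 0 ≤ θ := by rw [hθ]; positivity
  have hθl : θ ≤ log 2 := by linarith
  have hτ40 : τ ≤ 1 / 40 := by rw [hτ]; linarith
  have exN : ∀ K, ∃ s : ℝ × ℝ, K ∈ NB → NCell (e' (grp K)) v (Φ (grp K)) (grp K) g ρ τ θ B0 K s.1 s.2 ∧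
      M K ≤ 13 * ∫ x in midK (e' (grp K)) K s.1 s.2, u x ^ 2 := by
    intro K
    by_cases hK : K ∈ NB
    · have hKB := NBBd K hK
      have hK1 := BdP1 K hKB
      have hKP := P1P K hK1
      obtain ⟨n0, n00, n000, n1, n2, n3, -, n4⟩ := hcl K hKP
      obtain ⟨f1, f2, f3⟩ := hΦ (grp K) n1 n2
      have ha := (Finset.mem_filter.1 hK).2
      obtain ⟨a0, a1, a2⟩ := hab K hKP
      obtain ⟨s1, s2, hC⟩ := cell1 K hK1 (e' (grp K)) n1 (Φ (grp K)) f1 f2 (by rw [(ine K hKP).1]; exact ha)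
      rw [(ine K hKP).1] at hC
      obtain ⟨b1, b2⟩ := cell_B hC (by linarith) hdlp g (by rw [hdl, hgdef]; linarith) (hg8.trans (by norm_num)) (Mp K hK1) (badR K hKB)
      obtain ⟨b3, b4⟩ := b2 τ hτp hτ40 (by rw [hsg, hτ]; linarith)
      refine ⟨(s1, s2), fun _ => ⟨⟨hC.1, (hP.1 K hKP).1, (hP.1 K hKP).2.1, n0, n3, b3, ?_, (ab K).1, (ab K).2, ha, a1, bNB K hK, b1, ?_⟩, b4 hθl⟩⟩
      · refine hC.2.1.trans ?_
        have : (ab K).1 ≤ 1 := by nlinarith only [a0, a1, sq_nonneg (ab K).2]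
        nlinarith only [this, hdl1, hdlp, a0]
      · rw [← a2]; exact n4
    · exact ⟨0, fun h => absurd h hK⟩
  choose s hs using exN
  set T := ⋃ K ∈ NB, midK (e' (grp K)) K (s K).1 (s K).2 with hT
  have NBP : ∀ K ∈ NB, K ∈ P := fun K hK => P1P K (BdP1 K (NBBd K hK))
  have mmid : ∀ K ∈ NB, MeasurableSet (midK (e' (grp K)) K (s K).1 (s K).2) := by
    intro K hK
    apply (hP.1 K (NBP K hK)).1.measurableSet.inter
    exact (measurableSet_Ioc).preimage (continuous_id.inner continuous_const).measurable
  have hTm : MeasurableSet T := Finset.measurableSet_biUnion _ mmid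
  have hTΩ : T ⊆ Ω := iUnion₂_subset fun K hK => inter_subset_left.trans (hP.1 K (NBP K hK)).2.2.2.1
  have lm := line_measure v hv Ω hd NB grp e' Φ (fun K => (s K).1) (fun K => (s K).2)
    (fun K hK K' hK' => hgrp K (NBP K hK) K' (NBP K' hK')) (fun K hK K' hK' => hP.2.1 K (NBP K hK) K' (NBP K' hK'))
    (fun K hK => (hcl K (NBP K hK)).2.1) (fun K hK => (hcl K (NBP K hK)).2.2.1)
    (fun K hK => ⟨(hcl K (NBP K hK)).2.2.2.1, (hcl K (NBP K hK)).2.2.2.2.1⟩)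
    (fun K hK => (hΦ (grp K) (hcl K (NBP K hK)).2.2.2.1 (hcl K (NBP K hK)).2.2.2.2.1).2)
    g ρ τ θ B0 τ₁ hgp hg8 hρp hρg hτp hτ40 B0p (by rw [hsg, hτ]; linarith)
    (by rw [hsg, hτ]; linarith) hθ2 (fun K hK => (hs K hK).1)
  have hτw : 0 < τ₁ * w := by positivity
  have Hb : 100 * (τ₁ + 6 * √g + ρ) * B0 + ρ + 6 * √g ≤ 1200 * ((k : ℝ) + 2) * τ₁ * w := by
    have e1 : 6 * √g = 60 * (sc * w) := by rw [hsg]; ring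
    have e2 : sc * w ≤ τ₁ / 1000 * w := mul_le_mul_of_nonneg_right hsc1 hw.le
    have e3 : τ₁ + 6 * √g + ρ ≤ 1.1 * τ₁ := by
      rw [e1]
      nlinarith only [hρw, hswb, hsc1, hτ₁, hw2, hτw]
    have e4 : 100 * (τ₁ + 6 * √g + ρ) * B0 ≤ 100 * (1.1 * τ₁) * B0 := by gcongr
    have e5 : 100 * (1.1 * τ₁) * B0 = 1100 * ((k : ℝ) + 2) * (τ₁ * w) := by rw [hB0]; ring
    have e6 : 0 ≤ (k : ℝ) * (τ₁ * w) := by positivity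
    rw [e1]; rw [e1, e5] at e4
    nlinarith only [e4, e2, hρw, e6, hτw]
  have mm := mid_mass Ω T ho hc hd v hv w hw hw2 hwv hTm hTΩ δ κ hδ hκ (fun z => (lm z).trans (ENNReal.ofReal_le_ofReal (by
    have h5 : (0:ℝ) < 5 ^ (k+1) := by positivity
    calc 4 * 5 ^ (k+1) * (2 * (100 * (τ₁ + 6 * √g + ρ) * B0 + ρ + 6 * √g)) ≤
        4 * 5 ^ (k+1) * (2 * (1200 * ((k : ℝ) + 2) * τ₁ * w)) := by gcongr
      _ = (9600 * ((k : ℝ) + 2) * τ₁ * 5 ^ (k+1)) * w := by ring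
      _ ≤ κ * w := by gcongr))) u hu hcs hDm
  have i2 : IntegrableOn (fun x => u x ^ 2) Ω := io_bdd _ (cu.pow 2) _ hb
  have sT : ∫ x in T, u x ^ 2 = ∑ K ∈ NB, ∫ x in midK (e' (grp K)) K (s K).1 (s K).2, u x ^ 2 := by
    apply integral_biUnion_finset NB mmid
    · intro K hK K' hK' hne
      exact (hP.2.1 K (NBP K hK) K' (NBP K' hK') hne).mono inter_subset_left inter_subset_left
    · intro K hK
      exact i2.mono_set (inter_subset_left.trans (hP.1 K (NBP K hK)).2.2.2.1)
  have fin : ∑ K ∈ NB, M K ≤ 13 * ∫ x in T, u x ^ 2 := by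
    rw [sT, Finset.mul_sum]
    exact Finset.sum_le_sum fun K hK => (hs K hK).2
  linarith

end HelpersJ4

section HelpersJ5
open scoped Pointwise

theorem two_dirs {N : ℕ} (L : EuclideanSpace ℝ (Fin N) →L[ℝ] ℝ) (v1 v2 : EuclideanSpace ℝ (Fin N)) (h1 : ‖v1‖ = 1)
    (h2 : ‖v2‖ = 1) (h12 : ⟪v1, v2⟫ = 0) : (L v1) ^ 2 + (L v2) ^ 2 ≤ ‖L‖ ^ 2 := by
  set a := L v1
  set b := L v2
  have e1 : L (a • v1 + b • v2) = a ^ 2 + b ^ 2 := by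
    simp only [map_add, map_smul, smul_eq_mul]; ring
  have e2 : ‖a • v1 + b • v2‖ ^ 2 = a ^ 2 + b ^ 2 := by
    rw [norm_add_sq_real, norm_smul, norm_smul, h1, h2, real_inner_smul_left, real_inner_smul_right, h12,
      Real.norm_eq_abs, Real.norm_eq_abs]
    simp
  have e3 := L.le_opNorm (a • v1 + b • v2)
  rw [e1, Real.norm_eq_abs, abs_of_nonneg (by positivity)] at e3
  have e4 : (a ^ 2 + b ^ 2) ^ 2 ≤ ‖L‖ ^ 2 * (a ^ 2 + b ^ 2) := by
    rw [← e2, ← mul_pow, e2]; gcongr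
  rcases (by positivity : 0 ≤ a ^ 2 + b ^ 2).eq_or_lt with h | h
  · rw [← h]; positivity
  · rw [pow_two (a ^ 2 + b ^ 2)] at e4
    exact le_of_mul_le_mul_right e4 h

theorem core2 (k : ℕ) : ∃ c : ℝ, 0 < c ∧ ∀ (Ω : Set (EuclideanSpace ℝ (Fin (k+2)))), IsOpen Ω → Convex ℝ Ω →
    (∀ x ∈ Ω, ∀ y ∈ Ω, ‖x - y‖ ≤ 1) → ∀ v1 v2 : EuclideanSpace ℝ (Fin (k+2)), ‖v1‖ = 1 → ‖v2‖ = 1 → ⟪v1, v2⟫ = 0 →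
    ∀ w : ℝ, 0 < w → (∀ s : ℝ, |s| < w → s • v1 ∈ Ω) → (∀ s : ℝ, |s| < w → s • v2 ∈ Ω) →
    (∀ x ∈ Ω, |⟪x, v2⟫| ≤ ((k : ℝ) + 2) * w) →
    ∀ u : EuclideanSpace ℝ (Fin (k+2)) → ℝ, ContDiff ℝ 1 u → HasCompactSupport u → ∫ x in Ω, u x = 0 →
    (π ^ 2 + c * w ^ 2) * (∫ x in Ω, u x ^ 2) ≤ ∫ x in Ω, ‖fderiv ℝ u x‖ ^ 2 := by
  have k0 : (0 : ℝ) ≤ k := Nat.cast_nonneg k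
  set δ : ℝ := 1 / (2000 * (2 * ((k : ℝ) + 2) + 1)) with hδ
  set κ : ℝ := δ / 8000 with hκ
  have hδp : 0 < δ := by positivity
  have hκp : 0 < κ := by positivity
  set lam := log (1 + (1 / 5 : ℝ) ^ (k+1)) with hlam
  have hl : 0 < lam := Real.log_pos (by have : (0:ℝ) < (1 / 5 : ℝ) ^ (k+1) := by positivity
                                        linarith)
  set τ₁ : ℝ := min (1 / 1000) (κ / (9600 * ((k : ℝ) + 2) * 5 ^ (k+1))) with hτ₁
  have hτp : 0 < τ₁ := by rw [hτ₁]; positivity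
  have hτs : τ₁ ≤ 1 / 1000 := min_le_left _ _
  have hτκ : τ₁ ≤ κ / (9600 * ((k : ℝ) + 2) * 5 ^ (k+1)) := min_le_right _ _
  rw [le_div_iff₀ (by positivity)] at hτκ
  set sc : ℝ := τ₁ * min (1 / 1000) (lam / 1000) with hsc
  have hscp : 0 < sc := by rw [hsc]; positivity
  have hsc1 : sc ≤ τ₁ / 1000 := by
    have : min (1 / 1000) (lam / 1000) ≤ 1 / 1000 := min_le_left _ _
    rw [hsc]; nlinarith only [this, hτp]
  have hsc2 : 800 * sc < lam * τ₁ := by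
    have : min (1 / 1000) (lam / 1000) ≤ lam / 1000 := min_le_right _ _
    rw [hsc]; nlinarith only [this, hτp, hl, mul_pos hτp hl]
  refine ⟨sc ^ 2, by positivity, ?_⟩
  intro Ω ho hc hd v1 v2 h1 h2 h12 w hw hw1 hw2 hW u hu hcs hu0
  have cf : Continuous (fderiv ℝ u) := hu.continuous_fderiv one_ne_zero
  have cfv : ∀ z, Continuous fun x => fderiv ℝ u x z := fun z => cf.clm_apply continuous_const
  have hb : IsBounded Ω := bdd_of_dist hd
  have hwh : w ≤ 1 / 2 := by
    refine le_of_forall_lt fun s hs => ?_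
    rcases le_or_gt s 0 with h | h
    · linarith
    by_contra hcon
    push Not at hcon
    obtain ⟨r, hr1, hr2⟩ := exists_between hs
    have := hd _ (hw1 r (by rw [abs_of_pos (by linarith)]; exact hr2)) _ (hw1 (-r) (by rw [abs_neg, abs_of_pos (by linarith)]; exact hr2))
    rw [← sub_smul, norm_smul, h1, mul_one, Real.norm_eq_abs] at this
    have := (abs_le.1 this).2
    linarith
  have main := fun v hv hwv hAB => core1 τ₁ (τ₁ / 10) sc δ κ hτp hτs rfl hscp hsc1 hsc2 hδ hκ (by linarith) Ω ho hc hd v hv w hw hwh hwv u hu hcs hu0 hAB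
  rcases le_or_gt 1 (10 * ((k : ℝ) + 2) * w) with h | h
  · have hs : (∫ x in Ω, (fderiv ℝ u x v1) ^ 2) + (∫ x in Ω, (fderiv ℝ u x v2) ^ 2) ≤ ∫ x in Ω, ‖fderiv ℝ u x‖ ^ 2 := by
      rw [← integral_add]
      · apply integral_mono (io_bdd _ (((cfv v1).pow 2).add ((cfv v2).pow 2)) _ hb) (io_bdd _ (cf.norm.pow 2) _ hb)
        intro x
        exact two_dirs (fderiv ℝ u x) v1 v2 h1 h2 h12
      · exact io_bdd _ ((cfv v1).pow 2) _ hb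
      · exact io_bdd _ ((cfv v2).pow 2) _ hb
    rcases le_total (∫ x in Ω, (fderiv ℝ u x v1) ^ 2) (∫ x in Ω, (fderiv ℝ u x v2) ^ 2) with h' | h'
    · exact main v1 h1 hw1 (Or.inl ⟨h, by linarith⟩)
    · exact main v2 h2 hw2 (Or.inl ⟨h, by linarith⟩)
  · exact main v2 h2 hw2 (Or.inr ⟨h, hW⟩)

end HelpersJ5

section HelpersK1
open scoped Pointwise

theorem cutoff {N : ℕ} (Ω A : Set (EuclideanSpace ℝ (Fin N))) (ho : IsOpen Ω) (hb : IsBounded Ω) (hA : IsClosed A) (hAΩ : A ⊆ Ω)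
    (u : EuclideanSpace ℝ (Fin N) → ℝ) (hu : ContDiffOn ℝ 1 u Ω) :
    ∃ U : EuclideanSpace ℝ (Fin N) → ℝ, ContDiff ℝ 1 U ∧ HasCompactSupport U ∧ ∀ x ∈ A, U x = u x := by
  obtain ⟨f, h0, h1, -⟩ := exists_contMDiffMap_zero_one_nhds_of_isClosed (n := 1) (modelWithCornersSelf ℝ (EuclideanSpace ℝ (Fin N)))
    ho.isClosed_compl hA (disjoint_compl_left_iff_subset.2 hAΩ)
  have hf : ContDiff ℝ 1 f := f.contMDiff.contDiff
  refine ⟨fun x => f x * u x, ?_, ?_, ?_⟩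
  · rw [contDiff_iff_contDiffAt]
    intro x
    by_cases hx : x ∈ Ω
    · exact hf.contDiffAt.mul (hu.contDiffAt (ho.mem_nhds hx))
    · have : (fun x => f x * u x) =ᶠ[nhds x] fun _ => 0 := by
        filter_upwards [(eventually_nhdsSet_iff_forall.1 h0) x hx] with y hy
        rw [hy, zero_mul]
      exact contDiffAt_const.congr_of_eventuallyEq this
  · apply HasCompactSupport.of_support_subset_isCompact hb.isCompact_closure
    intro x hx
    by_contra h
    apply hx
    have : f x = 0 := h0.self_of_nhdsSet x (fun h' => h (subset_closure h'))
    simp [this]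
  · intro x hx
    have : f x = 1 := h1.self_of_nhdsSet x hx
    simp [this]

theorem closure_smul_subset_self {N : ℕ} {Ω : Set (EuclideanSpace ℝ (Fin N))} (ho : IsOpen Ω) (hc : Convex ℝ Ω)
    (h0 : (0 : EuclideanSpace ℝ (Fin N)) ∈ Ω) (t : ℝ) (ht : 0 < t) (ht1 : t < 1) : closure (t • Ω) ⊆ Ω := by
  have h := hc.combo_interior_closure_subset_interior (by linarith : 0 < 1 - t) ht.le (by ring)
  rw [ho.interior_eq] at h
  rw [closure_smul₀]
  rintro x hx
  exact h ⟨0, ⟨0, h0, by simp⟩, x, hx, by simp⟩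

/-- Inner approximation. -/
theorem inner_ineq (k : ℕ) : ∃ c : ℝ, 0 < c ∧ ∀ (Ω : Set (EuclideanSpace ℝ (Fin (k+2)))), IsOpen Ω → Convex ℝ Ω →
    (∀ x ∈ Ω, ∀ y ∈ Ω, ‖x - y‖ ≤ 1) → ∀ v1 v2 : EuclideanSpace ℝ (Fin (k+2)), ‖v1‖ = 1 → ‖v2‖ = 1 → ⟪v1, v2⟫ = 0 →
    ∀ w : ℝ, 0 < w → (∀ s : ℝ, |s| < w → s • v1 ∈ Ω) → (∀ s : ℝ, |s| < w → s • v2 ∈ Ω) →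
    (∀ x ∈ Ω, |⟪x, v2⟫| ≤ ((k : ℝ) + 2) * w) →
    ∀ u : EuclideanSpace ℝ (Fin (k+2)) → ℝ, ContDiffOn ℝ 1 u Ω → ∀ t, 0 < t → t < 1 →
    IntegrableOn u (t • Ω) ∧ IntegrableOn (fun x => u x ^ 2) (t • Ω) ∧ IntegrableOn (fun x => ‖fderiv ℝ u x‖ ^ 2) (t • Ω) ∧
    (π ^ 2 + c * (t * w) ^ 2) * ((∫ x in t • Ω, u x ^ 2) - (∫ x in t • Ω, u x) ^ 2 / volume.real (t • Ω)) ≤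
      ∫ x in t • Ω, ‖fderiv ℝ u x‖ ^ 2 := by
  obtain ⟨c, hc0, core⟩ := core2 k
  refine ⟨c, hc0, ?_⟩
  intro Ω ho hc hd v1 v2 h1 h2 h12 w hw hw1 hw2 hW u hu t ht ht1
  have hb : IsBounded Ω := bdd_of_dist hd
  have h0 : (0 : EuclideanSpace ℝ (Fin (k+2))) ∈ Ω := by
    have := hw1 0 (by simpa using hw)
    simpa using this
  have hcl := closure_smul_subset_self ho hc h0 t ht ht1
  have hto : IsOpen (t • Ω) := ho.smul₀ ht.ne'
  have htb : IsBounded (t • Ω) := hb.subset (subset_closure.trans hcl)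
  have tsub : t • Ω ⊆ Ω := subset_closure.trans hcl
  have io : ∀ f : EuclideanSpace ℝ (Fin (k+2)) → ℝ, ContinuousOn f Ω → IntegrableOn f (t • Ω) := by
    intro f hf
    exact ((hf.mono hcl).integrableOn_compact htb.isCompact_closure).mono_set subset_closure
  have cu : ContinuousOn u Ω := hu.continuousOn
  have cf : ContinuousOn (fderiv ℝ u) Ω := hu.continuousOn_fderiv_of_isOpen ho le_rfl
  have i1 := io u cu
  have i2 := io (fun x => u x ^ 2) (cu.pow 2)
  have i3 := io (fun x => ‖fderiv ℝ u x‖ ^ 2) (cf.norm.pow 2)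
  refine ⟨i1, i2, i3, ?_⟩
  set V := volume.real (t • Ω) with hV
  have Vp : 0 < V := ENNReal.toReal_pos (hto.measure_pos volume ⟨_, ⟨0, h0, rfl⟩⟩).ne' htb.measure_lt_top.ne
  set q := (∫ x in t • Ω, u x) / V with hq
  obtain ⟨U, hU, hUc, hUeq⟩ := cutoff Ω (closure (t • Ω)) ho hb isClosed_closure hcl (fun x => u x - q) (hu.sub contDiffOn_const)
  have eqU : ∀ x ∈ t • Ω, U x = u x - q := fun x hx => hUeq x (subset_closure hx)
  have ic : ∀ r : ℝ, ∫ x in t • Ω, r = r * V := by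
    intro r; rw [setIntegral_const, smul_eq_mul, mul_comm]
  have icn : ∀ r : ℝ, IntegrableOn (fun _ => r) (t • Ω) := fun r => io _ continuousOn_const
  have m0 : ∫ x in t • Ω, U x = 0 := by
    rw [setIntegral_congr_fun hto.measurableSet eqU, integral_sub i1 (icn q), ic, hq]
    field_simp; ring
  have m2 : ∫ x in t • Ω, U x ^ 2 = (∫ x in t • Ω, u x ^ 2) - (∫ x in t • Ω, u x) ^ 2 / V := by
    have : ∀ x ∈ t • Ω, U x ^ 2 = u x ^ 2 + (-(2 * q) * u x + q ^ 2) := by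
      intro x hx; rw [eqU x hx]; ring
    have i4 : Integrable (fun x => -(2 * q) * u x + q ^ 2) (volume.restrict (t • Ω)) := (i1.const_mul _).add (icn _)
    rw [setIntegral_congr_fun hto.measurableSet this, integral_add i2 i4,
      integral_add (i1.const_mul _) (icn _), integral_const_mul, ic, hq]
    field_simp; ring
  have m3 : ∫ x in t • Ω, ‖fderiv ℝ U x‖ ^ 2 = ∫ x in t • Ω, ‖fderiv ℝ u x‖ ^ 2 := by
    apply setIntegral_congr_fun hto.measurableSet
    intro x hx
    have : U =ᶠ[nhds x] fun x => u x - q := by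
      filter_upwards [hto.mem_nhds hx] with y hy
      exact eqU y hy
    show ‖fderiv ℝ U x‖ ^ 2 = ‖fderiv ℝ u x‖ ^ 2
    rw [this.fderiv_eq, fderiv_sub_const]
  rw [← m2, ← m3]
  refine core (t • Ω) hto (hc.smul t) (fun x hx y hy => hd x (tsub hx) y (tsub hy)) v1 v2 h1 h2 h12 (t * w) (by positivity) ?_ ?_ ?_ U hU hUc m0
  · intro s hs
    refine ⟨(s / t) • v1, hw1 _ ?_, ?_⟩
    · rw [abs_div, abs_of_pos ht, div_lt_iff₀ ht]; linarith
    · show t • (s / t) • v1 = s • v1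
      rw [smul_smul, mul_div_cancel₀ _ ht.ne']
  · intro s hs
    refine ⟨(s / t) • v2, hw2 _ ?_, ?_⟩
    · rw [abs_div, abs_of_pos ht, div_lt_iff₀ ht]; linarith
    · show t • (s / t) • v2 = s • v2
      rw [smul_smul, mul_div_cancel₀ _ ht.ne']
  · rintro _ ⟨x, hx, rfl⟩
    show |⟪t • x, v2⟫| ≤ _
    rw [real_inner_smul_left, abs_mul, abs_of_pos ht]
    have := hW x hx
    nlinarith only [this, ht]

/-- Passing to the limit. -/
theorem core3 (k : ℕ) : ∃ c : ℝ, 0 < c ∧ ∀ (Ω : Set (EuclideanSpace ℝ (Fin (k+2)))), IsOpen Ω → Convex ℝ Ω →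
    (∀ x ∈ Ω, ∀ y ∈ Ω, ‖x - y‖ ≤ 1) → ∀ v1 v2 : EuclideanSpace ℝ (Fin (k+2)), ‖v1‖ = 1 → ‖v2‖ = 1 → ⟪v1, v2⟫ = 0 →
    ∀ w : ℝ, 0 < w → (∀ s : ℝ, |s| < w → s • v1 ∈ Ω) → (∀ s : ℝ, |s| < w → s • v2 ∈ Ω) →
    (∀ x ∈ Ω, |⟪x, v2⟫| ≤ ((k : ℝ) + 2) * w) →
    ∀ u : EuclideanSpace ℝ (Fin (k+2)) → ℝ, ContDiffOn ℝ 1 u Ω → (∫⁻ x in Ω, ENNReal.ofReal (u x ^ 2)) ≠ ∞ →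
    ∫ x in Ω, u x = 0 →
    ENNReal.ofReal (π ^ 2 + c * w ^ 2) * (∫⁻ x in Ω, ENNReal.ofReal (u x ^ 2)) ≤
      ∫⁻ x in Ω, ENNReal.ofReal (‖fderiv ℝ u x‖ ^ 2) := by
  obtain ⟨c, hc0, core⟩ := inner_ineq k
  refine ⟨c, hc0, ?_⟩
  intro Ω ho hc hd v1 v2 h1 h2 h12 w hw hw1 hw2 hW u hu hfin hu0
  have hb : IsBounded Ω := bdd_of_dist hd
  have h0 : (0 : EuclideanSpace ℝ (Fin (k+2))) ∈ Ω := by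
    have := hw1 0 (by simpa using hw)
    simpa using this
  have main := core Ω ho hc hd v1 v2 h1 h2 h12 w hw hw1 hw2 hW u hu
  have cu : ContinuousOn u Ω := hu.continuousOn
  have cf : ContinuousOn (fderiv ℝ u) Ω := hu.continuousOn_fderiv_of_isOpen ho le_rfl
  by_cases hI : (∫⁻ x in Ω, ENNReal.ofReal (‖fderiv ℝ u x‖ ^ 2)) = ∞
  · rw [hI]; exact le_top
  have mk : ∀ f : EuclideanSpace ℝ (Fin (k+2)) → ℝ, ContinuousOn f Ω → (∀ x, 0 ≤ f x) → (∫⁻ x in Ω, ENNReal.ofReal (f x)) ≠ ∞ →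
      IntegrableOn f Ω := by
    intro f hf hn hfi
    refine ⟨hf.aestronglyMeasurable ho.measurableSet, ?_⟩
    rw [hasFiniteIntegral_iff_ofReal (Eventually.of_forall hn)]
    exact hfi.lt_top
  have i2 : IntegrableOn (fun x => u x ^ 2) Ω := mk _ (cu.pow 2) (fun x => sq_nonneg _) hfin
  have i3 : IntegrableOn (fun x => ‖fderiv ℝ u x‖ ^ 2) Ω := mk _ (cf.norm.pow 2) (fun x => sq_nonneg _) hI
  have ic : IntegrableOn (fun _ => (1:ℝ)) Ω := io_bdd _ continuous_const _ hb
  have i1 : IntegrableOn u Ω := by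
    have i12 : Integrable (fun x => 1 + u x ^ 2) (volume.restrict Ω) := ic.add i2
    refine Integrable.mono' i12 (cu.aestronglyMeasurable ho.measurableSet) ?_
    refine Eventually.of_forall fun x => ?_
    rw [Real.norm_eq_abs, ← sq_abs]
    nlinarith only [sq_nonneg (|u x| - 1), abs_nonneg (u x)]
  rw [← ofReal_integral_eq_lintegral_ofReal i2 (Eventually.of_forall fun x => sq_nonneg _),
    ← ofReal_integral_eq_lintegral_ofReal i3 (Eventually.of_forall fun x => sq_nonneg _),
    ← ENNReal.ofReal_mul (by positivity)]
  apply ENNReal.ofReal_le_ofReal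
  set t : ℕ → ℝ := fun n => 1 - 1 / ((n : ℝ) + 2) with htd
  have tpos : ∀ n, 0 < t n := by
    intro n
    have : (1:ℝ) / ((n : ℝ) + 2) < 1 := by
      rw [div_lt_one (by positivity)]; linarith [(Nat.cast_nonneg n : (0:ℝ) ≤ n)]
    simp only [htd]; linarith
  have tlt : ∀ n, t n < 1 := by
    intro n
    have : (0:ℝ) < 1 / ((n : ℝ) + 2) := by positivity
    simp only [htd]; linarith
  have tmono : Monotone t := by
    intro a b hab
    simp only [htd]
    have : (a : ℝ) ≤ b := by exact_mod_cast hab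
    gcongr
  have tlim : Tendsto t atTop (nhds 1) := by
    have h1 : Tendsto (fun n : ℕ => (1:ℝ) / ((n : ℝ) + 2)) atTop (nhds 0) := by
      have h2 : Tendsto (fun n : ℕ => (n : ℝ) + 2) atTop atTop := tendsto_atTop_add_const_right _ _ tendsto_natCast_atTop_atTop
      have h3 := h2.inv_tendsto_atTop
      simp only [one_div]; exact h3
    have := h1.const_sub 1
    rw [sub_zero] at this
    exact this
  have smono : Monotone fun n => t n • Ω := by
    intro a b hab
    rintro _ ⟨x, hx, rfl⟩
    refine ⟨(t a / t b) • x, ?_, ?_⟩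
    · have q1 : t a / t b ≤ 1 := (div_le_one (tpos b)).2 (tmono hab)
      have q0 : 0 ≤ t a / t b := (div_pos (tpos a) (tpos b)).le
      have := hc h0 hx (by linarith : 0 ≤ 1 - t a / t b) q0 (by ring)
      simpa using this
    · show t b • (t a / t b) • x = t a • x
      rw [smul_smul, mul_div_cancel₀ _ (tpos b).ne']
  have sU : (⋃ n, t n • Ω) = Ω := by
    apply Subset.antisymm
    · exact iUnion_subset fun n => subset_closure.trans (closure_smul_subset_self ho hc h0 _ (tpos n) (tlt n))
    · intro x hx
      have l1 : Tendsto (fun n => (t n)⁻¹ • x) atTop (nhds x) := by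
        have := (tlim.inv₀ one_ne_zero).smul_const x
        simpa using this
      obtain ⟨n, hn⟩ := (l1.eventually (ho.mem_nhds hx)).exists
      refine mem_iUnion.2 ⟨n, (t n)⁻¹ • x, hn, ?_⟩
      show t n • (t n)⁻¹ • x = x
      rw [smul_smul, mul_inv_cancel₀ (tpos n).ne', one_smul]
  have sm : ∀ n, MeasurableSet (t n • Ω) := fun n => (ho.smul₀ (tpos n).ne').measurableSet
  have lim : ∀ f : EuclideanSpace ℝ (Fin (k+2)) → ℝ, IntegrableOn f Ω → Tendsto (fun n => ∫ x in t n • Ω, f x) atTop (nhds (∫ x in Ω, f x)) := by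
    intro f hf
    have := tendsto_setIntegral_of_monotone (μ := volume) (f := f) sm smono (by rw [sU]; exact hf)
    rwa [sU] at this
  have l1 := lim u i1
  have l2 := lim _ i2
  have l3 : Tendsto (fun n => volume.real (t n • Ω)) atTop (nhds (volume.real Ω)) := by
    have := lim _ ic
    simpa using this
  have Vp : 0 < volume.real Ω := ENNReal.toReal_pos (ho.measure_pos volume ⟨0, h0⟩).ne' hb.measure_lt_top.ne
  have L := ((((tlim.mul_const w).pow 2).const_mul c).const_add (π ^ 2)).mul (l2.sub ((l1.pow 2).div l3 Vp.ne'))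
  rw [hu0] at L
  have L' := le_of_tendsto' L (b := ∫ x in Ω, ‖fderiv ℝ u x‖ ^ 2) (fun n => by
    refine (main (t n) (tpos n) (tlt n)).2.2.2.trans ?_
    apply setIntegral_mono_set i3
    · exact Eventually.of_forall fun x => sq_nonneg _
    · exact (subset_closure.trans (closure_smul_subset_self ho hc h0 _ (tpos n) (tlt n))).eventuallyLE)
  simpa using L'

end HelpersK1

section HelpersK2
open scoped Pointwise

theorem affine_map_volume {N : ℕ} (x₀ : EuclideanSpace ℝ (Fin N)) (D : ℝ) (hD : 0 < D) :
    ∃ C : ℝ≥0∞, C ≠ 0 ∧ C ≠ ∞ ∧ Measure.map (fun y : EuclideanSpace ℝ (Fin N) => x₀ + D • y) volume = C • volume := by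
  refine ⟨ENNReal.ofReal |(D ^ Module.finrank ℝ (EuclideanSpace ℝ (Fin N)))⁻¹|, ?_, ENNReal.ofReal_ne_top, ?_⟩
  · rw [Ne, ENNReal.ofReal_eq_zero, not_le]; positivity
  · have h1 : (fun y : EuclideanSpace ℝ (Fin N) => x₀ + D • y) = (fun y => x₀ + y) ∘ (fun y => D • y) := rfl
    rw [h1, ← Measure.map_map (measurable_const_add x₀) (measurable_const_smul D),
      Measure.map_addHaar_smul volume hD.ne', Measure.map_smul, map_add_left_eq_self]

theorem affine_emb {N : ℕ} (x₀ : EuclideanSpace ℝ (Fin N)) (D : ℝ) (hD : 0 < D) :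
    MeasurableEmbedding (fun y : EuclideanSpace ℝ (Fin N) => x₀ + D • y) :=
  ((Homeomorph.smulOfNeZero D hD.ne').trans (Homeomorph.addLeft x₀)).measurableEmbedding

theorem gap_u (k : ℕ) : ∃ c : ℝ, 0 < c ∧
      ∀ Ω : Set (EuclideanSpace ℝ (Fin (k+2))),
        IsOpen Ω → IsBounded Ω → Convex ℝ Ω →
        ∀ (x₀ : EuclideanSpace ℝ (Fin (k+2))) (v1 v2 : EuclideanSpace ℝ (Fin (k+2))) (r : ℝ), 0 < r →
          ‖v1‖ = 1 → ‖v2‖ = 1 → ⟪v1, v2⟫ = 0 →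
          (∀ s : ℝ, |s| < r → x₀ + s • v1 ∈ Ω) → (∀ s : ℝ, |s| < r → x₀ + s • v2 ∈ Ω) →
          (∀ x ∈ Ω, |⟪x - x₀, v2⟫| ≤ ((k : ℝ) + 2) * r) →
          ENNReal.ofReal (π ^ 2 / Metric.diam Ω ^ 2 + c * r ^ 2 / Metric.diam Ω ^ 4) ≤ wEV Ω (fun _ => 1) := by
  obtain ⟨c, hc0, core⟩ := core3 k
  refine ⟨c, hc0, ?_⟩
  intro Ω ho hb hc x₀ v1 v2 r hr h1 h2 h12 hs1 hs2 hW
  set D := Metric.diam Ω with hDd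
  have hD : 0 < D := by
    have p1 := hs1 0 (by simpa using hr)
    have p2 := hs1 (r/2) (by rw [abs_of_pos (by positivity)]; linarith)
    have := Metric.dist_le_diam_of_mem hb p2 p1
    rw [dist_eq_norm, zero_smul, add_zero, add_sub_cancel_left, norm_smul, h1, Real.norm_eq_abs, abs_of_pos (by positivity)] at this
    linarith
  unfold wEV
  refine le_iInf₂ fun u hadm => ?_
  obtain ⟨hu, hn0, hnt, hu0⟩ := hadm
  simp only [mul_one] at hn0 hnt hu0
  unfold wRayleigh
  simp only [mul_one]
  obtain ⟨C, hC0, hCt, hC⟩ := affine_map_volume x₀ D hD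
  have emb := affine_emb x₀ D hD
  set ψ : EuclideanSpace ℝ (Fin (k+2)) → EuclideanSpace ℝ (Fin (k+2)) := fun y => x₀ + D • y with hψ
  have ψd : ContDiff ℝ 1 ψ := contDiff_const.add (contDiff_const_smul D)
  have tr : ∀ f : EuclideanSpace ℝ (Fin (k+2)) → ℝ≥0∞, ∫⁻ y in ψ ⁻¹' Ω, f (ψ y) = C * ∫⁻ x in Ω, f x := by
    intro f
    rw [← emb.lintegral_map, ← emb.restrict_map, hC, Measure.restrict_smul, lintegral_smul_measure, smul_eq_mul]
  have tri : ∫ y in ψ ⁻¹' Ω, u (ψ y) = 0 := by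
    rw [← emb.integral_map, ← emb.restrict_map, hC, Measure.restrict_smul, integral_smul_measure, hu0, smul_zero]
  have hder : ∀ y ∈ ψ ⁻¹' Ω, ‖fderiv ℝ (fun y => u (ψ y)) y‖ ^ 2 = D ^ 2 * ‖fderiv ℝ u (ψ y)‖ ^ 2 := by
    intro y hy
    have d1 : HasFDerivAt u (fderiv ℝ u (ψ y)) (ψ y) :=
      ((hu.contDiffAt (ho.mem_nhds hy)).differentiableAt one_ne_zero).hasFDerivAt
    have d2 : HasFDerivAt ψ (D • ContinuousLinearMap.id ℝ (EuclideanSpace ℝ (Fin (k+2)))) y :=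
      ((hasFDerivAt_id y).const_smul D).const_add x₀
    have d3 := d1.comp y d2
    have e : fderiv ℝ (fun y => u (ψ y)) y = D • fderiv ℝ u (ψ y) := by
      rw [show (fun y => u (ψ y)) = u ∘ ψ from rfl, d3.fderiv]
      ext z; simp
    rw [e, norm_smul, mul_pow, Real.norm_eq_abs, sq_abs]
  have inn : ∀ (s : ℝ) (v : EuclideanSpace ℝ (Fin (k+2))), ψ (s • v) = x₀ + (D * s) • v := by
    intro s v; simp only [hψ, smul_smul]
  have hab : ∀ s : ℝ, |s| < r / D → |D * s| < r := by
    intro s hs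
    rw [abs_mul, abs_of_pos hD, mul_comm]; exact (lt_div_iff₀ hD).1 hs
  have ho' : IsOpen (ψ ⁻¹' Ω) := ho.preimage ψd.continuous
  have key := core (ψ ⁻¹' Ω) ho' ?_ ?_ v1 v2 h1 h2 h12 (r / D) (by positivity) ?_ ?_ ?_ (fun y => u (ψ y)) ?_ ?_ tri
  · rw [tr (fun x => ENNReal.ofReal (u x ^ 2))] at key
    have e3 : ∫⁻ y in ψ ⁻¹' Ω, ENNReal.ofReal (‖fderiv ℝ (fun y => u (ψ y)) y‖ ^ 2) =
        C * (ENNReal.ofReal (D ^ 2) * ∫⁻ x in Ω, ENNReal.ofReal (‖fderiv ℝ u x‖ ^ 2)) := by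
      rw [← lintegral_const_mul' _ _ ENNReal.ofReal_ne_top, ← tr]
      apply setLIntegral_congr_fun ho'.measurableSet
      intro y hy
      show ENNReal.ofReal _ = _
      rw [hder y hy, ENNReal.ofReal_mul (by positivity)]
    rw [e3, mul_left_comm, ENNReal.mul_le_mul_iff_right hC0 hCt] at key
    rw [ENNReal.le_div_iff_mul_le (Or.inl hn0) (Or.inl hnt)]
    have hD2 : ENNReal.ofReal (D ^ 2) ≠ 0 := by
      rw [Ne, ENNReal.ofReal_eq_zero, not_le]; positivity
    rw [← ENNReal.mul_le_mul_iff_right hD2 ENNReal.ofReal_ne_top, ← mul_assoc, ← ENNReal.ofReal_mul (by positivity)]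
    convert key using 3
    field_simp
  · intro x hx y hy p q hp hq hpq
    have := hc hx hy hp hq hpq
    show ψ (p • x + q • y) ∈ Ω
    convert this using 1
    simp only [hψ]
    have : x₀ = p • x₀ + q • x₀ := by rw [← add_smul, hpq, one_smul]
    nth_rewrite 1 [this]
    module
  · intro x hx y hy
    have := Metric.dist_le_diam_of_mem hb hx hy
    rw [dist_eq_norm, ← hDd] at this
    have e : ψ x - ψ y = D • (x - y) := by simp only [hψ]; module
    rw [e, norm_smul, Real.norm_eq_abs, abs_of_pos hD] at this
    nlinarith only [this, hD]
  · intro s hs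
    show ψ _ ∈ Ω
    rw [inn]; exact hs1 _ (hab s hs)
  · intro s hs
    show ψ _ ∈ Ω
    rw [inn]; exact hs2 _ (hab s hs)
  · intro x hx
    have := hW _ hx
    have e : ψ x - x₀ = D • x := by simp only [hψ]; module
    rw [e, real_inner_smul_left, abs_mul, abs_of_pos hD] at this
    rw [← mul_div_assoc, le_div_iff₀ hD]; linarith
  · exact hu.comp ψd.contDiffOn (fun y hy => hy)
  · rw [tr (fun x => ENNReal.ofReal (u x ^ 2))]
    exact ENNReal.mul_ne_top hCt hnt

end HelpersK2

/-- Theorem 1.2 / `t:quantitativeN`: for `N ≥ 2` there exists a dimensional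
constant `c̄ > 0` such that, for every open bounded convex domain `Ω ⊂ ℝ^N` with diameter `D`
and John ellipsoid of semi-axes `a₁ ≥ … ≥ a_N`, the first nontrivial Neumann eigenvalue
satisfies `μ₁(Ω) ≥ π²/D² + c̄ a₂²/D⁴`. The John ellipsoid (center `x₀`, orthonormal axes `b`,
semi-axes `a`) satisfies `ℰ ⊆ Ω ⊆ N·ℰ`. -/
theorem quantitative_neumann_gap :
    ∀ (N : ℕ) (hN : 2 ≤ N), ∃ c : ℝ, 0 < c ∧
      ∀ Ω : Set (EuclideanSpace ℝ (Fin N)),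
        IsOpen Ω → IsBounded Ω → Convex ℝ Ω → Ω.Nonempty →
        ∀ (x₀ : EuclideanSpace ℝ (Fin N)) (b : Fin N → EuclideanSpace ℝ (Fin N))
          (a : Fin N → ℝ),
          Orthonormal ℝ b →
          (∀ i, 0 < a i) →
          (∀ i j : Fin N, i ≤ j → a j ≤ a i) →
          {x : EuclideanSpace ℝ (Fin N) | ∑ i, (⟪x - x₀, b i⟫ / a i) ^ 2 < 1} ⊆ Ω →
          Ω ⊆ {x : EuclideanSpace ℝ (Fin N) | ∑ i, (⟪x - x₀, b i⟫ / (N * a i)) ^ 2 < 1} →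
          ENNReal.ofReal (π ^ 2 / Metric.diam Ω ^ 2 +
              c * (a ⟨1, by omega⟩) ^ 2 / Metric.diam Ω ^ 4) ≤
            wEV Ω (fun _ => 1) := by
  intro N hN
  obtain ⟨k, rfl⟩ : ∃ k, N = k + 2 := ⟨N - 2, by omega⟩
  obtain ⟨c, hc0, core⟩ := gap_u k
  refine ⟨c, hc0, ?_⟩
  intro Ω ho hb hc _ x₀ b a hO ha hmono hin hout
  set i0 : Fin (k+2) := ⟨0, by omega⟩ with hi0
  set i1 : Fin (k+2) := ⟨1, by omega⟩ with hi1
  have hin' : ∀ j : Fin (k+2), a i1 ≤ a j → ∀ s : ℝ, |s| < a i1 → x₀ + s • b j ∈ Ω := by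
    intro j hj s hs
    apply hin
    show ∑ i, (⟪x₀ + s • b j - x₀, b i⟫ / a i) ^ 2 < 1
    rw [Finset.sum_eq_single j]
    · rw [add_sub_cancel_left, real_inner_smul_left, real_inner_self_eq_norm_sq, hO.1 j, sq_lt_one_iff_abs_lt_one,
        abs_div, abs_of_pos (ha j), div_lt_one (ha j)]
      have : |s * 1 ^ 2| = |s| := by norm_num
      linarith
    · intro i _ hij
      rw [add_sub_cancel_left, real_inner_smul_left, hO.2 (Ne.symm hij)]; simp
    · intro h; exact absurd (Finset.mem_univ j) h
  refine core Ω ho hb hc x₀ (b i0) (b i1) (a i1) (ha _) (hO.1 _) (hO.1 _) (hO.2 (by simp [hi0, hi1])) (hin' i0 (hmono _ _ (by simp [hi0, hi1])))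
    (hin' i1 le_rfl) ?_
  intro x hx
  have h := hout hx
  have h' : ∑ i, (⟪x - x₀, b i⟫ / (((k + 2 : ℕ) : ℝ) * a i)) ^ 2 < 1 := h
  have h2 := (Finset.single_le_sum (f := fun i => (⟪x - x₀, b i⟫ / (((k + 2 : ℕ) : ℝ) * a i)) ^ 2) (fun i _ => sq_nonneg _) (Finset.mem_univ i1)).trans_lt h'
  have hp : (0:ℝ) < ((k + 2 : ℕ) : ℝ) * a i1 := mul_pos (by positivity) (ha _)
  simp only [sq_lt_one_iff_abs_lt_one] at h2
  rw [abs_div, abs_of_pos hp, div_lt_one hp] at h2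
  push_cast at h2
  exact h2.le
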